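/- Let κ be a cardinal with 2 ≤ κ ≤ 2^{ℵ₀}. Then the fundamental groups π₁(𝔾𝕊₂, ∘₂) and π₁(𝔾𝕊_κ, ∘_κ) are isomorphic as groups. -/

import Mathlib

noncomputable section

open Set

namespace Griffiths

/-- The one-fold Griffiths cone over the Hawaiian earring, as a subset of Euclidean 3-space:
the union over heights `r ∈ [0,1]` and `n ∈ ℕ` of the circle at height `r` with center
`(0, (1-r)/(n+3))` and radius `(1-r)/(n+3)` (the geodesic cone over the Hawaiian earring
`𝔼 × {0}` with cone tip `(0,0,1)`). -/
def GS1set : Set (EuclideanSpace ℝ (Fin 3)) :=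
  ⋃ r ∈ Set.Icc (0 : ℝ) 1, ⋃ n : ℕ,
    {x | x 0 ^ 2 + (x 1 - (1 - r) / (n + 3)) ^ 2 = ((1 - r) / (n + 3)) ^ 2 ∧ x 2 = r}

lemma zero_mem_GS1set : (0 : EuclideanSpace ℝ (Fin 3)) ∈ GS1set := by
  have h0 : (0:ℝ) ∈ Set.Icc (0:ℝ) 1 := by norm_num
  refine Set.mem_biUnion h0 (Set.mem_iUnion.2 ⟨0, ?_, ?_⟩) <;> simp

/-- The relation identifying the copies of the origin `(0,0,0)` in the disjoint union of
`ι`-many copies of `𝔾𝕊₁`. -/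
def wedgeSetoid (ι : Type) : Setoid (Σ _ : ι, GS1set) where
  r x y := x = y ∨ (x.2.val = 0 ∧ y.2.val = 0)
  iseqv := by
    constructor
    · intro x; exact Or.inl rfl
    · rintro x y (rfl | h); exacts [Or.inl rfl, Or.inr ⟨h.2, h.1⟩]
    · rintro x y z (rfl | h) (rfl | h')
      · exact Or.inl rfl
      · exact Or.inr h'
      · exact Or.inr h
      · exact Or.inr ⟨h.1, h'.2⟩

/-- The `ι`-fold Griffiths space: the wedge of `ι`-many copies of `𝔾𝕊₁` at the point
`(0,0,0)`. -/
def GS (ι : Type) : Type := Quotient (wedgeSetoid ι)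

/-- The wedge metric on representatives. -/
def preDist {ι : Type} (x y : Σ _ : ι, GS1set) : ℝ :=
  @ite _ (x.1 = y.1) (Classical.dec _)
    (dist (x.2.val) (y.2.val))
    (dist (x.2.val) 0 + dist (0 : EuclideanSpace ℝ (Fin 3)) (y.2.val))

lemma preDist_wd {ι : Type} (x y x' y' : Σ _ : ι, GS1set)
    (hx : (wedgeSetoid ι).r x x') (hy : (wedgeSetoid ι).r y y') :
    preDist x y = preDist x' y' := by
  classical
  have key : ∀ a b c : Σ _ : ι, GS1set, a.2.val = 0 → b.2.val = 0 →
      preDist a c = preDist b c := by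
    intro a b c ha hb
    unfold preDist
    by_cases h1 : a.1 = c.1 <;> by_cases h2 : b.1 = c.1 <;>
      simp [h1, h2, ha, hb, dist_comm]
  have symmkey : ∀ a c d : Σ _ : ι, GS1set, c.2.val = 0 → d.2.val = 0 →
      preDist a c = preDist a d := by
    intro a c d hc hd
    unfold preDist
    by_cases h1 : a.1 = c.1 <;> by_cases h2 : a.1 = d.1 <;>
      simp [h1, h2, hc, hd]
  rcases hx with rfl | hx
  · rcases hy with rfl | hy
    · rfl
    · exact symmkey _ _ _ hy.1 hy.2
  · rcases hy with rfl | hy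
    · exact key _ _ _ hx.1 hx.2
    · rw [key _ x' _ hx.1 hx.2, symmkey _ _ _ hy.1 hy.2]

instance GSMetric (ι : Type) : MetricSpace (GS ι) where
  dist := Quotient.lift₂ preDist fun a₁ b₁ a₂ b₂ h₁ h₂ => preDist_wd a₁ b₁ a₂ b₂ h₁ h₂
  dist_self := by
    rintro ⟨x⟩
    show preDist x x = 0
    simp [preDist]
  dist_comm := by
    rintro ⟨x⟩ ⟨y⟩
    show preDist x y = preDist y x
    unfold preDist
    by_cases h : x.1 = y.1
    · rw [if_pos h, if_pos h.symm, dist_comm]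
    · have h' : ¬ y.1 = x.1 := fun hh => h hh.symm
      rw [if_neg h, if_neg h', dist_comm (x.2.val) (0 : EuclideanSpace ℝ (Fin 3)),
        dist_comm ((0 : EuclideanSpace ℝ (Fin 3))) (y.2.val)]
      ring
  dist_triangle := by
    rintro ⟨x⟩ ⟨y⟩ ⟨z⟩
    show preDist x z ≤ preDist x y + preDist y z
    unfold preDist
    have t3 := dist_triangle (x.2.val) (y.2.val) (z.2.val)
    have txy0 := dist_triangle (x.2.val) (y.2.val) (0 : EuclideanSpace ℝ (Fin 3))
    have t0yz := dist_triangle (0 : EuclideanSpace ℝ (Fin 3)) (y.2.val) (z.2.val)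
    have tx0z := dist_triangle (x.2.val) (0 : EuclideanSpace ℝ (Fin 3)) (z.2.val)
    have h0y : (0:ℝ) ≤ dist (0 : EuclideanSpace ℝ (Fin 3)) (y.2.val) := dist_nonneg
    have hy0 : (0:ℝ) ≤ dist (y.2.val) (0 : EuclideanSpace ℝ (Fin 3)) := dist_nonneg
    have hcy : dist (y.2.val) (0 : EuclideanSpace ℝ (Fin 3))
        = dist (0 : EuclideanSpace ℝ (Fin 3)) (y.2.val) := dist_comm _ _
    split_ifs with h1 h2 h3 h3' h2' h3'' h3'''
    all_goals
      first
        | exact absurd (‹x.1 = y.1›.trans ‹y.1 = z.1›) ‹¬ x.1 = z.1›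
        | exact absurd (‹x.1 = y.1›.symm.trans ‹x.1 = z.1›) ‹¬ y.1 = z.1›
        | exact absurd (‹x.1 = z.1›.trans ‹y.1 = z.1›.symm) ‹¬ x.1 = y.1›
        | linarith
  eq_of_dist_eq_zero := by
    rintro ⟨x⟩ ⟨y⟩ h
    replace h : preDist x y = 0 := h
    unfold preDist at h
    apply Quotient.sound
    by_cases hxy : x.1 = y.1
    · rw [if_pos hxy] at h
      left
      obtain ⟨a, xv⟩ := x
      obtain ⟨b, yv⟩ := y
      cases hxy
      have : xv = yv := Subtype.ext (by simpa using dist_eq_zero.mp h)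
      rw [this]
    · rw [if_neg hxy] at h
      right
      have hx0 : (0:ℝ) ≤ dist (x.2.val) (0 : EuclideanSpace ℝ (Fin 3)) := dist_nonneg
      have h0y : (0:ℝ) ≤ dist (0 : EuclideanSpace ℝ (Fin 3)) (y.2.val) := dist_nonneg
      have h1 : dist (x.2.val) (0 : EuclideanSpace ℝ (Fin 3)) = 0 := by linarith
      have h2 : dist (0 : EuclideanSpace ℝ (Fin 3)) (y.2.val) = 0 := by linarith
      exact ⟨dist_eq_zero.mp h1, (dist_eq_zero.mp h2).symm⟩

/-- The wedge point `∘` of the `ι`-fold Griffiths space. -/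
def basept {ι : Type} (a : ι) : GS ι := ⟦⟨a, ⟨0, zero_mem_GS1set⟩⟩⟧

lemma basept_eq {ι : Type} (a b : ι) : basept a = basept b :=
  Quotient.sound (Or.inr ⟨rfl, rfl⟩)

end Griffiths

namespace GrifAux

/-! ## Words -/

/-- Signed letters. The letter `((α, n), b)` has color `α`, level `n`. -/
abbrev Lt (ι : Type) := (ι × ℕ) × Bool

variable {ι : Type}

/-- delete letters of level `≥ m` -/
def cut (m : ℕ) (l : List (Lt ι)) : List (Lt ι) := l.filter (fun x => decide (x.1.2 < m))

@[simp] lemma cut_nil (m : ℕ) : cut m ([] : List (Lt ι)) = [] := rfl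
@[simp] lemma cut_append (m : ℕ) (a b : List (Lt ι)) : cut m (a ++ b) = cut m a ++ cut m b := by
  simp [cut]
lemma cut_cons_pos {m : ℕ} {x : Lt ι} (h : x.1.2 < m) (l : List (Lt ι)) :
    cut m (x :: l) = x :: cut m l := by simp [cut, h]
lemma cut_cons_neg {m : ℕ} {x : Lt ι} (h : ¬ x.1.2 < m) (l : List (Lt ι)) :
    cut m (x :: l) = cut m l := by simp [cut, h]
lemma cut_cut {m n : ℕ} (h : m ≤ n) (l : List (Lt ι)) : cut m (cut n l) = cut m l := by
  unfold cut
  rw [List.filter_filter]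
  apply List.filter_congr
  intro x _
  by_cases hx : x.1.2 < m
  · have : x.1.2 < n := by omega
    simp [hx, this]
  · simp [hx]
lemma cut_cut' {m n : ℕ} (h : n ≤ m) (l : List (Lt ι)) : cut m (cut n l) = cut n l := by
  unfold cut
  rw [List.filter_filter]
  apply List.filter_congr
  intro x _
  by_cases hx : x.1.2 < n
  · have : x.1.2 < m := by omega
    simp [hx, this]
  · simp [hx]
lemma mem_cut {m : ℕ} {x : Lt ι} {l : List (Lt ι)} : x ∈ cut m l ↔ x ∈ l ∧ x.1.2 < m := by
  simp [cut]
lemma cut_invRev (m : ℕ) (l : List (Lt ι)) :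
    cut m (FreeGroup.invRev l) = FreeGroup.invRev (cut m l) := by
  unfold cut FreeGroup.invRev
  rw [List.filter_reverse, List.filter_map]
  rfl

/-- A countable word: coherent sequence of finite lists. -/
@[ext] structure Wd (ι : Type) where
  s : ℕ → List (Lt ι)
  coh : ∀ m n, m ≤ n → cut m (s n) = s m

namespace Wd

lemma cut_self (W : Wd ι) (n : ℕ) : cut n (W.s n) = W.s n := W.coh n n le_rfl

lemma ext_ge {V W : Wd ι} (N : ℕ) (h : ∀ n, N ≤ n → V.s n = W.s n) : V = W := by
  apply Wd.ext; funext n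
  rw [← V.coh n (max n N) (le_max_left _ _), ← W.coh n (max n N) (le_max_left _ _),
    h _ (le_max_right _ _)]

lemma ext_freq {V W : Wd ι} (h : ∀ N, ∃ n, N ≤ n ∧ V.s n = W.s n) : V = W := by
  apply Wd.ext; funext n
  obtain ⟨k, hk, e⟩ := h n
  rw [← V.coh n k hk, ← W.coh n k hk, e]

instance : Mul (Wd ι) := ⟨fun a b => ⟨fun n => a.s n ++ b.s n, fun m n h => by
  rw [cut_append, a.coh m n h, b.coh m n h]⟩⟩
instance : One (Wd ι) := ⟨⟨fun _ => [], fun _ _ _ => rfl⟩⟩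
instance : Inv (Wd ι) := ⟨fun a => ⟨fun n => FreeGroup.invRev (a.s n), fun m n h => by
  rw [cut_invRev, a.coh m n h]⟩⟩

@[simp] lemma s_mul (a b : Wd ι) (n : ℕ) : (a * b).s n = a.s n ++ b.s n := rfl
@[simp] lemma s_one (n : ℕ) : (1 : Wd ι).s n = [] := rfl
@[simp] lemma s_inv (a : Wd ι) (n : ℕ) : (a⁻¹).s n = FreeGroup.invRev (a.s n) := rfl

lemma eq_one_of_s {a : Wd ι} (h : ∀ n, a.s n = []) : a = 1 := by
  apply Wd.ext; funext n; simp [h n]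

lemma exists_s_ne {a : Wd ι} (h : a ≠ 1) : ∃ n, a.s n ≠ [] := by
  by_contra hc; push Not at hc; exact h (eq_one_of_s hc)

lemma s_ne_mono {a : Wd ι} {m n : ℕ} (h : m ≤ n) (ha : a.s m ≠ []) : a.s n ≠ [] := by
  intro h'; apply ha; rw [← a.coh m n h, h']; rfl

instance : Monoid (Wd ι) where
  mul_assoc a b c := by apply Wd.ext; funext n; simp
  one_mul a := by apply Wd.ext; funext n; simp
  mul_one a := by apply Wd.ext; funext n; simp

lemma mul_eq_one {a b : Wd ι} (h : a * b = 1) : a = 1 ∧ b = 1 := by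
  have : ∀ n, a.s n = [] ∧ b.s n = [] := fun n => by
    have := congrArg (fun w => Wd.s w n) h
    simpa using this
  exact ⟨eq_one_of_s fun n => (this n).1, eq_one_of_s fun n => (this n).2⟩

instance : DivisionMonoid (Wd ι) where
  inv_inv a := by apply Wd.ext; funext n; simp
  mul_inv_rev a b := by
    apply Wd.ext; funext n
    simp [FreeGroup.invRev]
  inv_eq_of_mul a b h := by
    obtain ⟨rfl, rfl⟩ := mul_eq_one h
    rfl

instance : IsCancelMul (Wd ι) where
  mul_left_cancel a b c h := by
    apply Wd.ext; funext n
    have := congrArg (fun w => Wd.s w n) h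
    simpa using this
  mul_right_cancel a b c h := by
    apply Wd.ext; funext n
    have := congrArg (fun w => Wd.s w n) h
    simpa using this

/-- Prefixes. `a ∣ c` means `∃ e, c = a * e`. -/
lemma dvd_iff {a c : Wd ι} : a ∣ c ↔ ∀ n, a.s n <+: c.s n := by
  constructor
  · rintro ⟨e, rfl⟩ n; exact ⟨e.s n, rfl⟩
  · intro h
    choose e he using h
    refine ⟨⟨e, fun m n hmn => ?_⟩, ?_⟩
    · have := congrArg (cut m) (he n)
      rw [cut_append, a.coh m n hmn, c.coh m n hmn, ← he m] at this
      exact List.append_cancel_left this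
    · apply Wd.ext; funext n; exact (he n).symm

lemma cut_pfx_of {l l' : List (Lt ι)} (h : l <+: l') (m : ℕ) : cut m l <+: cut m l' :=
  List.IsPrefix.filter _ h

lemma dvd_of_freq {a c : Wd ι} (h : ∀ N, ∃ n, N ≤ n ∧ a.s n <+: c.s n) : a ∣ c := by
  rw [dvd_iff]; intro n
  obtain ⟨k, hk, e⟩ := h n
  rw [← a.coh n k hk, ← c.coh n k hk]
  exact cut_pfx_of e n

lemma dvd_antisymm' {a b : Wd ι} (h : a ∣ b) (h' : b ∣ a) : a = b := by
  obtain ⟨e, rfl⟩ := h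
  obtain ⟨f, hf⟩ := h'
  rw [mul_assoc] at hf
  have : e * f = 1 := by
    have := mul_left_cancel (a := a) (b := 1) (c := e * f) (by rw [mul_one]; exact hf)
    exact this.symm
  rw [(mul_eq_one this).1, mul_one]

lemma dvd_total {a b c : Wd ι} (ha : a ∣ c) (hb : b ∣ c) : a ∣ b ∨ b ∣ a := by
  by_cases h : ∀ N, ∃ n, N ≤ n ∧ a.s n <+: b.s n
  · exact Or.inl (dvd_of_freq h)
  · right
    push Not at h
    obtain ⟨N, hN⟩ := h
    apply dvd_of_freq
    intro M
    refine ⟨max N M, le_max_right _ _, ?_⟩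
    have := hN (max N M) (le_max_left _ _)
    rcases List.prefix_or_prefix_of_prefix (dvd_iff.1 ha (max N M)) (dvd_iff.1 hb (max N M)) with h | h
    · exact absurd h this
    · exact h

lemma levi {a b c d : Wd ι} (h : a * b = c * d) :
    (∃ e, c = a * e ∧ b = e * d) ∨ (∃ e, a = c * e ∧ d = e * b) := by
  rcases dvd_total (c := a * b) ⟨b, rfl⟩ ⟨d, h⟩ with ⟨e, he⟩ | ⟨e, he⟩
  · left; refine ⟨e, he, ?_⟩
    subst he
    rw [mul_assoc] at h
    exact mul_left_cancel h
  · right; refine ⟨e, he, ?_⟩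
    subst he
    rw [mul_assoc] at h
    exact (mul_left_cancel h).symm

lemma eq_of_dvd_of_s {a c : Wd ι} (h : a ∣ c) (hl : ∀ n, (c.s n).length ≤ (a.s n).length) :
    a = c := by
  apply Wd.ext; funext n
  exact (dvd_iff.1 h n).eq_of_length_le (hl n)

/-- sup of a set of prefixes of `W` -/
lemma exists_sup (W : Wd ι) (S : Set (Wd ι)) (hS : ∀ C ∈ S, C ∣ W) (hne : S.Nonempty) :
    ∃ B, (∀ C ∈ S, C ∣ B) ∧ (∀ n, ∃ C ∈ S, B.s n = C.s n) ∧ B ∣ W := by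
  have hmax : ∀ n, ∃ C ∈ S, ∀ C' ∈ S, C'.s n <+: C.s n := by
    intro n
    have hfin : (((fun C : Wd ι => (C.s n).length) '' S)).Finite := by
      apply (Set.finite_Iic (W.s n).length).subset
      rintro _ ⟨C, hC, rfl⟩
      exact (dvd_iff.1 (hS C hC) n).length_le
    obtain ⟨_, ⟨C, hC, rfl⟩, hm⟩ := Set.exists_max_image _ id hfin (hne.image _)
    have hmax : ∀ C' ∈ S, (C'.s n).length ≤ (C.s n).length :=
      fun C' hC' => hm _ (mem_image_of_mem _ hC')
    refine ⟨C, hC, fun C' hC' => ?_⟩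
    exact List.prefix_of_prefix_length_le (dvd_iff.1 (hS C' hC') n) (dvd_iff.1 (hS C hC) n)
      (hmax C' hC')
  choose C hC hCm using hmax
  have hBcoh : ∀ m n, m ≤ n → cut m ((C n).s n) = (C m).s m := by
    intro m n hmn
    rw [(C n).coh m n hmn]
    apply List.IsPrefix.eq_of_length_le (hCm m _ (hC n))
    have h1 := cut_pfx_of (hCm n _ (hC m)) m
    rw [(C n).coh m n hmn, (C m).coh m n hmn] at h1
    exact h1.length_le
  refine ⟨⟨fun n => (C n).s n, hBcoh⟩, ?_, ?_, ?_⟩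
  · intro C' hC'; rw [dvd_iff]; intro n; exact hCm n C' hC'
  · intro n; exact ⟨C n, hC n, rfl⟩
  · rw [dvd_iff]; intro n; exact dvd_iff.1 (hS _ (hC n)) n

/-- one-letter word -/
def of (x : Lt ι) : Wd ι := ⟨fun n => if x.1.2 < n then [x] else [], fun m n h => by
  by_cases h1 : x.1.2 < m
  · have : x.1.2 < n := by omega
    simp [h1, this, cut_cons_pos]
  · by_cases h2 : x.1.2 < n <;> simp [h1, h2, cut_cons_neg]⟩

lemma of_s_pos {x : Lt ι} {n : ℕ} (h : x.1.2 < n) : (of x).s n = [x] := by simp [of, h]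
lemma of_s_neg {x : Lt ι} {n : ℕ} (h : ¬ x.1.2 < n) : (of x).s n = [] := by simp [of, h]

lemma of_ne_one (x : Lt ι) : of x ≠ 1 := by
  intro h
  have := congrArg (fun w => Wd.s w (x.1.2+1)) h
  simp [of] at this

lemma of_inv (x : Lt ι) : (of x)⁻¹ = of (x.1, !x.2) := by
  apply Wd.ext; funext n
  by_cases h : x.1.2 < n <;> simp [of, h, FreeGroup.invRev]

lemma split_unique {p : Lt ι → Bool} {A A' B B' : List (Lt ι)} {x x' : Lt ι}
    (h : A ++ x :: B = A' ++ x' :: B') (hx : p x = true) (hx' : p x' = true)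
    (hl : (A.filter p).length = (A'.filter p).length) : A = A' ∧ x = x' ∧ B = B' := by
  induction A generalizing A' with
  | nil =>
    cases A' with
    | nil => simpa using h
    | cons y A' =>
      simp only [List.nil_append, List.cons_append, List.cons.injEq] at h
      rw [← h.1, List.filter_cons_of_pos hx] at hl
      simp at hl
  | cons z A ih =>
    cases A' with
    | nil =>
      simp only [List.nil_append, List.cons_append, List.cons.injEq] at h
      rw [h.1, List.filter_cons_of_pos hx'] at hl
      simp at hl
    | cons y A' =>
      simp only [List.cons_append, List.cons.injEq] at h
      obtain ⟨rfl, h⟩ := h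
      have := ih h (by
        by_cases hz : p z = true
        · simpa [List.filter_cons_of_pos hz] using hl
        · simpa [List.filter_cons_of_neg hz] using hl)
      exact ⟨by rw [this.1], this.2⟩

lemma filter_split {p : Lt ι → Bool} : ∀ {l L1 L2 : List (Lt ι)} {x : Lt ι},
    l.filter p = L1 ++ x :: L2 →
    ∃ A B, l = A ++ x :: B ∧ A.filter p = L1 ∧ B.filter p = L2
  | [], L1, L2, x, h => by simp at h
  | y :: l, L1, L2, x, h => by
    by_cases hy : p y = true
    · rw [List.filter_cons_of_pos hy] at h
      cases L1 with
      | nil =>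
        simp only [List.nil_append, List.cons.injEq] at h
        exact ⟨[], l, by simp [h.1], rfl, h.2⟩
      | cons z L1 =>
        simp only [List.cons_append, List.cons.injEq] at h
        obtain ⟨A, B, rfl, h1, h2⟩ := filter_split h.2
        exact ⟨y :: A, B, rfl, by rw [List.filter_cons_of_pos hy, h1, h.1], h2⟩
    · rw [List.filter_cons_of_neg hy] at h
      obtain ⟨A, B, rfl, h1, h2⟩ := filter_split h
      exact ⟨y :: A, B, rfl, by rw [List.filter_cons_of_neg hy, h1], h2⟩

/-- word from eventual data -/
def ofTail (m : ℕ) (f : ℕ → List (Lt ι)) (h : ∀ n n', m ≤ n → n ≤ n' → cut n (f n') = f n) :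
    Wd ι := ⟨fun n => cut n (f (max m n)), fun k n hkn => by
      rw [cut_cut hkn]
      rw [← h (max m k) (max m n) (le_max_left _ _) (by omega), cut_cut (le_max_right _ _)]⟩

lemma ofTail_s {m : ℕ} {f : ℕ → List (Lt ι)} {h} {n : ℕ} (hn : m ≤ n) :
    (ofTail m f h).s n = f n := by
  have : max m n = n := by omega
  simp only [ofTail, this]
  exact h n n hn le_rfl

lemma letter_split {W : Wd ι} {m : ℕ} {L1 L2 : List (Lt ι)} {x : Lt ι}
    (h : W.s m = L1 ++ x :: L2) :
    ∃ X R, W = X * of x * R ∧ X.s m = L1 ∧ R.s m = L2 := by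
  have hx : x.1.2 < m := by
    have : x ∈ cut m (W.s m) := by rw [W.cut_self, h]; simp
    exact (mem_cut.1 this).2
  have key : ∀ n, ∃ AB : List (Lt ι) × List (Lt ι), m ≤ n →
      W.s n = AB.1 ++ x :: AB.2 ∧ cut m AB.1 = L1 ∧ cut m AB.2 = L2 := by
    intro n
    by_cases hn : m ≤ n
    · have h1 : cut m (W.s n) = L1 ++ x :: L2 := by rw [W.coh m n hn, h]
      obtain ⟨A, B, h2, h3, h4⟩ := filter_split h1
      exact ⟨(A, B), fun _ => ⟨h2, h3, h4⟩⟩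
    · exact ⟨([],[]), fun h => absurd h hn⟩
  choose f hf using key
  have hc : ∀ n n', m ≤ n → n ≤ n' → cut n (f n').1 = (f n).1 ∧ cut n (f n').2 = (f n).2 := by
    intro n n' h1 h2
    have e := congrArg (cut n) (hf n' (h1.trans h2)).1
    rw [W.coh n n' h2, (hf n h1).1, cut_append, cut_cons_pos (lt_of_lt_of_le hx h1)] at e
    have := split_unique (p := fun x => decide (x.1.2 < m)) e.symm (by simpa using hx)
      (by simpa using hx) (by
        change (cut m (cut n _)).length = (cut m _).length
        rw [cut_cut h1, (hf n' (h1.trans h2)).2.1, (hf n h1).2.1])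
    exact ⟨this.1, this.2.2⟩
  refine ⟨ofTail m (fun n => (f n).1) (fun n n' h1 h2 => (hc n n' h1 h2).1),
    ofTail m (fun n => (f n).2) (fun n n' h1 h2 => (hc n n' h1 h2).2), ?_, ?_, ?_⟩
  · apply ext_ge m
    intro n hn
    rw [s_mul, s_mul, ofTail_s hn, ofTail_s hn, of_s_pos (lt_of_lt_of_le hx hn), (hf n hn).1]
    simp
  · rw [ofTail_s le_rfl, ← (hf m le_rfl).2.1, ← hc m m le_rfl le_rfl |>.1, cut_cut le_rfl]
  · rw [ofTail_s le_rfl, ← (hf m le_rfl).2.2, ← hc m m le_rfl le_rfl |>.2, cut_cut le_rfl]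

end Wd

/-! ## Projection to free groups -/

abbrev FG (ι : Type) := FreeGroup (ι × ℕ)

open scoped Classical in
/-- kill generators of level ≥ m -/
def rho (m : ℕ) : FG ι →* FG ι :=
  FreeGroup.lift (fun x => if x.2 < m then FreeGroup.of x else 1)

lemma FG_mk_cons (x : Lt ι) (l : List (Lt ι)) :
    (FreeGroup.mk (x :: l) : FG ι) = FreeGroup.mk [x] * FreeGroup.mk l := by
  rw [FreeGroup.mul_mk]; rfl

lemma rho_mk (m : ℕ) (l : List (Lt ι)) :
    rho m (FreeGroup.mk l) = FreeGroup.mk (cut m l) := by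
  induction l with
  | nil => simp only [cut_nil]; exact map_one _
  | cons x l ih =>
    rw [FG_mk_cons, map_mul, ih]
    by_cases h : x.1.2 < m
    · rw [cut_cons_pos h, FG_mk_cons x (cut m l)]
      congr 1
      rcases x with ⟨x, b⟩
      have h' : x.2 < m := h
      cases b <;> simp [rho, h', FreeGroup.of, FreeGroup.inv_mk, FreeGroup.invRev]
    · rw [cut_cons_neg h]
      rcases x with ⟨x, b⟩
      have h' : ¬ x.2 < m := h
      cases b <;> simp [rho, h']

/-- the map from words to the inverse limit -/
def ppi : Wd ι →* (ℕ → FG ι) where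
  toFun W n := FreeGroup.mk (W.s n)
  map_one' := rfl
  map_mul' a b := by funext n; simp [FreeGroup.mul_mk]

lemma ppi_apply (W : Wd ι) (n : ℕ) : ppi W n = FreeGroup.mk (W.s n) := rfl

lemma ppi_inv (W : Wd ι) : ppi (W⁻¹) = (ppi W)⁻¹ := by
  funext n
  simp [ppi, FreeGroup.inv_mk]

lemma rho_ppi (W : Wd ι) {m n : ℕ} (h : m ≤ n) : rho m (ppi W n) = ppi W m := by
  rw [ppi_apply, rho_mk, W.coh m n h]; rfl

/-- The Hawaiian earring group. -/
def H (ι : Type) : Subgroup (ℕ → FG ι) where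
  carrier := Set.range ppi
  one_mem' := ⟨1, map_one _⟩
  mul_mem' := by rintro _ _ ⟨a, rfl⟩ ⟨b, rfl⟩; exact ⟨a * b, map_mul _ _ _⟩
  inv_mem' := by rintro _ ⟨a, rfl⟩; exact ⟨a⁻¹, ppi_inv a⟩

def pr : Wd ι →* H ι where
  toFun W := ⟨ppi W, W, rfl⟩
  map_one' := Subtype.ext (map_one _)
  map_mul' a b := Subtype.ext (map_mul _ _ _)

lemma pr_inv (W : Wd ι) : pr (W⁻¹) = (pr W)⁻¹ := Subtype.ext (ppi_inv W)

lemma pr_surj (g : H ι) : ∃ W, pr W = g := by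
  obtain ⟨g, W, rfl⟩ := g; exact ⟨W, rfl⟩

lemma pr_eq {V W : Wd ι} : pr V = pr W ↔ ∀ n, (FreeGroup.mk (V.s n) : FG ι) = FreeGroup.mk (W.s n) := by
  constructor
  · intro h n
    exact congrFun (congrArg Subtype.val h) n
  · intro h; apply Subtype.ext; funext n; exact h n

lemma pr_eq_one {V : Wd ι} : pr V = 1 ↔ ∀ n, (FreeGroup.mk (V.s n) : FG ι) = 1 := by
  rw [← map_one pr, pr_eq]; rfl

lemma pr_eq_one_freq {V : Wd ι} (h : ∀ N, ∃ n, N ≤ n ∧ (FreeGroup.mk (V.s n) : FG ι) = 1) :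
    pr V = 1 := by
  rw [pr_eq_one]
  intro n
  obtain ⟨k, hk, e⟩ := h n
  rw [← V.coh n k hk, ← rho_mk, e, map_one]

/-- reduced words -/
def Red (W : Wd ι) : Prop := ∀ a b c, W = a * b * c → pr b = 1 → b = 1

lemma Red.fac {a b c : Wd ι} (h : Red (a * b * c)) : Red b := by
  intro x y z hb hy
  subst hb
  exact h (a * x) y (z * c) (by simp [mul_assoc]) hy

lemma Red.left {a b : Wd ι} (h : Red (a * b)) : Red a := by
  apply Red.fac (a := 1) (c := b); simpa using h
lemma Red.right {a b : Wd ι} (h : Red (a * b)) : Red b := by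
  apply Red.fac (a := a) (c := 1); simpa using h

lemma Red.inv {a : Wd ι} (h : Red a) : Red a⁻¹ := by
  intro x y z ha hy
  have : a = z⁻¹ * y⁻¹ * x⁻¹ := by rw [← inv_inv a, ha]; simp [mul_assoc]
  have := h _ _ _ this (by rw [pr_inv, hy, inv_one])
  exact inv_eq_one.1 this

lemma Red.one : Red (1 : Wd ι) := by
  intro a b c h _
  exact (Wd.mul_eq_one (Wd.mul_eq_one h.symm).1).2

lemma Red.eq_one {a : Wd ι} (h : Red a) (h1 : pr a = 1) : a = 1 :=
  h 1 a 1 (by simp) h1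

/-! ### finite reduction lemmas -/

open scoped Classical in
lemma reduce_head : ∀ (N : ℕ) (L : List (Lt ι)), L.length ≤ N → ∀ y rest,
    FreeGroup.reduce L = y :: rest →
    ∃ L2 L3, L = L2 ++ y :: L3 ∧ (FreeGroup.mk L2 : FG ι) = 1 ∧ FreeGroup.reduce L3 = rest := by
  intro N
  induction N with
  | zero =>
    intro L hL y rest h
    have : L = [] := List.length_eq_zero_iff.1 (by omega)
    subst this
    simp at h
  | succ N ih =>
    intro L hL y rest h
    cases L with
    | nil => simp at h
    | cons x L' =>
      simp only [List.length_cons, Nat.add_le_add_iff_right] at hL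
      rw [FreeGroup.reduce.cons] at h
      cases hr : FreeGroup.reduce L' with
      | nil =>
        rw [hr] at h
        simp only [List.cons.injEq] at h
        exact ⟨[], L', by simp [h.1], rfl, by rw [hr, h.2]⟩
      | cons z r' =>
        rw [hr] at h
        simp only at h
        split_ifs at h with hz
        · obtain ⟨M2, M3, rfl, h2, h3⟩ := ih L' hL z r' hr
          rw [h] at h3
          obtain ⟨N2, N3, rfl, h4, h5⟩ := ih M3 (by simp at hL; omega) y rest h3
          refine ⟨x :: M2 ++ z :: N2, N3, by simp, ?_, h5⟩
          have hz' : x = (z.1, !z.2) := Prod.ext hz.1 hz.2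
          rw [← FreeGroup.mul_mk, FG_mk_cons, FG_mk_cons z, h2, h4, mul_one, mul_one,
            FreeGroup.mul_mk, hz']
          rcases z with ⟨z, b⟩
          have : FreeGroup.Red.Step ([] ++ (z, !b) :: (z, !!b) :: []) ([] ++ ([] : List (Lt ι))) :=
            FreeGroup.Red.Step.not
          have := FreeGroup.Red.exact.2 ⟨_, FreeGroup.Red.Step.to_red this, FreeGroup.Red.refl⟩
          rw [FreeGroup.one_eq_mk]
          simpa using this
        · simp only [List.cons.injEq] at h
          exact ⟨[], L', by simp [h.1], rfl, by rw [hr, h.2]⟩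

open scoped Classical in
lemma reduce_lose (m : ℕ) (L : List (Lt ι)) :
    cut m (FreeGroup.reduce L) = cut m L ∨
    ∃ L1 x L2 L3, L = L1 ++ x :: (L2 ++ (x.1, !x.2) :: L3) ∧ x.1.2 < m ∧
      (FreeGroup.mk L2 : FG ι) = 1 := by
  induction L with
  | nil => left; simp
  | cons x L ih =>
    rcases ih with ih | ⟨L1, y, L2, L3, rfl, h1, h2⟩
    · rw [FreeGroup.reduce.cons]
      cases hr : FreeGroup.reduce L with
      | nil =>
        left
        rw [hr] at ih
        show cut m [x] = _
        change cut m ([x] ++ []) = cut m ([x] ++ L)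
        rw [cut_append, cut_append, ih]
      | cons z r' =>
        rw [hr] at ih
        simp only
        split_ifs with hz
        · by_cases hx : x.1.2 < m
          · right
            obtain ⟨L2, L3, rfl, h2, -⟩ := reduce_head _ L le_rfl z r' hr
            refine ⟨[], x, L2, L3, ?_, hx, h2⟩
            have : z = (x.1, !x.2) := by
              rw [hz.2, hz.1]; simp
            rw [← this]; simp
          · left
            rw [cut_cons_neg hx, ← ih, cut_cons_neg]
            rw [← hz.1]; exact hx
        · left
          change cut m ([x] ++ _) = cut m ([x] ++ L)
          rw [cut_append, cut_append, ih]
    · right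
      exact ⟨x :: L1, y, L2, L3, rfl, h1, h2⟩

open scoped Classical in
lemma toWord_rho_sublist (m : ℕ) (g : FG ι) :
    (rho m g).toWord.Sublist (cut m g.toWord) := by
  have : rho m g = FreeGroup.mk (cut m g.toWord) := by
    rw [← rho_mk, FreeGroup.mk_toWord]
  rw [this, FreeGroup.toWord_mk]
  exact FreeGroup.reduce.red.sublist

lemma cut_sublist {l l' : List (Lt ι)} (h : l.Sublist l') (m : ℕ) :
    (cut m l).Sublist (cut m l') := List.Sublist.filter _ h

open scoped Classical in
/-- F1 existence in the form of a criterion. -/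
lemma exists_reduced (g : ℕ → FG ι) (hg : ∀ m n, m ≤ n → rho m (g n) = g m)
    (hb : ∀ m, ∃ C, ∀ n, (cut m (g n).toWord).length ≤ C) :
    ∃ V : Wd ι, ppi V = g ∧ Red V ∧ ∀ m, ∃ N, ∀ n, N ≤ n → cut m (g n).toWord = V.s m := by
  have hself : ∀ n, cut n (g n).toWord = (g n).toWord := by
    intro n
    have h1 := toWord_rho_sublist n (g n)
    rw [hg n n le_rfl] at h1
    apply List.Sublist.eq_of_length_le (List.filter_sublist)
    exact h1.length_le
  have hmono : ∀ m n n', m ≤ n → n ≤ n' → (cut m (g n).toWord).Sublist (cut m (g n').toWord) := by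
    intro m n n' h1 h2
    have h3 := toWord_rho_sublist n (g n')
    rw [hg n n' h2] at h3
    have h4 := cut_sublist h3 m
    rwa [cut_cut h1] at h4
  have hst : ∀ m, ∃ N, m ≤ N ∧ ∀ n, N ≤ n → cut m (g n).toWord = cut m (g N).toWord := by
    intro m
    obtain ⟨C, hC⟩ := hb m
    have hfin : ((fun n => (cut m (g n).toWord).length) '' Ici m).Finite :=
      (Set.finite_Iic C).subset (by rintro _ ⟨n, -, rfl⟩; exact hC n)
    obtain ⟨_, ⟨N, hN, rfl⟩, hmax⟩ := Set.exists_max_image _ id hfin ⟨_, m, self_mem_Ici, rfl⟩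
    refine ⟨N, hN, fun n hn => ?_⟩
    symm
    apply (hmono m N n hN hn).eq_of_length_le
    exact hmax _ ⟨n, le_trans (mem_Ici.1 hN) hn, rfl⟩
  choose N hN hst using hst
  let V : Wd ι := ⟨fun m => cut m (g (N m)).toWord, fun m n hmn => by
    have h1 := hst n (max (N m) (N n)) (le_max_right _ _)
    have h2 := hst m (max (N m) (N n)) (le_max_left _ _)
    rw [← h1, ← h2, cut_cut hmn]⟩
  have hV : ∀ m n, N m ≤ n → cut m (g n).toWord = V.s m := hst
  have hpi : ppi V = g := by
    funext m
    rw [ppi_apply]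
    show FreeGroup.mk (cut m (g (N m)).toWord) = _
    rw [← rho_mk, FreeGroup.mk_toWord, hg m _ (hN m)]
  refine ⟨V, hpi, ?_, fun m => ⟨N m, hV m⟩⟩
  intro a b c habc hb1
  by_contra hbne
  obtain ⟨m, hm⟩ := Wd.exists_s_ne hbne
  set n := max (N m) m
  have h1 : (FreeGroup.mk (a.s n ++ c.s n) : FG ι) = g n := by
    rw [← hpi, habc]
    rw [map_mul, map_mul]
    have : ppi b = 1 := congrArg Subtype.val hb1
    rw [this, mul_one, ← map_mul]; rfl
  have h2 : (g n).toWord.Sublist (a.s n ++ c.s n) := by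
    rw [← h1, FreeGroup.toWord_mk]
    exact FreeGroup.reduce.red.sublist
  have h3 := (cut_sublist h2 m).length_le
  rw [hV m n (le_max_left _ _), cut_append, a.coh m n (le_max_right _ _),
    c.coh m n (le_max_right _ _), habc] at h3
  have := List.length_pos_iff.2 hm
  simp only [Wd.s_mul, List.length_append] at h3
  omega

open scoped Classical in
lemma exists_red (W : Wd ι) : ∃ V, pr V = pr W ∧ Red V ∧ ∀ m, (V.s m).Sublist (W.s m) := by
  obtain ⟨V, h1, h2, h3⟩ := exists_reduced (ppi W) (fun m n h => rho_ppi W h) (fun m =>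
    ⟨(W.s m).length, fun n => by
      by_cases h : m ≤ n
      · rw [ppi_apply, FreeGroup.toWord_mk, ← W.coh m n h]
        exact (cut_sublist FreeGroup.reduce.red.sublist m).length_le
      · rw [ppi_apply, FreeGroup.toWord_mk]
        push Not at h
        calc _ ≤ (FreeGroup.reduce (W.s n)).length := List.length_filter_le _ _
          _ ≤ (W.s n).length := FreeGroup.reduce.red.sublist.length_le
          _ ≤ _ := by rw [← W.coh n m h.le]; exact List.length_filter_le _ _⟩)
  refine ⟨V, Subtype.ext h1, h2, fun m => ?_⟩
  obtain ⟨N, hN⟩ := h3 m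
  rw [← hN (max N m) (le_max_left _ _), ppi_apply, FreeGroup.toWord_mk,
    ← W.coh m (max N m) (le_max_right _ _)]
  exact cut_sublist FreeGroup.reduce.red.sublist m

open scoped Classical in
lemma Red.frequently {V : Wd ι} (hV : Red V) (m : ℕ) :
    ∃ N, ∀ n, N ≤ n → cut m (FreeGroup.reduce (V.s n)) = V.s m := by
  have hfreq : ∃ N, m ≤ N ∧ cut m (FreeGroup.reduce (V.s N)) = V.s m := by
    by_contra hc
    push Not at hc
    have key : ∀ n, ∃ q : ℕ × ℕ, m ≤ n → q.1 ≤ (V.s m).length ∧ q.2 ≤ (V.s m).length ∧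
      ∃ L1 x L2 L3, V.s n = L1 ++ x :: (L2 ++ (x.1, !x.2) :: L3) ∧ x.1.2 < m ∧
      (FreeGroup.mk L2 : FG ι) = 1 ∧ (cut m L1).length = q.1 ∧ (cut m L2).length = q.2 := by
      intro n
      by_cases hn : m ≤ n
      · rcases reduce_lose m (V.s n) with h | ⟨L1, x, L2, L3, h1, h2, h3⟩
        · rw [V.coh m n hn] at h; exact absurd h (hc n hn)
        · refine ⟨((cut m L1).length, (cut m L2).length), fun _ => ⟨?_, ?_, L1, x, L2, L3, h1, h2, h3, rfl, rfl⟩⟩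
          all_goals
            rw [← V.coh m n hn, h1, cut_append, cut_cons_pos h2, cut_append]
            simp
            try omega
      · exact ⟨(0,0), fun h => absurd h hn⟩
    choose q hq using key
    have hmaps : ∀ n : {n // m ≤ n}, ∃ r : Iic (V.s m).length × Iic (V.s m).length,
        (r.1.1, r.2.1) = q n := fun n => ⟨(⟨_, (hq n.1 n.2).1⟩, ⟨_, (hq n.1 n.2).2.1⟩), rfl⟩
    choose r hr using hmaps
    have : Infinite {n // m ≤ n} := Set.infinite_coe_iff.2 (Set.Ici_infinite m)
    obtain ⟨r0, hr0⟩ := Finite.exists_infinite_fiber r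
    have hinf : ∀ M, ∃ n, M ≤ n ∧ m ≤ n ∧ q n = (r0.1.1, r0.2.1) := by
      intro M
      have hi : (Subtype.val '' (r ⁻¹' {r0})).Infinite :=
        (Set.infinite_coe_iff.1 hr0).image Subtype.val_injective.injOn
      obtain ⟨n, ⟨n', hn', rfl⟩, hM⟩ := hi.exists_gt M
      refine ⟨n'.1, hM.le, n'.2, ?_⟩
      rw [← hr n']
      have : r n' = r0 := hn'
      rw [this]
    obtain ⟨n0, -, hn0, hq0⟩ := hinf 0
    obtain ⟨L1, x, L2, L3, e, hx, -, hl1, hl2⟩ := (hq n0 hn0).2.2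
    obtain ⟨X, R, hW, hX, hR⟩ := Wd.letter_split e
    obtain ⟨Y, Z, hR', hY, -⟩ := Wd.letter_split hR
    have hpY : pr Y = 1 := by
      apply pr_eq_one_freq
      intro M
      obtain ⟨n, hn, hmn, hqn⟩ := hinf (max M n0)
      refine ⟨n, le_trans (le_max_left _ _) hn, ?_⟩
      have hn0n : n0 ≤ n := le_trans (le_max_right _ _) hn
      obtain ⟨L1', x', L2', L3', e', hx', ht, hl1', hl2'⟩ := (hq n hmn).2.2
      have hVn : V.s n = X.s n ++ x :: (Y.s n ++ (x.1, !x.2) :: Z.s n) := by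
        rw [hW, hR']
        simp [Wd.of_s_pos (x := x) (lt_of_lt_of_le hx hmn), Wd.of_s_pos (x := (x.1, !x.2)) (lt_of_lt_of_le hx hmn)]
      have s1 := Wd.split_unique (p := fun x => decide (x.1.2 < m)) (hVn.symm.trans e')
        (by simpa using hx) (by simpa using hx') (by
          change (cut m _).length = (cut m _).length
          rw [hl1', hqn, ← hq0, ← hl1, ← hX, X.coh m n hmn, X.coh m n0 hn0])
      have s2 := Wd.split_unique (p := fun x => decide (x.1.2 < m)) s1.2.2
        (by simpa using hx) (by simpa using hx') (by
          change (cut m _).length = (cut m _).length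
          rw [hl2', hqn, ← hq0, ← hl2, ← hY, Y.coh m n hmn, Y.coh m n0 hn0])
      rw [s2.1]; exact ht
    have := hV X (Wd.of x * Y * Wd.of (x.1, !x.2)) Z (by rw [hW, hR']; simp [mul_assoc]) (by
      rw [map_mul, map_mul, hpY, ← Wd.of_inv, pr_inv]; simp)
    exact Wd.of_ne_one x (Wd.mul_eq_one (Wd.mul_eq_one this).1).1
  obtain ⟨N, hmN, hN⟩ := hfreq
  refine ⟨N, fun n hn => ?_⟩
  symm
  have h0 : ∀ n, m ≤ n → (cut m (FreeGroup.reduce (V.s n))).Sublist (V.s m) := fun n hn => by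
    rw [← V.coh m n hn]; exact cut_sublist FreeGroup.reduce.red.sublist m
  have h1 := toWord_rho_sublist N (ppi V n)
  rw [rho_ppi V hn, ppi_apply, ppi_apply, FreeGroup.toWord_mk, FreeGroup.toWord_mk] at h1
  have h2 := cut_sublist h1 m
  rw [cut_cut hmN, hN] at h2
  exact h2.eq_of_length_le (h0 n (hmN.trans hn)).length_le

/-- F1 uniqueness -/
lemma Red.unique {V W : Wd ι} (hV : Red V) (hW : Red W) (h : pr V = pr W) : V = W := by
  classical
  apply Wd.ext; funext m
  obtain ⟨N, hN⟩ := hV.frequently m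
  obtain ⟨M, hM⟩ := hW.frequently m
  rw [← hN (max N M) (le_max_left _ _), ← hM (max N M) (le_max_right _ _)]
  have := pr_eq.1 h (max N M)
  have e := congrArg FreeGroup.toWord this
  rw [FreeGroup.toWord_mk, FreeGroup.toWord_mk] at e
  rw [e]

/-- F2 -/
lemma red_mul {A B : Wd ι} (hA : Red A) (hB : Red B) :
    ∃ A' B' C, A = A' * C ∧ B = C⁻¹ * B' ∧ Red (A' * B') := by
  obtain ⟨E, h1, h2, h3⟩ := Wd.exists_sup B {D | D ∣ B ∧ D ∣ A⁻¹} (fun C hC => hC.1)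
    ⟨1, one_dvd _, one_dvd _⟩
  have h4 : E ∣ A⁻¹ := by
    rw [Wd.dvd_iff]; intro n
    obtain ⟨C, hC, e⟩ := h2 n
    rw [e]; exact Wd.dvd_iff.1 hC.2 n
  obtain ⟨B', rfl⟩ := h3
  obtain ⟨A'', hA''⟩ := h4
  have hAe : A = A''⁻¹ * E⁻¹ := by rw [← inv_inv A, hA'']; simp
  refine ⟨A''⁻¹, B', E⁻¹, hAe, by simp, ?_⟩
  have rA : Red A''⁻¹ := by rw [hAe] at hA; exact hA.left
  have rB : Red B' := hB.right
  intro a b c habc hb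
  by_contra hbne
  rw [mul_assoc] at habc
  rcases Wd.levi habc with ⟨e, he, he'⟩ | ⟨e, he, he'⟩
  · -- b inside B'
    exact hbne (rB e b c (by rw [he', mul_assoc]) hb)
  · -- A' = a * e, b * c = e * B'
    rcases Wd.levi he' with ⟨f, hf, hf'⟩ | ⟨f, hf, hf'⟩
    · rw [hf, ← mul_assoc] at he
      exact hbne (rA _ _ _ he hb)
    · -- b = e * f, B' = f * c
      have hef : e = f⁻¹ := by
        apply Red.unique
        · rw [he] at rA; exact rA.right
        · rw [hf'] at rB; exact rB.left.inv
        · rw [hf, map_mul] at hb; rw [pr_inv]; exact eq_inv_of_mul_eq_one_left hb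
      have : E * f ∈ {D | D ∣ E * B' ∧ D ∣ A⁻¹} := by
        constructor
        · exact ⟨c, by rw [hf', mul_assoc]⟩
        · refine ⟨a⁻¹, ?_⟩
          rw [hAe, he, hef]; simp [mul_assoc]
      have h5 := Wd.dvd_antisymm' (h1 _ this) ⟨f, rfl⟩
      have hf1 : f = 1 := mul_left_cancel (a := E) (by rw [h5, mul_one])
      apply hbne
      rw [hf, hef, hf1]; simp

/-- reduced representative -/
def nf (g : H ι) : Wd ι := (exists_red (pr_surj g).choose).choose

lemma pr_nf (g : H ι) : pr (nf g) = g :=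
  (exists_red (pr_surj g).choose).choose_spec.1.trans (pr_surj g).choose_spec

lemma red_nf (g : H ι) : Red (nf g) := (exists_red (pr_surj g).choose).choose_spec.2.1

lemma nf_pr {W : Wd ι} (h : Red W) : nf (pr W) = W := (red_nf _).unique h (pr_nf _)

lemma nf_one : nf (1 : H ι) = 1 := by rw [← map_one pr, nf_pr Red.one]
lemma nf_inv (g : H ι) : nf g⁻¹ = (nf g)⁻¹ := by
  rw [← nf_pr (red_nf g).inv, pr_inv, pr_nf]

lemma nf_sublist (W : Wd ι) (m : ℕ) : ((nf (pr W)).s m).Sublist (W.s m) := by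
  obtain ⟨V, h1, h2, h3⟩ := exists_red W
  rw [← h1, nf_pr h2]; exact h3 m

end GrifAux

namespace GrifAux
variable {ι ι' : Type}

/-! ## Homs on subgroups -/

def HomOn {G K : Type} [Group G] [Group K] (D : Subgroup G) (f : G → K) : Prop :=
  ∀ g ∈ D, ∀ h ∈ D, f (g * h) = f g * f h

namespace HomOn
variable {G K : Type} [Group G] [Group K] {D : Subgroup G} {f : G → K}
lemma one (h : HomOn D f) : f 1 = 1 := by
  have := h 1 D.one_mem 1 D.one_mem
  rw [mul_one] at this
  exact left_eq_mul.1 this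
lemma inv (h : HomOn D f) {g : G} (hg : g ∈ D) : f g⁻¹ = (f g)⁻¹ := by
  rw [eq_inv_iff_mul_eq_one, ← h _ (D.inv_mem hg) _ hg, inv_mul_cancel, h.one]
lemma mono (h : HomOn D f) {E : Subgroup G} (hE : E ≤ D) : HomOn E f :=
  fun a ha b hb => h a (hE ha) b (hE hb)
end HomOn

/-- factor closed -/
def FC (D : Subgroup (H ι)) : Prop :=
  ∀ a b c : Wd ι, Red (a * b * c) → pr (a * b * c) ∈ D → pr b ∈ D

lemma FC.left {D : Subgroup (H ι)} (h : FC D) {a b : Wd ι} (hr : Red (a * b))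
    (hm : pr (a * b) ∈ D) : pr a ∈ D :=
  h 1 a b (by simpa using hr) (by simpa using hm)
lemma FC.right {D : Subgroup (H ι)} (h : FC D) {a b : Wd ι} (hr : Red (a * b))
    (hm : pr (a * b) ∈ D) : pr b ∈ D :=
  h a b 1 (by simpa using hr) (by simpa using hm)

/-! ## The gluing lemma -/

structure PSys (P : Set (Wd ι)) : Prop where
  one : 1 ∈ P
  red : ∀ X ∈ P, Red X
  fac : ∀ a b c, a * b * c ∈ P → b ∈ P
  inv : ∀ X ∈ P, X⁻¹ ∈ P

namespace PSys
variable {P : Set (Wd ι)} (hP : PSys P)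
include hP
lemma left {a b : Wd ι} (h : a * b ∈ P) : a ∈ P := hP.fac 1 a b (by simpa using h)
lemma right {a b : Wd ι} (h : a * b ∈ P) : b ∈ P := hP.fac a b 1 (by simpa using h)
end PSys

/-- finite products of words in `P` -/
def Lists (P : Set (Wd ι)) : Set (List (Wd ι)) := {l | ∀ x ∈ l, x ∈ P}

lemma lists_nil (P : Set (Wd ι)) : [] ∈ Lists P := by simp [Lists]
lemma lists_cons {P : Set (Wd ι)} {x : Wd ι} {l} : x :: l ∈ Lists P ↔ x ∈ P ∧ l ∈ Lists P := by
  simp [Lists]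
lemma lists_append {P : Set (Wd ι)} {l l'} (h : l ∈ Lists P) (h' : l' ∈ Lists P) :
    l ++ l' ∈ Lists P := by
  intro x hx
  rcases List.mem_append.1 hx with h1 | h1
  exacts [h x h1, h' x h1]

lemma list_prod_one {l : List (Wd ι)} (h : l.prod = 1) : ∀ x ∈ l, x = 1 := by
  induction l with
  | nil => simp
  | cons x l ih =>
    rw [List.prod_cons] at h
    obtain ⟨h1, h2⟩ := Wd.mul_eq_one h
    intro y hy
    rcases List.mem_cons.1 hy with rfl | hy
    exacts [h1, ih h2 y hy]

structure VSys (P : Set (Wd ι)) {K : Type} [Group K] (v : Wd ι → K) : Prop extends PSys P where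
  vmul : ∀ X Y, X * Y ∈ P → v (X * Y) = v X * v Y
  vinv : ∀ X ∈ P, v X⁻¹ = (v X)⁻¹

namespace VSys
variable {P : Set (Wd ι)} {K : Type} [Group K] {v : Wd ι → K} (hv : VSys P v)
include hv

lemma v_one : v 1 = 1 := by
  have := hv.vmul 1 1 (by simpa using hv.one)
  rw [mul_one] at this
  exact left_eq_mul.1 this

lemma list_unique : ∀ (N : ℕ) (l l' : List (Wd ι)), l.length + l'.length ≤ N →
    l ∈ Lists P → l' ∈ Lists P → l.prod = l'.prod → (l.map v).prod = (l'.map v).prod := by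
  have h1 : ∀ l : List (Wd ι), l.prod = 1 → (l.map v).prod = 1 := by
    intro l hl
    apply List.prod_eq_one
    intro x hx
    obtain ⟨y, hy, rfl⟩ := List.mem_map.1 hx
    rw [list_prod_one hl y hy, hv.v_one]
  intro N
  induction N with
  | zero =>
    intro l l' h _ _ _
    have e1 : l = [] := List.length_eq_zero_iff.1 (by omega)
    have e2 : l' = [] := List.length_eq_zero_iff.1 (by omega)
    rw [e1, e2]
  | succ N ih =>
    intro l l' h hl hl' hp
    cases l with
    | nil => rw [h1 l' (by rw [← hp]; rfl)]; rfl
    | cons x t =>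
      cases l' with
      | nil => rw [h1 _ hp]; rfl
      | cons y t' =>
        rw [lists_cons] at hl hl'
        simp only [List.prod_cons, List.length_cons, List.map_cons] at hp h ⊢
        rcases Wd.levi hp with ⟨e, rfl, he⟩ | ⟨e, rfl, he⟩
        · have := ih t (e :: t') (by simp; omega) hl.2
            (lists_cons.2 ⟨hv.right hl'.1, hl'.2⟩) he
          rw [this, hv.vmul _ _ hl'.1, List.map_cons, List.prod_cons, mul_assoc]
        · have := ih (e :: t) t' (by simp; omega) 
            (lists_cons.2 ⟨hv.right hl.1, hl.2⟩) hl'.2 he.symm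
          rw [← this, hv.vmul _ _ hl.1, List.map_cons, List.prod_cons, mul_assoc]
end VSys

def Rep (P : Set (Wd ι)) {K : Type} [Group K] (v : Wd ι → K) (W : Wd ι) (k : K) : Prop :=
  ∃ l ∈ Lists P, l.prod = W ∧ (l.map v).prod = k

namespace VSys
variable {P : Set (Wd ι)} {K : Type} [Group K] {v : Wd ι → K} (hv : VSys P v)
include hv

lemma rep_unique {W : Wd ι} {k k' : K} (h : Rep P v W k) (h' : Rep P v W k') : k = k' := by
  obtain ⟨l, hl, e, rfl⟩ := h
  obtain ⟨l', hl', e', rfl⟩ := h'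
  exact hv.list_unique _ l l' le_rfl hl hl' (e.trans e'.symm)

lemma rep_split : ∀ (l : List (Wd ι)), l ∈ Lists P → ∀ A B, l.prod = A * B →
    ∃ l1 ∈ Lists P, ∃ l2 ∈ Lists P, l1.prod = A ∧ l2.prod = B ∧
      (l.map v).prod = (l1.map v).prod * (l2.map v).prod := by
  intro l
  induction l with
  | nil =>
    intro _ A B h
    obtain ⟨rfl, rfl⟩ := Wd.mul_eq_one h.symm
    exact ⟨[], lists_nil P, [], lists_nil P, rfl, rfl, by simp⟩
  | cons x l ih =>
    intro hl A B h
    rw [lists_cons] at hl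
    rw [List.prod_cons] at h
    rcases Wd.levi h with ⟨e, rfl, he⟩ | ⟨e, rfl, he⟩
    · obtain ⟨l1, h1, l2, h2, rfl, rfl, h3⟩ := ih hl.2 _ _ he
      exact ⟨x :: l1, lists_cons.2 ⟨hl.1, h1⟩, l2, h2, by simp, rfl, by simp [h3, mul_assoc]⟩
    · refine ⟨[A], lists_cons.2 ⟨hv.left hl.1, lists_nil P⟩, e :: l,
        lists_cons.2 ⟨hv.right hl.1, hl.2⟩, by simp, by simp [he], ?_⟩
      simp [hv.vmul _ _ hl.1, mul_assoc]

lemma rep_mul {A B : Wd ι} {k k' : K} (h : Rep P v A k) (h' : Rep P v B k') :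
    Rep P v (A * B) (k * k') := by
  obtain ⟨l, hl, rfl, rfl⟩ := h
  obtain ⟨l', hl', rfl, rfl⟩ := h'
  exact ⟨l ++ l', lists_append hl hl', by simp, by simp⟩

lemma rep_inv {A : Wd ι} {k : K} (h : Rep P v A k) : Rep P v A⁻¹ k⁻¹ := by
  obtain ⟨l, hl, rfl, rfl⟩ := h
  induction l with
  | nil => exact ⟨[], lists_nil P, by simp, by simp⟩
  | cons x l ih =>
    rw [lists_cons] at hl
    simp only [List.prod_cons, List.map_cons, mul_inv_rev]
    apply hv.rep_mul (ih hl.2)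
    exact ⟨[x⁻¹], lists_cons.2 ⟨hv.inv _ hl.1, lists_nil P⟩, by simp, by simp [hv.vinv _ hl.1]⟩

lemma rep_red_mul {A B : Wd ι} {k k' : K} (hA : Red A) (hB : Red B) (h : Rep P v A k)
    (h' : Rep P v B k') : Rep P v (nf (pr A * pr B)) (k * k') := by
  obtain ⟨A', B', C, rfl, rfl, hr⟩ := red_mul hA hB
  obtain ⟨l, hl, e, rfl⟩ := h
  obtain ⟨l1, h1, l2, h2, rfl, rfl, h3⟩ := hv.rep_split l hl _ _ e
  obtain ⟨l', hl', e', rfl⟩ := h'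
  obtain ⟨m1, g1, m2, g2, f1, rfl, g3⟩ := hv.rep_split l' hl' _ _ e'
  have : (m1.map v).prod = (l2.map v).prod⁻¹ :=
    hv.rep_unique (W := l2.prod⁻¹) ⟨m1, g1, f1, rfl⟩ (hv.rep_inv ⟨l2, h2, rfl, rfl⟩)
  have e2 : pr (l1.prod * l2.prod) * pr (l2.prod⁻¹ * m2.prod) = pr (l1.prod * m2.prod) := by
    simp [map_mul, pr_inv, mul_assoc]
  rw [e2, nf_pr hr, h3, g3, this]
  have : (l1.map v).prod * (l2.map v).prod * ((l2.map v).prod⁻¹ * (m2.map v).prod)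
    = (l1.map v).prod * (m2.map v).prod := by group
  rw [this]
  exact hv.rep_mul ⟨l1, h1, rfl, rfl⟩ ⟨m2, g2, rfl, rfl⟩

lemma rep_mem {X : Wd ι} (h : X ∈ P) : Rep P v X (v X) :=
  ⟨[X], lists_cons.2 ⟨h, lists_nil P⟩, by simp, by simp⟩

lemma exists_rep {g : H ι} (hg : g ∈ Subgroup.closure (pr '' P)) : ∃ k, Rep P v (nf g) k := by
  induction hg using Subgroup.closure_induction with
  | mem x hx =>
    obtain ⟨X, hX, rfl⟩ := hx
    rw [nf_pr (hv.red X hX)]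
    exact ⟨_, hv.rep_mem hX⟩
  | one => rw [nf_one]; exact ⟨_, hv.rep_mem hv.one⟩
  | mul x y _ _ hx hy =>
    obtain ⟨k, hk⟩ := hx
    obtain ⟨k', hk'⟩ := hy
    have := hv.rep_red_mul (red_nf x) (red_nf y) hk hk'
    rw [pr_nf, pr_nf] at this
    exact ⟨_, this⟩
  | inv x _ hx =>
    obtain ⟨k, hk⟩ := hx
    rw [nf_inv]
    exact ⟨_, hv.rep_inv hk⟩

/-- GL lemma, hom part -/
theorem exists_hom : ∃ f : H ι → K, HomOn (Subgroup.closure (pr '' P)) f ∧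
    ∀ X ∈ P, f (pr X) = v X := by
  classical
  let f : H ι → K := fun g => if h : ∃ k, Rep P v (nf g) k then h.choose else 1
  have hf : ∀ g ∈ Subgroup.closure (pr '' P), Rep P v (nf g) (f g) := by
    intro g hg
    have h := hv.exists_rep hg
    have : f g = h.choose := dif_pos h
    rw [this]; exact h.choose_spec
  refine ⟨f, ?_, ?_⟩
  · intro g hg h hh
    have := hv.rep_red_mul (red_nf g) (red_nf h) (hf g hg) (hf h hh)
    rw [pr_nf, pr_nf] at this
    exact hv.rep_unique (hf _ (mul_mem hg hh)) this
  · intro X hX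
    have := hf (pr X) (Subgroup.subset_closure (mem_image_of_mem _ hX))
    rw [nf_pr (hv.red X hX)] at this
    exact hv.rep_unique this (hv.rep_mem hX)
end VSys

namespace PSys
variable {P : Set (Wd ι)} (hP : PSys P)
include hP

lemma triv : VSys P (fun _ => (1 : Multiplicative ℤ)) :=
  { hP with vmul := fun _ _ _ => by simp, vinv := fun _ _ => by simp }

/-- GL lemma, normal form part -/
theorem exists_list {g : H ι} (hg : g ∈ Subgroup.closure (pr '' P)) :
    ∃ l ∈ Lists P, l.prod = nf g := by
  obtain ⟨k, l, hl, e, -⟩ := hP.triv.exists_rep hg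
  exact ⟨l, hl, e⟩

lemma list_mem {l : List (Wd ι)} (hl : l ∈ Lists P) : pr l.prod ∈ Subgroup.closure (pr '' P) := by
  rw [map_list_prod]
  apply Subgroup.list_prod_mem
  intro x hx
  obtain ⟨y, hy, rfl⟩ := List.mem_map.1 hx
  exact Subgroup.subset_closure (mem_image_of_mem _ (hl y hy))

lemma split {l : List (Wd ι)} (hl : l ∈ Lists P) {A B : Wd ι} (h : l.prod = A * B) :
    ∃ l1 ∈ Lists P, ∃ l2 ∈ Lists P, l1.prod = A ∧ l2.prod = B := by
  obtain ⟨l1, h1, l2, h2, h3, h4, -⟩ := hP.triv.rep_split l hl A B h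
  exact ⟨l1, h1, l2, h2, h3, h4⟩

theorem fc : FC (Subgroup.closure (pr '' P)) := by
  intro a b c hr hm
  obtain ⟨l, hl, e⟩ := hP.exists_list hm
  rw [nf_pr hr] at e
  obtain ⟨l1, h1, l2, h2, h3, h4⟩ := hP.split hl e
  obtain ⟨l3, h5, l4, h6, h7, h8⟩ := hP.split h1 h3
  rw [← h8]
  exact hP.list_mem h6
end PSys

/-- The system of a factor closed subgroup -/
def PD (D : Subgroup (H ι)) : Set (Wd ι) := {X | Red X ∧ pr X ∈ D}

lemma PD_sys {D : Subgroup (H ι)} (h : FC D) : PSys (PD D) where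
  one := ⟨Red.one, by rw [map_one]; exact D.one_mem⟩
  red X hX := hX.1
  fac a b c hX := ⟨hX.1.fac, h a b c hX.1 hX.2⟩
  inv X hX := ⟨hX.1.inv, by rw [pr_inv]; exact D.inv_mem hX.2⟩

lemma nf_mem_PD {D : Subgroup (H ι)} {g : H ι} (h : g ∈ D) : nf g ∈ PD D :=
  ⟨red_nf g, by rwa [pr_nf]⟩

lemma closure_PD (D : Subgroup (H ι)) : Subgroup.closure (pr '' PD D) = D := by
  apply le_antisymm
  · rw [Subgroup.closure_le]
    rintro _ ⟨X, hX, rfl⟩; exact hX.2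
  · intro g hg
    exact Subgroup.subset_closure ⟨nf g, nf_mem_PD hg, pr_nf g⟩

/-! ## Pure words -/

def PureW (W : Wd ι) : Prop := ∃ α, ∀ n, ∀ x ∈ W.s n, x.1.1 = α

def PureH (g : H ι) : Prop := ∃ W, PureW W ∧ pr W = g

lemma PureW.nf {W : Wd ι} (h : PureW W) : PureW (nf (pr W)) := by
  obtain ⟨α, h⟩ := h
  exact ⟨α, fun n x hx => h n x ((nf_sublist W n).subset hx)⟩

lemma mem_invRev {x : Lt ι} {l : List (Lt ι)} :
    x ∈ FreeGroup.invRev l ↔ (x.1, !x.2) ∈ l := by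
  simp only [FreeGroup.invRev, List.mem_reverse, List.mem_map]
  constructor
  · rintro ⟨y, hy, rfl⟩; simpa using hy
  · intro h; exact ⟨_, h, by simp⟩

lemma PureW.inv {W : Wd ι} (h : PureW W) : PureW W⁻¹ := by
  obtain ⟨α, h⟩ := h
  refine ⟨α, fun n x hx => ?_⟩
  rw [Wd.s_inv, mem_invRev] at hx
  exact h n (x.1, !x.2) hx

lemma PureW.fac {a b c : Wd ι} (h : PureW (a * b * c)) : PureW b := by
  obtain ⟨α, h⟩ := h
  exact ⟨α, fun n x hx => h n x (by simp [hx])⟩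

lemma PureH.inv {g : H ι} (h : PureH g) : PureH g⁻¹ := by
  obtain ⟨W, h, rfl⟩ := h
  exact ⟨W⁻¹, h.inv, pr_inv W⟩

/-- reduced pure words -/
def PP (ι : Type) : Set (Wd ι) := {X | Red X ∧ (PureW X ∨ X = 1)}

lemma PP_sys : PSys (PP ι) where
  one := ⟨Red.one, Or.inr rfl⟩
  red X hX := hX.1
  fac a b c hX := ⟨hX.1.fac, by
    rcases hX.2 with h | h
    · exact Or.inl h.fac
    · exact Or.inr (Wd.mul_eq_one (Wd.mul_eq_one h).1).2⟩
  inv X hX := ⟨hX.1.inv, by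
    rcases hX.2 with h | h
    · exact Or.inl h.inv
    · exact Or.inr (by rw [h, inv_one])⟩

def pureGp (ι : Type) : Subgroup (H ι) := Subgroup.closure (pr '' PP ι)

lemma pureGp_eq : pureGp ι = Subgroup.closure {g | PureH g} := by
  apply le_antisymm
  · rw [pureGp, Subgroup.closure_le]
    rintro _ ⟨X, ⟨-, h | h⟩, rfl⟩
    · exact Subgroup.subset_closure ⟨X, h, rfl⟩
    · rw [h, map_one]; exact one_mem _
  · rw [Subgroup.closure_le]
    rintro _ ⟨W, hW, rfl⟩
    exact Subgroup.subset_closure ⟨nf (pr W), ⟨red_nf _, Or.inl hW.nf⟩, pr_nf _⟩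

/-- subgroup generated by conjugates of pure elements by elements of `D` -/
def NC (D : Subgroup (H ι)) : Subgroup (H ι) :=
  Subgroup.closure {x | ∃ d ∈ D, ∃ p, PureH p ∧ x = d * p * d⁻¹}

lemma NC_mono {D E : Subgroup (H ι)} (h : D ≤ E) : NC D ≤ NC E := by
  apply Subgroup.closure_mono
  rintro x ⟨d, hd, p, hp, rfl⟩
  exact ⟨d, h hd, p, hp, rfl⟩

lemma pure_mem_NC (D : Subgroup (H ι)) {p : H ι} (hp : PureH p) : p ∈ NC D :=
  Subgroup.subset_closure ⟨1, one_mem _, p, hp, by simp⟩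

lemma NC_le {D : Subgroup (H ι)} (h : ∀ p, PureH p → p ∈ D) : NC D ≤ D := by
  unfold NC
  rw [Subgroup.closure_le]
  rintro x ⟨d, hd, p, hp, rfl⟩
  exact D.mul_mem (D.mul_mem hd (h p hp)) (D.inv_mem hd)

lemma NC_conj {D : Subgroup (H ι)} {x d : H ι} (hx : x ∈ NC D) (hd : d ∈ D) :
    d * x * d⁻¹ ∈ NC D := by
  induction hx using Subgroup.closure_induction with
  | mem x hx =>
    obtain ⟨e, he, p, hp, rfl⟩ := hx
    exact Subgroup.subset_closure ⟨d * e, mul_mem hd he, p, hp, by group⟩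
  | one => simp [one_mem]
  | mul x y _ _ hx hy =>
    have : d * (x * y) * d⁻¹ = (d * x * d⁻¹) * (d * y * d⁻¹) := by group
    rw [this]; exact mul_mem hx hy
  | inv x _ hx =>
    have : d * x⁻¹ * d⁻¹ = (d * x * d⁻¹)⁻¹ := by group
    rw [this]; exact inv_mem hx

/-- quotient map of D by NC D as a partial hom on all of H -/
lemma exists_quot (D : Subgroup (H ι)) :
    ∃ (K : Type) (_ : Group K) (c : H ι → K), HomOn D c ∧ ∀ g ∈ D, (c g = 1 ↔ g ∈ NC D) := by
  classical
  let N : Subgroup D := (NC D).subgroupOf D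
  have : N.Normal := ⟨fun x hx d => by
    rw [Subgroup.mem_subgroupOf] at hx ⊢
    exact NC_conj hx d.2⟩
  refine ⟨D ⧸ N, inferInstance, fun g => if h : g ∈ D then QuotientGroup.mk (⟨g, h⟩ : D) else 1,
    ?_, ?_⟩
  · intro g hg h hh
    simp only [hg, hh, mul_mem hg hh, dif_pos]
    rfl
  · intro g hg
    simp only [hg, dif_pos]
    rw [QuotientGroup.eq_one_iff]
    rfl

/-! ## Good partial isomorphisms -/

abbrev pfst (Γ : Subgroup (H ι × H ι')) : Subgroup (H ι) := Γ.map (MonoidHom.fst _ _)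
abbrev psnd (Γ : Subgroup (H ι × H ι')) : Subgroup (H ι') := Γ.map (MonoidHom.snd _ _)

lemma mem_pfst {Γ : Subgroup (H ι × H ι')} {g : H ι} : g ∈ pfst Γ ↔ ∃ g', (g, g') ∈ Γ := by
  simp [pfst, Subgroup.mem_map]
lemma mem_psnd {Γ : Subgroup (H ι × H ι')} {g' : H ι'} : g' ∈ psnd Γ ↔ ∃ g, (g, g') ∈ Γ := by
  simp [psnd, Subgroup.mem_map]

structure Good (Γ : Subgroup (H ι × H ι')) : Prop where
  fc1 : FC (pfst Γ)
  fc2 : FC (psnd Γ)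
  p1 : ∀ p, PureH p → (p, 1) ∈ Γ
  p2 : ∀ p, PureH p → (1, p) ∈ Γ
  k1 : ∀ g, (g, 1) ∈ Γ → g ∈ NC (pfst Γ)
  k2 : ∀ g, (1, g) ∈ Γ → g ∈ NC (psnd Γ)

def swp (Γ : Subgroup (H ι × H ι')) : Subgroup (H ι' × H ι) := Γ.map (MulEquiv.prodComm : H ι × H ι' ≃* H ι' × H ι).toMonoidHom

lemma mem_swp {Γ : Subgroup (H ι × H ι')} {x : H ι' × H ι} : x ∈ swp Γ ↔ (x.2, x.1) ∈ Γ := by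
  rcases x with ⟨a, b⟩
  unfold swp
  rw [Subgroup.mem_map]
  constructor
  · rintro ⟨y, hy, e⟩
    rw [← e]; exact hy
  · intro h; exact ⟨_, h, rfl⟩

lemma pfst_swp (Γ : Subgroup (H ι × H ι')) : pfst (swp Γ) = psnd Γ := by
  ext x; simp only [mem_pfst, mem_psnd, mem_swp]
lemma psnd_swp (Γ : Subgroup (H ι × H ι')) : psnd (swp Γ) = pfst Γ := by
  ext x; simp only [mem_pfst, mem_psnd, mem_swp]
lemma swp_swp (Γ : Subgroup (H ι × H ι')) : swp (swp Γ) = Γ := by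
  ext x; simp only [mem_swp]

lemma swp_mono {Γ Δ : Subgroup (H ι × H ι')} (h : Γ ≤ Δ) : swp Γ ≤ swp Δ := Subgroup.map_mono h

lemma Good.swap {Γ : Subgroup (H ι × H ι')} (h : Good Γ) : Good (swp Γ) where
  fc1 := by rw [pfst_swp]; exact h.fc2
  fc2 := by rw [psnd_swp]; exact h.fc1
  p1 p hp := by rw [mem_swp]; exact h.p2 p hp
  p2 p hp := by rw [mem_swp]; exact h.p1 p hp
  k1 g hg := by rw [mem_swp] at hg; rw [pfst_swp]; exact h.k2 g hg
  k2 g hg := by rw [mem_swp] at hg; rw [psnd_swp]; exact h.k1 g hg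

lemma Good.pure1 {Γ : Subgroup (H ι × H ι')} (h : Good Γ) {p : H ι} (hp : PureH p) : p ∈ pfst Γ :=
  mem_pfst.2 ⟨1, h.p1 p hp⟩
lemma Good.pure2 {Γ : Subgroup (H ι × H ι')} (h : Good Γ) {p : H ι'} (hp : PureH p) : p ∈ psnd Γ :=
  mem_psnd.2 ⟨1, h.p2 p hp⟩

lemma good_bot : Good ((pureGp ι).prod (pureGp ι')) := by
  have e1 : pfst ((pureGp ι).prod (pureGp ι')) = pureGp ι := by
    ext x; rw [mem_pfst]
    simp only [Subgroup.mem_prod]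
    exact ⟨fun ⟨_, h, _⟩ => h, fun h => ⟨1, h, one_mem _⟩⟩
  have e2 : psnd ((pureGp ι).prod (pureGp ι')) = pureGp ι' := by
    ext x; rw [mem_psnd]
    simp only [Subgroup.mem_prod]
    exact ⟨fun ⟨_, _, h⟩ => h, fun h => ⟨1, one_mem _, h⟩⟩
  have hN : ∀ {κ : Type} (D : Subgroup (H κ)), pureGp κ ≤ NC D := by
    intro κ D
    rw [pureGp_eq, Subgroup.closure_le]
    intro p hp; exact pure_mem_NC D hp
  refine ⟨by rw [e1]; exact PP_sys.fc, by rw [e2]; exact PP_sys.fc, ?_, ?_, ?_, ?_⟩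
  · intro p hp
    refine Subgroup.mem_prod.2 ⟨?_, one_mem _⟩
    rw [pureGp_eq]; exact Subgroup.subset_closure hp
  · intro p hp
    refine Subgroup.mem_prod.2 ⟨one_mem _, ?_⟩
    rw [pureGp_eq]; exact Subgroup.subset_closure hp
  · intro g hg; exact hN _ (Subgroup.mem_prod.1 hg).1
  · intro g hg; exact hN _ (Subgroup.mem_prod.1 hg).2

lemma good_sSup {c : Set (Subgroup (H ι × H ι'))} (hne : c.Nonempty) (hc : IsChain (· ≤ ·) c)
    (hg : ∀ Γ ∈ c, Good Γ) : Good (sSup c) := by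
  have hmem : ∀ x, x ∈ sSup c ↔ ∃ Γ ∈ c, x ∈ Γ := fun x =>
    Subgroup.mem_sSup_of_directedOn hne hc.directedOn
  obtain ⟨Γ0, h0⟩ := hne
  have m1 : ∀ Γ ∈ c, pfst Γ ≤ pfst (sSup c) := fun Γ h => Subgroup.map_mono (le_sSup h)
  have m2 : ∀ Γ ∈ c, psnd Γ ≤ psnd (sSup c) := fun Γ h => Subgroup.map_mono (le_sSup h)
  refine ⟨?_, ?_, ?_, ?_, ?_, ?_⟩
  · intro a b d hr hm
    obtain ⟨g', hg'⟩ := mem_pfst.1 hm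
    obtain ⟨Γ, hΓ, h⟩ := (hmem _).1 hg'
    exact m1 Γ hΓ ((hg Γ hΓ).fc1 a b d hr (mem_pfst.2 ⟨g', h⟩))
  · intro a b d hr hm
    obtain ⟨g', hg'⟩ := mem_psnd.1 hm
    obtain ⟨Γ, hΓ, h⟩ := (hmem _).1 hg'
    exact m2 Γ hΓ ((hg Γ hΓ).fc2 a b d hr (mem_psnd.2 ⟨g', h⟩))
  · intro p hp; exact (hmem _).2 ⟨Γ0, h0, (hg Γ0 h0).p1 p hp⟩
  · intro p hp; exact (hmem _).2 ⟨Γ0, h0, (hg Γ0 h0).p2 p hp⟩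
  · intro g h
    obtain ⟨Γ, hΓ, h⟩ := (hmem _).1 h
    exact NC_mono (m1 Γ hΓ) ((hg Γ hΓ).k1 g h)
  · intro g h
    obtain ⟨Γ, hΓ, h⟩ := (hmem _).1 h
    exact NC_mono (m2 Γ hΓ) ((hg Γ hΓ).k2 g h)

/-- Kernel condition for an extension (half). `Δ = Γ ⊔ closure S`. -/
lemma ker_ext {Γ : Subgroup (H ι × H ι')} (hΓ : Good Γ) (S : Set (H ι × H ι'))
    (hext : ∀ (K : Type) [Group K] (φ : H ι → K) (c : H ι' → K), HomOn (pfst Γ) φ →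
      HomOn (psnd (Γ ⊔ Subgroup.closure S)) c → (∀ x ∈ Γ, φ x.1 = c x.2) →
      ∃ f, HomOn (pfst (Γ ⊔ Subgroup.closure S)) f ∧ (∀ g ∈ pfst Γ, f g = φ g) ∧
        ∀ x ∈ S, f x.1 = c x.2) :
    ∀ g, (1, g) ∈ Γ ⊔ Subgroup.closure S → g ∈ NC (psnd (Γ ⊔ Subgroup.closure S)) := by
  classical
  set Δ := Γ ⊔ Subgroup.closure S with hΔ
  have hle2 : psnd Γ ≤ psnd Δ := Subgroup.map_mono le_sup_left
  obtain ⟨K, _, c, hc, hk⟩ := exists_quot (psnd Δ)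
  let φ : H ι → K := fun g => if h : ∃ g', (g, g') ∈ Γ then c h.choose else 1
  have hφ : ∀ x ∈ Γ, φ x.1 = c x.2 := by
    rintro ⟨g, g'⟩ hx
    have h : ∃ g', (g, g') ∈ Γ := ⟨g', hx⟩
    have e : φ g = c h.choose := dif_pos h
    show φ g = c g'
    rw [e]
    have h1 : h.choose ∈ psnd Δ := hle2 (mem_psnd.2 ⟨g, h.choose_spec⟩)
    have h2 : g' ∈ psnd Δ := hle2 (mem_psnd.2 ⟨g, hx⟩)
    have h3 : (1, h.choose * g'⁻¹) ∈ Γ := by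
      have := Γ.mul_mem h.choose_spec (Γ.inv_mem hx)
      simpa using this
    have h4 := (hk _ (mul_mem h1 (inv_mem h2))).2 (NC_mono hle2 (hΓ.k2 _ h3))
    rw [hc _ h1 _ (inv_mem h2), hc.inv h2] at h4
    exact mul_inv_eq_one.1 h4
  have hφhom : HomOn (pfst Γ) φ := by
    intro g hg h hh
    obtain ⟨g', hg'⟩ := mem_pfst.1 hg
    obtain ⟨h', hh'⟩ := mem_pfst.1 hh
    rw [hφ _ hg', hφ _ hh', hφ (g * h, g' * h') (Γ.mul_mem hg' hh')]
    exact hc _ (hle2 (mem_psnd.2 ⟨g, hg'⟩)) _ (hle2 (mem_psnd.2 ⟨h, hh'⟩))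
  obtain ⟨f, hf, hfφ, hfS⟩ := hext K φ c hφhom hc hφ
  have key : ∀ x ∈ Δ, f x.1 = c x.2 := by
    have hΔ' : Δ = Subgroup.closure ((Γ : Set (H ι × H ι')) ∪ S) := by
      rw [Subgroup.closure_union, Subgroup.closure_eq]
    intro x hx
    have hx0 := hx
    rw [hΔ'] at hx
    induction hx using Subgroup.closure_induction with
    | mem x h =>
      rcases h with h | h
      · rw [hfφ _ (mem_pfst.2 ⟨x.2, h⟩), hφ x h]
      · exact hfS x h
    | one => exact hf.one.trans hc.one.symm
    | mul x y hx hy ihx ihy =>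
      rw [← hΔ'] at hx hy
      have h1 := hf _ (mem_pfst.2 ⟨x.2, hx⟩) _ (mem_pfst.2 ⟨y.2, hy⟩)
      have h2 := hc _ (mem_psnd.2 ⟨x.1, hx⟩) _ (mem_psnd.2 ⟨y.1, hy⟩)
      rw [Prod.fst_mul, Prod.snd_mul, h1, h2, ihx hx, ihy hy]
    | inv x hx ihx =>
      rw [← hΔ'] at hx
      rw [Prod.fst_inv, Prod.snd_inv, hf.inv (mem_pfst.2 ⟨x.2, hx⟩),
        hc.inv (mem_psnd.2 ⟨x.1, hx⟩), ihx hx]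
  intro g hg
  have := key _ hg
  simp only at this
  rw [hf.one] at this
  exact (hk g (mem_psnd.2 ⟨1, hg⟩)).1 this.symm

/-- the final normal subgroup -/
def NN (ι : Type) : Subgroup (H ι) := NC ⊤

instance : (NN ι).Normal := ⟨fun x hx d => NC_conj hx (Subgroup.mem_top d)⟩

theorem final_iso {Γ : Subgroup (H ι × H ι')} (h : Good Γ) (h1 : pfst Γ = ⊤) (h2 : psnd Γ = ⊤) :
    Nonempty ((H ι ⧸ NN ι) ≃* (H ι' ⧸ NN ι')) := by
  have ex : ∀ g, ∃ g', (g, g') ∈ Γ := fun g => mem_pfst.1 (by rw [h1]; trivial)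
  have ex2 : ∀ g', ∃ g, (g, g') ∈ Γ := fun g => mem_psnd.1 (by rw [h2]; trivial)
  choose c hc using ex
  have hk1 : ∀ g, (g, 1) ∈ Γ → g ∈ NN ι := fun g hg => by
    have := h.k1 g hg; rwa [h1] at this
  have hk2 : ∀ g, (1, g) ∈ Γ → g ∈ NN ι' := fun g hg => by
    have := h.k2 g hg; rwa [h2] at this
  have hn1 : ∀ g ∈ NN ι, (g, 1) ∈ Γ := by
    intro g hg
    induction hg using Subgroup.closure_induction with
    | mem x hx =>
      obtain ⟨d, -, p, hp, rfl⟩ := hx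
      have := Γ.mul_mem (Γ.mul_mem (hc d) (h.p1 p hp)) (Γ.inv_mem (hc d))
      simpa using this
    | one => exact one_mem _
    | mul x y _ _ hx hy => simpa using Γ.mul_mem hx hy
    | inv x _ hx => simpa using Γ.inv_mem hx
  have hn2 : ∀ g ∈ NN ι', (1, g) ∈ Γ := by
    intro g hg
    induction hg using Subgroup.closure_induction with
    | mem x hx =>
      obtain ⟨d, -, p, hp, rfl⟩ := hx
      obtain ⟨e, he⟩ := ex2 d
      have := Γ.mul_mem (Γ.mul_mem he (h.p2 p hp)) (Γ.inv_mem he)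
      simpa using this
    | one => exact one_mem _
    | mul x y _ _ hx hy => simpa using Γ.mul_mem hx hy
    | inv x _ hx => simpa using Γ.inv_mem hx
  have hval : ∀ g g', (g, g') ∈ Γ → (QuotientGroup.mk (c g) : H ι' ⧸ NN ι') = QuotientGroup.mk g' := by
    intro g g' hg
    rw [QuotientGroup.eq]
    apply hk2
    have := Γ.mul_mem (Γ.inv_mem (hc g)) hg
    simpa using this
  let F : H ι →* H ι' ⧸ NN ι' := MonoidHom.mk' (fun g => QuotientGroup.mk (c g)) (fun a b => by
    exact hval (a * b) (c a * c b) (Γ.mul_mem (hc a) (hc b)))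
  have hF : ∀ g ∈ NN ι, F g = 1 := fun g hg => (hval g 1 (hn1 g hg)).trans rfl
  refine ⟨MulEquiv.ofBijective (QuotientGroup.lift (NN ι) F hF) ⟨?_, ?_⟩⟩
  · rw [injective_iff_map_eq_one]
    intro x
    induction x using QuotientGroup.induction_on with
    | H g =>
      intro hg
      have hg' : (QuotientGroup.mk (c g) : H ι' ⧸ NN ι') = 1 := hg
      rw [QuotientGroup.eq_one_iff] at hg'
      rw [QuotientGroup.eq_one_iff]
      apply hk1
      have := Γ.mul_mem (hc g) (Γ.inv_mem (hn2 _ hg'))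
      simpa using this
  · intro y
    induction y using QuotientGroup.induction_on with
    | H g' =>
      obtain ⟨g, hg⟩ := ex2 g'
      exact ⟨QuotientGroup.mk g, hval g g' hg⟩

end GrifAux

namespace GrifAux
variable {ι ι' : Type}

/-! ## The omega step -/

lemma FG_sq {g : FG ι} (h : g * g = 1) : g = 1 := by
  have : g ^ 2 = 1 := by rw [pow_two, h]
  exact (pow_eq_one_iff.1 this).resolve_right (by norm_num)

lemma pr_eq_one_of_self_inv {X : Wd ι} (h : X = X⁻¹) : pr X = 1 := by
  have h1 : pr X * pr X = 1 := by
    nth_rewrite 1 [h]; rw [pr_inv, inv_mul_cancel]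
  apply Subtype.ext
  funext n
  have := congrFun (congrArg Subtype.val h1) n
  exact FG_sq this

lemma eq_of_mul_same_length {a b e : Wd ι} (h : a = e * b)
    (hl : ∀ n, (a.s n).length = (b.s n).length) : a = b := by
  have : e = 1 := by
    apply Wd.eq_one_of_s
    intro n
    have := hl n
    rw [h, Wd.s_mul, List.length_append] at this
    exact List.length_eq_zero_iff.1 (by omega)
  rw [h, this, one_mul]

/-- all proper prefixes of `A` in `D` but not `A` -/
def LimW (D : Subgroup (H ι)) (A : Wd ι) : Prop :=
  Red A ∧ pr A ∉ D ∧ ∀ B T, A = B * T → T ≠ 1 → pr B ∈ D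

/-- factors of `A` and their inverses -/
def FacPM (A : Wd ι) : Set (Wd ι) := {X | (∃ a b, A = a * X * b) ∨ (∃ a b, A = a * X⁻¹ * b)}

lemma FacPM_sys {A : Wd ι} (hA : Red A) : PSys (FacPM A) where
  one := Or.inl ⟨1, A, by simp⟩
  red X hX := by
    rcases hX with ⟨a, b, h⟩ | ⟨a, b, h⟩
    · rw [h] at hA; exact hA.fac
    · rw [h] at hA; simpa using hA.fac.inv
  fac a b c h := by
    rcases h with ⟨x, y, h⟩ | ⟨x, y, h⟩
    · exact Or.inl ⟨x * a, c * y, by rw [h]; simp [mul_assoc]⟩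
    · exact Or.inr ⟨x * c⁻¹, a⁻¹ * y, by rw [h]; simp [mul_assoc]⟩
  inv X hX := by
    rcases hX with ⟨a, b, h⟩ | ⟨a, b, h⟩
    · exact Or.inr ⟨a, b, by simpa using h⟩
    · exact Or.inl ⟨a, b, h⟩

lemma PSys.union {P Q : Set (Wd ι)} (hP : PSys P) (hQ : PSys Q) : PSys (P ∪ Q) where
  one := Or.inl hP.one
  red X hX := hX.elim (hP.red X) (hQ.red X)
  fac a b c h := h.elim (fun h => Or.inl (hP.fac a b c h)) (fun h => Or.inr (hQ.fac a b c h))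
  inv X hX := hX.elim (fun h => Or.inl (hP.inv X h)) (fun h => Or.inr (hQ.inv X h))

section
variable {D : Subgroup (H ι)} (hD : FC D) {A : Wd ι} (hA : LimW D A)
include hD hA

lemma LimW.tail {a X b : Wd ι} (h : A = a * X * b) (hX : pr X ∉ D) : b = 1 := by
  by_contra hb
  have h1 := hA.2.2 (a * X) b h hb
  have h2 : Red (a * X) := by have := hA.1; rw [h] at this; exact this.left
  exact hX (hD.right h2 h1)

lemma LimW.prefix_mem {a X : Wd ι} (h : A = a * X) (hX : pr X ∉ D) : pr a ∈ D := by
  apply hA.2.2 a X h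
  rintro rfl
  exact hX (by rw [map_one]; exact one_mem _)

lemma LimW.not_both {a b X : Wd ι} (h : A = a * X) (h' : A = b * X⁻¹) : pr X ∈ D := by
  have hl : ∀ n, (X.s n).length = ((X⁻¹).s n).length := fun n => by simp
  have : X = X⁻¹ := by
    rcases Wd.levi (h.symm.trans h') with ⟨e, -, he⟩ | ⟨e, -, he⟩
    · exact eq_of_mul_same_length he hl
    · exact (eq_of_mul_same_length he (fun n => (hl n).symm)).symm
  rw [pr_eq_one_of_self_inv this]; exact one_mem _

lemma LimW.closure_eq : Subgroup.closure (pr '' (PD D ∪ FacPM A)) =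
    D ⊔ Subgroup.closure {pr A} := by
  apply le_antisymm
  · rw [Subgroup.closure_le]
    have key : ∀ X a b, A = a * X * b → pr X ∈ D ⊔ Subgroup.closure {pr A} := by
      intro X a b h
      by_cases hX : pr X ∈ D
      · exact Subgroup.mem_sup_left hX
      · have hb := hA.tail hD h hX
        rw [hb, mul_one] at h
        have ha := hA.prefix_mem hD h hX
        have : pr X = (pr a)⁻¹ * pr A := by rw [h, map_mul]; group
        rw [this]
        exact mul_mem (inv_mem (Subgroup.mem_sup_left ha))
          (Subgroup.mem_sup_right (Subgroup.subset_closure rfl))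
    rintro _ ⟨X, h | ⟨a, b, h⟩ | ⟨a, b, h⟩, rfl⟩
    · exact Subgroup.mem_sup_left h.2
    · exact key X a b h
    · have := key _ a b h
      rw [pr_inv] at this
      exact inv_mem_iff.1 this
  · rw [sup_le_iff]
    constructor
    · nth_rewrite 1 [← closure_PD D]
      exact Subgroup.closure_mono (image_mono subset_union_left)
    · apply Subgroup.closure_mono
      rintro _ rfl
      exact ⟨A, Or.inr (Or.inl ⟨1, 1, by simp⟩), rfl⟩

theorem omega_ext {K : Type} [Group K] (φ : H ι → K) (hφ : HomOn D φ) (u : K) :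
    ∃ f, HomOn (D ⊔ Subgroup.closure {pr A}) f ∧ (∀ g ∈ D, f g = φ g) ∧ f (pr A) = u := by
  classical
  let v : Wd ι → K := fun X =>
    if pr X ∈ D then φ (pr X) else
      if h : ∃ B, A = B * X then (φ (pr h.choose))⁻¹ * u else
        if h : ∃ B, A = B * X⁻¹ then u⁻¹ * φ (pr h.choose) else 1
  have v1 : ∀ X, pr X ∈ D → v X = φ (pr X) := fun X h => if_pos h
  have v2 : ∀ X B, pr X ∉ D → A = B * X → v X = (φ (pr B))⁻¹ * u := by
    intro X B h1 h2
    have h : ∃ B, A = B * X := ⟨B, h2⟩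
    have e : v X = (φ (pr h.choose))⁻¹ * u := by
      simp only [v, if_neg h1, dif_pos h]
    have e2 : h.choose = B := mul_right_cancel (h.choose_spec.symm.trans h2)
    rw [e, e2]
  have v3 : ∀ X B, pr X ∉ D → A = B * X⁻¹ → v X = u⁻¹ * φ (pr B) := by
    intro X B h1 h2
    have hn : ¬ ∃ B, A = B * X := fun ⟨C, hC⟩ => h1 (hA.not_both hD hC h2)
    have h : ∃ B, A = B * X⁻¹ := ⟨B, h2⟩
    have e : v X = u⁻¹ * φ (pr h.choose) := by
      simp only [v, if_neg h1, dif_neg hn, dif_pos h]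
    have e2 : h.choose = B := mul_right_cancel (h.choose_spec.symm.trans h2)
    rw [e, e2]
  have hPS : PSys (PD D ∪ FacPM A) := (PD_sys hD).union (FacPM_sys hA.1)
  have hinv : ∀ X ∈ PD D ∪ FacPM A, v X⁻¹ = (v X)⁻¹ := by
    intro X hX
    by_cases hXD : pr X ∈ D
    · rw [v1 X hXD, v1 X⁻¹ (by rw [pr_inv]; exact inv_mem hXD), pr_inv, hφ.inv hXD]
    · have hXD' : pr X⁻¹ ∉ D := by rw [pr_inv, inv_mem_iff]; exact hXD
      rcases hX with hX | ⟨a, b, h⟩ | ⟨a, b, h⟩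
      · exact absurd hX.2 hXD
      · have := hA.tail hD h hXD
        rw [this, mul_one] at h
        rw [v2 X a hXD h, v3 X⁻¹ a hXD' (by simpa using h)]
        group
      · have := hA.tail hD h hXD'
        rw [this, mul_one] at h
        rw [v3 X a hXD h, v2 X⁻¹ a hXD' (by simpa using h)]
        group
  have hmul1 : ∀ a X Y, A = a * (X * Y) → pr (X * Y) ∉ D → v (X * Y) = v X * v Y := by
    intro a X Y h hXY
    by_cases hY : Y = 1
    · subst hY
      rw [v1 1 (by rw [map_one]; exact one_mem _), map_one, hφ.one]; simp
    · have h1 : pr (a * X) ∈ D := hA.2.2 (a * X) Y (by rw [h, mul_assoc]) hY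
      have hr : Red (a * X) := by
        have := hA.1; rw [h, ← mul_assoc] at this; exact this.left
      have hX := hD.right hr h1
      have ha := hD.left hr h1
      have hYD : pr Y ∉ D := fun hYD => hXY (by rw [map_mul]; exact mul_mem hX hYD)
      rw [v2 _ a hXY h, v1 X hX, v2 Y (a * X) hYD (by rw [h, mul_assoc]), map_mul, hφ _ ha _ hX]
      group
  have hmul : ∀ X Y, X * Y ∈ PD D ∪ FacPM A → v (X * Y) = v X * v Y := by
    intro X Y hXY
    by_cases hD' : pr (X * Y) ∈ D
    · have hr := hPS.red _ hXY
      have hX := hD.left hr hD'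
      have hY := hD.right hr hD'
      rw [v1 _ hD', v1 _ hX, v1 _ hY, map_mul, hφ _ hX _ hY]
    · rcases hXY with h | ⟨a, b, h⟩ | ⟨a, b, h⟩
      · exact absurd h.2 hD'
      · have := hA.tail hD h hD'
        rw [this, mul_one] at h
        exact hmul1 a X Y h hD'
      · have hD'' : pr (X * Y)⁻¹ ∉ D := by rw [pr_inv, inv_mem_iff]; exact hD'
        have := hA.tail hD h hD''
        rw [this, mul_one] at h
        have hmem : X * Y ∈ PD D ∪ FacPM A := Or.inr (Or.inr ⟨a, 1, by simpa using h⟩)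
        have e := hmul1 a Y⁻¹ X⁻¹ (by rw [h]; simp) (by simpa using hD'')
        rw [← mul_inv_rev, hinv _ hmem, hinv _ (hPS.right hmem), hinv _ (hPS.left hmem),
          ← mul_inv_rev] at e
        exact inv_injective e
  have hV : VSys (PD D ∪ FacPM A) v := { hPS with vmul := hmul, vinv := hinv }
  obtain ⟨f, hf, hfv⟩ := hV.exists_hom
  rw [hA.closure_eq hD] at hf
  refine ⟨f, hf, ?_, ?_⟩
  · intro g hg
    have := hfv (nf g) (Or.inl (nf_mem_PD hg))
    rw [pr_nf, v1 _ (by rwa [pr_nf]), pr_nf] at this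
    exact this
  · rw [hfv A (Or.inr (Or.inl ⟨1, 1, by simp⟩)), v2 A 1 hA.2.1 (by simp), map_one, hφ.one]
    simp
end

lemma pfst_sup (Γ : Subgroup (H ι × H ι')) (S : Set (H ι × H ι')) :
    pfst (Γ ⊔ Subgroup.closure S) = pfst Γ ⊔ Subgroup.closure (Prod.fst '' S) := by
  rw [pfst, Subgroup.map_sup, MonoidHom.map_closure]; rfl
lemma psnd_sup (Γ : Subgroup (H ι × H ι')) (S : Set (H ι × H ι')) :
    psnd (Γ ⊔ Subgroup.closure S) = psnd Γ ⊔ Subgroup.closure (Prod.snd '' S) := by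
  rw [psnd, Subgroup.map_sup, MonoidHom.map_closure]; rfl

lemma swp_sup (Γ : Subgroup (H ι × H ι')) (S : Set (H ι × H ι')) :
    swp (Γ ⊔ Subgroup.closure S) = swp Γ ⊔ Subgroup.closure (Prod.swap '' S) := by
  rw [swp, Subgroup.map_sup, MonoidHom.map_closure]; rfl

/-- Generic extension step -/
theorem good_ext {Γ : Subgroup (H ι × H ι')} (hΓ : Good Γ) (S : Set (H ι × H ι'))
    (hfc1 : FC (pfst Γ ⊔ Subgroup.closure (Prod.fst '' S)))
    (hfc2 : FC (psnd Γ ⊔ Subgroup.closure (Prod.snd '' S)))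
    (hext1 : ∀ (K : Type) [Group K] (φ : H ι → K) (c : H ι' → K), HomOn (pfst Γ) φ →
      HomOn (psnd Γ ⊔ Subgroup.closure (Prod.snd '' S)) c → (∀ x ∈ Γ, φ x.1 = c x.2) →
      ∃ f, HomOn (pfst Γ ⊔ Subgroup.closure (Prod.fst '' S)) f ∧ (∀ g ∈ pfst Γ, f g = φ g) ∧
        ∀ x ∈ S, f x.1 = c x.2)
    (hext2 : ∀ (K : Type) [Group K] (φ : H ι' → K) (c : H ι → K), HomOn (psnd Γ) φ →
      HomOn (pfst Γ ⊔ Subgroup.closure (Prod.fst '' S)) c → (∀ x ∈ Γ, φ x.2 = c x.1) →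
      ∃ f, HomOn (psnd Γ ⊔ Subgroup.closure (Prod.snd '' S)) f ∧ (∀ g ∈ psnd Γ, f g = φ g) ∧
        ∀ x ∈ S, f x.2 = c x.1) :
    Good (Γ ⊔ Subgroup.closure S) where
  fc1 := by rw [pfst_sup]; exact hfc1
  fc2 := by rw [psnd_sup]; exact hfc2
  p1 p hp := Subgroup.mem_sup_left (hΓ.p1 p hp)
  p2 p hp := Subgroup.mem_sup_left (hΓ.p2 p hp)
  k2 := by
    apply ker_ext hΓ S
    intro K _ φ c h1 h2 h3
    rw [psnd_sup] at h2
    rw [pfst_sup]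
    exact hext1 K φ c h1 h2 h3
  k1 := by
    have := ker_ext hΓ.swap (Prod.swap '' S) (by
      intro K _ φ c h1 h2 h3
      rw [← swp_sup, psnd_swp, pfst_sup] at h2
      rw [← swp_sup, pfst_swp, pfst_swp, psnd_sup]
      rw [pfst_swp] at h1
      obtain ⟨f, f1, f2, f3⟩ := hext2 K φ c h1 h2 (fun x hx => h3 (x.2, x.1) (mem_swp.2 hx))
      refine ⟨f, f1, f2, ?_⟩
      rintro _ ⟨x, hx, rfl⟩
      exact f3 x hx)
    intro g hg
    have h := this g (by rw [← swp_sup, mem_swp]; exact hg)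
    rwa [← swp_sup, psnd_swp] at h

theorem omega_step {Γ : Subgroup (H ι × H ι')} (hΓ : Good Γ) {A : Wd ι} {U : Wd ι'}
    (hA : LimW (pfst Γ) A) (hU : LimW (psnd Γ) U) :
    Good (Γ ⊔ Subgroup.closure {(pr A, pr U)}) := by
  have e1 : Prod.fst '' ({(pr A, pr U)} : Set (H ι × H ι')) = {pr A} := by simp
  have e2 : Prod.snd '' ({(pr A, pr U)} : Set (H ι × H ι')) = {pr U} := by simp
  apply good_ext hΓ
  · rw [e1, ← hA.closure_eq hΓ.fc1]
    exact ((PD_sys hΓ.fc1).union (FacPM_sys hA.1)).fc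
  · rw [e2, ← hU.closure_eq hΓ.fc2]
    exact ((PD_sys hΓ.fc2).union (FacPM_sys hU.1)).fc
  · intro K _ φ c h1 h2 h3
    rw [e1]
    obtain ⟨f, f1, f2, f3⟩ := omega_ext hΓ.fc1 hA φ h1 (c (pr U))
    exact ⟨f, f1, f2, by rintro _ rfl; exact f3⟩
  · intro K _ φ c h1 h2 h3
    rw [e2]
    obtain ⟨f, f1, f2, f3⟩ := omega_ext hΓ.fc2 hU φ h1 (c (pr A))
    exact ⟨f, f1, f2, by rintro _ rfl; exact f3⟩

end GrifAux

namespace GrifAux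
variable {ι ι' : Type}

/-! ## Ordered infinite products -/

section iprod
variable {Q : Type} [LinearOrder Q] {Q' : Type} [LinearOrder Q']

def LFin (X : Q → Wd ι) : Prop := ∀ m, {q | (X q).s m ≠ []}.Finite

lemma flatMap_filter_ne {α β : Type} (f : α → List β) (p : α → Bool) (l : List α)
    (h : ∀ q ∈ l, p q = false → f q = []) : (l.filter p).flatMap f = l.flatMap f := by
  induction l with
  | nil => rfl
  | cons x l ih =>
    have ih' := ih (fun q hq => h q (List.mem_cons_of_mem _ hq))
    by_cases hx : p x = true
    · rw [List.filter_cons_of_pos hx, List.flatMap_cons, List.flatMap_cons, ih']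
    · rw [List.filter_cons_of_neg hx, List.flatMap_cons, ih',
        h x List.mem_cons_self (by simpa using hx)]
      rfl

lemma sorted_ext {l l' : List Q} (h : l.Pairwise (· < ·)) (h' : l'.Pairwise (· < ·))
    (hm : ∀ x, x ∈ l ↔ x ∈ l') : l = l' := by
  apply List.Perm.eq_of_pairwise (le := (· < ·)) _ h h'
  · exact (List.perm_ext_iff_of_nodup (h.imp (fun h => h.ne)) (h'.imp (fun h => h.ne))).2 hm
  · intro a b _ _ h1 h2; exact absurd h1 (lt_asymm h2)

open scoped Classical in
/-- sorted list of relevant indices -/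
def slist (X : Q → Wd ι) (T : Set Q) (m : ℕ) : List Q :=
  if h : {q | q ∈ T ∧ (X q).s m ≠ []}.Finite then h.toFinset.sort else []

lemma slist_pw (X : Q → Wd ι) (T : Set Q) (m : ℕ) : (slist X T m).Pairwise (· < ·) := by
  unfold slist
  split_ifs
  · exact Finset.sortedLT_sort _ |>.pairwise
  · exact List.Pairwise.nil

variable {X : Q → Wd ι} (hX : LFin X)
include hX

lemma mem_slist {T : Set Q} {m : ℕ} {q : Q} :
    q ∈ slist X T m ↔ q ∈ T ∧ (X q).s m ≠ [] := by
  have h : {q | q ∈ T ∧ (X q).s m ≠ []}.Finite := (hX m).subset (fun q hq => hq.2)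
  unfold slist
  rw [dif_pos h, Finset.mem_sort, Set.Finite.mem_toFinset]
  rfl

lemma flatMap_slist {T : Set Q} {m : ℕ} {l : List Q} (h1 : l.Pairwise (· < ·))
    (h2 : ∀ q ∈ l, q ∈ T) (h3 : ∀ q ∈ T, (X q).s m ≠ [] → q ∈ l) :
    (slist X T m).flatMap (fun q => (X q).s m) = l.flatMap (fun q => (X q).s m) := by
  rw [← flatMap_filter_ne (fun q => (X q).s m) (fun q => decide ((X q).s m ≠ [])) l
    (fun q _ hq => by simpa using hq)]
  congr 1
  apply sorted_ext (slist_pw X T m) (h1.filter _)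
  intro q
  rw [mem_slist hX, List.mem_filter]
  constructor
  · intro h; exact ⟨h3 q h.1 h.2, by simpa using h.2⟩
  · intro h; exact ⟨h2 q h.1, by simpa using h.2⟩

/-- ordered product of the words `X q`, `q ∈ T`. -/
def iprod (T : Set Q) : Wd ι :=
  ⟨fun m => (slist X T m).flatMap (fun q => (X q).s m), fun m n hmn => by
    have e : ∀ l : List Q, cut m (l.flatMap (fun q => (X q).s n)) =
        l.flatMap (fun q => (X q).s m) := by
      intro l
      induction l with
      | nil => rfl
      | cons x l ih => rw [List.flatMap_cons, cut_append, ih, (X x).coh m n hmn, List.flatMap_cons]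
    rw [e]
    symm
    apply flatMap_slist hX (slist_pw X T n)
    · intro q hq; exact ((mem_slist hX).1 hq).1
    · intro q hq hq'; exact (mem_slist hX).2 ⟨hq, Wd.s_ne_mono hmn hq'⟩⟩

lemma iprod_s (T : Set Q) (m : ℕ) {l : List Q} (h1 : l.Pairwise (· < ·))
    (h2 : ∀ q ∈ l, q ∈ T) (h3 : ∀ q ∈ T, (X q).s m ≠ [] → q ∈ l) :
    (iprod hX T).s m = l.flatMap (fun q => (X q).s m) := flatMap_slist hX h1 h2 h3

lemma iprod_s' (T : Set Q) (m : ℕ) :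
    (iprod hX T).s m = (slist X T m).flatMap (fun q => (X q).s m) := rfl

@[simp] lemma iprod_empty : iprod hX ∅ = 1 := by
  apply Wd.eq_one_of_s
  intro n
  rw [iprod_s hX ∅ n (l := []) List.Pairwise.nil (by simp) (by simp)]
  rfl

@[simp] lemma iprod_singleton (q : Q) : iprod hX {q} = X q := by
  apply Wd.ext; funext n
  rw [iprod_s hX {q} n (l := [q]) (List.pairwise_singleton _ _) (by simp) (by simp)]
  simp

lemma iprod_union {S T : Set Q} (h : ∀ s ∈ S, ∀ t ∈ T, s < t) :
    iprod hX (S ∪ T) = iprod hX S * iprod hX T := by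
  apply Wd.ext; funext n
  rw [iprod_s hX (S ∪ T) n (l := slist X S n ++ slist X T n)]
  · rw [List.flatMap_append]; rfl
  · rw [List.pairwise_append]
    refine ⟨slist_pw _ _ _, slist_pw _ _ _, fun a ha b hb => h a ?_ b ?_⟩
    · exact ((mem_slist hX).1 ha).1
    · exact ((mem_slist hX).1 hb).1
  · intro q hq
    rcases List.mem_append.1 hq with hq | hq
    · exact Or.inl ((mem_slist hX).1 hq).1
    · exact Or.inr ((mem_slist hX).1 hq).1
  · intro q hq hq'
    rw [List.mem_append, mem_slist hX, mem_slist hX]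
    exact hq.elim (fun h => Or.inl ⟨h, hq'⟩) (fun h => Or.inr ⟨h, hq'⟩)

lemma iprod_insert_mid {S T : Set Q} {q : Q} (hS : ∀ s ∈ S, s < q) (hT : ∀ t ∈ T, q < t) :
    iprod hX (S ∪ {q} ∪ T) = iprod hX S * X q * iprod hX T := by
  rw [iprod_union, iprod_union, iprod_singleton]
  · intro s hs t ht; rw [mem_singleton_iff.1 ht]; exact hS s hs
  · rintro s (hs | hs) t ht
    · exact (hS s hs).trans (hT t ht)
    · rw [mem_singleton_iff.1 hs]; exact hT t ht

lemma iprod_map {X' : Q' → Wd ι} (hX' : LFin X') {T : Set Q} {T' : Set Q'} (θ : Q → Q')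
    (hθ : StrictMonoOn θ T) (him : θ '' T = T') (he : ∀ q ∈ T, X' (θ q) = X q) :
    iprod hX T = iprod hX' T' := by
  apply Wd.ext; funext n
  have hsub : ∀ q ∈ slist X T n, q ∈ T := fun q hq => ((mem_slist hX).1 hq).1
  rw [iprod_s hX' T' n (l := (slist X T n).map θ)]
  · rw [List.flatMap_map, iprod_s']
    apply List.flatMap_congr
    intro q hq
    simp only [he q (hsub q hq)]
  · rw [List.pairwise_map]
    apply List.Pairwise.imp_of_mem _ (slist_pw X T n)
    intro a b ha hb hab
    exact hθ (hsub a ha) (hsub b hb) hab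
  · intro q hq
    obtain ⟨r, hr, rfl⟩ := List.mem_map.1 hq
    rw [← him]; exact mem_image_of_mem _ (hsub r hr)
  · intro q hq hq'
    rw [← him] at hq
    obtain ⟨r, hr, rfl⟩ := hq
    rw [he r hr] at hq'
    exact List.mem_map.2 ⟨r, (mem_slist hX).2 ⟨hr, hq'⟩, rfl⟩

lemma LFin.dual : LFin (Q := Qᵒᵈ) (fun q => (X (OrderDual.ofDual q))⁻¹) := by
  intro m
  apply (hX m).subset
  intro q hq hq'
  apply hq
  simp only [Wd.s_inv]
  have : (X (OrderDual.ofDual q)).s m = [] := hq'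
  rw [this]; rfl

lemma iprod_inv (T : Set Q) :
    (iprod hX T)⁻¹ = iprod (LFin.dual hX) (OrderDual.ofDual ⁻¹' T) := by
  apply Wd.ext; funext n
  rw [iprod_s (LFin.dual hX) _ n (l := ((slist X T n).map OrderDual.toDual).reverse)]
  · rw [Wd.s_inv, iprod_s']
    generalize slist X T n = l
    induction l with
    | nil => rfl
    | cons x l ih =>
      rw [List.flatMap_cons, List.map_cons, List.reverse_cons, List.flatMap_append, ← ih]
      simp [FreeGroup.invRev]
  · rw [List.pairwise_reverse, List.pairwise_map]
    exact slist_pw X T n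
  · intro q hq
    simp only [List.mem_reverse, List.mem_map] at hq
    obtain ⟨r, hr, rfl⟩ := hq
    exact ((mem_slist hX).1 hr).1
  · intro q hq hq'
    simp only [List.mem_reverse, List.mem_map]
    refine ⟨OrderDual.ofDual q, (mem_slist hX).2 ⟨hq, ?_⟩, rfl⟩
    intro h0
    apply hq'
    simp only [Wd.s_inv, h0]; rfl

lemma iprod_ne_one {T : Set Q} {q : Q} (hq : q ∈ T) (hq1 : X q ≠ 1) : iprod hX T ≠ 1 := by
  intro h
  have e : T = (T ∩ Iio q) ∪ {q} ∪ (T ∩ Ioi q) := by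
    ext x
    simp only [mem_union, mem_inter_iff, mem_Iio, mem_singleton_iff, mem_Ioi]
    constructor
    · intro hx
      rcases lt_trichotomy x q with h | h | h <;> tauto
    · rintro ((h | rfl) | h)
      exacts [h.1, hq, h.1]
  rw [e, iprod_insert_mid hX (fun s hs => hs.2) (fun s hs => hs.2)] at h
  exact hq1 (Wd.mul_eq_one (Wd.mul_eq_one h).1).2

/-- the cut lemma -/
lemma iprod_cut {T : Set Q} {A B : Wd ι} (h : iprod hX T = A * B) :
    ∃ T1 T2 : Set Q, (∀ s ∈ T1, ∀ t ∈ T2, s < t) ∧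
      ((T = T1 ∪ T2 ∧ A = iprod hX T1 ∧ B = iprod hX T2) ∨
       ∃ q a b, q ∈ T ∧ T = T1 ∪ {q} ∪ T2 ∧ (∀ s ∈ T1, s < q) ∧ (∀ t ∈ T2, q < t) ∧ X q = a * b ∧
        a ≠ 1 ∧ b ≠ 1 ∧ A = iprod hX T1 * a ∧ B = b * iprod hX T2) := by
  have hsp : ∀ q, T = (T ∩ Iic q) ∪ (T ∩ Ioi q) := by
    intro q; rw [← inter_union_distrib_left, Iic_union_Ioi, inter_univ]
  have hdv : ∀ q, iprod hX (T ∩ Iic q) ∣ iprod hX T := by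
    intro q
    refine ⟨iprod hX (T ∩ Ioi q), ?_⟩
    rw [← iprod_union hX, ← hsp q]
    intro s hs t ht; exact lt_of_le_of_lt hs.2 ht.2
  have hmono : ∀ p q, p ≤ q → iprod hX (T ∩ Iic p) ∣ iprod hX (T ∩ Iic q) := by
    intro p q hpq
    refine ⟨iprod hX (T ∩ Ioc p q), ?_⟩
    rw [← iprod_union hX, ← inter_union_distrib_left, Iic_union_Ioc_eq_Iic hpq]
    intro s hs t ht; exact lt_of_le_of_lt hs.2 ht.2.1
  let T1 := {q | q ∈ T ∧ iprod hX (T ∩ Iic q) ∣ A}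
  let T2 := {q | q ∈ T ∧ ¬ iprod hX (T ∩ Iic q) ∣ A}
  have hT : T = T1 ∪ T2 := by
    ext q; simp only [T1, T2, mem_union, mem_setOf_eq]; tauto
  have hlt : ∀ s ∈ T1, ∀ t ∈ T2, s < t := by
    intro s hs t ht
    by_contra hc
    push Not at hc
    exact ht.2 ((hmono t s hc).trans hs.2)
  have hW : iprod hX T = iprod hX T1 * iprod hX T2 := by
    nth_rewrite 1 [hT]; exact iprod_union hX hlt
  have hA1 : iprod hX T1 ∣ A := by
    rw [Wd.dvd_iff]; intro m
    by_cases hne : slist X T1 m = []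
    · rw [iprod_s', hne]; exact List.nil_prefix
    · obtain ⟨q, hq, hmax⟩ := Set.exists_max_image {q | q ∈ slist X T1 m} id
        (List.finite_toSet _) (by
          obtain ⟨q, hq⟩ := List.exists_mem_of_ne_nil _ hne
          exact ⟨q, hq⟩)
      have hqT := ((mem_slist hX).1 hq).1
      have : (iprod hX T1).s m = (iprod hX (T ∩ Iic q)).s m := by
        rw [iprod_s', iprod_s hX (T ∩ Iic q) m (slist_pw X T1 m)]
        · intro r hr
          exact ⟨((mem_slist hX).1 hr).1.1, hmax r hr⟩
        · intro r hr hr'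
          apply (mem_slist hX).2
          refine ⟨⟨hr.1, (hmono r q hr.2).trans hqT.2⟩, hr'⟩
      rw [this]
      exact Wd.dvd_iff.1 hqT.2 m
  obtain ⟨e, he⟩ := hA1
  have heB : iprod hX T2 = e * B := by
    rw [hW, he, mul_assoc] at h
    exact mul_left_cancel h
  by_cases he1 : e = 1
  · refine ⟨T1, T2, hlt, Or.inl ⟨hT, by rw [he, he1, mul_one], by rw [heB, he1, one_mul]⟩⟩
  obtain ⟨m, hm⟩ := Wd.exists_s_ne he1
  have hpre : ∀ q ∈ T2, iprod hX (T ∩ Iic q) = iprod hX T1 * iprod hX (T2 ∩ Iic q) := by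
    intro q hq
    rw [← iprod_union hX]
    · congr 1
      ext r
      constructor
      · rintro ⟨h1, h2⟩
        rw [hT] at h1
        exact h1.elim Or.inl (fun h1 => Or.inr ⟨h1, h2⟩)
      · rintro (h1 | h1)
        · exact ⟨h1.1, (hlt r h1 q hq).le⟩
        · exact ⟨h1.1.1, h1.2⟩
    · intro s hs t ht; exact hlt s hs t ht.1
  have hed : ∀ q ∈ T2, ∃ f, f ≠ 1 ∧ iprod hX (T2 ∩ Iic q) = e * f := by
    intro q hq
    rcases Wd.dvd_total (hdv q) ⟨B, h⟩ with h1 | ⟨f, hf⟩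
    · exact absurd h1 hq.2
    · refine ⟨f, ?_, ?_⟩
      · rintro rfl
        rw [mul_one] at hf
        exact hq.2 (by rw [hf])
      · rw [hpre q hq, he, mul_assoc] at hf
        exact mul_left_cancel hf
  have hne : {q | q ∈ slist X T2 m}.Nonempty := by
    have : (iprod hX T2).s m ≠ [] := by rw [heB]; simp [hm]
    rw [iprod_s'] at this
    by_contra hc
    apply this
    have : slist X T2 m = [] := by
      by_contra h0
      obtain ⟨q, hq⟩ := List.exists_mem_of_ne_nil _ h0
      exact hc ⟨q, hq⟩
    rw [this]; rfl
  obtain ⟨q0, hq0, hmin⟩ := Set.exists_min_image {q | q ∈ slist X T2 m} id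
        (List.finite_toSet _) hne
  have hq0T := ((mem_slist hX).1 hq0).1
  have hleast : ∀ q ∈ T2, q0 ≤ q := by
    intro q hq
    obtain ⟨f, -, hf⟩ := hed q hq
    have h1 : (iprod hX (T2 ∩ Iic q)).s m ≠ [] := by rw [hf]; simp [hm]
    rw [iprod_s'] at h1
    have h2 : slist X (T2 ∩ Iic q) m ≠ [] := by
      intro h0; apply h1; rw [h0]; rfl
    obtain ⟨r, hr⟩ := List.exists_mem_of_ne_nil _ h2
    have hr' := (mem_slist hX).1 hr
    exact le_trans (hmin r ((mem_slist hX).2 ⟨hr'.1.1, hr'.2⟩)) hr'.1.2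
  have hT2 : T2 = {q0} ∪ (T2 ∩ Ioi q0) := by
    ext r
    constructor
    · intro hr
      rcases (hleast r hr).eq_or_lt with h | h
      · exact Or.inl h.symm
      · exact Or.inr ⟨hr, h⟩
    · rintro (h | h)
      · rw [mem_singleton_iff.1 h]; exact hq0T
      · exact h.1
  obtain ⟨b, hb1, hb⟩ := hed q0 hq0T
  have hI : T2 ∩ Iic q0 = {q0} := by
    ext r
    constructor
    · rintro ⟨h1, h2⟩; exact le_antisymm h2 (hleast r h1)
    · rintro h; rw [mem_singleton_iff.1 h]; exact ⟨hq0T, le_refl q0⟩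
  rw [hI, iprod_singleton] at hb
  refine ⟨T1, T2 ∩ Ioi q0, fun s hs t ht => hlt s hs t ht.1,
    Or.inr ⟨q0, e, b, hq0T.1, ?_, fun s hs => hlt s hs q0 hq0T, fun t ht => ht.2, hb, he1, hb1,
      he, ?_⟩⟩
  · rw [union_assoc, ← hT2]; exact hT
  · have : iprod hX T2 = X q0 * iprod hX (T2 ∩ Ioi q0) := by
      nth_rewrite 1 [hT2]
      rw [iprod_union, iprod_singleton]
      intro s hs t ht
      rw [mem_singleton_iff.1 hs]; exact ht.2
    rw [this, hb, mul_assoc] at heB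
    exact (mul_left_cancel heB).symm

end iprod
end GrifAux

namespace GrifAux
variable {ι ι' : Type}

/-! ## Dense systems and the rigidity lemma -/

structure DSys (D : Subgroup (H ι)) {Q : Type} [LinearOrder Q] (X : Q → Wd ι) (hX : LFin X) :
    Prop where
  red : Red (iprod hX univ)
  mem : ∀ q, pr (X q) ∈ D
  ne : ∀ q, X q ≠ 1
  dense : ∀ q q', q < q' → pr (iprod hX (Icc q q')) ∉ D

section
variable {Q : Type} [LinearOrder Q] {X : Q → Wd ι} {hX : LFin X}

lemma iprod_fac (hX : LFin X) {R T : Set Q} (hT : T.OrdConnected) (h : T ⊆ R) :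
    ∃ a b, iprod hX R = a * iprod hX T * b := by
  refine ⟨iprod hX {r | r ∈ R ∧ ∀ t ∈ T, r < t}, iprod hX {r | r ∈ R ∧ r ∉ T ∧ ∃ t ∈ T, t ≤ r}, ?_⟩
  rw [← iprod_union, ← iprod_union]
  · congr 1
    ext r
    simp only [mem_union, mem_setOf_eq]
    constructor
    · intro hr
      by_cases h1 : r ∈ T
      · exact Or.inl (Or.inr h1)
      · by_cases h2 : ∀ t ∈ T, r < t
        · exact Or.inl (Or.inl ⟨hr, h2⟩)
        · push Not at h2
          exact Or.inr ⟨hr, h1, h2⟩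
    · rintro ((h1 | h1) | h1)
      exacts [h1.1, h h1, h1.1]
  · rintro s hs t ⟨ht, ht', t0, ht0, h0⟩
    rcases hs with hs | hs
    · exact (hs.2 t0 ht0).trans_le h0
    · by_contra hc
      push Not at hc
      exact ht' (hT.out ht0 hs ⟨h0, hc⟩)
  · rintro s hs t ht
    exact hs.2 t ht

lemma ord_split {T : Set Q} {q : Q} (hq : q ∈ T) : T = (T ∩ Iio q) ∪ {q} ∪ (T ∩ Ioi q) := by
  ext x
  simp only [mem_union, mem_inter_iff, mem_Iio, mem_singleton_iff, mem_Ioi]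
  constructor
  · intro hx
    rcases lt_trichotomy x q with h | h | h
    exacts [Or.inl (Or.inl ⟨hx, h⟩), Or.inl (Or.inr h), Or.inr ⟨hx, h⟩]
  · rintro ((h | h) | h)
    exacts [h.1, h ▸ hq, h.1]

lemma iprod_at (hX : LFin X) {T : Set Q} {q : Q} (hq : q ∈ T) :
    iprod hX T = iprod hX (T ∩ Iio q) * X q * iprod hX (T ∩ Ioi q) := by
  nth_rewrite 1 [ord_split hq]
  exact iprod_insert_mid hX (fun s hs => hs.2) (fun t ht => ht.2)

lemma iprod_least (hX : LFin X) {T : Set Q} {q : Q} (hq : IsLeast T q) :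
    iprod hX T = X q * iprod hX (T ∩ Ioi q) := by
  rw [iprod_at hX hq.1]
  have : T ∩ Iio q = ∅ := by
    ext x; simp only [mem_inter_iff, mem_Iio, mem_empty_iff_false, iff_false, not_and, not_lt]
    exact fun h => hq.2 h
  rw [this]; simp

lemma iprod_greatest (hX : LFin X) {T : Set Q} {q : Q} (hq : IsGreatest T q) :
    iprod hX T = iprod hX (T ∩ Iio q) * X q := by
  rw [iprod_at hX hq.1]
  have : T ∩ Ioi q = ∅ := by
    ext x; simp only [mem_inter_iff, mem_Ioi, mem_empty_iff_false, iff_false, not_and, not_lt]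
    exact fun h => hq.2 h
  rw [this]; simp

variable {D : Subgroup (H ι)} (hD : FC D)

lemma DSys.redT (S : DSys D X hX) {T : Set Q} (hT : T.OrdConnected) : Red (iprod hX T) := by
  obtain ⟨a, b, h⟩ := iprod_fac hX hT (subset_univ T)
  have := S.red
  rw [h] at this
  exact this.fac

include hD in
lemma DSys.subsing (S : DSys D X hX) {T : Set Q} (hT : T.OrdConnected)
    (h : pr (iprod hX T) ∈ D) : T.Subsingleton := by
  intro q hq q' hq'
  by_contra hne
  have key : ∀ a b, a ∈ T → b ∈ T → a < b → False := by
    intro a b ha hb hab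
    obtain ⟨x, y, e⟩ := iprod_fac hX (T := Icc a b) ordConnected_Icc (hT.out ha hb)
    have hr := S.redT hT
    rw [e] at h hr
    exact S.dense a b hab (hD _ _ _ hr h)
  rcases lt_or_gt_of_ne hne with h1 | h1
  exacts [key _ _ hq hq' h1, key _ _ hq' hq h1]

lemma DSys.exists_between (S : DSys D X hX) {a b : Q} (h : a < b) : ∃ c, a < c ∧ c < b := by
  by_contra hc
  push Not at hc
  apply S.dense a b h
  have : Icc a b = {a} ∪ {b} := by
    ext x
    simp only [mem_Icc, mem_union, mem_singleton_iff]
    constructor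
    · rintro ⟨h1, h2⟩
      rcases h1.eq_or_lt with h3 | h3
      · exact Or.inl h3.symm
      · exact Or.inr (le_antisymm h2 (hc x h3))
    · rintro (rfl | rfl)
      exacts [⟨le_rfl, h.le⟩, ⟨h.le, le_rfl⟩]
  rw [this, iprod_union, iprod_singleton, iprod_singleton, map_mul]
  · exact mul_mem (S.mem a) (S.mem b)
  · rintro s hs t ht
    rw [mem_singleton_iff.1 hs, mem_singleton_iff.1 ht]; exact h

lemma DSys.noleast (S : DSys D X hX) {T : Set Q} (hT : T.OrdConnected) {q : Q} (hq : q ∈ T) :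
    ¬ ∃ r, IsLeast (T ∩ Ioi q) r := by
  rintro ⟨r, ⟨hr, hqr⟩, hl⟩
  obtain ⟨c, h1, h2⟩ := S.exists_between hqr
  exact absurd (hl ⟨hT.out hq hr ⟨h1.le, h2.le⟩, h1⟩) (not_le.2 h2)

lemma DSys.nogreatest (S : DSys D X hX) {T : Set Q} (hT : T.OrdConnected) {q : Q} (hq : q ∈ T) :
    ¬ ∃ r, IsGreatest (T ∩ Iio q) r := by
  rintro ⟨r, ⟨hr, hqr⟩, hl⟩
  obtain ⟨c, h1, h2⟩ := S.exists_between hqr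
  exact absurd (hl ⟨hT.out hr hq ⟨h1.le, h2.le⟩, h2⟩) (not_le.2 h1)

include hD in
lemma DSys.pre (S : DSys D X hX) {T : Set Q} (hT : T.OrdConnected)
    (hno : ¬ ∃ q, IsLeast T q) {z w : Wd ι} (h : iprod hX T = z * w) (hz : pr z ∈ D) : z = 1 := by
  have hr := S.redT hT
  obtain ⟨T1, T2, hlt, ⟨hTT, rfl, -⟩ | ⟨q, a, b, hq, hTT, h1, h2, hab, ha, hb, rfl, -⟩⟩ :=
    iprod_cut hX h
  · by_contra hne
    have hT1 : T1.OrdConnected := by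
      constructor
      intro x hx y hy r hr
      have : r ∈ T := hT.out (hTT ▸ Or.inl hx) (hTT ▸ Or.inl hy) hr
      rw [hTT] at this
      rcases this with h' | h'
      · exact h'
      · exact absurd (hlt y hy r h') (not_lt.2 hr.2)
    have hs := S.subsing hD hT1 hz
    rcases hs.eq_empty_or_singleton with h' | ⟨q, h'⟩
    · rw [h'] at hne; simp at hne
    · apply hno
      refine ⟨q, by rw [hTT, h']; exact Or.inl rfl, ?_⟩
      intro r hr
      rw [hTT] at hr
      rcases hr with hr | hr
      · rw [h'] at hr; exact le_of_eq hr.symm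
      · exact (hlt q (by rw [h']; rfl) r hr).le
  · exfalso
    by_cases hT1 : T1 = ∅
    · apply hno
      refine ⟨q, hq, ?_⟩
      intro r hr
      rw [hTT, hT1] at hr
      simp only [empty_union] at hr
      rcases hr with hr | hr
      · exact le_of_eq hr.symm
      · exact (h2 r hr).le
    · obtain ⟨s, hs⟩ := nonempty_iff_ne_empty.2 hT1
      obtain ⟨c, hc1, hc2⟩ := S.exists_between (h1 s hs)
      have hsT : s ∈ T := by rw [hTT]; exact Or.inl (Or.inl hs)
      have hsub : Icc s c ⊆ T1 := by
        intro r hr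
        have : r ∈ T := hT.out hsT hq ⟨hr.1, (hr.2.trans_lt hc2).le⟩
        rw [hTT] at this
        have hrq := hr.2.trans_lt hc2
        rcases this with (h' | h') | h'
        · exact h'
        · exact absurd hrq (not_lt.2 (le_of_eq h'.symm))
        · exact absurd hrq (not_lt.2 (h2 r h').le)
      obtain ⟨x, y, e⟩ := iprod_fac hX (T := Icc s c) ordConnected_Icc hsub
      rw [h, e] at hr
      rw [e] at hz
      have hr' := hr.left
      rw [mul_assoc] at hz hr'
      exact S.dense s c hc1 (hD _ _ _ hr' hz)

end

section
variable {Q : Type} [LinearOrder Q] {X : Q → Wd ι} {hX : LFin X} {D : Subgroup (H ι)} (hD : FC D)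

lemma DSys.dual (S : DSys D X hX) :
    DSys D (Q := Qᵒᵈ) (fun q => (X (OrderDual.ofDual q))⁻¹) (LFin.dual hX) where
  red := by
    have := S.red.inv
    rw [iprod_inv] at this
    exact this
  mem q := by rw [pr_inv]; exact inv_mem (S.mem _)
  ne q := by
    intro h
    exact S.ne _ (inv_eq_one.1 h)
  dense q q' h := by
    have := S.dense (OrderDual.ofDual q') (OrderDual.ofDual q) h
    intro h'
    apply this
    rw [← inv_mem_iff, ← pr_inv, iprod_inv]
    have e : OrderDual.ofDual ⁻¹' Icc (OrderDual.ofDual q') (OrderDual.ofDual q) = Icc q q' := by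
      ext x; simp only [mem_preimage, mem_Icc]; constructor
      · rintro ⟨a, b⟩; exact ⟨b, a⟩
      · rintro ⟨a, b⟩; exact ⟨b, a⟩
    rw [e]; exact h'

lemma ord_dual {T : Set Q} (hT : T.OrdConnected) :
    (OrderDual.ofDual ⁻¹' T : Set Qᵒᵈ).OrdConnected := by
  constructor
  intro x hx y hy r hr
  exact hT.out hy hx ⟨hr.2, hr.1⟩

include hD in
lemma DSys.suf (S : DSys D X hX) {T : Set Q} (hT : T.OrdConnected)
    (hno : ¬ ∃ q, IsGreatest T q) {z w : Wd ι} (h : iprod hX T = w * z) (hz : pr z ∈ D) :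
    z = 1 := by
  have h1 : iprod (LFin.dual hX) (OrderDual.ofDual ⁻¹' T) = z⁻¹ * w⁻¹ := by
    rw [← iprod_inv hX, h, mul_inv_rev]
  have := S.dual.pre hD (ord_dual hT) (by
    rintro ⟨q, hq⟩
    exact hno ⟨OrderDual.ofDual q, hq.1, fun r hr => hq.2 (show OrderDual.toDual r ∈ _ from hr)⟩) h1
    (by rw [pr_inv]; exact inv_mem hz)
  exact inv_eq_one.1 this

lemma ord_Iio {T : Set Q} (hT : T.OrdConnected) (q : Q) : (T ∩ Iio q).OrdConnected :=
  hT.inter ordConnected_Iio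
lemma ord_Ioi {T : Set Q} (hT : T.OrdConnected) (q : Q) : (T ∩ Ioi q).OrdConnected :=
  hT.inter ordConnected_Ioi

variable {Q' : Type} [LinearOrder Q'] {X' : Q' → Wd ι} {hX' : LFin X'}

include hD in
lemma DSys.match1 (S : DSys D X hX) (S' : DSys D X' hX') {T : Set Q} {T' : Set Q'}
    (hT : T.OrdConnected) (hT' : T'.OrdConnected)
    (h : iprod hX T = iprod hX' T') {q : Q} (hq : q ∈ T) :
    ∃ q' ∈ T', X' q' = X q ∧ iprod hX (T ∩ Iio q) = iprod hX' (T' ∩ Iio q') := by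
  have e0 := iprod_at hX hq
  rw [h, mul_assoc] at e0
  have hno := S.noleast hT hq
  obtain ⟨T1, T2, hlt, ⟨hTT, e1, e2⟩ | ⟨r, a, b, hr, hTT, h1, h2, hab, ha, hb, e1, e2⟩⟩ :=
    iprod_cut hX' e0
  · have hT2 : T2.OrdConnected := by
      constructor
      intro x hx y hy r hr
      have : r ∈ T' := hT'.out (hTT ▸ Or.inr hx) (hTT ▸ Or.inr hy) hr
      rw [hTT] at this
      rcases this with h' | h'
      · exact absurd (hlt r h' x hx) (not_lt.2 hr.1)
      · exact h'
    have hl : ∃ r, IsLeast T2 r := by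
      by_contra hc
      exact S.ne q (S'.pre hD hT2 hc e2.symm (S.mem q))
    obtain ⟨r, hr⟩ := hl
    have hrT : r ∈ T' := by rw [hTT]; exact Or.inr hr.1
    have hT1 : T' ∩ Iio r = T1 := by
      ext x
      constructor
      · rintro ⟨hx, hxr⟩
        rw [hTT] at hx
        rcases hx with hx | hx
        · exact hx
        · exact absurd (hr.2 hx) (not_le.2 hxr)
      · intro hx
        exact ⟨by rw [hTT]; exact Or.inl hx, hlt x hx r hr.1⟩
    refine ⟨r, hrT, ?_, by rw [hT1]; exact e1⟩
    rw [iprod_least hX' hr] at e2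
    rcases Wd.levi e2 with ⟨e, f1, f2⟩ | ⟨e, f1, f2⟩
    · have he : pr e ∈ D := by
        have := S'.mem r
        rw [f1, map_mul] at this
        exact (mul_mem_cancel_left (S.mem q)).1 this
      have := S.pre hD (ord_Ioi hT q) hno f2 he
      rw [f1, this, mul_one]
    · have he : pr e ∈ D := by
        have := S.mem q
        rw [f1, map_mul] at this
        exact (mul_mem_cancel_left (S'.mem r)).1 this
      have := S'.pre hD (ord_Ioi hT2 r) (S'.noleast hT2 hr.1) f2 he
      rw [f1, this, mul_one]
  · exfalso
    apply ha
    apply S.suf hD (ord_Iio hT q) (S.nogreatest hT hq) e1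
    have hm := S'.mem r
    have hrr : Red (X' r) := by
      have := S'.redT (T := {r}) ordConnected_singleton
      rwa [iprod_singleton] at this
    rw [hab] at hm hrr
    exact hD.left hrr hm

lemma iprod_Iio_ssub (hne : ∀ q, X q ≠ 1) {T : Set Q} {q r : Q} (hq : q ∈ T) (h : q < r) :
    ∃ e, e ≠ 1 ∧ iprod hX (T ∩ Iio r) = iprod hX (T ∩ Iio q) * e := by
  refine ⟨X q * iprod hX (T ∩ Iio r ∩ Ioi q), fun h => hne q (Wd.mul_eq_one h).1, ?_⟩
  rw [iprod_at hX (show q ∈ T ∩ Iio r from ⟨hq, h⟩), mul_assoc]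
  have : T ∩ Iio r ∩ Iio q = T ∩ Iio q := by
    ext x; simp only [mem_inter_iff, mem_Iio]
    constructor
    · rintro ⟨⟨a, b⟩, c⟩; exact ⟨a, c⟩
    · rintro ⟨a, c⟩; exact ⟨⟨a, c.trans h⟩, c⟩
  rw [this]

lemma iprod_Iio_inj (hne : ∀ q, X q ≠ 1) {T : Set Q} {q r : Q} (hq : q ∈ T) (hr : r ∈ T)
    (h : iprod hX (T ∩ Iio q) = iprod hX (T ∩ Iio r)) : q = r := by
  rcases lt_trichotomy q r with h1 | h1 | h1
  · obtain ⟨e, he, e1⟩ := iprod_Iio_ssub (hX := hX) hne hq h1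
    rw [h] at e1
    exact absurd (left_eq_mul.1 e1) he
  · exact h1
  · obtain ⟨e, he, e1⟩ := iprod_Iio_ssub (hX := hX) hne hr h1
    rw [h] at e1
    exact absurd (left_eq_mul.1 e1) he

include hD in
/-- Rigidity -/
theorem DSys.rigid (S : DSys D X hX) (S' : DSys D X' hX') {T : Set Q} {T' : Set Q'}
    (hT : T.OrdConnected) (hT' : T'.OrdConnected)
    (h : iprod hX T = iprod hX' T') {U : Q → Wd ι'} {U' : Q' → Wd ι'} (hU : LFin U) (hU' : LFin U')
    (hc : ∀ q q', X q = X' q' → U q = U' q') : iprod hU T = iprod hU' T' := by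
  classical
  by_cases hN : Nonempty Q'
  swap
  · have h1 : T = ∅ := eq_empty_of_forall_notMem fun r hr => by
      obtain ⟨q', -⟩ := S.match1 hD S' hT hT' h hr
      exact hN ⟨q'⟩
    have h2 : T' = ∅ := eq_empty_of_forall_notMem fun r hr => hN ⟨r⟩
    rw [h1, h2]; simp
  have hm : ∀ q, ∃ q', q ∈ T → q' ∈ T' ∧ X' q' = X q ∧
      iprod hX (T ∩ Iio q) = iprod hX' (T' ∩ Iio q') := by
    intro q
    by_cases hq : q ∈ T
    · obtain ⟨q', h1, h2, h3⟩ := S.match1 hD S' hT hT' h hq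
      exact ⟨q', fun _ => ⟨h1, h2, h3⟩⟩
    · exact ⟨hN.some, fun h => absurd h hq⟩
  choose θ hθ using hm
  apply iprod_map hU hU' θ
  · intro q hq r hr hqr
    by_contra hle
    push Not at hle
    obtain ⟨e, he, e1⟩ := iprod_Iio_ssub (hX := hX) S.ne hq hqr
    rcases hle.eq_or_lt with h1 | h1
    · rw [(hθ q hq).2.2, (hθ r hr).2.2, h1] at e1
      exact he (left_eq_mul.1 e1)
    · obtain ⟨f, hf, f1⟩ := iprod_Iio_ssub (hX := hX') S'.ne (hθ r hr).1 h1
      rw [(hθ q hq).2.2, (hθ r hr).2.2, f1, mul_assoc] at e1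
      exact hf (Wd.mul_eq_one (left_eq_mul.1 e1)).1
  · ext q'
    constructor
    · rintro ⟨q, hq, rfl⟩; exact (hθ q hq).1
    · intro hq'
      obtain ⟨q, h1, h2, h3⟩ := S'.match1 hD S hT' hT h.symm hq'
      refine ⟨q, h1, ?_⟩
      apply iprod_Iio_inj (hX := hX') S'.ne (hθ q h1).1 hq'
      rw [← (hθ q h1).2.2, h3]
  · intro q hq
    exact (hc q (θ q) (hθ q hq).2.1.symm).symm
end
end GrifAux

namespace GrifAux
variable {ι ι' : Type}

/-! ## Dense extension -/

section
variable {Q : Type} [LinearOrder Q]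

lemma ord_cut1 {T T1 T2 : Set Q} (hT : T.OrdConnected) (h : T = T1 ∪ T2)
    (hlt : ∀ s ∈ T1, ∀ t ∈ T2, s < t) : T1.OrdConnected ∧ T2.OrdConnected := by
  constructor
  · constructor
    intro x hx y hy r hr
    have : r ∈ T := hT.out (h ▸ Or.inl hx) (h ▸ Or.inl hy) hr
    rw [h] at this
    rcases this with h' | h'
    · exact h'
    · exact absurd (hlt y hy r h') (not_lt.2 hr.2)
  · constructor
    intro x hx y hy r hr
    have : r ∈ T := hT.out (h ▸ Or.inr hx) (h ▸ Or.inr hy) hr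
    rw [h] at this
    rcases this with h' | h'
    · exact absurd (hlt r h' x hx) (not_lt.2 hr.1)
    · exact h'

lemma ord_cut2 {T T1 T2 : Set Q} {q : Q} (hT : T.OrdConnected) (h : T = T1 ∪ {q} ∪ T2)
    (h1 : ∀ s ∈ T1, s < q) (h2 : ∀ t ∈ T2, q < t) : T1.OrdConnected ∧ T2.OrdConnected := by
  have a : (T1 ∪ {q}).OrdConnected ∧ T2.OrdConnected := by
    apply ord_cut1 hT h
    rintro s (hs | hs) t ht
    · exact (h1 s hs).trans (h2 t ht)
    · rw [mem_singleton_iff.1 hs]; exact h2 t ht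
  refine ⟨(ord_cut1 a.1 rfl ?_).1, a.2⟩
  intro s hs t ht
  rw [mem_singleton_iff.1 ht]; exact h1 s hs

variable {K : Type} [Group K]

/-- `k` is a value of the word `Y` -/
def DVal (D : Subgroup (H ι)) {X : Q → Wd ι} (hX : LFin X) {U : Q → Wd ι'} (hU : LFin U)
    (φ : H ι → K) (c : H ι' → K) (Y : Wd ι) (k : K) : Prop :=
  ∃ x T y, T.OrdConnected ∧ Y = x * iprod hX T * y ∧ pr x ∈ D ∧ pr y ∈ D ∧
    k = φ (pr x) * c (pr (iprod hU T)) * φ (pr y)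

/-- Data for a dense extension -/
structure DExt (D : Subgroup (H ι)) (E : Subgroup (H ι')) {X : Q → Wd ι} (hX : LFin X)
    {U : Q → Wd ι'} (hU : LFin U) (φ : H ι → K) (c : H ι' → K) : Prop where
  fc : FC D
  sys : DSys D X hX
  hφ : HomOn D φ
  hc : HomOn E c
  memU : ∀ T : Set Q, T.OrdConnected → pr (iprod hU T) ∈ E
  com : ∀ q, φ (pr (X q)) = c (pr (U q))

namespace DExt
variable {D : Subgroup (H ι)} {E : Subgroup (H ι')} {X : Q → Wd ι} {hX : LFin X}
    {U : Q → Wd ι'} {hU : LFin U} {φ : H ι → K} {c : H ι' → K} (S : DExt D E hX hU φ c)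
include S

lemma memq (q : Q) : pr (U q) ∈ E := by
  have := S.memU {q} ordConnected_singleton
  rwa [iprod_singleton] at this

lemma c_union {T1 T2 : Set Q} (h1 : T1.OrdConnected) (h2 : T2.OrdConnected)
    (hlt : ∀ s ∈ T1, ∀ t ∈ T2, s < t) :
    c (pr (iprod hU (T1 ∪ T2))) = c (pr (iprod hU T1)) * c (pr (iprod hU T2)) := by
  rw [iprod_union hU hlt, map_mul, S.hc _ (S.memU _ h1) _ (S.memU _ h2)]

lemma c_mid {T1 T2 : Set Q} {q : Q} (h1 : T1.OrdConnected) (h2 : T2.OrdConnected)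
    (hl : ∀ s ∈ T1, s < q) (hr : ∀ t ∈ T2, q < t) :
    c (pr (iprod hU (T1 ∪ {q} ∪ T2))) =
      c (pr (iprod hU T1)) * φ (pr (X q)) * c (pr (iprod hU T2)) := by
  rw [iprod_insert_mid hU hl hr, map_mul, map_mul,
    S.hc _ (mul_mem (S.memU _ h1) (S.memq q)) _ (S.memU _ h2),
    S.hc _ (S.memU _ h1) _ (S.memq q), S.com]

lemma split {Y Z : Wd ι} {k : K} (hr : Red (Y * Z)) (h : DVal D hX hU φ c (Y * Z) k) :
    ∃ k1 k2, DVal D hX hU φ c Y k1 ∧ DVal D hX hU φ c Z k2 ∧ k = k1 * k2 := by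
  obtain ⟨x, T, y, hT, e, hx, hy, rfl⟩ := h
  have h1D : pr (1 : Wd ι) ∈ D := by rw [map_one]; exact one_mem _
  have hem : (∅ : Set Q).OrdConnected := ordConnected_empty
  have hφ1 : φ (pr (1 : Wd ι)) = 1 := by rw [map_one, S.hφ.one]
  have hc1 : c (pr (iprod hU ∅)) = 1 := by rw [iprod_empty, map_one, S.hc.one]
  have hr' := hr
  rw [e] at hr
  rw [mul_assoc] at e
  rcases Wd.levi e.symm with ⟨f, e1, e2⟩ | ⟨f, e1, e2⟩
  · rcases Wd.levi e2 with ⟨g, e3, e4⟩ | ⟨g, e3, e4⟩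
    · have hgz : pr g ∈ D ∧ pr Z ∈ D := by
        have : Red y := hr.right
        rw [e4] at this hy
        exact ⟨S.fc.left this hy, S.fc.right this hy⟩
      refine ⟨_, φ (pr Z), ⟨x, T, g, hT, by rw [e1, e3, mul_assoc], hx, hgz.1, rfl⟩,
        ⟨Z, ∅, 1, hem, by simp, hgz.2, h1D, by rw [hφ1, hc1]; simp⟩, ?_⟩
      rw [e4, map_mul, S.hφ _ hgz.1 _ hgz.2]; group
    · obtain ⟨T1, T2, hlt, ⟨hTT, f1, f2⟩ | ⟨q, a, b, hq, hTT, h1, h2, hab, ha, hb, f1, f2⟩⟩ :=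
        iprod_cut hX e3
      · have ho := ord_cut1 hT hTT hlt
        refine ⟨_, _, ⟨x, T1, 1, ho.1, by rw [e1, f1]; simp, hx, h1D, rfl⟩,
          ⟨1, T2, y, ho.2, by rw [e4, f2]; simp, h1D, hy, rfl⟩, ?_⟩
        rw [hφ1, hTT, S.c_union ho.1 ho.2 hlt]; group
      · have ho := ord_cut2 hT hTT h1 h2
        have hred : Red (a * b) := by
          have : Red (X q) := by
            have := S.sys.redT (T := {q}) ordConnected_singleton
            rwa [iprod_singleton] at this
          rwa [← hab]
        have hm : pr (a * b) ∈ D := by rw [← hab]; exact S.sys.mem q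
        have haD := S.fc.left hred hm
        have hbD := S.fc.right hred hm
        refine ⟨_, _, ⟨x, T1, a, ho.1, by rw [e1, f1]; simp [mul_assoc], hx, haD, rfl⟩,
          ⟨b, T2, y, ho.2, by rw [e4, f2], hbD, hy, rfl⟩, ?_⟩
        rw [hTT, S.c_mid ho.1 ho.2 h1 h2, hab, map_mul, S.hφ _ haD _ hbD]; group
  · have hgz : pr Y ∈ D ∧ pr f ∈ D := by
      have : Red x := hr.left.left
      rw [e1] at this hx
      exact ⟨S.fc.left this hx, S.fc.right this hx⟩
    refine ⟨φ (pr Y), _, ⟨Y, ∅, 1, hem, by simp, hgz.1, h1D, by rw [hφ1, hc1]; simp⟩,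
      ⟨f, T, y, hT, by rw [e2, mul_assoc], hgz.2, hy, rfl⟩, ?_⟩
    rw [e1, map_mul, S.hφ _ hgz.1 _ hgz.2]; group

lemma normal {Y : Wd ι} {k : K} (h : DVal D hX hU φ c Y k) :
    ∃ x T y, T.OrdConnected ∧ (¬ ∃ q, IsLeast T q) ∧ (¬ ∃ q, IsGreatest T q) ∧
      Y = x * iprod hX T * y ∧ pr x ∈ D ∧ pr y ∈ D ∧
      k = φ (pr x) * c (pr (iprod hU T)) * φ (pr y) := by
  have step1 : ∃ x T y, T.OrdConnected ∧ (¬ ∃ q, IsLeast T q) ∧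
      Y = x * iprod hX T * y ∧ pr x ∈ D ∧ pr y ∈ D ∧
      k = φ (pr x) * c (pr (iprod hU T)) * φ (pr y) := by
    obtain ⟨x, T, y, hT, e, hx, hy, rfl⟩ := h
    by_cases hl : ∃ q, IsLeast T q
    · obtain ⟨q, hq⟩ := hl
      refine ⟨x * X q, T ∩ Ioi q, y, ord_Ioi hT q, S.sys.noleast hT hq.1, ?_, ?_, hy, ?_⟩
      · rw [e, iprod_least hX hq]; simp [mul_assoc]
      · rw [map_mul]; exact mul_mem hx (S.sys.mem q)
      · rw [iprod_least hU hq, map_mul, map_mul,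
          S.hc _ (S.memq q) _ (S.memU _ (ord_Ioi hT q)), S.hφ _ hx _ (S.sys.mem q), S.com]
        group
    · exact ⟨x, T, y, hT, hl, e, hx, hy, rfl⟩
  obtain ⟨x, T, y, hT, hl, e, hx, hy, rfl⟩ := step1
  by_cases hg : ∃ q, IsGreatest T q
  · obtain ⟨q, hq⟩ := hg
    refine ⟨x, T ∩ Iio q, X q * y, ord_Iio hT q, ?_, S.sys.nogreatest hT hq.1, ?_, hx, ?_, ?_⟩
    · rintro ⟨r, hr⟩
      refine hl ⟨r, hr.1.1, fun t ht => ?_⟩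
      by_cases h : t < q
      · exact hr.2 ⟨ht, h⟩
      · exact hr.1.2.le.trans (not_lt.1 h)
    · rw [e, iprod_greatest hX hq]; simp [mul_assoc]
    · rw [map_mul]; exact mul_mem (S.sys.mem q) hy
    · rw [iprod_greatest hU hq, map_mul, map_mul,
        S.hc _ (S.memU _ (ord_Iio hT q)) _ (S.memq q), S.hφ _ (S.sys.mem q) _ hy, S.com]
      group
  · exact ⟨x, T, y, hT, hl, hg, e, hx, hy, rfl⟩

lemma empty_of {T : Set Q} (hT : T.OrdConnected) (hl : ¬ ∃ q, IsLeast T q)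
    (h : pr (iprod hX T) ∈ D) : T = ∅ := by
  rcases (S.sys.subsing S.fc hT h).eq_empty_or_singleton with h | ⟨q, h⟩
  · exact h
  · exact absurd ⟨q, by rw [h]; exact isLeast_singleton⟩ hl

lemma unique {Q' : Type} [LinearOrder Q'] {X' : Q' → Wd ι} {hX' : LFin X'}
    {U' : Q' → Wd ι'} {hU' : LFin U'} (S' : DExt D E hX' hU' φ c)
    (hcp : ∀ q q', X q = X' q' → U q = U' q') {Y : Wd ι} {k k' : K} (hr : Red Y)
    (h : DVal D hX hU φ c Y k) (h' : DVal D hX' hU' φ c Y k') : k = k' := by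
  obtain ⟨x, T, y, hT, hl, hg, e, hx, hy, rfl⟩ := S.normal h
  obtain ⟨x', T', y', hT', hl', hg', e', hx', hy', rfl⟩ := S'.normal h'
  have hrr := hr
  have hrr' := hr
  rw [e] at hrr
  rw [e'] at hrr'
  by_cases hYD : pr Y ∈ D
  · have h1 : T = ∅ := S.empty_of hT hl (S.fc _ _ _ hrr (e ▸ hYD))
    have h2 : T' = ∅ := S'.empty_of hT' hl' (S.fc _ _ _ hrr' (e' ▸ hYD))
    rw [h1, iprod_empty, mul_one] at e
    rw [h2, iprod_empty, mul_one] at e'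
    rw [h1, h2, iprod_empty, iprod_empty, map_one, S.hc.one, mul_one, mul_one,
      ← S.hφ _ hx _ hy, ← S.hφ _ hx' _ hy', ← map_mul, ← map_mul, ← e, ← e']
  have hTD : pr (iprod hX T) ∉ D := fun h => hYD (by
    rw [e, map_mul, map_mul]; exact mul_mem (mul_mem hx h) hy)
  have hTD' : pr (iprod hX' T') ∉ D := fun h => hYD (by
    rw [e', map_mul, map_mul]; exact mul_mem (mul_mem hx' h) hy')
  have E0 := e.symm.trans e'
  rw [mul_assoc, mul_assoc] at E0
  have hxx : x = x' := by
    rcases Wd.levi E0 with ⟨f, f1, f2⟩ | ⟨f, f1, f2⟩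
    · have hf : pr f ∈ D := by
        rw [f1, map_mul] at hx'; exact (mul_mem_cancel_left hx).1 hx'
      rcases Wd.levi f2 with ⟨g, g1, g2⟩ | ⟨g, g1, g2⟩
      · exact absurd (S.fc.left (by rw [← g1]; exact (f1 ▸ hrr').left.left.right) (g1 ▸ hf)) hTD
      · rw [f1, S.sys.pre S.fc hT hl g1 hf, mul_one]
    · have hf : pr f ∈ D := by
        rw [f1, map_mul] at hx; exact (mul_mem_cancel_left hx').1 hx
      rcases Wd.levi f2 with ⟨g, g1, g2⟩ | ⟨g, g1, g2⟩
      · exact absurd (S.fc.left (by rw [← g1]; exact (f1 ▸ hrr).left.left.right) (g1 ▸ hf)) hTD'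
      · rw [f1, S'.sys.pre S.fc hT' hl' g1 hf, mul_one]
  subst hxx
  have E1 := mul_left_cancel E0
  have hyy : iprod hX T = iprod hX' T' := by
    rcases Wd.levi E1 with ⟨f, f1, f2⟩ | ⟨f, f1, f2⟩
    · have hf : pr f ∈ D := by
        rw [f2, map_mul] at hy; exact (mul_mem_cancel_right hy').1 hy
      rw [f1, S'.sys.suf S.fc hT' hg' f1 hf, mul_one]
    · have hf : pr f ∈ D := by
        rw [f2, map_mul] at hy'; exact (mul_mem_cancel_right hy).1 hy'
      rw [f1, S.sys.suf S.fc hT hg f1 hf, mul_one]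
  rw [hyy] at E1
  rw [mul_left_cancel E1, S.sys.rigid S.fc S'.sys hT hT' hyy hU hU' hcp]

lemma dual : DExt D E (Q := Qᵒᵈ) (LFin.dual hX) (LFin.dual hU) φ c where
  fc := S.fc
  sys := S.sys.dual
  hφ := S.hφ
  hc := S.hc
  memU T hT := by
    have := S.memU (OrderDual.toDual ⁻¹' T) ⟨fun x hx y hy r hr => hT.out hy hx ⟨hr.2, hr.1⟩⟩
    have := inv_mem this
    rw [← pr_inv, iprod_inv] at this
    exact this
  com q := by rw [pr_inv, pr_inv, S.hφ.inv (S.sys.mem _), S.hc.inv (S.memq _), S.com]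

lemma dval_dual {Y : Wd ι} {k : K} (h : DVal D hX hU φ c Y k) :
    DVal D (LFin.dual hX) (LFin.dual hU) φ c Y⁻¹ k⁻¹ := by
  obtain ⟨x, T, y, hT, e, hx, hy, rfl⟩ := h
  refine ⟨y⁻¹, OrderDual.ofDual ⁻¹' T, x⁻¹, ord_dual hT, ?_, ?_, ?_, ?_⟩
  · rw [e, ← iprod_inv hX]; simp [mul_assoc]
  · rw [pr_inv]; exact inv_mem hy
  · rw [pr_inv]; exact inv_mem hx
  · rw [← iprod_inv hU, pr_inv, pr_inv, pr_inv, S.hφ.inv hx, S.hφ.inv hy, S.hc.inv (S.memU T hT)]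
    group

end DExt

/-- words `x X[T] y` -/
def DP (D : Subgroup (H ι)) {X : Q → Wd ι} (hX : LFin X) : Set (Wd ι) :=
  {Y | Red Y ∧ ∃ x T y, T.OrdConnected ∧ Y = x * iprod hX T * y ∧ pr x ∈ D ∧ pr y ∈ D}

def DPP (D : Subgroup (H ι)) {X : Q → Wd ι} (hX : LFin X) : Set (Wd ι) :=
  {Y | Y ∈ DP D hX ∨ Y⁻¹ ∈ DP D hX}

/-- the elements `X[T]` -/
def DT {X : Q → Wd ι} (hX : LFin X) : Set (H ι) := {g | ∃ T, T.OrdConnected ∧ g = pr (iprod hX T)}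

lemma DP_split {D : Subgroup (H ι)} {X : Q → Wd ι} {hX : LFin X} (hD : FC D) (S : DSys D X hX)
    {Y Z : Wd ι} (h : Y * Z ∈ DP D hX) : Y ∈ DP D hX ∧ Z ∈ DP D hX := by
  have hS : DExt D (⊤ : Subgroup (H ι)) hX hX (fun _ => (1 : Multiplicative ℤ)) (fun _ => 1) :=
    { fc := hD, sys := S, hφ := fun _ _ _ _ => by simp, hc := fun _ _ _ _ => by simp
      memU := fun _ _ => trivial, com := fun _ => rfl }
  obtain ⟨hr, x, T, y, hT, e, hx, hy⟩ := h
  obtain ⟨k1, k2, ⟨x1, T1, y1, a1, a2, a3, a4, -⟩, ⟨x2, T2, y2, b1, b2, b3, b4, -⟩, -⟩ :=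
    hS.split hr ⟨x, T, y, hT, e, hx, hy, rfl⟩
  exact ⟨⟨hr.left, x1, T1, y1, a1, a2, a3, a4⟩, ⟨hr.right, x2, T2, y2, b1, b2, b3, b4⟩⟩

lemma DPP_sys {D : Subgroup (H ι)} {X : Q → Wd ι} {hX : LFin X} (hD : FC D) (S : DSys D X hX) :
    PSys (DPP D hX) where
  one := Or.inl ⟨Red.one, 1, ∅, 1, ordConnected_empty, by simp, by rw [map_one]; exact one_mem _,
    by rw [map_one]; exact one_mem _⟩
  red X hX := by
    rcases hX with h | h
    · exact h.1
    · simpa using h.1.inv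
  fac a b c h := by
    rcases h with h | h
    · exact Or.inl (DP_split hD S (DP_split hD S h).1).2
    · rw [mul_inv_rev, mul_inv_rev] at h
      exact Or.inr (DP_split hD S (DP_split hD S h).2).1
  inv X hX := by
    rcases hX with h | h
    · exact Or.inr (by simpa using h)
    · exact Or.inl h

lemma PD_DPP {D : Subgroup (H ι)} {X : Q → Wd ι} {hX : LFin X} : PD D ⊆ DPP D hX :=
  fun Y hY => Or.inl ⟨hY.1, Y, ∅, 1, ordConnected_empty, by simp, hY.2,
    by rw [map_one]; exact one_mem _⟩

lemma iprod_DPP {D : Subgroup (H ι)} {X : Q → Wd ι} {hX : LFin X} (S : DSys D X hX)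
    {T : Set Q} (hT : T.OrdConnected) : iprod hX T ∈ DPP D hX :=
  Or.inl ⟨S.redT hT, 1, T, 1, hT, by simp, by rw [map_one]; exact one_mem _,
    by rw [map_one]; exact one_mem _⟩

lemma DPP_closure {D : Subgroup (H ι)} {X : Q → Wd ι} {hX : LFin X} (S : DSys D X hX) :
    Subgroup.closure (pr '' DPP D hX) = D ⊔ Subgroup.closure (DT hX) := by
  apply le_antisymm
  · rw [Subgroup.closure_le]
    have key : ∀ Y ∈ DP D hX, pr Y ∈ D ⊔ Subgroup.closure (DT hX) := by
      rintro Y ⟨-, x, T, y, hT, rfl, hx, hy⟩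
      rw [map_mul, map_mul]
      exact mul_mem (mul_mem (Subgroup.mem_sup_left hx)
        (Subgroup.mem_sup_right (Subgroup.subset_closure ⟨T, hT, rfl⟩))) (Subgroup.mem_sup_left hy)
    rintro _ ⟨Y, h | h, rfl⟩
    · exact key Y h
    · have := key _ h
      rw [pr_inv] at this
      exact inv_mem_iff.1 this
  · rw [sup_le_iff]
    constructor
    · nth_rewrite 1 [← closure_PD D]
      exact Subgroup.closure_mono (image_mono PD_DPP)
    · apply Subgroup.closure_mono
      rintro _ ⟨T, hT, rfl⟩
      exact ⟨_, iprod_DPP S hT, rfl⟩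

theorem DExt.ext {D : Subgroup (H ι)} {E : Subgroup (H ι')} {X : Q → Wd ι} {hX : LFin X}
    {U : Q → Wd ι'} {hU : LFin U} {φ : H ι → K} {c : H ι' → K} (S : DExt D E hX hU φ c)
    (h1 : ∀ q r, X q = X r → U q = U r) (h2 : ∀ q r, X q = (X r)⁻¹ → U q = (U r)⁻¹) :
    ∃ f, HomOn (D ⊔ Subgroup.closure (DT hX)) f ∧ (∀ g ∈ D, f g = φ g) ∧
      ∀ T : Set Q, T.OrdConnected → f (pr (iprod hX T)) = c (pr (iprod hU T)) := by
  classical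
  let v : Wd ι → K := fun Y =>
    if h : ∃ k, DVal D hX hU φ c Y k then h.choose else
      if h : ∃ k, DVal D hX hU φ c Y⁻¹ k then h.choose⁻¹ else 1
  have v1 : ∀ Y k, Red Y → DVal D hX hU φ c Y k → v Y = k := by
    intro Y k hr h
    have h' : ∃ k, DVal D hX hU φ c Y k := ⟨k, h⟩
    have e : v Y = h'.choose := by simp only [v, dif_pos h']
    rw [e]
    exact S.unique S h1 hr h'.choose_spec h
  have cross : ∀ Y k k', Red Y → DVal D hX hU φ c Y k → DVal D hX hU φ c Y⁻¹ k' → k' = k⁻¹ := by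
    intro Y k k' hr h h'
    exact S.unique S.dual (fun q r => h2 q _) hr.inv h' (S.dval_dual h)
  have v2 : ∀ Y k, Red Y → DVal D hX hU φ c Y⁻¹ k → v Y = k⁻¹ := by
    intro Y k hr h
    by_cases h' : ∃ k, DVal D hX hU φ c Y k
    · obtain ⟨k', h'⟩ := h'
      rw [v1 Y k' hr h', cross Y k' k hr h' h, inv_inv]
    · have h'' : ∃ k, DVal D hX hU φ c Y⁻¹ k := ⟨k, h⟩
      have e : v Y = h''.choose⁻¹ := by simp only [v, dif_neg h', dif_pos h'']
      rw [e, S.unique S h1 hr.inv h''.choose_spec h]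
  have hval : ∀ Y ∈ DP D hX, ∃ k, DVal D hX hU φ c Y k := by
    rintro Y ⟨-, x, T, y, hT, e, hx, hy⟩
    exact ⟨_, x, T, y, hT, e, hx, hy, rfl⟩
  have hPS := DPP_sys S.fc S.sys
  have hinv : ∀ Y ∈ DPP D hX, v Y⁻¹ = (v Y)⁻¹ := by
    intro Y hY
    have hr := hPS.red Y hY
    rcases hY with h | h
    · obtain ⟨k, hk⟩ := hval _ h
      rw [v1 Y k hr hk, v2 Y⁻¹ k hr.inv (by simpa using hk)]
    · obtain ⟨k, hk⟩ := hval _ h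
      rw [v2 Y k hr hk, v1 Y⁻¹ k hr.inv hk, inv_inv]
  have hmul1 : ∀ Y Z, Y * Z ∈ DP D hX → v (Y * Z) = v Y * v Z := by
    intro Y Z h
    obtain ⟨k, hk⟩ := hval _ h
    obtain ⟨k1, k2, a, b, e⟩ := S.split h.1 hk
    rw [v1 _ k h.1 hk, v1 _ k1 h.1.left a, v1 _ k2 h.1.right b, e]
  have hmul : ∀ Y Z, Y * Z ∈ DPP D hX → v (Y * Z) = v Y * v Z := by
    intro Y Z h
    rcases h with h | h
    · exact hmul1 Y Z h
    · have hm : Y * Z ∈ DPP D hX := Or.inr h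
      rw [mul_inv_rev] at h
      have e := hmul1 _ _ h
      rw [← mul_inv_rev, hinv _ hm, hinv _ (hPS.left hm), hinv _ (hPS.right hm),
        ← mul_inv_rev] at e
      exact inv_injective e
  have hV : VSys (DPP D hX) v := { hPS with vmul := hmul, vinv := hinv }
  obtain ⟨f, hf, hfv⟩ := hV.exists_hom
  rw [DPP_closure S.sys] at hf
  refine ⟨f, hf, ?_, ?_⟩
  · intro g hg
    have hm := nf_mem_PD hg
    have := hfv (nf g) (PD_DPP hm)
    rw [pr_nf] at this
    rw [this]
    apply v1 _ _ hm.1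
    refine ⟨nf g, ∅, 1, ordConnected_empty, by simp, hm.2, by rw [map_one]; exact one_mem _, ?_⟩
    rw [pr_nf, iprod_empty, map_one, map_one, S.hφ.one, S.hc.one]; simp
  · intro T hT
    rw [hfv _ (iprod_DPP S.sys hT)]
    apply v1 _ _ (S.sys.redT hT)
    refine ⟨1, T, 1, hT, by simp, by rw [map_one]; exact one_mem _,
      by rw [map_one]; exact one_mem _, ?_⟩
    rw [map_one, S.hφ.one]; simp

/-- The dense step -/
theorem dense_step {Γ : Subgroup (H ι × H ι')} (hΓ : Good Γ) {X : Q → Wd ι} {U : Q → Wd ι'}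
    {hX : LFin X} {hU : LFin U} (SX : DSys (pfst Γ) X hX) (SU : DSys (psnd Γ) U hU)
    (hm : ∀ q, (pr (X q), pr (U q)) ∈ Γ)
    (h1 : ∀ q r, X q = X r ↔ U q = U r) (h2 : ∀ q r, X q = (X r)⁻¹ ↔ U q = (U r)⁻¹) :
    Good (Γ ⊔ Subgroup.closure
      {g | ∃ T : Set Q, T.OrdConnected ∧ g = (pr (iprod hX T), pr (iprod hU T))}) := by
  set S := {g : H ι × H ι' | ∃ T : Set Q, T.OrdConnected ∧ g = (pr (iprod hX T), pr (iprod hU T))}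
  have e1 : Prod.fst '' S = DT hX := by
    ext g; constructor
    · rintro ⟨_, ⟨T, hT, rfl⟩, rfl⟩; exact ⟨T, hT, rfl⟩
    · rintro ⟨T, hT, rfl⟩; exact ⟨_, ⟨T, hT, rfl⟩, rfl⟩
  have e2 : Prod.snd '' S = DT hU := by
    ext g; constructor
    · rintro ⟨_, ⟨T, hT, rfl⟩, rfl⟩; exact ⟨T, hT, rfl⟩
    · rintro ⟨T, hT, rfl⟩; exact ⟨_, ⟨T, hT, rfl⟩, rfl⟩
  apply good_ext hΓ
  · rw [e1, ← DPP_closure SX]; exact (DPP_sys hΓ.fc1 SX).fc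
  · rw [e2, ← DPP_closure SU]; exact (DPP_sys hΓ.fc2 SU).fc
  · intro K _ φ c a1 a2 a3
    rw [e1]
    rw [e2] at a2
    have hE : DExt (pfst Γ) (psnd Γ ⊔ Subgroup.closure (DT hU)) hX hU φ c :=
      { fc := hΓ.fc1, sys := SX, hφ := a1, hc := a2
        memU := fun T hT => Subgroup.mem_sup_right (Subgroup.subset_closure ⟨T, hT, rfl⟩)
        com := fun q => a3 _ (hm q) }
    obtain ⟨f, f1, f2, f3⟩ := hE.ext (fun q r => (h1 q r).1) (fun q r => (h2 q r).1)
    refine ⟨f, f1, f2, ?_⟩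
    rintro _ ⟨T, hT, rfl⟩
    exact f3 T hT
  · intro K _ φ c a1 a2 a3
    rw [e2]
    rw [e1] at a2
    have hE : DExt (psnd Γ) (pfst Γ ⊔ Subgroup.closure (DT hX)) hU hX φ c :=
      { fc := hΓ.fc2, sys := SU, hφ := a1, hc := a2
        memU := fun T hT => Subgroup.mem_sup_right (Subgroup.subset_closure ⟨T, hT, rfl⟩)
        com := fun q => a3 _ (hm q) }
    obtain ⟨f, f1, f2, f3⟩ := hE.ext (fun q r => (h1 q r).2) (fun q r => (h2 q r).2)
    refine ⟨f, f1, f2, ?_⟩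
    rintro _ ⟨T, hT, rfl⟩
    exact f3 T hT
end
end GrifAux

namespace GrifAux
variable {ι ι' : Type}

/-! ## Regular decomposition -/

/-- closure condition: no factor of `W` is a limit word -/
def CLr (D : Subgroup (H ι)) (W : Wd ι) : Prop :=
  ∀ a Y b, W = a * Y * b → (∀ B T, Y = B * T → T ≠ 1 → pr B ∈ D) → pr Y ∈ D

lemma not_CLr {D : Subgroup (H ι)} {W : Wd ι} (hW : Red W) (h : ¬ CLr D W) :
    ∃ a Y b, W = a * Y * b ∧ LimW D Y := by
  unfold CLr at h
  push Not at h
  obtain ⟨a, Y, b, h1, h2, h3⟩ := h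
  refine ⟨a, Y, b, h1, ?_, h3, h2⟩
  rw [h1] at hW; exact hW.fac

lemma ext_right {D : Subgroup (H ι)} (hD : FC D) {W : Wd ι} (hW : Red W) (hC : CLr D W)
    {A q B : Wd ι} (h : W = A * q * B) (hq : pr q ∈ D) :
    ∃ C B', B = C * B' ∧ pr (q * C) ∈ D ∧ ∀ C2 B2, B = C2 * B2 → pr (q * C2) ∈ D → C2 ∣ C := by
  obtain ⟨C, h1, h2, B', h3⟩ := Wd.exists_sup B {C | C ∣ B ∧ pr (q * C) ∈ D} (fun C hC => hC.1)
    ⟨1, one_dvd _, by simpa using hq⟩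
  refine ⟨C, B', h3, ?_, fun C2 B2 e hm => h1 C2 ⟨⟨B2, e⟩, hm⟩⟩
  apply hC A (q * C) B' (by rw [h, h3]; simp [mul_assoc])
  intro Z T hZ hT
  obtain ⟨n, hn⟩ := Wd.exists_s_ne hT
  obtain ⟨C0, ⟨hC0, hC0D⟩, e⟩ := h2 n
  have hC0C := h1 C0 ⟨hC0, hC0D⟩
  rcases Wd.dvd_total (a := Z) (b := q * C0) (c := q * C) ⟨T, hZ⟩ (mul_dvd_mul_left q hC0C) with
    ⟨f, hf⟩ | ⟨f, hf⟩
  · have hr : Red (q * C0) := by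
      obtain ⟨B0, hB0⟩ := hC0
      rw [h, hB0, mul_assoc, ← mul_assoc q, ← mul_assoc] at hW
      exact hW.fac
    rw [hf] at hr hC0D
    exact hD.left hr hC0D
  · exfalso
    have e1 := congrArg (fun w => (w.s n).length) hZ
    have e2 := congrArg (fun w => (w.s n).length) hf
    simp only [Wd.s_mul, List.length_append] at e1 e2
    rw [e] at e1
    have := List.length_pos_iff.2 hn
    omega

/-- maximal `D`-factors -/
def Piece (D : Subgroup (H ι)) (W A q : Wd ι) : Prop :=
  q ≠ 1 ∧ pr q ∈ D ∧ (∃ B, W = A * q * B) ∧ ∀ A' q' B', W = A' * q' * B' → A' ∣ A → A * q ∣ A' * q' →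
    pr q' ∈ D → A' = A ∧ q' = q

lemma exists_piece {D : Subgroup (H ι)} (hD : FC D) {W : Wd ι} (hW : Red W) (hC : CLr D W)
    (hC' : CLr D W⁻¹) {A q B : Wd ι} (h : W = A * q * B) (hq : pr q ∈ D) (hq1 : q ≠ 1) :
    ∃ A' q', Piece D W A' q' ∧ A' ∣ A ∧ A * q ∣ A' * q' := by
  obtain ⟨C, B', rfl, h2, h3⟩ := ext_right hD hW hC h hq
  have hi : W⁻¹ = B'⁻¹ * (q * C)⁻¹ * A⁻¹ := by rw [h]; simp [mul_assoc]
  obtain ⟨G', A', e1, e2, e3⟩ := ext_right hD hW.inv hC' hi (by rw [pr_inv]; exact inv_mem h2)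
  have e4 : A = A'⁻¹ * G'⁻¹ := by rw [← inv_inv A, e1, mul_inv_rev]
  have e5 : W = A'⁻¹ * (G'⁻¹ * q * C) * B' := by rw [h, e4]; simp [mul_assoc]
  refine ⟨A'⁻¹, G'⁻¹ * q * C, ⟨?_, ?_, ⟨B', e5⟩, ?_⟩, ⟨G'⁻¹, e4⟩, ⟨C, by
    have : A * q * C = A'⁻¹ * G'⁻¹ * q * C := congrArg (fun z => z * q * C) e4
    rw [this]; simp only [mul_assoc]⟩⟩
  · intro h; exact hq1 (Wd.mul_eq_one (Wd.mul_eq_one h).1).2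
  · rw [← inv_mem_iff, ← pr_inv]
    simpa [mul_assoc] using e2
  · rintro A2 q2 B2 f1 ⟨a, f2⟩ ⟨b, f3⟩ hm
    have f4 : q2 = a * (G'⁻¹ * q * C) * b := by
      rw [f2] at f3
      simp only [mul_assoc] at f3 ⊢
      exact mul_left_cancel f3
    have hr : Red q2 := by rw [f1] at hW; exact hW.fac
    rw [f4] at hr hm
    have f5 : B' = b * B2 := by
      rw [e5, f2, f4] at f1
      simp only [mul_assoc] at f1
      exact mul_left_cancel (mul_left_cancel (mul_left_cancel (mul_left_cancel
        (mul_left_cancel f1))))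
    have hb : b = 1 := by
      have := h3 (C * b) B2 (by rw [f5, mul_assoc]) (by
        have : a * (G'⁻¹ * q * C) * b = (a * G'⁻¹) * (q * (C * b)) := by simp [mul_assoc]
        rw [this] at hr hm
        exact hD.right hr hm)
      obtain ⟨c, hc⟩ := this
      rw [mul_assoc] at hc
      exact (Wd.mul_eq_one (left_eq_mul.1 hc)).1
    have ha : a = 1 := by
      have := e3 (G' * a⁻¹) A2⁻¹ (by rw [e4, f2]; simp [mul_assoc]) (by
        rw [← inv_mem_iff, ← pr_inv]
        rw [hb, mul_one] at hm
        simpa [mul_assoc] using hm)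
      obtain ⟨c, hc⟩ := this
      rw [mul_assoc] at hc
      exact inv_eq_one.1 (Wd.mul_eq_one (left_eq_mul.1 hc)).1
    rw [f2, f4, ha, hb]; simp

lemma Piece.disj {D : Subgroup (H ι)} (hD : FC D) {W : Wd ι} (hW : Red W) {A1 q1 A2 q2 : Wd ι}
    (h1 : Piece D W A1 q1) (h2 : Piece D W A2 q2) (h : A1 ∣ A2) :
    (A1 = A2 ∧ q1 = q2) ∨ A1 * q1 ∣ A2 := by
  obtain ⟨n1, m1, ⟨B1, b1⟩, x1⟩ := h1
  obtain ⟨n2, m2, ⟨B2, b2⟩, x2⟩ := h2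
  rcases Wd.dvd_total (a := A1 * q1) (b := A2) (c := W) ⟨B1, b1⟩ ⟨q2 * B2, by rw [b2, mul_assoc]⟩
    with h3 | h3
  · exact Or.inr h3
  left
  rcases Wd.dvd_total (a := A1 * q1) (b := A2 * q2) (c := W) ⟨B1, b1⟩ ⟨B2, b2⟩ with h4 | h4
  · obtain ⟨e, rfl⟩ := h
    obtain ⟨d, hd⟩ := h3
    rw [mul_assoc] at hd
    have hd := mul_left_cancel hd
    obtain ⟨f, hf⟩ := h4
    rw [mul_assoc, mul_assoc, hd, mul_assoc] at hf
    have hf := mul_left_cancel (mul_left_cancel hf)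
    have hr : Red q2 := by rw [b2] at hW; exact hW.fac
    have hfD : pr f ∈ D := by rw [hf] at hr m2; exact hD.right hr m2
    have hm : pr (q1 * f) ∈ D := by rw [map_mul]; exact mul_mem m1 hfD
    have hWq : W = A1 * (q1 * f) * B2 := by rw [b2, hf, hd]; simp [mul_assoc]
    have y1 := x1 A1 (q1 * f) B2 hWq dvd_rfl ⟨f, by simp [mul_assoc]⟩ hm
    have y2 := x2 A1 (q1 * f) B2 hWq ⟨e, rfl⟩ ⟨1, by rw [hf, hd]; simp [mul_assoc]⟩ hm
    exact ⟨y2.1, y1.2.symm.trans y2.2⟩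
  · exact x2 A1 q1 B1 b1 h h4 m1

def PT (D : Subgroup (H ι)) (W : Wd ι) : Type := {p : Wd ι × Wd ι // Piece D W p.1 p.2}

open scoped Classical in
/-- order on pieces -/
@[reducible] def ptOrder {D : Subgroup (H ι)} (hD : FC D) {W : Wd ι} (hW : Red W) :
    LinearOrder (PT D W) where
  le p q := p.1.1 ∣ q.1.1
  le_refl p := dvd_rfl
  le_trans p q r := dvd_trans
  le_antisymm p q h h' := by
    have e := Wd.dvd_antisymm' h h'
    apply Subtype.ext
    rcases p.2.disj hD hW q.2 h with h1 | h1
    · exact Prod.ext h1.1 h1.2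
    · exfalso
      rw [← e] at h1
      obtain ⟨f, hf⟩ := h1
      rw [mul_assoc] at hf
      exact p.2.1 (Wd.mul_eq_one (left_eq_mul.1 hf)).1
  le_total p q := by
    obtain ⟨-, -, ⟨B, hB⟩, -⟩ := p.2
    obtain ⟨-, -, ⟨B', hB'⟩, -⟩ := q.2
    exact Wd.dvd_total (c := W) ⟨p.1.2 * B, hB.trans (mul_assoc _ _ _)⟩
      ⟨q.1.2 * B', hB'.trans (mul_assoc _ _ _)⟩
  toDecidableLE := Classical.decRel _

theorem regular {D : Subgroup (H ι)} (hD : FC D) (hpure : ∀ p, PureH p → p ∈ D) {W : Wd ι}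
    (hW : Red W) (hC : CLr D W) (hC' : CLr D W⁻¹) :
    ∃ (Q : Type) (_ : LinearOrder Q) (X : Q → Wd ι) (hX : LFin X), DSys D X hX ∧
      W = iprod hX univ := by
  let this := ptOrder hD hW
  let X : PT D W → Wd ι := fun p => p.1.2
  have hle : ∀ p q : PT D W, p ≤ q ↔ p.1.1 ∣ q.1.1 := fun p q => Iff.rfl
  have hlt : ∀ p q : PT D W, p < q → p.1.1 * p.1.2 ∣ q.1.1 := by
    intro p q h
    rcases p.2.disj hD hW q.2 h.le with h1 | h1
    · exact absurd (Subtype.ext (Prod.ext h1.1 h1.2)) h.ne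
    · exact h1
  have hX : LFin X := by
    intro m
    apply Set.Finite.of_finite_image (f := fun p : PT D W => (p.1.1.s m).length)
    · apply (finite_Iic (W.s m).length).subset
      rintro _ ⟨p, -, rfl⟩
      obtain ⟨-, -, ⟨B, hB⟩, -⟩ := p.2
      show (p.1.1.s m).length ≤ _
      have h0 := congrArg (fun w => (w.s m).length) hB
      simp only [Wd.s_mul, List.length_append] at h0; omega
    · have key : ∀ p q : PT D W, (X p).s m ≠ [] → p < q →
          (p.1.1.s m).length < (q.1.1.s m).length := by
        intro p q hp h
        obtain ⟨e, he⟩ := hlt p q h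
        rw [he]; simp only [Wd.s_mul, List.length_append]
        have := List.length_pos_iff.2 hp
        simp only [X] at this
        omega
      intro p hp q hq he
      simp only at he
      rcases lt_trichotomy p q with h | h | h
      · have := key p q hp h; omega
      · exact h
      · have := key q p hq h; omega
  -- every letter lies in a piece
  have hlet : ∀ m, ∀ A G B : Wd ι, W = A * G * B → G.s m ≠ [] → ∃ p : PT D W, ∃ A1 x G1,
      G = A1 * Wd.of x * G1 ∧ x.1.2 < m ∧ p.1.1 ∣ A * A1 ∧ A * A1 * Wd.of x ∣ p.1.1 * p.1.2 := by
    intro m A G B h hG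
    obtain ⟨x, L, hL⟩ := List.exists_cons_of_ne_nil hG
    obtain ⟨A1, G1, e, -, -⟩ := Wd.letter_split (W := G) (L1 := []) hL
    have hx : x.1.2 < m := by
      have : x ∈ cut m (G.s m) := by rw [Wd.cut_self, hL]; simp
      exact (mem_cut.1 this).2
    obtain ⟨A', q', hp, h1, h2⟩ := exists_piece hD hW hC hC' (A := A * A1) (q := Wd.of x) (B := G1 * B)
      (by rw [h, e]; simp [mul_assoc]) (hpure _ ⟨Wd.of x, ⟨x.1.1, by
        intro n y hy
        simp only [Wd.of] at hy
        split_ifs at hy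
        · rw [List.mem_singleton.1 hy]
        · simp at hy⟩, rfl⟩) (Wd.of_ne_one x)
    exact ⟨⟨(A', q'), hp⟩, A1, x, G1, e, hx, h1, h2⟩
  have hmain : ∀ (m : ℕ) (l : List (PT D W)) (A R : Wd ι), W = A * R →
      (∀ p : PT D W, p.1.1 * p.1.2 ∣ A ∨ A ∣ p.1.1) → l.Pairwise (· < ·) → (∀ p ∈ l, A ∣ p.1.1) →
      (∀ p : PT D W, A ∣ p.1.1 → (X p).s m ≠ [] → p ∈ l) →
      R.s m = l.flatMap (fun p => (X p).s m) := by
    intro m l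
    -- a letter after A lies in a piece after A
    have hlet2 : ∀ A G B : Wd ι, W = A * G * B →
      (∀ p : PT D W, p.1.1 * p.1.2 ∣ A ∨ A ∣ p.1.1) → G.s m ≠ [] → ∃ p : PT D W, A ∣ p.1.1 ∧
        (X p).s m ≠ [] ∧ ∃ A1 x G1, G = A1 * Wd.of x * G1 ∧ p.1.1 ∣ A * A1 := by
      intro A G B h hn hG
      obtain ⟨p, A1, x, G1, e, hx, h1, h2⟩ := hlet m A G B h hG
      refine ⟨p, ?_, ?_, A1, x, G1, e, h1⟩
      · rcases hn p with h3 | h3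
        · exfalso
          obtain ⟨u, hu⟩ := h2.trans h3
          rw [mul_assoc, mul_assoc] at hu
          exact Wd.of_ne_one x (Wd.mul_eq_one (Wd.mul_eq_one (left_eq_mul.1 hu)).2).1
        · exact h3
      · obtain ⟨a, ha⟩ := h1
        obtain ⟨b, hb⟩ := h2
        rw [ha, mul_assoc, mul_assoc] at hb
        have hb := mul_left_cancel hb
        show p.1.2.s m ≠ []
        rw [hb]
        simp [Wd.of_s_pos hx]
    induction l with
    | nil =>
      intro A R h hn _ _ h3
      by_contra hR
      obtain ⟨p, hp1, hp2, -⟩ := hlet2 A R 1 (by simpa using h) hn hR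
      simpa using h3 p hp1 hp2
    | cons q l ih =>
      intro A R h hn hpw h2 h3
      obtain ⟨G, hG⟩ := h2 q (by simp)
      obtain ⟨-, -, ⟨B, hB⟩, -⟩ := q.2
      have hR : R = G * q.1.2 * B := by
        have h7 := hB.symm.trans h
        rw [hG, mul_assoc, mul_assoc] at h7
        rw [← mul_left_cancel h7, mul_assoc]
      rw [List.pairwise_cons] at hpw
      have hGm : G.s m = [] := by
        by_contra hGm
        obtain ⟨p, hp1, hp2, A1, x, G1, e, h4⟩ := hlet2 A G (q.1.2 * B) 
          (by rw [← hG, ← mul_assoc]; exact hB) hn hGm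
        have hqp : q ≤ p := by
          rcases List.mem_cons.1 (h3 p hp1 hp2) with h5 | h5
          · exact h5.symm.le
          · exact (hpw.1 p h5).le
        obtain ⟨u, hu⟩ := ((hle q p).1 hqp).trans h4
        rw [hG, e, mul_assoc] at hu
        have hu := mul_left_cancel hu
        rw [mul_assoc, mul_assoc] at hu
        exact Wd.of_ne_one x (Wd.mul_eq_one (left_eq_mul.1 hu)).1
      rw [List.flatMap_cons, ← ih (q.1.1 * q.1.2) B hB]
      · rw [hR]; simp [X, hGm]
      · intro p
        rcases le_or_gt p q with h5 | h5
        · left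
          rcases h5.eq_or_lt with h6 | h6
          · rw [h6]
          · exact (hlt p q h6).trans ⟨_, rfl⟩
        · right; exact hlt q p h5
      · exact hpw.2
      · intro p hp; exact hlt q p (hpw.1 p hp)
      · intro p hp hpm
        have hqp : q ≤ p := (hle q p).2 ((Dvd.intro _ rfl).trans hp)
        rcases List.mem_cons.1 (h3 p ((hG ▸ Dvd.intro _ rfl : A ∣ q.1.1).trans ((hle q p).1 hqp)) hpm)
          with h5 | h5
        · exfalso
          rw [h5] at hp
          obtain ⟨u, hu⟩ := hp
          rw [mul_assoc] at hu
          exact q.2.1 (Wd.mul_eq_one (left_eq_mul.1 hu)).1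
        · exact h5
  have hfinal : ∀ A R : Wd ι, W = A * R → (∀ p : PT D W, p.1.1 * p.1.2 ∣ A ∨ A ∣ p.1.1) →
      R = iprod hX {p | A ∣ p.1.1} := by
    intro A R h hn
    apply Wd.ext; funext m
    rw [iprod_s']
    exact hmain m _ A R h hn (slist_pw _ _ _) (fun p hp => ((mem_slist hX).1 hp).1)
      (fun p h1 h2 => (mem_slist hX).2 ⟨h1, h2⟩)
  have hWW : W = iprod hX univ := by
    refine (hfinal 1 W (by simp) (fun p => Or.inr (one_dvd _))).trans ?_
    congr 1
    ext p; simp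
  refine ⟨PT D W, this, X, hX, ⟨?_, ?_, ?_, ?_⟩, hWW⟩
  · rw [← hWW]; exact hW
  · exact fun q => q.2.2.1
  · exact fun q => q.2.1
  · intro q r hqr hm
    have hq := q.2
    obtain ⟨-, -, ⟨B, hB⟩, hmax⟩ := hq
    have e1 : q.1.2 * B = iprod hX (Ici q) := by
      rw [hfinal q.1.1 (q.1.2 * B) (hB.trans (mul_assoc _ _ _))]
      · rfl
      · intro p
        rcases lt_or_ge p q with h5 | h5
        · exact Or.inl (hlt p q h5)
        · exact Or.inr h5
    have e2 : Ici q = Icc q r ∪ Ioi r := by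
      rw [Icc_union_Ioi_eq_Ici hqr.le]
    have e3 : Icc q r = {q} ∪ Ioc q r := by
      rw [← Icc_self q, Icc_union_Ioc_eq_Icc le_rfl hqr.le]
    have e4 : iprod hX (Icc q r) = q.1.2 * iprod hX (Ioc q r) := by
      rw [e3, iprod_union hX, iprod_singleton]
      intro s hs t ht; rw [mem_singleton_iff.1 hs]; exact ht.1
    have e5 := hmax q.1.1 (iprod hX (Icc q r)) (iprod hX (Ioi r)) (by
        refine hB.trans ?_
        rw [mul_assoc, e1, e2, iprod_union hX, mul_assoc]
        intro s hs t ht; exact hs.2.trans_lt ht) dvd_rfl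
        ⟨iprod hX (Ioc q r), by rw [e4, mul_assoc]⟩ hm
    rw [e4] at e5
    have := e5.2
    exact iprod_ne_one hX (show r ∈ Ioc q r from ⟨hqr, le_rfl⟩) r.2.1 (mul_eq_left.1 this)
end GrifAux

namespace GrifAux
variable {ι ι' : Type}

/-! ## Tameness -/

/-- `V` has no factor in `S ∪ S⁻¹` -/
def Av (S : Set (Wd ι)) (V : Wd ι) : Prop := ∀ a s b, s ∈ S → V ≠ a * s * b ∧ V⁻¹ ≠ a * s * b

lemma Av.fac {S : Set (Wd ι)} {V a z b : Wd ι} (h : Av S V) (e : V = a * z * b) : Av S z := by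
  intro p s q hs
  constructor
  · rintro rfl
    exact (h (a * p) s (q * b) hs).1 (by rw [e]; simp only [mul_assoc])
  · intro hz
    refine (h (b⁻¹ * p) s (q * a⁻¹) hs).2 ?_
    rw [e, mul_inv_rev, mul_inv_rev, hz]; simp only [mul_assoc]

lemma Av.inv {S : Set (Wd ι)} {V : Wd ι} (h : Av S V) : Av S V⁻¹ := by
  intro p s q hs
  rw [inv_inv]
  exact ⟨(h p s q hs).2, (h p s q hs).1⟩

lemma Av.mono {S S' : Set (Wd ι)} {V : Wd ι} (h : Av S V) (hS : S' ⊆ S) : Av S' V :=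
  fun a s b hs => h a s b (hS hs)

def Tame (S : Set (Wd ι)) (V : Wd ι) : Prop := ∃ l : List (Wd ι), V = l.prod ∧ ∀ z ∈ l, Av S z

lemma Av.tame {S : Set (Wd ι)} {V : Wd ι} (h : Av S V) : Tame S V := ⟨[V], by simp, by simpa using h⟩

lemma Tame.mul {S : Set (Wd ι)} {V V' : Wd ι} (h : Tame S V) (h' : Tame S V') : Tame S (V * V') := by
  obtain ⟨l, rfl, hl⟩ := h
  obtain ⟨l', rfl, hl'⟩ := h'
  refine ⟨l ++ l', by simp, fun z hz => ?_⟩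
  rcases List.mem_append.1 hz with h | h
  exacts [hl z h, hl' z h]

lemma Tame.list {S : Set (Wd ι)} {l : List (Wd ι)} (h : ∀ z ∈ l, Tame S z) : Tame S l.prod := by
  induction l with
  | nil => exact ⟨[], by simp, by simp⟩
  | cons x l ih =>
    rw [List.prod_cons]
    exact (h x (by simp)).mul (ih fun z hz => h z (by simp [hz]))

lemma Tame.inv {S : Set (Wd ι)} {V : Wd ι} (h : Tame S V) : Tame S V⁻¹ := by
  obtain ⟨l, rfl, hl⟩ := h
  induction l with
  | nil => exact ⟨[], by simp, by simp⟩
  | cons x l ih =>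
    rw [List.prod_cons, mul_inv_rev]
    exact (ih fun z hz => hl z (by simp [hz])).mul (hl x (by simp)).inv.tame

lemma Tame.mono {S S' : Set (Wd ι)} {V : Wd ι} (h : Tame S V) (hS : S' ⊆ S) : Tame S' V := by
  obtain ⟨l, e, hl⟩ := h
  exact ⟨l, e, fun z hz => (hl z hz).mono hS⟩

/-- `V` has at least `n` disjoint factors in `S ∪ S⁻¹` -/
def Many (S : Set (Wd ι)) : ℕ → Wd ι → Prop
  | 0, _ => True
  | n + 1, V => ∃ a s b, (s ∈ S ∨ s⁻¹ ∈ S) ∧ V = a * s * b ∧ Many S n b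

lemma Many.left {S : Set (Wd ι)} {n : ℕ} {V : Wd ι} (e : Wd ι) (h : Many S n V) : Many S n (e * V) := by
  cases n with
  | zero => trivial
  | succ n =>
    obtain ⟨a, s, b, hs, rfl, hb⟩ := h
    exact ⟨e * a, s, b, hs, by simp only [mul_assoc], hb⟩

lemma Many.of_av {S : Set (Wd ι)} {n : ℕ} {z V : Wd ι} (hz : Av S z) (h : Many S (n+1) (z * V)) :
    Many S n V := by
  obtain ⟨a, s, b, hs, e, hb⟩ := h
  rcases Wd.levi e.symm with ⟨f, h1, h2⟩ | ⟨f, h1, h2⟩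
  · exfalso
    rcases hs with hs | hs
    · exact (hz a s f hs).1 h1
    · exact (hz f⁻¹ s⁻¹ a⁻¹ hs).2 (by rw [h1]; simp [mul_assoc])
  · rw [h2]; exact hb.left f

lemma Tame.not_many {S : Set (Wd ι)} {V : Wd ι} (h1 : (1 : Wd ι) ∉ S) (h : Tame S V) :
    ∃ n, ¬ Many S n V := by
  obtain ⟨l, rfl, hl⟩ := h
  refine ⟨l.length + 1, ?_⟩
  induction l with
  | nil =>
    rintro ⟨a, s, b, hs, e, -⟩
    have := (Wd.mul_eq_one (Wd.mul_eq_one e.symm).1).2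
    subst this
    simp [h1] at hs
  | cons x l ih =>
    intro h
    rw [List.prod_cons] at h
    exact ih (fun z hz => hl z (by simp [hz])) (h.of_av (hl x (by simp)))

/-- all elements of `D` are tame -/
def TG (S : Set (Wd ι)) (D : Subgroup (H ι)) : Prop := ∀ X ∈ PD D, Tame S X

lemma TG.closure {S P : Set (Wd ι)} (hP : PSys P) (h : ∀ X ∈ P, Tame S X) :
    TG S (Subgroup.closure (pr '' P)) := by
  intro X hX
  obtain ⟨l, hl, e⟩ := hP.exists_list hX.2
  rw [nf_pr hX.1] at e
  rw [← e]
  exact Tame.list fun z hz => h z (hl z hz)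

lemma TG.omega {S : Set (Wd ι)} {D : Subgroup (H ι)} (hD : FC D) {A : Wd ι} (hA : LimW D A)
    (h : TG S D) (hS : Av S A) : TG S (D ⊔ Subgroup.closure {pr A}) := by
  rw [← hA.closure_eq hD]
  apply TG.closure ((PD_sys hD).union (FacPM_sys hA.1))
  rintro X (hX | ⟨a, b, e⟩ | ⟨a, b, e⟩)
  · exact h X hX
  · exact (hS.fac e).tame
  · have := (hS.fac e).inv.tame
    simpa using this

lemma TG.dense {S : Set (Wd ι)} {D : Subgroup (H ι)} (hD : FC D) {Q : Type} [LinearOrder Q]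
    {X : Q → Wd ι} {hX : LFin X} (SX : DSys D X hX) (h : TG S D) (hS : Av S (iprod hX univ)) :
    TG S (D ⊔ Subgroup.closure (DT hX)) := by
  rw [← DPP_closure SX]
  apply TG.closure (DPP_sys hD SX)
  have key : ∀ Y ∈ DP D hX, Tame S Y := by
    rintro Y ⟨hr, x, T, y, hT, rfl, hx, hy⟩
    obtain ⟨a, b, e⟩ := iprod_fac hX hT (subset_univ T)
    exact ((h x ⟨hr.left.left, hx⟩).mul (hS.fac e).tame).mul (h y ⟨hr.right, hy⟩)
  rintro Y (hY | hY)
  · exact key Y hY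
  · have := (key _ hY).inv
    simpa using this

/-! ## Positive words -/

def PosW (W : Wd ι) : Prop := ∀ m, ∀ x ∈ W.s m, x.2 = true

lemma mk_pos (l : List (Lt ι)) (h : ∀ x ∈ l, x.2 = true) :
    FreeGroup.lift (fun _ => Multiplicative.ofAdd (1 : ℤ)) (FreeGroup.mk l : FG ι) =
      Multiplicative.ofAdd (l.length : ℤ) := by
  rw [FreeGroup.lift_mk]
  induction l with
  | nil => simp
  | cons x l ih =>
    simp only [List.map_cons, List.prod_cons, h x (by simp), cond_true]
    rw [ih fun y hy => h y (by simp [hy]), ← ofAdd_add]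
    congr 1
    simp only [List.length_cons]; push_cast; ring

lemma PosW.red {W : Wd ι} (h : PosW W) : Red W := by
  rintro a b c rfl hb
  apply Wd.eq_one_of_s
  intro n
  have h1 : (FreeGroup.mk (b.s n) : FG ι) = 1 := pr_eq_one.1 hb n
  have h2 := mk_pos (b.s n) (fun x hx => h n x (by simp [hx]))
  rw [h1, map_one] at h2
  have h3 : ((b.s n).length : ℤ) = 0 := (ofAdd_eq_one.1 h2.symm)
  exact List.length_eq_zero_iff.1 (by exact_mod_cast h3)

/-! ## Single letters -/

lemma Wd.of_eq_mul {x : Lt ι} {e f : Wd ι} (h : Wd.of x = e * f) : e = 1 ∨ f = 1 := by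
  have hn : ∀ n, x.1.2 + 1 ≤ n → e.s n ++ f.s n = [x] := by
    intro n hn
    rw [← Wd.s_mul, ← h, Wd.of_s_pos (by omega)]
  by_cases he : e.s (x.1.2 + 1) = []
  · left
    have hf : f.s (x.1.2 + 1) ≠ [] := by
      intro hf
      have := hn _ le_rfl
      rw [he, hf] at this; simp at this
    apply Wd.ext_ge (x.1.2 + 1)
    intro n h1
    have h2 := Wd.s_ne_mono h1 hf
    have h3 := congrArg List.length (hn n h1)
    have h4 := List.length_pos_iff.2 h2
    simp only [List.length_append, List.length_singleton] at h3
    rw [Wd.s_one]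
    exact List.length_eq_zero_iff.1 (by omega)
  · right
    apply Wd.ext_ge (x.1.2 + 1)
    intro n h1
    have h2 := Wd.s_ne_mono h1 he
    have h3 := congrArg List.length (hn n h1)
    have h4 := List.length_pos_iff.2 h2
    simp only [List.length_append, List.length_singleton] at h3
    rw [Wd.s_one]
    exact List.length_eq_zero_iff.1 (by omega)

lemma Wd.of_self_mem (x : Lt ι) : x ∈ (Wd.of x).s (x.1.2+1) := by
  rw [Wd.of_s_pos (by omega)]; simp

lemma of_first {x : Lt ι} {p p' R R' : Wd ι} (h : p * (Wd.of x * R) = p' * (Wd.of x * R'))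
    (hp : x ∉ p.s (x.1.2+1)) (hp' : x ∉ p'.s (x.1.2+1)) : p = p' ∧ R = R' := by
  have key : ∀ e R R' : Wd ι, x ∉ e.s (x.1.2+1) → Wd.of x * R = e * (Wd.of x * R') → e = 1 := by
    intro e R R' he h
    rcases Wd.levi h with ⟨f, h1, -⟩ | ⟨f, h1, -⟩
    · exfalso; apply he; rw [h1]; simp [Wd.of_self_mem]
    · rcases Wd.of_eq_mul h1 with h2 | h2
      · exact h2
      · exfalso; apply he; rw [h2, mul_one] at h1; rw [← h1]; exact Wd.of_self_mem x
  have : p = p' := by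
    rcases Wd.levi h with ⟨e, h1, h2⟩ | ⟨e, h1, h2⟩
    · rw [h1, key e R R' (fun he => hp' (by rw [h1]; simp [he])) h2, mul_one]
    · rw [h1, key e R' R (fun he => hp (by rw [h1]; simp [he])) h2, mul_one]
  subst this
  exact ⟨rfl, mul_left_cancel (mul_left_cancel h)⟩

/-! ## Markers -/

/-- the pure part of a marker -/
def PWf (a : ι) (n : ℕ) (c : ℕ → ℕ) : Wd ι :=
  ⟨fun m => (List.range m).flatMap (fun j => if n ≤ j then List.replicate (1 + c (j - n)) ((a, j), true)
    else []), fun m k h => by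
    induction k, h using Nat.le_induction with
    | base =>
      apply List.filter_eq_self.2
      intro x hx
      obtain ⟨j, hj, hx⟩ := List.mem_flatMap.1 hx
      split_ifs at hx with h1
      · rw [List.eq_of_mem_replicate hx]; simpa using hj
      · simp at hx
    | succ k hk ih =>
      rw [List.range_succ, List.flatMap_append, cut_append, ih]
      convert List.append_nil _
      apply List.filter_eq_nil_iff.2
      intro x hx
      simp only [List.flatMap_cons, List.flatMap_nil, List.append_nil] at hx
      split_ifs at hx with h1
      · rw [List.eq_of_mem_replicate hx]; simpa using hk
      · simp at hx⟩

lemma PWf_mem {a : ι} {n : ℕ} {c : ℕ → ℕ} {m : ℕ} {x : Lt ι} (h : x ∈ (PWf a n c).s m) :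
    ∃ j, n ≤ j ∧ x = ((a, j), true) := by
  obtain ⟨j, hj, hx⟩ := List.mem_flatMap.1 h
  split_ifs at hx with h1
  · exact ⟨j, h1, List.eq_of_mem_replicate hx⟩
  · simp at hx

lemma PWf_inj {a : ι} {n : ℕ} {c c' : ℕ → ℕ} (h : PWf a n c = PWf a n c') : c = c' := by
  funext i
  have key : ∀ c : ℕ → ℕ, ((PWf a n c).s (n+i+1)).length = ((PWf a n c).s (n+i)).length + (1 + c i) := by
    intro c
    simp [PWf, List.range_succ]
  have h1 := key c
  rw [h, key c'] at h1
  omega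

/-- markers -/
def Ymk (a b : ι) (n : ℕ) (c : ℕ → ℕ) : Wd ι :=
  Wd.of ((b, n), true) * (PWf a n c * Wd.of ((b, n), true))

lemma Ymk_mem {a b : ι} {n : ℕ} {c : ℕ → ℕ} {m : ℕ} {x : Lt ι} (h : x ∈ (Ymk a b n c).s m) :
    x = ((b, n), true) ∨ ∃ j, n ≤ j ∧ x = ((a, j), true) := by
  simp only [Ymk, Wd.s_mul, List.mem_append] at h
  have h0 : ∀ y : Lt ι, x ∈ (Wd.of y).s m → x = y := by
    intro y hy
    simp only [Wd.of] at hy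
    split_ifs at hy
    · simpa using hy
    · simp at hy
  rcases h with h | h | h
  · exact Or.inl (h0 _ h)
  · exact Or.inr (PWf_mem h)
  · exact Or.inl (h0 _ h)

lemma Ymk_pos (a b : ι) (n : ℕ) (c : ℕ → ℕ) : PosW (Ymk a b n c) := by
  intro m x hx
  rcases Ymk_mem hx with rfl | ⟨j, -, rfl⟩ <;> rfl

lemma Ymk_ne_one (a b : ι) (n : ℕ) (c : ℕ → ℕ) : Ymk a b n c ≠ 1 :=
  fun h => Wd.of_ne_one _ (Wd.mul_eq_one h).1

lemma mem_level {W : Wd ι} {m : ℕ} {x : Lt ι} (h : x ∈ W.s m) : x.1.2 < m := by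
  rw [← Wd.cut_self] at h; exact (mem_cut.1 h).2

lemma Ymk_low {a b : ι} {n m : ℕ} {c : ℕ → ℕ} (h : m ≤ n) : (Ymk a b n c).s m = [] := by
  rw [List.eq_nil_iff_forall_not_mem]
  intro x hx
  have := mem_level hx
  rcases Ymk_mem hx with rfl | ⟨j, hj, rfl⟩
  · simp only at this; omega
  · simp only at this; omega

lemma Ymk_lfin (a b : ι) (f : ℕ → ℕ → ℕ) : LFin (fun n => Ymk a b n (f n)) := by
  intro m
  apply (finite_Iio m).subset
  intro n hn
  by_contra h
  exact hn (Ymk_low (by simpa using h))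

lemma pureW_of (x : Lt ι) : PureW (Wd.of x) := ⟨x.1.1, fun n y hy => by
  simp only [Wd.of] at hy
  split_ifs at hy
  · rw [List.mem_singleton.1 hy]
  · simp at hy⟩

lemma PWf_pure (a : ι) (n : ℕ) (c : ℕ → ℕ) : PureW (PWf a n c) := ⟨a, fun m x hx => by
  obtain ⟨j, -, rfl⟩ := PWf_mem hx; rfl⟩

lemma pr_Ymk_mem {D : Subgroup (H ι)} (hp : ∀ p, PureH p → p ∈ D) (a b : ι) (n : ℕ) (c : ℕ → ℕ) :
    pr (Ymk a b n c) ∈ D := by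
  rw [Ymk, map_mul, map_mul]
  exact mul_mem (hp _ ⟨_, pureW_of _, rfl⟩) (mul_mem (hp _ ⟨_, PWf_pure _ _ _, rfl⟩)
    (hp _ ⟨_, pureW_of _, rfl⟩))

lemma not_pure_Ymk {a b : ι} (hab : a ≠ b) (n : ℕ) (c : ℕ → ℕ) : ¬ PureW (Ymk a b n c) := by
  rintro ⟨α, h⟩
  have h1 := h (n+1) ((b, n), true) (by simp [Ymk, Wd.of])
  have h2 := h (n+1) ((a, n), true) (by simp [Ymk, PWf, Wd.of])
  exact hab (h2.trans h1.symm)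

lemma iprod_nat (X : ℕ → Wd ι) (hX : LFin X) (n : ℕ) :
    iprod hX univ = iprod hX (Iio n) * (X n * iprod hX (Ioi n)) := by
  have : (univ : Set ℕ) = Iio n ∪ ({n} ∪ Ioi n) := by
    ext k; simp only [mem_univ, mem_union, mem_Iio, mem_singleton_iff, mem_Ioi, true_iff]; omega
  rw [this, iprod_union hX, iprod_union hX, iprod_singleton]
  · intro s hs t ht; rw [mem_singleton_iff.1 hs]; exact ht
  · rintro s hs t (ht | ht)
    · rw [mem_singleton_iff.1 ht]; exact hs
    · exact lt_trans hs ht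

lemma iprod_mem {Q : Type} [LinearOrder Q] {X : Q → Wd ι} {hX : LFin X} {T : Set Q} {m : ℕ} {x : Lt ι}
    (h : x ∈ (iprod hX T).s m) : ∃ q ∈ T, x ∈ (X q).s m := by
  rw [iprod_s'] at h
  obtain ⟨q, hq, hx⟩ := List.mem_flatMap.1 h
  exact ⟨q, ((mem_slist hX).1 hq).1, hx⟩

/-- limits of markers -/
def UA (a b : ι) (c : ℕ → ℕ) : Wd ι := iprod (Ymk_lfin a b fun _ => c) univ

lemma UA_pos (a b : ι) (c : ℕ → ℕ) : PosW (UA a b c) := by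
  intro m x hx
  obtain ⟨q, -, h⟩ := iprod_mem hx
  exact Ymk_pos _ _ _ _ m x h

lemma UA_fac {a b : ι} (hab : a ≠ b) {n : ℕ} {c c' : ℕ → ℕ} {p r : Wd ι}
    (h : UA a b c = p * Ymk a b n c' * r) : c' = c := by
  classical
  set x : Lt ι := ((b, n), true) with hx
  have hUA : UA a b c = _ := iprod_nat _ (Ymk_lfin a b fun _ => c) n
  set A := iprod (Ymk_lfin a b fun _ => c) (Iio n) with hA
  set B := iprod (Ymk_lfin a b fun _ => c) (Ioi n) with hB
  have hA' : x ∉ A.s (n+1) := by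
    intro h
    obtain ⟨q, hq, h⟩ := iprod_mem h
    rcases Ymk_mem h with h | ⟨j, -, h⟩
    · simp only [hx, Prod.mk.injEq, true_and, and_true] at h
      exact absurd h (ne_of_gt hq)
    · simp only [hx, Prod.mk.injEq, and_true] at h
      exact hab h.1.symm
  have hB' : x ∉ B.s (n+1) := by
    intro h
    obtain ⟨q, hq, h⟩ := iprod_mem h
    rcases Ymk_mem h with h | ⟨j, -, h⟩
    · simp only [hx, Prod.mk.injEq, true_and, and_true] at h
      exact absurd h (ne_of_lt hq)
    · simp only [hx, Prod.mk.injEq, and_true] at h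
      exact hab h.1.symm
  have hP : ∀ c, x ∉ (PWf a n c).s (n+1) := by
    intro c h
    obtain ⟨j, -, h⟩ := PWf_mem h
    simp only [hx, Prod.mk.injEq, and_true] at h
    exact hab h.1.symm
  rw [hUA] at h
  have hc := congrArg (fun w => (w.s (n+1)).count x) h
  have ho : (Wd.of x).s (n+1) = [x] := Wd.of_s_pos (by simp [hx])
  simp only [Ymk, Wd.s_mul, List.count_append, ← hx, ho, List.count_singleton_self,
    List.count_eq_zero.2 hA', List.count_eq_zero.2 hB', List.count_eq_zero.2 (hP _)] at hc
  have hp : x ∉ p.s (n+1) := List.count_eq_zero.1 (by omega)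
  have hr : x ∉ r.s (n+1) := List.count_eq_zero.1 (by omega)
  simp only [Ymk, ← hx, mul_assoc] at h
  obtain ⟨-, h1⟩ := of_first h hA' hp
  obtain ⟨h2, -⟩ := of_first h1 (hP _) (hP _)
  exact (PWf_inj h2).symm

lemma UA_av {a b : ι} (hab : a ≠ b) {S : Set (Wd ι)} {c : ℕ → ℕ}
    (hS : ∀ s ∈ S, ∃ n c', s = Ymk a b n c' ∧ c' ≠ c) : Av S (UA a b c) := by
  intro p s r hs
  obtain ⟨n, c', rfl, hc⟩ := hS s hs
  refine ⟨fun h => hc (UA_fac hab h), fun h => ?_⟩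
  have hx : ((b, n), true) ∈ ((UA a b c)⁻¹).s (n+1) := by
    rw [h]; simp [Ymk, Wd.of]
  rw [Wd.s_inv, mem_invRev] at hx
  simpa using UA_pos _ _ _ _ _ hx

lemma UA_many {a b : ι} {c : ℕ → ℕ} {S : Set (Wd ι)} (hS : ∀ n, Ymk a b n c ∈ S) (k : ℕ) :
    Many S k (UA a b c) := by
  have key : ∀ k n, Many S k (iprod (Ymk_lfin a b fun _ => c) (Ioi n)) := by
    intro k
    induction k with
    | zero => intro n; trivial
    | succ k ih =>
      intro n
      refine ⟨1, Ymk a b (n+1) c, iprod (Ymk_lfin a b fun _ => c) (Ioi (n+1)), Or.inl (hS _), ?_, ih _⟩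
      have : Ioi n = {n+1} ∪ Ioi (n+1) := by
        ext k; simp only [mem_union, mem_singleton_iff, mem_Ioi]; omega
      rw [this, iprod_union, iprod_singleton, one_mul]
      intro s hs t ht; rw [mem_singleton_iff.1 hs]; exact ht
  rw [UA, iprod_nat _ _ 0]
  exact ((key k 0).left _).left _

lemma UA_lim {a b : ι} {c : ℕ → ℕ} {S : Set (Wd ι)} (hS : ∀ n, Ymk a b n c ∈ S) (h1 : (1 : Wd ι) ∉ S)
    {D : Subgroup (H ι)} (hD : FC D) (hp : ∀ p, PureH p → p ∈ D) (hT : TG S D) :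
    LimW D (UA a b c) := by
  have hred := (UA_pos a b c).red
  refine ⟨hred, fun h => ?_, ?_⟩
  · obtain ⟨n, hn⟩ := (hT _ ⟨hred, h⟩).not_many h1
    exact hn (UA_many hS n)
  · intro B T hBT hT1
    obtain ⟨m, hm⟩ := Wd.exists_s_ne hT1
    have hfin : ∀ n, pr (iprod (Ymk_lfin a b fun _ => c) (Iio n)) ∈ D := by
      intro n
      induction n with
      | zero =>
        have : Iio 0 = (∅ : Set ℕ) := by ext; simp
        rw [this, iprod_empty, map_one]; exact one_mem _
      | succ n ih =>
        have : Iio (n+1) = Iio n ∪ {n} := by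
          ext k; simp only [mem_union, mem_singleton_iff, mem_Iio]; omega
        rw [this, iprod_union, iprod_singleton, map_mul]
        · exact mul_mem ih (pr_Ymk_mem hp _ _ _ _)
        · intro s hs t ht; rw [mem_singleton_iff.1 ht]; exact hs
    have e : UA a b c = _ := iprod_nat _ (Ymk_lfin a b fun _ => c) m
    rcases Wd.levi (hBT.symm.trans e) with ⟨f, hf, -⟩ | ⟨f, -, hf⟩
    · have h2 := hfin m
      rw [hf] at h2
      have hr : Red (B * f) := by
        rw [e, hf] at hred; exact hred.left
      exact hD.left hr h2
    · exfalso
      have h3 : (Ymk a b m c * iprod (Ymk_lfin a b fun _ => c) (Ioi m)).s m = [] := by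
        rw [List.eq_nil_iff_forall_not_mem]
        intro x hx
        rw [Wd.s_mul, Ymk_low le_rfl, List.nil_append] at hx
        obtain ⟨q, hq, hx⟩ := iprod_mem hx
        rw [Ymk_low (le_of_lt hq)] at hx
        simp at hx
      rw [hf, Wd.s_mul] at h3
      exact hm (List.append_eq_nil_iff.1 h3).2
end GrifAux

namespace GrifAux
variable {ι ι' : Type}

/-! ## Codes and the omega closure -/

abbrev Code := ℕ → Bool

def cde (x y : Code) : ℕ → ℕ := fun j => (x j).toNat + 2 * (y j).toNat

lemma cde_inj {x y x' y' : Code} (h : cde x y = cde x' y') : x = x' ∧ y = y' := by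
  have : ∀ j, x j = x' j ∧ y j = y' j := by
    intro j
    have := congrFun h j
    simp only [cde] at this
    revert this
    cases x j <;> cases x' j <;> cases y j <;> cases y' j <;> simp
  exact ⟨funext fun j => (this j).1, funext fun j => (this j).2⟩

def MkS (a b : ι) (x : Code) : Set (Wd ι) := {s | ∃ n y, s = Ymk a b n (cde x y)}
def MkSy (a b : ι) (x y : Code) : Set (Wd ι) := {s | ∃ n, s = Ymk a b n (cde x y)}

lemma MkSy_sub (a b : ι) (x y : Code) : MkSy a b x y ⊆ MkS a b x := by
  rintro _ ⟨n, rfl⟩; exact ⟨n, y, rfl⟩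

lemma one_MkS (a b : ι) (x : Code) : (1 : Wd ι) ∉ MkS a b x := by
  rintro ⟨n, y, h⟩; exact Ymk_ne_one _ _ _ _ h.symm

def badS (a b : ι) (D : Subgroup (H ι)) : Set Code := {x | ¬ TG (MkS a b x) D}
def Occ (a b : ι) (W : Wd ι) : Set Code := {x | ¬ Av (MkS a b x) W}

lemma of_pos {x : Lt ι} {p p' R R' : Wd ι} (h : p * (Wd.of x * R) = p' * (Wd.of x * R'))
    (hp : (p.s (x.1.2+1)).length = (p'.s (x.1.2+1)).length) : p = p' ∧ R = R' := by
  have key : ∀ e R R' : Wd ι, e.s (x.1.2+1) = [] → Wd.of x * R = e * (Wd.of x * R') → e = 1 := by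
    intro e R R' he h
    rw [← one_mul (Wd.of x * R)] at h
    exact (of_first h (by simp) (by rw [he]; simp)).1.symm
  have : p = p' := by
    rcases Wd.levi h with ⟨e, h1, h2⟩ | ⟨e, h1, h2⟩
    · rw [h1, key e R R' ?_ h2, mul_one]
      rw [h1, Wd.s_mul, List.length_append] at hp
      exact List.length_eq_zero_iff.1 (by omega)
    · rw [h1, key e R' R ?_ h2, mul_one]
      rw [h1, Wd.s_mul, List.length_append] at hp
      exact List.length_eq_zero_iff.1 (by omega)
  subst this
  exact ⟨rfl, mul_left_cancel (mul_left_cancel h)⟩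

lemma Occ_countable {a b : ι} (hab : a ≠ b) (W : Wd ι) : (Occ a b W).Countable := by
  have key : ∀ W : Wd ι, {x : Code | ∃ n y p r, W = p * Ymk a b n (cde x y) * r}.Countable := by
    intro W
    have h : ∀ x : {x : Code | ∃ n y p r, W = p * Ymk a b n (cde x y) * r}, ∃ n y p r,
      W = p * Ymk a b n (cde x.1 y) * r := fun x => x.2
    choose n y p r e using h
    rw [← countable_coe_iff]
    apply Function.Injective.countable (f := fun x => (n x, ((p x).s (n x + 1)).length))
    intro x x' hx
    simp only [Prod.mk.injEq] at hx
    obtain ⟨h1, h2⟩ := hx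
    have e1 := (e x).symm.trans (e x')
    rw [← h1] at e1 h2
    simp only [Ymk, mul_assoc] at e1
    obtain ⟨-, h3⟩ := of_pos e1 h2
    have hP : ∀ c, ((b, n x), true) ∉ (PWf a (n x) c).s (n x+1) := by
      intro c h
      obtain ⟨j, -, h⟩ := PWf_mem h
      simp only [Prod.mk.injEq, and_true] at h
      exact hab h.1.symm
    exact Subtype.ext (cde_inj (PWf_inj (of_first h3 (hP _) (hP _)).1)).1
  apply ((key W).union (key W⁻¹)).mono
  intro x hx
  simp only [Occ, Av, mem_setOf_eq] at hx
  push Not at hx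
  obtain ⟨p, s, r, ⟨n, y, rfl⟩, h⟩ := hx
  by_cases hW : W = p * Ymk a b n (cde x y) * r
  · exact Or.inl ⟨n, y, p, r, hW⟩
  · exact Or.inr ⟨n, y, p, r, h hW⟩

lemma mem_pfst_sSup {c : Set (Subgroup (H ι × H ι'))} (hne : c.Nonempty) (hc : IsChain (· ≤ ·) c)
    (g : H ι) : g ∈ pfst (sSup c) ↔ ∃ Γ ∈ c, g ∈ pfst Γ := by
  have hmem : ∀ x, x ∈ sSup c ↔ ∃ Γ ∈ c, x ∈ Γ := fun x =>
    Subgroup.mem_sSup_of_directedOn hne hc.directedOn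
  rw [mem_pfst]
  constructor
  · rintro ⟨g', h⟩
    obtain ⟨Γ, h1, h2⟩ := (hmem _).1 h
    exact ⟨Γ, h1, mem_pfst.2 ⟨g', h2⟩⟩
  · rintro ⟨Γ, h1, h2⟩
    obtain ⟨g', h⟩ := mem_pfst.1 h2
    exact ⟨g', (hmem _).2 ⟨Γ, h1, h⟩⟩

lemma mem_psnd_sSup {c : Set (Subgroup (H ι × H ι'))} (hne : c.Nonempty) (hc : IsChain (· ≤ ·) c)
    (g : H ι') : g ∈ psnd (sSup c) ↔ ∃ Γ ∈ c, g ∈ psnd Γ := by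
  have hmem : ∀ x, x ∈ sSup c ↔ ∃ Γ ∈ c, x ∈ Γ := fun x =>
    Subgroup.mem_sSup_of_directedOn hne hc.directedOn
  rw [mem_psnd]
  constructor
  · rintro ⟨g', h⟩
    obtain ⟨Γ, h1, h2⟩ := (hmem _).1 h
    exact ⟨Γ, h1, mem_psnd.2 ⟨g', h2⟩⟩
  · rintro ⟨Γ, h1, h2⟩
    obtain ⟨g', h⟩ := mem_psnd.1 h2
    exact ⟨g', (hmem _).2 ⟨Γ, h1, h⟩⟩

lemma pfst_mono {Γ Γ' : Subgroup (H ι × H ι')} (h : Γ ≤ Γ') : pfst Γ ≤ pfst Γ' := Subgroup.map_mono h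
lemma psnd_mono {Γ Γ' : Subgroup (H ι × H ι')} (h : Γ ≤ Γ') : psnd Γ ≤ psnd Γ' := Subgroup.map_mono h

theorem omega_closure {Γ : Subgroup (H ι × H ι')} (hΓ : Good Γ) (W : Wd ι) (hW : Red W)
    {a b : ι} {a' b' : ι'} (hab' : a' ≠ b') (yc : Wd ι → Code)
    (hyc : Function.Injective yc) {x0 : Code} (hx0 : x0 ∉ badS a' b' (psnd Γ)) :
    ∃ Γ1, Γ ≤ Γ1 ∧ Good Γ1 ∧ CLr (pfst Γ1) W ∧ CLr (pfst Γ1) W⁻¹ ∧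
      badS a b (pfst Γ1) ⊆ badS a b (pfst Γ) ∪ Occ a b W ∧
      badS a' b' (psnd Γ1) ⊆ badS a' b' (psnd Γ) ∪ {x0} := by
  let Z : Set (Subgroup (H ι × H ι')) := {Γ1 | Γ ≤ Γ1 ∧ Good Γ1 ∧
    (∀ x, x ∉ badS a b (pfst Γ) → x ∉ Occ a b W → TG (MkS a b x) (pfst Γ1)) ∧
    (∀ y, (∀ A ∈ PD (pfst Γ1), yc A ≠ y) → TG (MkSy a' b' x0 y) (psnd Γ1)) ∧
    (∀ x, x ≠ x0 → x ∉ badS a' b' (psnd Γ) → TG (MkS a' b' x) (psnd Γ1))}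
  have hZ0 : Γ ∈ Z := by
    refine ⟨le_rfl, hΓ, fun x hx _ => not_not.1 hx, fun y _ => ?_, fun x _ hx => not_not.1 hx⟩
    intro X hX
    exact ((not_not.1 hx0) X hX).mono (MkSy_sub _ _ _ _)
  obtain ⟨M, hM, hmax⟩ := zorn_le_nonempty₀ Z (by
    intro c hc hch Γ0 h0
    have hne : c.Nonempty := ⟨Γ0, h0⟩
    refine ⟨sSup c, ⟨(hc h0).1.trans (le_sSup h0), good_sSup hne hch fun Γ h => (hc h).2.1, ?_, ?_, ?_⟩,
      fun z hz => le_sSup hz⟩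
    · rintro x h1 h2 X ⟨hr, hX⟩
      obtain ⟨Γ1, h3, h4⟩ := (mem_pfst_sSup hne hch _).1 hX
      exact (hc h3).2.2.1 x h1 h2 X ⟨hr, h4⟩
    · rintro y h1 X ⟨hr, hX⟩
      obtain ⟨Γ1, h3, h4⟩ := (mem_psnd_sSup hne hch _).1 hX
      exact (hc h3).2.2.2.1 y (fun A hA => h1 A ⟨hA.1, pfst_mono (le_sSup h3) hA.2⟩) X ⟨hr, h4⟩
    · rintro x h1 h2 X ⟨hr, hX⟩
      obtain ⟨Γ1, h3, h4⟩ := (mem_psnd_sSup hne hch _).1 hX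
      exact (hc h3).2.2.2.2 x h1 h2 X ⟨hr, h4⟩) Γ hZ0
  obtain ⟨⟨z0, zg, z1, z2, z3⟩, hmax⟩ := hmax
  have key : ∀ A, LimW (pfst M) A → (∀ S, Av S W → Av S A) → False := by
    intro A hA hAv
    have hU : LimW (psnd M) (UA a' b' (cde x0 (yc A))) := by
      apply UA_lim (S := MkSy a' b' x0 (yc A)) (fun n => ⟨n, rfl⟩)
        (fun h => one_MkS _ _ _ (MkSy_sub _ _ _ _ h)) zg.fc2
      · intro p hp; exact mem_psnd.2 ⟨1, zg.p2 p hp⟩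
      · apply z2
        intro B hB h
        rw [hyc h] at hB
        exact hA.2.1 hB.2
    have e1 : pfst (M ⊔ Subgroup.closure {(pr A, pr (UA a' b' (cde x0 (yc A))))}) =
        pfst M ⊔ Subgroup.closure {pr A} := by rw [pfst_sup]; simp
    have e2 : psnd (M ⊔ Subgroup.closure {(pr A, pr (UA a' b' (cde x0 (yc A))))}) =
        psnd M ⊔ Subgroup.closure {pr (UA a' b' (cde x0 (yc A)))} := by rw [psnd_sup]; simp
    have hA1 : pr A ∈ pfst M ⊔ Subgroup.closure {pr A} :=
      Subgroup.mem_sup_right (Subgroup.subset_closure rfl)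
    have h1 : M ⊔ Subgroup.closure {(pr A, pr (UA a' b' (cde x0 (yc A))))} ∈ Z := by
      refine ⟨z0.trans le_sup_left, omega_step zg hA hU, ?_, ?_, ?_⟩
      · intro x hx hx'
        rw [e1]
        exact (z1 x hx hx').omega zg.fc1 hA (hAv _ (not_not.1 hx'))
      · intro y hy
        rw [e2]
        rw [e1] at hy
        refine (z2 y fun B hB => hy B ⟨hB.1, Subgroup.mem_sup_left hB.2⟩).omega zg.fc2 hU ?_
        apply UA_av hab'
        rintro _ ⟨n, rfl⟩
        exact ⟨n, _, rfl, fun h => hy A ⟨hA.1, hA1⟩ (cde_inj h).2.symm⟩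
      · intro x hx hx'
        rw [e2]
        refine (z3 x hx hx').omega zg.fc2 hU ?_
        apply UA_av hab'
        rintro _ ⟨n, y, rfl⟩
        exact ⟨n, _, rfl, fun h => hx (cde_inj h).1⟩
    have h2 := pfst_mono (hmax h1 le_sup_left)
    rw [e1] at h2
    exact hA.2.1 (h2 hA1)
  refine ⟨M, z0, zg, ?_, ?_, ?_, ?_⟩
  · by_contra h
    obtain ⟨p, Y, r, e, hY⟩ := not_CLr hW h
    exact key Y hY fun S hS => hS.fac e
  · by_contra h
    obtain ⟨p, Y, r, e, hY⟩ := not_CLr hW.inv h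
    exact key Y hY fun S hS => hS.inv.fac e
  · intro x hx
    by_contra h
    rw [mem_union, not_or] at h
    exact hx (z1 x h.1 h.2)
  · intro x hx
    by_contra h
    rw [mem_union, not_or] at h
    exact hx (z3 x h.2 h.1)
end GrifAux

namespace GrifAux
variable {ι ι' : Type}

abbrev CP := Monoid.CoprodI (fun _ : ℕ => Multiplicative ℤ)

def ev1 (M : ℕ → ℕ) (s : ℕ × ℤ × ℤ) : CP :=
  Monoid.CoprodI.of (i := s.1) (Multiplicative.ofAdd ((M s.1 : ℤ) * s.2.1 + s.2.2))

def ev2 {G : Type} [Group G] (g : ℕ → G) (s : ℕ × ℤ × ℤ) : G := g s.1 ^ s.2.1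

def scost (k : ℕ) (L : List (ℕ × ℤ × ℤ)) : ℤ := (L.map fun s => if s.1 = k then |s.2.2| else 0).sum

lemma scost_append (k : ℕ) (L L' : List (ℕ × ℤ × ℤ)) : scost k (L ++ L') = scost k L + scost k L' := by
  simp [scost]

lemma scost_cons (k : ℕ) (s) (L : List (ℕ × ℤ × ℤ)) :
    scost k (s :: L) = (if s.1 = k then |s.2.2| else 0) + scost k L := by
  simp [scost]

lemma scost_nonneg (k : ℕ) (L : List (ℕ × ℤ × ℤ)) : 0 ≤ scost k L := by
  induction L with
  | nil => simp [scost]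
  | cons s L ih =>
    rw [scost_cons]; split_ifs <;> positivity

lemma not_chain {α : Type} {R : α → α → Prop} : ∀ {L : List α}, ¬ L.IsChain R →
    ∃ L1 a b L2, L = L1 ++ a :: b :: L2 ∧ ¬ R a b
  | [], h => absurd List.IsChain.nil h
  | [a], h => absurd (List.IsChain.singleton a) h
  | a :: b :: L, h => by
    rw [List.isChain_cons_cons] at h
    by_cases hR : R a b
    · obtain ⟨L1, x, y, L2, e, h'⟩ := not_chain (fun hc => h ⟨hR, hc⟩)
      exact ⟨a :: L1, x, y, L2, by rw [e]; rfl, h'⟩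
    · exact ⟨[], a, b, L, rfl, hR⟩

theorem lemR {G : Type} [Group G] (M : ℕ → ℕ) (g : ℕ → G) (N : ℕ) : ∀ L : List (ℕ × ℤ × ℤ),
    L.length = N → (∀ k, scost k L < M k) → (L.map (ev1 M)).prod = 1 → (L.map (ev2 g)).prod = 1 := by
  induction N using Nat.strong_induction_on with
  | _ N ih =>
  intro L hN hc h1
  by_cases hz : ∃ s ∈ L, (M s.1 : ℤ) * s.2.1 + s.2.2 = 0
  · obtain ⟨s, hs, h0⟩ := hz
    obtain ⟨L1, L2, rfl⟩ := List.append_of_mem hs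
    have hcs := hc s.1
    rw [scost_append, scost_cons, if_pos rfl] at hcs
    have n1 := scost_nonneg s.1 L1
    have n2 := scost_nonneg s.1 L2
    have hi : s.2.1 = 0 := by
      by_contra hi
      have : (1:ℤ) ≤ |s.2.1| := Int.one_le_abs hi
      have e : |s.2.2| = (M s.1 : ℤ) * |s.2.1| := by
        have : s.2.2 = -((M s.1 : ℤ) * s.2.1) := by linarith
        rw [this, abs_neg, abs_mul, Nat.abs_cast]
      nlinarith
    have := ih (L1 ++ L2).length (by simp at hN ⊢; omega) (L1 ++ L2) rfl
      (fun k => by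
        have := hc k
        rw [scost_append, scost_cons] at this
        rw [scost_append]
        have : 0 ≤ (if s.1 = k then |s.2.2| else 0) := by split_ifs <;> positivity
        linarith)
      (by
        have e : ev1 M s = 1 := by simp [ev1, h0]
        simpa [e] using h1)
    have e : ev2 g s = 1 := by simp [ev2, hi]
    simpa [e] using this
  · by_cases hch : (L.map Prod.fst).IsChain (· ≠ ·)
    · push Not at hz
      let w : Monoid.CoprodI.Word (fun _ : ℕ => Multiplicative ℤ) :=
        { toList := L.map fun s => ⟨s.1, Multiplicative.ofAdd ((M s.1 : ℤ) * s.2.1 + s.2.2)⟩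
          ne_one := by
            intro l hl
            rw [List.mem_map] at hl
            obtain ⟨s, hs, rfl⟩ := hl
            intro h; exact hz s hs (ofAdd_eq_one.1 h)
          chain_ne := by
            rw [List.isChain_map] at hch ⊢
            exact hch }
      have hw : w.prod = 1 := by
        rw [← h1, Monoid.CoprodI.Word.prod]
        simp only [w, List.map_map]; rfl
      have : w = Monoid.CoprodI.Word.empty := by
        apply Monoid.CoprodI.Word.equiv.symm.injective
        exact hw
      have h2 : w.toList = [] := by rw [this]; rfl
      have : L = [] := by simpa [w] using h2
      simp [this]
    · rw [List.isChain_map] at hch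
      obtain ⟨L1, ⟨k, i, j⟩, ⟨k', i', j'⟩, L2, rfl, hk⟩ := not_chain hch
      simp only [ne_eq, not_not] at hk
      subst hk
      have := ih (L1 ++ (k, i + i', j + j') :: L2).length (by simp at hN ⊢; omega) _ rfl
        (fun k0 => by
          have := hc k0
          rw [scost_append, scost_cons, scost_cons] at this
          rw [scost_append, scost_cons]
          refine lt_of_le_of_lt ?_ this
          have := abs_add_le j j'
          simp only
          split_ifs <;> linarith)
        (by
          rw [← h1]
          simp only [List.map_append, List.map_cons, List.prod_append, List.prod_cons, ev1]
          rw [← mul_assoc (Monoid.CoprodI.of _) (Monoid.CoprodI.of _), ← map_mul, ← ofAdd_add]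
          congr 4; ring_nf)
      rw [← this]
      simp only [List.map_append, List.map_cons, List.prod_append, List.prod_cons, ev2, zpow_add, mul_assoc]


open Classical in
def hh (a : ι) (live : ℕ → Prop) : FG ι →* CP :=
  FreeGroup.lift fun x => if x.1 = a ∧ live x.2 then
    Monoid.CoprodI.of (i := x.2) (Multiplicative.ofAdd (1:ℤ)) else 1

open Classical in
def jl (a : ι) (live : ℕ → Prop) (w : List (Lt ι)) : List (ℕ × ℤ × ℤ) :=
  w.flatMap fun x => if x.1.1 = a ∧ live x.1.2 then [(x.1.2, 0, if x.2 then 1 else -1)] else []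

open Classical in
/-- number of occurrences of the letter `(a,k)` in a word -/
def lcnt (a : ι) (k : ℕ) (w : List (Lt ι)) : ℕ := w.countP fun x => x.1 = (a, k)

lemma jl_cons (a : ι) (live : ℕ → Prop) (x) (w : List (Lt ι)) : jl a live (x :: w) =
    jl a live [x] ++ jl a live w := by simp [jl]

lemma mk_cons' (x : Lt ι) (w : List (Lt ι)) : (FreeGroup.mk (x :: w) : FG ι) =
    FreeGroup.mk [x] * FreeGroup.mk w := by rw [FreeGroup.mul_mk]; rfl

lemma hh_single (a : ι) (live : ℕ → Prop) (k : ℕ) (hk : live k) (b : Bool) :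
    hh a live (FreeGroup.mk [((a, k), b)]) =
      Monoid.CoprodI.of (i := k) (Multiplicative.ofAdd (if b then 1 else -1 : ℤ)) := by
  have e : (FreeGroup.mk [((a, k), true)] : FG ι) = FreeGroup.of (a, k) := rfl
  have e' : (FreeGroup.mk [((a, k), false)] : FG ι) = (FreeGroup.of (a, k))⁻¹ := rfl
  cases b
  · rw [e', map_inv, hh, FreeGroup.lift_apply_of]
    simp [hk, ← map_inv]
  · rw [e, hh, FreeGroup.lift_apply_of]
    simp [hk]

lemma hh_single' (a : ι) (live : ℕ → Prop) (x : Lt ι) (hx : ¬ (x.1.1 = a ∧ live x.1.2)) :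
    hh a live (FreeGroup.mk [x]) = 1 := by
  obtain ⟨x, b⟩ := x
  have e : (FreeGroup.mk [(x, true)] : FG ι) = FreeGroup.of x := rfl
  have e' : (FreeGroup.mk [(x, false)] : FG ι) = (FreeGroup.of x)⁻¹ := rfl
  cases b
  · rw [e', map_inv, hh, FreeGroup.lift_apply_of, if_neg hx, inv_one]
  · rw [e, hh, FreeGroup.lift_apply_of, if_neg hx]

lemma jl_ev1 (a : ι) (live : ℕ → Prop) (M : ℕ → ℕ) (w : List (Lt ι)) :
    ((jl a live w).map (ev1 M)).prod = hh a live (FreeGroup.mk w) := by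
  induction w with
  | nil => simp [jl]; exact (map_one (hh a live)).symm
  | cons x w ih =>
    rw [jl_cons, List.map_append, List.prod_append, ih, mk_cons', map_mul]
    congr 1
    by_cases hx : x.1.1 = a ∧ live x.1.2
    · obtain ⟨⟨a', k⟩, b⟩ := x
      obtain ⟨rfl, hk⟩ := hx
      rw [hh_single _ _ _ hk]
      simp only at hk
      simp [jl, hk, ev1]
    · rw [hh_single' _ _ _ hx]
      simp [jl, hx]

lemma jl_ev2 (a : ι) (live : ℕ → Prop) {G : Type} [Group G] (g : ℕ → G) (w : List (Lt ι)) :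
    ((jl a live w).map (ev2 g)).prod = 1 := by
  induction w with
  | nil => simp [jl]
  | cons x w ih =>
    rw [jl_cons, List.map_append, List.prod_append, ih, mul_one]
    by_cases hx : x.1.1 = a ∧ live x.1.2
    · simp [jl, hx, ev2]
    · simp [jl, hx]

lemma jl_cost (a : ι) (live : ℕ → Prop) (k : ℕ) (w : List (Lt ι)) :
    scost k (jl a live w) ≤ lcnt a k w ∧ (¬ live k → scost k (jl a live w) = 0) := by
  induction w with
  | nil => simp [jl, scost, lcnt]
  | cons x w ih =>
    rw [jl_cons, scost_append]
    have e : lcnt a k (x :: w) = lcnt a k w + lcnt a k [x] := by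
      unfold lcnt; rw [List.countP_cons, List.countP_cons]; simp
    rw [e]
    by_cases hx : x.1.1 = a ∧ live x.1.2
    · obtain ⟨⟨a', k'⟩, b⟩ := x
      obtain ⟨rfl, hk⟩ := hx
      simp only at hk
      have : scost k (jl a' live [((a', k'), b)]) = if k' = k then 1 else 0 := by
        cases b <;> simp [jl, scost, hk]
      rw [this]
      constructor
      · push_cast
        by_cases h : k' = k
        · subst h; simp [lcnt] at ih ⊢; linarith [ih.1]
        · simp [h]; linarith [ih.1]
      · intro hn
        rw [if_neg (by rintro rfl; exact hn hk), ih.2 hn, add_zero]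
    · have : jl a live [x] = [] := by simp [jl, hx]
      rw [this]; push_cast
      simp only [scost, List.map_nil, List.sum_nil, zero_add]
      exact ⟨le_trans ih.1 (by simp), ih.2⟩

lemma lcnt_append (a : ι) (k : ℕ) (w w' : List (Lt ι)) : lcnt a k (w ++ w') = lcnt a k w + lcnt a k w' := by
  simp [lcnt]

lemma lcnt_le (a : ι) (k n : ℕ) (W : Wd ι) : lcnt a k (W.s n) ≤ lcnt a k (W.s (k+1)) := by
  rcases le_total n (k+1) with h | h
  · have : cut n (W.s (k+1)) = W.s n := W.coh _ _ h
    rw [← this]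
    exact (List.filter_sublist).countP_le
  · have : cut (k+1) (W.s n) = W.s (k+1) := W.coh _ _ h
    rw [← this]
    have e : lcnt a k (cut (k+1) (W.s n)) = lcnt a k (W.s n) := by
      unfold lcnt cut
      rw [List.countP_filter]
      apply List.countP_congr
      intro x _
      simp only [decide_eq_true_eq, Bool.and_eq_true]
      constructor
      · exact fun h => h.1
      · intro h; exact ⟨h, by rw [h]; simp⟩
    rw [e]

lemma lcnt_zero (a : ι) (k : ℕ) (w : List (Lt ι)) (h : ∀ x ∈ w, x.1 ≠ (a, k)) : lcnt a k w = 0 := by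
  unfold lcnt; rw [List.countP_eq_zero]; simpa using h

lemma lcnt_invRev (a : ι) (k : ℕ) (w : List (Lt ι)) : lcnt a k (FreeGroup.invRev w) = lcnt a k w := by
  unfold lcnt FreeGroup.invRev
  rw [List.countP_reverse, List.countP_map]; rfl

lemma pow_s (W : Wd ι) (n m : ℕ) : (W ^ n).s m = (List.replicate n (W.s m)).flatten := by
  induction n with
  | zero => simp
  | succ n ih => rw [pow_succ', Wd.s_mul, ih, List.replicate_succ, List.flatten_cons]

/-- the block attached to a piece -/
def blk (a : ι) (M : ℕ → ℕ) (k : ℕ) (b : Bool) : Wd ι := Wd.of ((a, k), b) ^ M k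

lemma blk_hh (a : ι) (live : ℕ → Prop) (M : ℕ → ℕ) (k : ℕ) (hk : live k) (b : Bool) (n : ℕ) :
    hh a live (FreeGroup.mk ((blk a M k b).s n)) =
      if k < n then ev1 M (k, (if b then 1 else -1), 0) else 1 := by
  unfold blk
  have hp : ∀ N : ℕ, (FreeGroup.mk ((Wd.of ((a, k), b) ^ N).s n) : FG ι) =
      (FreeGroup.mk ((Wd.of ((a, k), b)).s n)) ^ N := by
    intro N
    induction N with
    | zero => simp; rfl
    | succ N ih => rw [pow_succ', Wd.s_mul, ← FreeGroup.mul_mk, ih, pow_succ']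
  rw [hp, map_pow]
  by_cases h : k < n
  · rw [if_pos h, Wd.of_s_pos (x := ((a, k), b)) h, hh_single _ _ _ hk, ← map_pow, ev1, ← ofAdd_nsmul]
    cases b <;> simp
  · rw [if_neg h, Wd.of_s_neg (x := ((a, k), b)) h]
    have : (FreeGroup.mk [] : FG ι) = 1 := rfl
    rw [this, map_one, one_pow]

end GrifAux

namespace GrifAux
variable {ι ι' : Type}

lemma flat_prod {α G : Type} [Monoid G] {β : Type} (f : α → List β) (ev : β → G) (l : List α) :
    ((l.flatMap f).map ev).prod = (l.map fun q => ((f q).map ev).prod).prod := by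
  induction l with
  | nil => simp
  | cons a l ih => simp [ih]

lemma mk_flatMap {α : Type} (f : α → List (Lt ι)) (l : List α) :
    (FreeGroup.mk (l.flatMap f) : FG ι) = (l.map fun q => (FreeGroup.mk (f q) : FG ι)).prod := by
  induction l with
  | nil => simp; rfl
  | cons a l ih => rw [List.flatMap_cons, ← FreeGroup.mul_mk, ih]; simp

lemma scost_flatMap {α : Type} (k : ℕ) (f : α → List (ℕ × ℤ × ℤ)) (l : List α) :
    scost k (l.flatMap f) = (l.map fun q => scost k (f q)).sum := by
  induction l with
  | nil => simp [scost]
  | cons a l ih => rw [List.flatMap_cons, scost_append, ih]; simp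

lemma list_sum_le {α : Type} (l : List α) (f g : α → ℤ) (h : ∀ x ∈ l, f x ≤ g x) :
    (l.map f).sum ≤ (l.map g).sum := by
  induction l with
  | nil => simp
  | cons a l ih =>
    simp only [List.map_cons, List.sum_cons]
    have := h a (by simp)
    have := ih (fun x hx => h x (by simp [hx]))
    linarith

open Classical in
theorem marker_red {Q : Type} [LinearOrder Q] (a : ι') (live : ℕ → Prop) (M : ℕ → ℕ)
    {V : Q → Wd ι'} (hV : LFin V) (A B : Q → Wd ι') {S R : Set Q} (hSR : S ⊆ R) (lv : Q → ℕ) (sg : Q → Bool)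
    (hlive : ∀ q, live (lv q)) (hM : ∀ k, 0 < M k)
    (hin : ∀ q ∈ S, V q = A q * blk a M (lv q) (sg q) * B q) (hout : ∀ q ∈ R, q ∉ S → V q = A q * B q)
    (hc : ∀ l : List Q, l.Nodup → (∀ q ∈ l, q ∈ R) → ∀ k, live k →
      (l.map fun q => lcnt a k ((A q).s (k+1)) + lcnt a k ((B q).s (k+1))).sum < M k)
    {X : Q → Wd ι} (hX : LFin X) (Z : ℕ → Wd ι)
    (hZ : ∀ q, X q = if sg q then Z (lv q) else (Z (lv q))⁻¹) (hF : pr (iprod hV R) = 1) :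
    pr (iprod hX S) = 1 := by
  rw [pr_eq_one] at hF ⊢
  intro m
  obtain ⟨n, hn⟩ : ∃ n, ∀ q ∈ {q | (X q).s m ≠ []}, lv q < n := by
    obtain ⟨n, hn⟩ := ((hX m).image lv).bddAbove
    exact ⟨n+1, fun q hq => Nat.lt_succ_of_le (hn ⟨q, hq, rfl⟩)⟩
  have hfin : ({q | q ∈ R ∧ ((V q).s n ≠ [] ∨ (X q).s m ≠ [])}).Finite :=
    ((hV n).union (hX m)).subset (fun q hq => hq.2)
  set l : List Q := hfin.toFinset.sort (· ≤ ·) with hl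
  have hpw : l.Pairwise (· < ·) := (Finset.sortedLT_sort _).pairwise
  have hmem : ∀ q, q ∈ l ↔ q ∈ R ∧ ((V q).s n ≠ [] ∨ (X q).s m ≠ []) := by
    intro q; rw [hl, Finset.mem_sort, Set.Finite.mem_toFinset]; rfl
  have hnd : l.Nodup := hpw.imp (fun h => ne_of_lt h)
  have e1 := iprod_s hV R n (l := l) hpw (fun q hq => ((hmem q).1 hq).1)
    (fun q hq h => (hmem q).2 ⟨hq, Or.inl h⟩)
  have e2 := iprod_s hX S m (l := l.filter (· ∈ S)) (hpw.filter _) (fun q hq => by simpa using (List.mem_filter.1 hq).2)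
    (fun q hq h => List.mem_filter.2 ⟨(hmem q).2 ⟨hSR hq, Or.inr h⟩, by simpa using hq⟩)
  set f : Q → List (ℕ × ℤ × ℤ) := fun q => jl a live ((A q).s n) ++
    ((if q ∈ S ∧ lv q < n then [(lv q, (if sg q then (1:ℤ) else -1), (0:ℤ))] else []) ++ jl a live ((B q).s n)) with hf
  have key := lemR M (fun k => (FreeGroup.mk ((Z k).s m) : FG ι)) _ (l.flatMap f) rfl ?_ ?_
  · rw [e2, mk_flatMap, ← key, flat_prod]
    have : ∀ l' : List Q, (∀ q ∈ l', q ∈ R) →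
        ((l'.filter (· ∈ S)).map fun q => (FreeGroup.mk ((X q).s m) : FG ι)).prod =
        (l'.map fun q => ((f q).map (ev2 fun k => (FreeGroup.mk ((Z k).s m) : FG ι))).prod).prod := by
      intro l' hl'
      induction l' with
      | nil => simp
      | cons q l' ih =>
        have ih := ih (fun r hr => hl' r (by simp [hr]))
        rw [List.map_cons, List.prod_cons, ← ih]
        have ef : ((f q).map (ev2 fun k => (FreeGroup.mk ((Z k).s m) : FG ι))).prod =
            if q ∈ S ∧ lv q < n then (FreeGroup.mk ((Z (lv q)).s m) : FG ι) ^ (if sg q then (1:ℤ) else -1) else 1 := by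
          simp only [hf, List.map_append, List.prod_append, jl_ev2, one_mul, mul_one]
          split_ifs <;> simp [ev2]
        rw [ef]
        by_cases hS : q ∈ S
        · rw [List.filter_cons_of_pos (by simpa using hS), List.map_cons, List.prod_cons]
          congr 1
          by_cases hlt : lv q < n
          · rw [if_pos ⟨hS, hlt⟩, hZ q]
            cases sg q
            · simp [FreeGroup.inv_mk]
            · simp
          · rw [if_neg (fun h => hlt h.2)]
            have : (X q).s m = [] := by
              by_contra h; exact hlt (hn q h)
            rw [this]; rfl
        · rw [List.filter_cons_of_neg (by simpa using hS), if_neg (fun h => hS h.1), one_mul]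
    exact this l (fun q hq => ((hmem q).1 hq).1)
  · intro k
    rw [scost_flatMap]
    have hb : ∀ q, scost k (f q) = scost k (jl a live ((A q).s n)) + scost k (jl a live ((B q).s n)) := by
      intro q
      simp only [hf, scost_append]
      split_ifs <;> simp [scost]
    by_cases hk : live k
    · refine lt_of_le_of_lt ?_ (by exact_mod_cast hc l hnd (fun q hq => ((hmem q).1 hq).1) k hk :
        (((l.map fun q => lcnt a k ((A q).s (k+1)) + lcnt a k ((B q).s (k+1))).sum : ℕ) : ℤ) < M k)
      have : (((l.map fun q => lcnt a k ((A q).s (k+1)) + lcnt a k ((B q).s (k+1))).sum : ℕ) : ℤ) =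
          (l.map fun q => ((lcnt a k ((A q).s (k+1)) + lcnt a k ((B q).s (k+1)) : ℕ) : ℤ)).sum := by
        generalize l = l'
        induction l' with
        | nil => simp
        | cons x l' ih => simp only [List.map_cons, List.sum_cons, Nat.cast_add] at ih ⊢; rw [ih]
      rw [this]
      apply list_sum_le
      intro q _
      rw [hb]; push_cast
      have h1 := (jl_cost a live k ((A q).s n)).1
      have h2 := (jl_cost a live k ((B q).s n)).1
      have h3 : (lcnt a k ((A q).s n) : ℤ) ≤ lcnt a k ((A q).s (k+1)) := by exact_mod_cast lcnt_le a k n _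
      have h4 : (lcnt a k ((B q).s n) : ℤ) ≤ lcnt a k ((B q).s (k+1)) := by exact_mod_cast lcnt_le a k n _
      linarith
    · have : ∀ q, scost k (f q) = 0 := by
        intro q
        rw [hb, (jl_cost a live k _).2 hk, (jl_cost a live k _).2 hk, add_zero]
      simp only [this, List.map_const', List.sum_replicate, smul_zero]
      exact_mod_cast hM k
  · rw [flat_prod]
    have : ∀ q ∈ l, ((f q).map (ev1 M)).prod = hh a live (FreeGroup.mk ((V q).s n)) := by
      intro q hq
      simp only [hf, List.map_append, List.prod_append, jl_ev1]
      by_cases hS : q ∈ S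
      · rw [hin q hS, Wd.s_mul, Wd.s_mul, ← FreeGroup.mul_mk, ← FreeGroup.mul_mk, map_mul, map_mul, mul_assoc,
          blk_hh _ _ _ _ (hlive q)]
        congr 2
        by_cases hlt : lv q < n <;> simp [hS, hlt]
      · rw [hout q ((hmem q).1 hq).1 hS, Wd.s_mul, ← FreeGroup.mul_mk, map_mul]
        simp [hS]
    rw [List.map_congr_left this]
    have h0 := hF n
    rw [e1, mk_flatMap] at h0
    have := congrArg (hh a live) h0
    rw [map_list_prod, List.map_map, map_one] at this
    exact this

end GrifAux

namespace GrifAux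
variable {ι ι' : Type}
section
variable {Q : Type} [LinearOrder Q]

lemma LFin.of_ne {U V : Q → Wd ι} (hU : LFin U) (h : ∀ q m, (V q).s m ≠ [] → (U q).s m ≠ []) : LFin V :=
  fun m => (hU m).subset fun q hq => h q m hq

lemma cutR {U : Q → Wd ι} (hU : LFin U) {R : Set Q} (hR : R.OrdConnected) {a G : Wd ι}
    (h : iprod hU R = a * G) : ∃ (R' : Set Q) (x V : Q → Wd ι) (hV : LFin V), R' ⊆ R ∧ R'.OrdConnected ∧
      (∀ q, U q = x q * V q) ∧ (∀ q ∈ R', x q ≠ 1 → IsLeast R' q) ∧ G = iprod hV R' := by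
  classical
  obtain ⟨T1, T2, hlt, ⟨rfl, h1, h2⟩ | ⟨q, b, c, hq, rfl, hq1, hq2, hbc, hb, hc, h1, h2⟩⟩ := iprod_cut hU h
  · refine ⟨T2, fun _ => 1, U, hU, subset_union_right, ⟨fun s hs t ht z hz => ?_⟩, by simp, by simp, h2⟩
    rcases hR.out (Or.inr hs) (Or.inr ht) hz with h | h
    · exact absurd (hlt z h s hs) (not_lt.2 hz.1)
    · exact h
  · have hV : LFin (Function.update U q c) := hU.of_ne (by
      intro r m hr
      by_cases e : r = q
      · subst e; rw [Function.update_self] at hr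
        rw [hbc, Wd.s_mul]; simp [hr]
      · rwa [Function.update_of_ne e] at hr)
    refine ⟨{q} ∪ T2, Function.update (fun _ => 1) q b, Function.update U q c, hV, ?_, ⟨?_⟩, ?_, ?_, ?_⟩
    · rintro r (rfl | h)
      · exact hq
      · exact Or.inr h
    · intro s hs t ht z hz
      have hs' : q ≤ s := by rcases hs with rfl | h; exacts [le_rfl, (hq2 _ h).le]
      have hR' : ∀ {s}, s ∈ ({q} ∪ T2 : Set Q) → s ∈ T1 ∪ {q} ∪ T2 := by
        rintro s (h | h); exacts [Or.inl (Or.inr h), Or.inr h]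
      rcases hR.out (hR' hs) (hR' ht) hz with (h | h) | h
      · exact absurd (hq1 z h) (not_lt.2 (hs'.trans hz.1))
      · exact Or.inl h
      · exact Or.inr h
    · intro r
      by_cases e : r = q
      · subst e; simpa using hbc
      · simp [Function.update_of_ne e]
    · intro r hr hx
      have : r = q := by by_contra e; simp [Function.update_of_ne e] at hx
      subst this
      exact ⟨hr, by rintro z (rfl | h); exacts [le_rfl, (hq2 z h).le]⟩
    · rw [h2, iprod_union hV (by rintro s rfl t ht; exact hq2 t ht), iprod_singleton, Function.update_self]
      congr 1
      refine iprod_map hU hV id (fun _ _ _ _ h => h) (by simp) (fun r hr => ?_)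
      exact Function.update_of_ne (ne_of_gt (hq2 r hr)) _ _

lemma cutL {U : Q → Wd ι} (hU : LFin U) {R : Set Q} (hR : R.OrdConnected) {a G : Wd ι}
    (h : iprod hU R = G * a) : ∃ (R' : Set Q) (V x : Q → Wd ι) (hV : LFin V), R' ⊆ R ∧ R'.OrdConnected ∧
      (∀ q, U q = V q * x q) ∧ (∀ q ∈ R', x q ≠ 1 → IsGreatest R' q) ∧ G = iprod hV R' := by
  classical
  obtain ⟨T1, T2, hlt, ⟨rfl, h1, h2⟩ | ⟨q, b, c, hq, rfl, hq1, hq2, hbc, hb, hc, h1, h2⟩⟩ := iprod_cut hU h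
  · refine ⟨T1, U, fun _ => 1, hU, subset_union_left, ⟨fun s hs t ht z hz => ?_⟩, by simp, by simp, h1⟩
    rcases hR.out (Or.inl hs) (Or.inl ht) hz with h | h
    · exact h
    · exact absurd (hlt t ht z h) (not_lt.2 hz.2)
  · have hV : LFin (Function.update U q b) := hU.of_ne (by
      intro r m hr
      by_cases e : r = q
      · subst e; rw [Function.update_self] at hr
        rw [hbc, Wd.s_mul]; simp [hr]
      · rwa [Function.update_of_ne e] at hr)
    refine ⟨T1 ∪ {q}, Function.update U q b, Function.update (fun _ => 1) q c, hV, ?_, ⟨?_⟩, ?_, ?_, ?_⟩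
    · exact subset_union_left
    · intro s hs t ht z hz
      have hs' : t ≤ q := by rcases ht with h | rfl; exacts [(hq1 _ h).le, le_rfl]
      rcases hR.out (Or.inl hs) (Or.inl ht) hz with h | h
      · exact h
      · exact absurd (hq2 z h) (not_lt.2 (hz.2.trans hs'))
    · intro r
      by_cases e : r = q
      · subst e; simpa using hbc
      · simp [Function.update_of_ne e]
    · intro r hr hx
      have : r = q := by by_contra e; simp [Function.update_of_ne e] at hx
      subst this
      exact ⟨hr, by rintro z (h | rfl); exacts [(hq1 z h).le, le_rfl]⟩
    · rw [h1, iprod_union hV (by rintro s hs t rfl; exact hq1 s hs), iprod_singleton, Function.update_self]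
      congr 1
      refine iprod_map hU hV id (fun _ _ _ _ h => h) (by simp) (fun r hr => ?_)
      exact Function.update_of_ne (ne_of_lt (hq1 r hr)) _ _

lemma iprod_factor {U : Q → Wd ι} (hU : LFin U) {a F c : Wd ι} (h : iprod hU univ = a * F * c) :
    ∃ (R : Set Q) (x V y : Q → Wd ι) (hV : LFin V), R.OrdConnected ∧ (∀ q, U q = x q * V q * y q) ∧
      (∀ q ∈ R, x q ≠ 1 → IsLeast R q) ∧ (∀ q ∈ R, y q ≠ 1 → IsGreatest R q) ∧ F = iprod hV R := by
  rw [mul_assoc] at h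
  obtain ⟨R1, x, V1, hV1, -, hR1, e1, hx, h1⟩ := cutR hU ordConnected_univ h
  obtain ⟨R2, V, y, hV, hsub, hR2, e2, hy, h2⟩ := cutL hV1 hR1 h1.symm
  refine ⟨R2, x, V, y, hV, hR2, fun q => by rw [e1, e2, mul_assoc], fun q hq hne => ⟨hq, fun r hr => ?_⟩, hy, h2⟩
  exact (hx q (hsub hq) hne).2 (hsub hr)

lemma lcnt_mul (a : ι) (k m : ℕ) (W W' : Wd ι) : lcnt a k ((W * W').s m) =
    lcnt a k (W.s m) + lcnt a k (W'.s m) := by rw [Wd.s_mul, lcnt_append]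

/-- at most one marker is cut -/
lemma cut_one {P A1 A2 T1 z : Wd ι} (h1 : A1 * T1 ∣ A2) (hz : z ∣ P) (h2 : A2 ∣ P)
    (b1 : ¬ A1 * T1 ∣ z) (b2 : ¬ z ∣ A2) : False := by
  rcases Wd.dvd_total hz h2 with h | h
  · exact b2 h
  · exact b1 (h1.trans h)

theorem red_crit {D : Subgroup (H ι)} {X : Q → Wd ι} {hX : LFin X} (SX : DSys D X hX)
    (a : ι') (live : Fin 3 → ℕ → Prop) (M : ℕ → ℕ) {U : Q → Wd ι'} (hU : LFin U)
    (A B : Fin 3 → Q → Wd ι') (lv : Fin 3 → Q → ℕ) (sg : Q → Bool)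
    (hlive : ∀ i q, live i (lv i q)) (hM : ∀ k, 0 < M k)
    (hdec : ∀ i q, U q = A i q * blk a M (lv i q) (sg q) * B i q)
    (hord : ∀ q i j, i ≠ j → A i q * blk a M (lv i q) (sg q) ∣ A j q ∨
      A j q * blk a M (lv j q) (sg q) ∣ A i q)
    (hc : ∀ i, ∀ l : List Q, l.Nodup → ∀ k, live i k →
      (l.map fun q => lcnt a k ((A i q).s (k+1)) + lcnt a k ((B i q).s (k+1))).sum < M k)
    (Z : Fin 3 → ℕ → Wd ι)
    (hZ : ∀ i q, X q = if sg q then Z i (lv i q) else (Z i (lv i q))⁻¹)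
    (hred : ∀ q, Red (U q)) : Red (iprod hU univ) := by
  classical
  intro a0 F c0 hF hF1
  obtain ⟨R, x, V, y, hV, hR, hdx, hx, hy, rfl⟩ := iprod_factor hU hF
  by_cases hss : R.Subsingleton
  · rcases hss.eq_empty_or_singleton with rfl | ⟨q, rfl⟩
    · simp
    · rw [iprod_singleton] at hF1 ⊢
      exact hred q _ _ _ (hdx q) hF1
  · exfalso
    obtain ⟨r, hr, r', hr', hlt⟩ : ∃ r ∈ R, ∃ r' ∈ R, r < r' := by
      rw [Set.not_subsingleton_iff] at hss
      obtain ⟨r, hr, r', hr', hne⟩ := hss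
      rcases lt_or_gt_of_ne hne with h | h
      exacts [⟨r, hr, r', hr', h⟩, ⟨r', hr', r, hr, h⟩]
    set bad : Wd ι' → Q → Fin 3 → Prop := fun z q i =>
      ¬ A i q * blk a M (lv i q) (sg q) ∣ z ∧ ¬ z ∣ A i q with hbad
    have hAd : ∀ i q, A i q ∣ U q := fun i q => ⟨_, by rw [hdec i q, mul_assoc]⟩
    have hbad1 : ∀ z q, z ∣ U q → ∀ i j, bad z q i → bad z q j → i = j := by
      intro z q hz i j hi hj
      by_contra hne
      rcases hord q i j hne with h | h
      · exact cut_one h hz (hAd j q) hi.1 hj.2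
      · exact cut_one h hz (hAd i q) hj.1 hi.2
    have hx1 : ∀ q, x q ∣ U q := fun q => ⟨V q * y q, by rw [hdx q, mul_assoc]⟩
    have hx2 : ∀ q, x q * V q ∣ U q := fun q => ⟨y q, hdx q⟩
    have hbx : ∀ q ∈ R, ∀ i, bad (x q) q i → IsLeast R q := by
      intro q hq i hb
      apply hx q hq
      intro e
      rw [e] at hb; exact hb.2 (one_dvd _)
    have hby : ∀ q ∈ R, ∀ i, bad (x q * V q) q i → IsGreatest R q := by
      intro q hq i hb
      apply hy q hq
      intro e
      have : x q * V q = U q := by rw [hdx q, e, mul_one]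
      rw [this] at hb; exact hb.1 ⟨_, hdec i q⟩
    obtain ⟨i, hi⟩ : ∃ i, ∀ q ∈ R, ¬ bad (x q) q i ∧ ¬ bad (x q * V q) q i := by
      by_contra hcon
      push Not at hcon
      have h3 : ∀ i, (∃ q, IsLeast R q ∧ bad (x q) q i) ∨ (∃ q, IsGreatest R q ∧ bad (x q * V q) q i) := by
        intro i
        obtain ⟨q, hq, h⟩ := hcon i
        by_cases hb : bad (x q) q i
        · exact Or.inl ⟨q, hbx q hq i hb, hb⟩
        · exact Or.inr ⟨q, hby q hq i (h hb), h hb⟩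
      have u1 : ∀ i j, (∃ q, IsLeast R q ∧ bad (x q) q i) → (∃ q, IsLeast R q ∧ bad (x q) q j) → i = j := by
        rintro i j ⟨q, hq, hb⟩ ⟨q', hq', hb'⟩
        obtain rfl := hq.unique hq'
        exact hbad1 _ _ (hx1 q) _ _ hb hb'
      have u2 : ∀ i j, (∃ q, IsGreatest R q ∧ bad (x q * V q) q i) →
          (∃ q, IsGreatest R q ∧ bad (x q * V q) q j) → i = j := by
        rintro i j ⟨q, hq, hb⟩ ⟨q', hq', hb'⟩
        obtain rfl := hq.unique hq'
        exact hbad1 _ _ (hx2 q) _ _ hb hb'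
      rcases h3 0 with h0 | h0 <;> rcases h3 1 with h1 | h1 <;> rcases h3 2 with h2 | h2 <;>
      first
        | exact absurd (u1 _ _ h0 h1) (by decide)
        | exact absurd (u1 _ _ h0 h2) (by decide)
        | exact absurd (u1 _ _ h1 h2) (by decide)
        | exact absurd (u2 _ _ h0 h1) (by decide)
        | exact absurd (u2 _ _ h0 h2) (by decide)
        | exact absurd (u2 _ _ h1 h2) (by decide)
    set S : Set Q := {q | q ∈ R ∧ x q ∣ A i q ∧ A i q * blk a M (lv i q) (sg q) ∣ x q * V q} with hS
    have hnt : ∀ q ∈ R, ¬ IsLeast R q → ¬ IsGreatest R q → q ∈ S := by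
      intro q hq h1 h2
      have ex : x q = 1 := by by_contra h; exact h1 (hx q hq h)
      have ey : y q = 1 := by by_contra h; exact h2 (hy q hq h)
      refine ⟨hq, by rw [ex]; exact one_dvd _, ?_⟩
      have : x q * V q = U q := by rw [hdx q, ey, mul_one]
      rw [this]; exact ⟨_, hdec i q⟩
    have hSo : S.OrdConnected := by
      refine ⟨fun s hs t ht z hz => ?_⟩
      rcases eq_or_lt_of_le hz.1 with rfl | h1
      · exact hs
      rcases eq_or_lt_of_le hz.2 with rfl | h2
      · exact ht
      exact hnt z (hR.out hs.1 ht.1 hz) (fun h => absurd (h.2 hs.1) (not_le.2 h1))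
        (fun h => absurd (h.2 ht.1) (not_le.2 h2))
    have hAB : ∀ q, ∃ A' B' : Wd ι', q ∈ R → (q ∈ S → V q = A' * blk a M (lv i q) (sg q) * B') ∧
        (q ∉ S → V q = A' * B') ∧ ∀ k, lcnt a k (A'.s (k+1)) + lcnt a k (B'.s (k+1)) ≤
          lcnt a k ((A i q).s (k+1)) + lcnt a k ((B i q).s (k+1)) := by
      intro q
      by_cases hq : q ∈ R
      swap
      · exact ⟨1, 1, fun h => absurd h hq⟩
      by_cases hqS : q ∈ S
      · obtain ⟨-, ⟨e, he⟩, ⟨f, hf⟩⟩ := hqS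
        have e1 : V q = e * blk a M (lv i q) (sg q) * f := by
          rw [he] at hf; simp only [mul_assoc] at hf ⊢; exact mul_left_cancel hf
        have e2 : B i q = f * y q := by
          have := hdec i q
          rw [hdx q, hf] at this
          simp only [mul_assoc] at this
          exact (mul_left_cancel (mul_left_cancel this)).symm
        refine ⟨e, f, fun _ => ⟨fun _ => e1, fun h => absurd ⟨hq, ⟨e, he⟩, ⟨f, hf⟩⟩ h, fun k => ?_⟩⟩
        rw [he, e2, lcnt_mul, lcnt_mul]; omega
      · refine ⟨V q, 1, fun _ => ⟨fun h => absurd h hqS, fun _ => by simp, fun k => ?_⟩⟩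
        by_cases hd : A i q * blk a M (lv i q) (sg q) ∣ x q
        · obtain ⟨f, hf⟩ := hd
          have e2 : B i q = f * (V q * y q) := by
            have := hdec i q
            rw [hdx q, hf] at this
            simp only [mul_assoc] at this
            exact (mul_left_cancel (mul_left_cancel this)).symm
          rw [e2, lcnt_mul, lcnt_mul]; simp [lcnt]; omega
        · have h1 : x q ∣ A i q := by
            by_contra h; exact (hi q hq).1 ⟨hd, h⟩
          have h2 : x q * V q ∣ A i q := by
            by_contra h; exact (hi q hq).2 ⟨fun h' => hqS ⟨hq, h1, h'⟩, h⟩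
          obtain ⟨f, hf⟩ := h2
          rw [hf, lcnt_mul, lcnt_mul]; simp [lcnt]; omega
    choose A' B' hAB using hAB
    have key := marker_red a (live i) M hV A' B' (S := S) (R := R) (fun q hq => hq.1) (lv i) sg (hlive i) hM
      (fun q hq => (hAB q hq.1).1 hq) (fun q hq hn => (hAB q hq).2.1 hn)
      (fun l hl hlR k hk => by
        refine lt_of_le_of_lt ?_ (hc i l hl k hk)
        apply List.sum_le_sum
        intro q hq
        exact (hAB q (hlR q hq)).2.2 k) hX (Z i) (hZ i) hF1
    obtain ⟨c, h1, h2⟩ := SX.exists_between hlt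
    have hcR : c ∈ R := hR.out hr hr' ⟨h1.le, h2.le⟩
    have hcS : c ∈ S := hnt c hcR (fun h => absurd (h.2 hr) (not_le.2 h1)) (fun h => absurd (h.2 hr') (not_le.2 h2))
    exact iprod_ne_one hX hcS (SX.ne c) (SX.redT hSo |>.eq_one key)

end
end GrifAux

namespace GrifAux
variable {ι ι' : Type}

lemma level_up {Γ : Subgroup (H ι × H ι')} (hΓ : Good Γ) (m : ℕ) (g : H ι) (N : ℕ) :
    ∀ W : Wd ι', Red W → (W.s m).length = N → (g, pr W) ∈ Γ → ∃ V, Red V ∧ (g, pr V) ∈ Γ ∧ V.s m = [] := by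
  induction N using Nat.strong_induction_on with
  | _ N ih =>
  intro W hW hN hg
  rcases hs : W.s m with _ | ⟨x, L⟩
  · exact ⟨W, hW, hg, hs⟩
  · obtain ⟨Y0, Y1, e, h0, h1⟩ := Wd.letter_split (L1 := []) (L2 := L) (x := x) (by simpa using hs)
    have hY0 : pr Y0 ∈ psnd Γ := by
      have := hΓ.fc2 1 Y0 (Wd.of x * Y1) (by simpa [mul_assoc, e] using hW)
        (by rw [one_mul, ← mul_assoc, ← e]; exact mem_psnd.2 ⟨_, hg⟩)
      exact this
    obtain ⟨g0, hg0⟩ := mem_psnd.1 hY0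
    have hx : ((1 : H ι), pr (Wd.of x)) ∈ Γ := hΓ.p2 _ ⟨_, pureW_of x, rfl⟩
    have hn : (g, pr (Y0 * Y1)) ∈ Γ := by
      have := Γ.mul_mem (Γ.inv_mem (Γ.mul_mem (Γ.mul_mem hg0 hx) (Γ.inv_mem hg0))) hg
      have e2 : ((g0, pr Y0) * (1, pr (Wd.of x)) * (g0, pr Y0)⁻¹)⁻¹ * (g, pr W) = (g, pr (Y0 * Y1)) := by
        rw [e]
        ext1
        · simp
        · simp [mul_assoc]
      rwa [e2] at this
    have hsub := (nf_sublist (Y0 * Y1) m).length_le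
    rw [Wd.s_mul, h0, h1, List.nil_append] at hsub
    refine ih ((nf (pr (Y0 * Y1))).s m).length ?_ _ (red_nf _) rfl (by rwa [pr_nf])
    rw [← hN, hs, List.length_cons]; omega

lemma fac_split {X Y a F b : Wd ι} {x : Lt ι} (h : X * (Wd.of x * Y) = a * (F * b))
    (hF : F.s (x.1.2+1) = []) : (∃ p q, X = p * F * q) ∨ (∃ p q, Y = p * F * q) := by
  have hne : (Wd.of x).s (x.1.2+1) ≠ [] := by rw [Wd.of_s_pos (Nat.lt_succ_self _)]; simp
  have notF : ∀ e f, F = e * (Wd.of x * f) → False := by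
    intro e f he; rw [he] at hF; simp at hF; exact hne hF.2.1
  rcases Wd.levi h with ⟨e, h1, h2⟩ | ⟨e, h1, h2⟩
  · -- a = X * e
    rcases Wd.levi h2 with ⟨f, h3, h4⟩ | ⟨f, h3, h4⟩
    · exact Or.inr ⟨f, b, by rw [h4, mul_assoc]⟩
    · rcases Wd.of_eq_mul h3 with rfl | rfl
      · rw [one_mul] at h3
        subst h3
        rcases Wd.levi h4 with ⟨f, h5, h6⟩ | ⟨f, h5, h6⟩
        · rcases Wd.of_eq_mul h5 with rfl | rfl
          · exact Or.inl ⟨X, 1, by simp⟩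
          · exact absurd (by rw [h5]; simp) (fun h => notF 1 1 h)
        · exact absurd (by rw [h5]; simp) (fun h => notF 1 f h)
      · exact Or.inr ⟨1, b, by rw [one_mul] at h4; rw [← h4, one_mul]⟩
  · -- X = a * e
    rcases Wd.levi h2 with ⟨f, h3, h4⟩ | ⟨f, h3, h4⟩
    · exact Or.inl ⟨a, f, by rw [h1, h3, mul_assoc]⟩
    · rcases Wd.levi h4 with ⟨f', h5, h6⟩ | ⟨f', h5, h6⟩
      · exact absurd (by rw [h3, h5]) (fun h => notF e f' h)
      · rcases Wd.of_eq_mul h5 with rfl | rfl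
        · exact Or.inl ⟨a, 1, by rw [h1, h3]; simp⟩
        · exact absurd (by rw [h3, h5]; simp) (fun h => notF e 1 h)

lemma mk_pos_ne {l : List (Lt ι)} (h : ∀ x ∈ l, x.2 = true) (h1 : (FreeGroup.mk l : FG ι) = 1) : l = [] := by
  have := mk_pos l h
  rw [h1, map_one] at this
  have h2 : (l.length : ℤ) = 0 := by
    have := ofAdd_eq_one.1 this.symm; exact this
  exact List.length_eq_zero_iff.1 (by exact_mod_cast h2)

lemma red_hat {P V : Wd ι} {c : ι × ℕ} (hP : PosW P) (hPc : P.s (c.2+1) = []) (hV : Red V)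
    (hVc : V.s (c.2+1) = []) : Red (P * (Wd.of (c, true) * (V * Wd.of (c, true)))) := by
  intro a F b h hF
  have hs : (a * F * b).s (c.2+1) = [(c, true), (c, true)] := by
    rw [← h]; simp [hPc, hVc, Wd.of_s_pos (x := (c, true)) (Nat.lt_succ_self c.2)]
  have hF0 : F.s (c.2+1) = [] := by
    apply mk_pos_ne
    · intro x hx
      have : x ∈ (a * F * b).s (c.2+1) := by simp [hx]
      rw [hs] at this; simp at this; rw [this]
    · exact (pr_eq_one).1 hF _
  rw [mul_assoc] at h
  rcases fac_split h hF0 with ⟨p, q, e⟩ | ⟨p, q, e⟩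
  · exact hP.red p F q e hF
  · have e' : V * (Wd.of (c, true) * 1) = p * (F * q) := by rw [mul_one, e, mul_assoc]
    rcases fac_split e' hF0 with ⟨p, q, e⟩ | ⟨p, q, e⟩
    · exact hV p F q e hF
    · exact (Wd.mul_eq_one (Wd.mul_eq_one e.symm).1).2

def sgd (b : Bool) (w : Wd ι) : Wd ι := if b then w else w⁻¹

lemma sgd_not (b : Bool) (w : Wd ι) : sgd (!b) w = (sgd b w)⁻¹ := by cases b <;> simp [sgd]

lemma sgd_inj {b b' : Bool} {w : Wd ι} (h : w ≠ w⁻¹) : sgd b w = sgd b' w ↔ b = b' := by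
  cases b <;> cases b' <;> simp [sgd, h, h.symm]

lemma ne_inv_of_red {w : Wd ι} (h : Red w) (h1 : w ≠ 1) : w ≠ w⁻¹ := fun e =>
  h1 (h.eq_one (pr_eq_one_of_self_inv e))

/-- enumeration of piece types -/
lemma types {D : Subgroup (H ι)} {Q : Type} [LinearOrder Q] {X : Q → Wd ι} {hX : LFin X} (SX : DSys D X hX) :
    ∃ (k : Q → ℕ) (sg : Q → Bool) (Z : ℕ → Wd ι), (∀ q, X q = sgd (sg q) (Z (k q))) ∧
      (∀ q r, k q = k r ↔ (X q = X r ∨ X q = (X r)⁻¹)) ∧ (∀ j, pr (Z j) ∈ D) ∧ (∀ m, {q | k q < m}.Finite) := by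
  classical
  let st : Setoid Q := ⟨fun q r => X q = X r ∨ X q = (X r)⁻¹, ⟨fun _ => Or.inl rfl,
    by rintro x y (h | h) <;> simp [h], by rintro x y z (h | h) (h' | h') <;> simp [h, h']⟩⟩
  have hQ : Countable Q := by
    have : (⋃ m, {q | (X q).s m ≠ []}) = univ := by
      ext q; simp only [mem_iUnion, mem_setOf_eq, mem_univ, iff_true]
      exact Wd.exists_s_ne (SX.ne q)
    rw [← Set.countable_univ_iff, ← this]
    exact Set.countable_iUnion fun m => (hX m).countable
  obtain ⟨f, hf⟩ := Countable.exists_injective_nat (Quotient st)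
  let k : Q → ℕ := fun q => f ⟦q⟧
  have hk : ∀ q r, k q = k r ↔ (X q = X r ∨ X q = (X r)⁻¹) := fun q r =>
    ⟨fun h => Quotient.exact (hf h), fun h => congrArg f (Quotient.sound h)⟩
  let Z : ℕ → Wd ι := fun j => if h : ∃ q, k q = j then X h.choose else 1
  have hZ : ∀ q, ∃ r, k r = k q ∧ Z (k q) = X r := by
    intro q
    have h : ∃ r, k r = k q := ⟨q, rfl⟩
    exact ⟨h.choose, h.choose_spec, dif_pos h⟩
  refine ⟨k, fun q => decide (X q = Z (k q)), Z, fun q => ?_, hk, fun j => ?_, fun m => ?_⟩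
  · obtain ⟨r, hr, e⟩ := hZ q
    by_cases h : X q = Z (k q)
    · simp [sgd, ← h]
    · simp only [sgd, h, decide_false, Bool.false_eq_true, if_false]
      rcases (hk q r).1 hr.symm with h' | h'
      · rw [e] at h; exact absurd h' h
      · rw [e, h']
  · by_cases h : ∃ q, k q = j
    · simp only [Z, dif_pos h]; exact SX.mem _
    · simp only [Z, dif_neg h, map_one]; exact one_mem _
  · have : {q | k q < m} = ⋃ j ∈ Iio m, {q | k q = j} := by ext q; simp
    rw [this]
    refine (Set.finite_Iio m).biUnion fun j _ => ?_
    by_cases h : ∃ q, k q = j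
    · obtain ⟨r, rfl⟩ := h
      obtain ⟨m', hm'⟩ := Wd.exists_s_ne (SX.ne r)
      refine (hX m').subset fun q hq => ?_
      rcases (hk q r).1 hq with h | h
      · simpa [h] using hm'
      · simp only [mem_setOf_eq, h, Wd.s_inv]
        simpa [FreeGroup.invRev] using hm'
    · have : {q | k q = j} = ∅ := by ext q; simp only [mem_setOf_eq, mem_empty_iff_false, iff_false]; exact fun h' => h ⟨q, h'⟩
      rw [this]; exact Set.finite_empty

lemma blk_mem {a : ι} {M : ℕ → ℕ} {k : ℕ} {b : Bool} {n : ℕ} {x : Lt ι} (h : x ∈ (blk a M k b).s n) :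
    x = ((a, k), b) := by
  unfold blk at h
  rw [pow_s, List.mem_flatten] at h
  obtain ⟨l, hl, hx⟩ := h
  rw [List.eq_of_mem_replicate hl] at hx
  by_cases h : k < n
  · rw [Wd.of_s_pos (x := ((a, k), b)) h] at hx; simpa using hx
  · rw [Wd.of_s_neg (x := ((a, k), b)) h] at hx; simp at hx

lemma blk_low {a : ι} {M : ℕ → ℕ} {k : ℕ} {b : Bool} {n : ℕ} (h : n ≤ k) : (blk a M k b).s n = [] := by
  apply List.eq_nil_iff_forall_not_mem.2
  intro x hx
  have := mem_level hx
  rw [blk_mem hx] at this; simp at this; omega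

lemma blk_inv (a : ι) (M : ℕ → ℕ) (k : ℕ) : (blk a M k true)⁻¹ = blk a M k false := by
  unfold blk; rw [← inv_pow, Wd.of_inv]; rfl

lemma blk_pure (a : ι) (M : ℕ → ℕ) (k : ℕ) (b : Bool) : PureW (blk a M k b) :=
  ⟨a, fun n x hx => by rw [blk_mem hx]⟩

end GrifAux

namespace GrifAux
variable {ι ι' : Type}
section
variable (a : ι) (M : ℕ → ℕ) (k : ℕ)

def tb (i : ℕ) : Wd ι := blk a M (3*k+i+1) true

def tpre (i : Fin 3) : Wd ι := ![1, tb a M k 0, tb a M k 0 * tb a M k 1] i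
def tsuf (i : Fin 3) : Wd ι := ![tb a M k 1 * tb a M k 2, tb a M k 2, 1] i

lemma tdec (i : Fin 3) : tpre a M k i * tb a M k i * tsuf a M k i = tb a M k 0 * tb a M k 1 * tb a M k 2 := by
  fin_cases i <;> simp [tpre, tsuf, mul_assoc]

lemma tord {i j : Fin 3} (h : i < j) : (∃ w, tpre a M k j = tpre a M k i * tb a M k i * w) ∧
    (∃ w, tsuf a M k i = w * tb a M k j * tsuf a M k j) := by
  fin_cases i <;> fin_cases j <;> simp [tpre, tsuf] at h ⊢

lemma lcnt_tb {n m i : ℕ} (h : 3*k+i+1 ≠ n) : lcnt a n ((tb a M k i).s m) = 0 := by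
  apply lcnt_zero
  intro x hx
  rw [blk_mem hx]; simpa using h

lemma lcnt_t {i : Fin 3} {n m : ℕ} (h : n % 3 = (i.val + 1) % 3) :
    lcnt a n ((tpre a M k i).s m) = 0 ∧ lcnt a n ((tsuf a M k i).s m) = 0 := by
  have h1 : ∀ n m, lcnt a n ((1 : Wd ι).s m) = 0 := by intro n m; simp [lcnt]
  fin_cases i <;> simp only [tpre, tsuf, Fin.zero_eta, Fin.mk_one, Fin.reduceFinMk, Matrix.cons_val, lcnt_mul, h1] <;>
    simp at h
  · rw [lcnt_tb _ _ _ (by omega), lcnt_tb _ _ _ (by omega)]; simp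
  · rw [lcnt_tb _ _ _ (by omega), lcnt_tb _ _ _ (by omega)]; simp
  · rw [lcnt_tb _ _ _ (by omega), lcnt_tb _ _ _ (by omega)]; simp

lemma tb_low {i m : ℕ} (h : m ≤ k + 1) : (tb a M k i).s m = [] := blk_low (by omega)

end

lemma sgd_s_ne {b : Bool} {w : Wd ι} {m : ℕ} : (sgd b w).s m ≠ [] ↔ w.s m ≠ [] := by
  cases b <;> simp [sgd, FreeGroup.invRev]

lemma sgd_red {b : Bool} {w : Wd ι} (h : Red w) : Red (sgd b w) := by
  cases b
  · simpa [sgd] using h.inv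
  · simpa [sgd] using h

lemma many_dense {Q : Type} [LinearOrder Q] {U : Q → Wd ι} (hU : LFin U) {S : Set (Wd ι)}
    (hb : ∀ a b : Q, a < b → ∃ c, a < c ∧ c < b)
    (hS : ∀ q, ∃ u s v, (s ∈ S ∨ s⁻¹ ∈ S) ∧ U q = u * s * v) (n : ℕ) :
    ∀ q q', q < q' → Many S n (iprod hU (Ioc q q')) := by
  induction n with
  | zero => intro _ _ _; trivial
  | succ n ih =>
    intro q q' hq
    obtain ⟨r, h1, h2⟩ := hb q q' hq
    obtain ⟨u, s, v, hs, e⟩ := hS r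
    have hr : r ∈ Ioc q q' := ⟨h1, h2.le⟩
    have hI : Ioc q q' ∩ Ioi r = Ioc r q' := by
      ext z; simp only [mem_inter_iff, mem_Ioc, mem_Ioi]
      exact ⟨fun h => ⟨h.2, h.1.2⟩, fun h => ⟨⟨h1.trans h.1, h.2⟩, h.1⟩⟩
    refine ⟨iprod hU (Ioc q q' ∩ Iio r) * u, s, v * iprod hU (Ioc r q'), hs, ?_, (ih r q' h2).left v⟩
    rw [iprod_at hU hr, hI, e]; simp only [mul_assoc]

theorem dense_ext {Γ : Subgroup (H ι × H ι')} (hΓ : Good Γ) {Q : Type} [LinearOrder Q] {X : Q → Wd ι} {hX : LFin X}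
    (SX : DSys (pfst Γ) X hX) {a b : ι'} {x1 : Code} (hx1 : x1 ∉ badS a b (psnd Γ)) :
    ∃ (U : Q → Wd ι') (hU : LFin U), DSys (psnd Γ) U hU ∧ (∀ q, (pr (X q), pr (U q)) ∈ Γ) ∧
      (∀ q r, X q = X r ↔ U q = U r) ∧ (∀ q r, X q = (X r)⁻¹ ↔ U q = (U r)⁻¹) := by
  classical
  obtain ⟨k, sg, Z, hXZ, hk, hZD, hkfin⟩ := types SX
  have hV : ∀ j, ∃ V : Wd ι', Red V ∧ (pr (Z j), pr V) ∈ Γ ∧ V.s (j+1) = [] := by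
    intro j
    obtain ⟨g', hg'⟩ := mem_pfst.1 (hZD j)
    exact level_up hΓ (j+1) (pr (Z j)) _ (nf g') (red_nf _) rfl (by rwa [pr_nf])
  choose V hVr hVΓ hVl using hV
  set y0 : Code := fun _ => false
  set Y : ℕ → Wd ι' := fun j => Ymk a b (j+1) (cde x1 y0) with hY
  set c : ℕ → Wd ι' := fun j => Wd.of ((a, j), true) with hcdef
  set W : ℕ → Wd ι' := fun j => c j * (V j * c j) with hW
  set J : ℕ → ℕ → ℕ := fun n j => lcnt a n ((Y j).s (n+1)) + lcnt a n ((W j).s (n+1)) with hJ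
  have hYl : ∀ j m, m ≤ j + 1 → (Y j).s m = [] := fun j m h => Ymk_low h
  have hWl : ∀ j m, m ≤ j → (W j).s m = [] := by
    intro j m h
    have h1 : (V j).s m = [] := by
      rw [← (V j).coh m (j+1) (by omega), hVl]; rfl
    simp only [hW, hcdef, Wd.s_mul, h1]
    rw [Wd.of_s_neg (by simp; omega)]; rfl
  have hJ0 : ∀ n q, J n (k q) ≠ 0 → q ∈ (hkfin (n+1)).toFinset := by
    intro n q h
    rw [Set.Finite.mem_toFinset, mem_setOf_eq]
    by_contra hlt
    apply h
    simp only [hJ]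
    rw [hYl _ _ (by omega), hWl _ _ (by omega)]; simp [lcnt]
  set M : ℕ → ℕ := fun n => 1 + ∑ q ∈ (hkfin (n+1)).toFinset, J n (k q) with hM
  set hat : ℕ → Wd ι' := fun j => Y j * (tb a M j 0 * tb a M j 1 * tb a M j 2) * W j with hhat
  have hatdec : ∀ (i : Fin 3) j, hat j = Y j * tpre a M j i * tb a M j i * (tsuf a M j i * W j) := by
    intro i j
    have := tdec a M j i
    simp only [hhat]; rw [← this]; simp only [mul_assoc]
  have hatl : ∀ j, (hat j).s j = [] := by
    intro j
    simp only [hhat, Wd.s_mul]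
    rw [hYl j j (by omega), hWl j j le_rfl, tb_low _ _ _ (by omega), tb_low _ _ _ (by omega),
      tb_low _ _ _ (by omega)]; rfl
  have hatl' : ∀ j, (hat j).s (j+1) ≠ [] := by
    intro j
    simp only [hhat, hW, hcdef, Wd.s_mul]
    rw [Wd.of_s_pos (by simp)]; simp
  have hat1 : ∀ j, hat j ≠ 1 := fun j h => hatl' j (by rw [h]; simp)
  have hatr : ∀ j, Red (hat j) := by
    intro j
    refine red_hat (c := (a, j)) (P := Y j * (tb a M j 0 * tb a M j 1 * tb a M j 2)) ?_ ?_ (hVr j) (hVl j)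
    · intro m x hx
      simp only [Wd.s_mul, List.mem_append] at hx
      rcases hx with h | (h | h) | h
      · exact Ymk_pos _ _ _ _ m x h
      all_goals rw [blk_mem h]
    · simp only [Wd.s_mul]
      rw [hYl j _ le_rfl, tb_low _ _ _ le_rfl, tb_low _ _ _ le_rfl, tb_low _ _ _ le_rfl]; rfl
  have hatΓ : ∀ j, (pr (Z j), pr (hat j)) ∈ Γ := by
    intro j
    let E : Subgroup (H ι') := Γ.comap (MonoidHom.inr (H ι) (H ι'))
    have hE : ∀ g, g ∈ E ↔ ((1 : H ι), g) ∈ Γ := fun g => Iff.rfl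
    have hp : ∀ p, PureH p → p ∈ E := fun p hp => hΓ.p2 p hp
    have h1 : pr (Y j * (tb a M j 0 * tb a M j 1 * tb a M j 2) * c j) ∈ E := by
      rw [map_mul, map_mul, map_mul, map_mul]
      have hb : ∀ i, pr (tb a M j i) ∈ E := fun i => hp _ ⟨_, blk_pure _ _ _ _, rfl⟩
      exact E.mul_mem (E.mul_mem (pr_Ymk_mem hp _ _ _ _) (E.mul_mem (E.mul_mem (hb 0) (hb 1)) (hb 2)))
        (hp _ ⟨_, pureW_of _, rfl⟩)
    have h2 : pr (c j) ∈ E := hp _ ⟨_, pureW_of _, rfl⟩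
    have := Γ.mul_mem (Γ.mul_mem ((hE _).1 h1) (hVΓ j)) ((hE _).1 h2)
    rw [Prod.mk_mul_mk, Prod.mk_mul_mk, one_mul, mul_one, ← map_mul, ← map_mul] at this
    simpa only [hhat, hW, mul_assoc] using this
  set U : Q → Wd ι' := fun q => sgd (sg q) (hat (k q)) with hU0
  have hU : LFin U := by
    intro m
    refine (hkfin m).subset fun q hq => ?_
    simp only [hU0, mem_setOf_eq, sgd_s_ne] at hq
    by_contra hlt
    exact Wd.s_ne_mono (not_lt.1 hlt) hq (hatl (k q))
  have hUr : ∀ q, Red (U q) := fun q => sgd_red (hatr _)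
  have hUred : Red (iprod hU univ) := by
    set A : Fin 3 → Q → Wd ι' := fun i q => if sg q then Y (k q) * tpre a M (k q) i
      else (tsuf a M (k q) i * W (k q))⁻¹ with hA
    set B : Fin 3 → Q → Wd ι' := fun i q => if sg q then tsuf a M (k q) i * W (k q)
      else (Y (k q) * tpre a M (k q) i)⁻¹ with hB
    refine red_crit SX a (fun i n => n % 3 = (i.val+1) % 3) M hU A B (fun i q => 3 * k q + i + 1) sg
      ?_ ?_ ?_ ?_ ?_ (fun i n => Z ((n - i - 1) / 3)) ?_ hUr
    · intro i q; show (3 * k q + i + 1) % 3 = _; omega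
    · intro n; simp [hM]
    · intro i q
      simp only [hA, hB, hU0]
      cases hs : sg q
      · simp only [sgd, Bool.false_eq_true, if_false]
        rw [← blk_inv, hatdec i]
        simp only [mul_inv_rev, mul_assoc]; rfl
      · simp only [sgd, if_true]
        rw [hatdec i]; simp only [mul_assoc]; rfl
    · have key : ∀ q (i j : Fin 3), i < j → (A i q * blk a M (3 * k q + i + 1) (sg q) ∣ A j q ∨
          A j q * blk a M (3 * k q + j + 1) (sg q) ∣ A i q) := by
        intro q i j hij
        obtain ⟨⟨w, hw⟩, ⟨w', hw'⟩⟩ := tord a M (k q) hij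
        simp only [hA]
        cases hs : sg q
        · right
          simp only [Bool.false_eq_true, if_false]
          rw [hw', ← blk_inv]
          exact ⟨w'⁻¹, by simp only [mul_inv_rev, mul_assoc]; rfl⟩
        · left
          simp only [if_true]
          rw [hw]; exact ⟨w, by simp only [mul_assoc]; rfl⟩
      intro q i j hij
      rcases lt_or_gt_of_ne hij with h | h
      · exact key q i j h
      · exact (key q j i h).symm
    · intro i l hl n hn
      have e : ∀ q, lcnt a n ((A i q).s (n+1)) + lcnt a n ((B i q).s (n+1)) = J n (k q) := by
        intro q
        obtain ⟨h1, h2⟩ := lcnt_t a M (k q) (m := n+1) hn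
        simp only [hA, hB, hJ]
        cases hs : sg q
        · simp only [Bool.false_eq_true, if_false, Wd.s_inv, lcnt_invRev, lcnt_mul, h1, h2]; omega
        · simp only [if_true, lcnt_mul, h1, h2]; omega
      simp only [e]
      rw [← List.sum_toFinset _ hl]
      have : ∑ q ∈ l.toFinset, J n (k q) ≤ ∑ q ∈ (hkfin (n+1)).toFinset, J n (k q) :=
        Finset.sum_le_sum_of_ne_zero fun q _ h => hJ0 n q h
      simp only [hM]; omega
    · intro i q
      have : (3 * k q + i + 1 - i - 1) / 3 = k q := by omega
      show X q = if sg q then Z ((3 * k q + i + 1 - i - 1) / 3) else (Z ((3 * k q + i + 1 - i - 1) / 3))⁻¹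
      rw [this]; exact hXZ q
  have hX1 : ∀ q, Z (k q) ≠ (Z (k q))⁻¹ := by
    intro q h
    have hr : Red (X q) := by
      have := SX.redT (T := {q}) ordConnected_singleton
      rwa [iprod_singleton] at this
    apply ne_inv_of_red hr (SX.ne q)
    rw [hXZ q]
    cases sg q <;> simp [sgd, ← h]
  have hkX : ∀ q r, X q = X r ↔ (k q = k r ∧ sg q = sg r) := by
    intro q r
    constructor
    · intro h
      have hk' := (hk q r).2 (Or.inl h)
      refine ⟨hk', (sgd_inj (hX1 r)).1 ?_⟩
      rw [← hXZ r, ← h, ← hk']; exact (hXZ q).symm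
    · rintro ⟨h1, h2⟩; rw [hXZ q, hXZ r, h1, h2]
  have hkX' : ∀ q r, X q = (X r)⁻¹ ↔ (k q = k r ∧ sg q = !sg r) := by
    intro q r
    constructor
    · intro h
      have hk' := (hk q r).2 (Or.inr h)
      refine ⟨hk', (sgd_inj (hX1 r)).1 ?_⟩
      rw [sgd_not, ← hXZ r, ← h, ← hk']; exact (hXZ q).symm
    · rintro ⟨h1, h2⟩; rw [hXZ q, hXZ r, h1, h2, sgd_not]
  have hlev : ∀ q b' j, U q = sgd b' (hat j) → k q = j := by
    intro q b' j h
    have h1 : ∀ m, (hat (k q)).s m ≠ [] ↔ (hat j).s m ≠ [] := by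
      intro m; rw [← sgd_s_ne (b := b') (w := hat j), ← h, hU0]; exact sgd_s_ne.symm
    rcases lt_trichotomy (k q) j with hlt | hlt | hlt
    · exact absurd (hatl j) (Wd.s_ne_mono hlt ((h1 _).1 (hatl' _)))
    · exact hlt
    · exact absurd (hatl (k q)) (Wd.s_ne_mono hlt ((h1 _).2 (hatl' _)))
  have hU1 : ∀ j, hat j ≠ (hat j)⁻¹ := fun j => ne_inv_of_red (hatr j) (hat1 j)
  refine ⟨U, hU, ⟨hUred, ?_, ?_, ?_⟩, ?_, ?_, ?_⟩
  · intro q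
    have : pr (hat (k q)) ∈ psnd Γ := mem_psnd.2 ⟨_, hatΓ _⟩
    simp only [hU0]
    cases sg q
    · have h2 := (psnd Γ).inv_mem this
      rw [← pr_inv] at h2; exact h2
    · exact this
  · intro q h
    have h1 : (U q).s (k q + 1) ≠ [] := by rw [hU0]; exact sgd_s_ne.2 (hatl' _)
    exact h1 (by rw [h]; simp)
  · intro q q' hq hmem
    have hT : TG (MkS a b x1) (psnd Γ) := by
      by_contra h; exact hx1 h
    obtain ⟨a0, b0, e0⟩ := iprod_fac hU (R := univ) (T := Icc q q') ordConnected_Icc (subset_univ _)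
    have hr : Red (iprod hU (Icc q q')) := by
      rw [e0] at hUred; exact hUred.fac
    obtain ⟨n, hn⟩ := (hT _ ⟨hr, hmem⟩).not_many (one_MkS a b x1)
    apply hn
    have hI : Icc q q' ∩ Ioi q = Ioc q q' := by
      ext z; simp only [mem_inter_iff, mem_Icc, mem_Ioi, mem_Ioc]
      exact ⟨fun h => ⟨h.2, h.1.2⟩, fun h => ⟨⟨h.1.le, h.2⟩, h.1⟩⟩
    rw [iprod_least hU (q := q) ⟨left_mem_Icc.2 hq.le, fun z hz => hz.1⟩, hI]
    apply Many.left
    refine many_dense hU (fun a b h => SX.exists_between h) (fun r => ?_) n q q' hq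
    simp only [hU0]
    cases sg r
    · refine ⟨(W (k r))⁻¹ * (tb a M (k r) 0 * tb a M (k r) 1 * tb a M (k r) 2)⁻¹, (Y (k r))⁻¹, 1, Or.inr ?_, ?_⟩
      · rw [inv_inv]; exact ⟨_, _, rfl⟩
      · simp [sgd, hhat, mul_assoc]
    · refine ⟨1, Y (k r), (tb a M (k r) 0 * tb a M (k r) 1 * tb a M (k r) 2) * W (k r), Or.inl ⟨_, _, rfl⟩, ?_⟩
      simp [sgd, hhat, mul_assoc]
  · intro q
    have h := hatΓ (k q)
    rw [hXZ q]; simp only [hU0]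
    cases sg q
    · have := Γ.inv_mem h
      rw [Prod.inv_mk, ← pr_inv, ← pr_inv] at this; exact this
    · exact h
  · intro q r
    rw [hkX]
    constructor
    · rintro ⟨h1, h2⟩; simp only [hU0, h1, h2]
    · intro h
      have h1 := hlev q _ _ h
      refine ⟨h1, (sgd_inj (hU1 (k r))).1 ?_⟩
      simp only [hU0] at h
      rw [← h, h1]
  · intro q r
    rw [hkX']
    constructor
    · rintro ⟨h1, h2⟩; simp only [hU0, h1, h2, sgd_not]
    · intro h
      have h' : U q = sgd (!sg r) (hat (k r)) := by rw [sgd_not]; exact h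
      have h1 := hlev q _ _ h'
      refine ⟨h1, (sgd_inj (hU1 (k r))).1 ?_⟩
      rw [← h']; simp only [hU0]; rw [h1]

end GrifAux

namespace GrifAux
variable {ι ι' : Type}

lemma card_Code : Cardinal.mk Code = Cardinal.continuum := by
  simp [Code]

theorem step1 {Γ : Subgroup (H ι × H ι')} (hΓ : Good Γ) (W : Wd ι) (hW : Red W)
    {a b : ι} {a' b' : ι'} (hab : a ≠ b) (hab' : a' ≠ b') (yc : Wd ι → Code)
    (hyc : Function.Injective yc) (hinf : (badS a' b' (psnd Γ))ᶜ.Infinite) :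
    ∃ Γ1, Γ ≤ Γ1 ∧ Good Γ1 ∧ pr W ∈ pfst Γ1 ∧
      (badS a b (pfst Γ1) \ badS a b (pfst Γ)).Countable ∧
      (badS a' b' (psnd Γ1) \ badS a' b' (psnd Γ)).Countable := by
  obtain ⟨x0, hx0⟩ := hinf.nonempty
  obtain ⟨x1, hx1, hne⟩ := (hinf.diff (finite_singleton x0)).nonempty
  obtain ⟨Γ1, hle, hG1, hc, hc', hb, hb'⟩ := omega_closure hΓ W hW (a := a) (b := b) hab' yc hyc hx0
  have hx1' : x1 ∉ badS a' b' (psnd Γ1) := by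
    intro h; rcases hb' h with h | h
    · exact hx1 h
    · exact hne h
  obtain ⟨Q, _, X, hX, SX, e⟩ := regular hG1.fc1 (fun p hp => hG1.pure1 hp) hW hc hc'
  obtain ⟨U, hU, SU, hm, h1, h2⟩ := dense_ext hG1 SX hx1'
  set S := {g : H ι × H ι' | ∃ T : Set Q, T.OrdConnected ∧ g = (pr (iprod hX T), pr (iprod hU T))} with hS
  have e1 : Prod.fst '' S = DT hX := by
    ext g; constructor
    · rintro ⟨_, ⟨T, hT, rfl⟩, rfl⟩; exact ⟨T, hT, rfl⟩
    · rintro ⟨T, hT, rfl⟩; exact ⟨_, ⟨T, hT, rfl⟩, rfl⟩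
  have e2 : Prod.snd '' S = DT hU := by
    ext g; constructor
    · rintro ⟨_, ⟨T, hT, rfl⟩, rfl⟩; exact ⟨T, hT, rfl⟩
    · rintro ⟨T, hT, rfl⟩; exact ⟨_, ⟨T, hT, rfl⟩, rfl⟩
  refine ⟨Γ1 ⊔ Subgroup.closure S, hle.trans le_sup_left, dense_step hG1 SX SU hm h1 h2, ?_, ?_, ?_⟩
  · rw [pfst_sup, e1]
    apply Subgroup.mem_sup_right
    apply Subgroup.subset_closure
    exact ⟨univ, ordConnected_univ, by rw [e]⟩
  · rw [pfst_sup, e1]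
    refine (Occ_countable hab W).mono ?_
    rintro x ⟨hx, hx'⟩
    by_contra hO
    have hx2 : x ∉ badS a b (pfst Γ1) := fun h => (hb h).elim hx' hO
    refine hx (TG.dense hG1.fc1 SX (not_not.1 hx2) ?_)
    rw [← e]; exact not_not.1 hO
  · rw [psnd_sup, e2]
    refine ((Occ_countable hab' (iprod hU univ)).union (countable_singleton x0)).mono ?_
    rintro x ⟨hx, hx'⟩
    by_contra hO
    have hx2 : x ∉ badS a' b' (psnd Γ1) := fun h => (hb' h).elim hx' (fun h => hO (Or.inr h))
    exact hx (TG.dense hG1.fc2 SU (not_not.1 hx2) (not_not.1 fun h => hO (Or.inl h)))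

theorem step2 {Γ : Subgroup (H ι × H ι')} (hΓ : Good Γ) (t : Wd ι ⊕ Wd ι')
    {a b : ι} {a' b' : ι'} (hab : a ≠ b) (hab' : a' ≠ b') (yc : Wd ι → Code)
    (hyc : Function.Injective yc) (yc' : Wd ι' → Code) (hyc' : Function.Injective yc')
    (hinf : (badS a b (pfst Γ))ᶜ.Infinite) (hinf' : (badS a' b' (psnd Γ))ᶜ.Infinite) :
    ∃ Γ1, Γ ≤ Γ1 ∧ Good Γ1 ∧ (∀ W, t = Sum.inl W → pr W ∈ pfst Γ1) ∧ (∀ W, t = Sum.inr W → pr W ∈ psnd Γ1) ∧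
      (badS a b (pfst Γ1) \ badS a b (pfst Γ)).Countable ∧
      (badS a' b' (psnd Γ1) \ badS a' b' (psnd Γ)).Countable := by
  rcases t with W | W
  · obtain ⟨Γ1, h1, h2, h3, h4, h5⟩ := step1 hΓ (nf (pr W)) (red_nf _) hab hab' yc hyc hinf'
    refine ⟨Γ1, h1, h2, fun W' h => ?_, fun W' h => (by cases h), h4, h5⟩
    cases h; rwa [pr_nf] at h3
  · obtain ⟨Γ1, h1, h2, h3, h4, h5⟩ := step1 hΓ.swap (nf (pr W)) (red_nf _) hab' hab yc' hyc' (by rwa [psnd_swp])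
    rw [pfst_swp] at h4; rw [psnd_swp] at h5
    refine ⟨swp Γ1, ?_, h2.swap, fun W' h => (by cases h), fun W' h => ?_, by rwa [pfst_swp], by rwa [psnd_swp]⟩
    · rw [← swp_swp Γ]; exact swp_mono h1
    · cases h; rw [pr_nf] at h3; rwa [psnd_swp]

lemma badS_pure {a b : ι} (hab : a ≠ b) : badS a b (pureGp ι) = ∅ := by
  ext x
  simp only [mem_empty_iff_false, iff_false]
  refine not_not.2 ?_
  apply TG.closure PP_sys
  rintro X ⟨hr, hp⟩
  rcases hp with hp | rfl
  · apply Av.tame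
    rintro p _ q ⟨n, y, rfl⟩
    obtain ⟨α, h⟩ := hp
    refine ⟨fun e => not_pure_Ymk hab n (cde x y) ⟨α, fun m z hz => h m z ?_⟩,
      fun e => not_pure_Ymk hab n (cde x y) ⟨α, fun m z hz => ?_⟩⟩
    · rw [e]; simp [hz]
    · have h3 : z ∈ (X⁻¹).s m := by rw [e]; simp [hz]
      rw [Wd.s_inv, mem_invRev] at h3
      have h4 := h m (z.1, !z.2) h3
      exact h4
  · exact ⟨[], by simp, by simp⟩

theorem main_iso (hι : Nontrivial ι) (hι' : Nontrivial ι') (yc : Wd ι → Code)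
    (hyc : Function.Injective yc) (yc' : Wd ι' → Code) (hyc' : Function.Injective yc') :
    Nonempty ((H ι ⧸ NN ι) ≃* (H ι' ⧸ NN ι')) := by
  classical
  obtain ⟨a, b, hab⟩ := hι
  obtain ⟨a', b', hab'⟩ := hι'
  let T := Wd ι ⊕ Wd ι'
  have hT : Cardinal.mk T ≤ Cardinal.continuum := by
    have h1 : Cardinal.mk Code = Cardinal.continuum := card_Code
    have h2 := (Cardinal.mk_le_of_injective hyc).trans h1.le
    have h3 := (Cardinal.mk_le_of_injective hyc').trans h1.le
    rw [Cardinal.mk_sum, Cardinal.lift_id, Cardinal.lift_id]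
    exact Cardinal.add_le_of_le Cardinal.aleph0_le_continuum h2 h3
  obtain ⟨r, hr, hord⟩ := Cardinal.exists_ord_eq T
  have hseg : ∀ t, Cardinal.mk {s // r s t} < Cardinal.continuum := by
    intro t
    refine lt_of_lt_of_le ?_ hT
    exact Cardinal.card_typein_lt (r := r) t hord
  let Γ0 : Subgroup (H ι × H ι') := (pureGp ι).prod (pureGp ι')
  let P : T → Subgroup (H ι × H ι') → Subgroup (H ι × H ι') → Prop := fun t Γ Γ1 =>
    Γ ≤ Γ1 ∧ Good Γ1 ∧ (∀ W, t = Sum.inl W → pr W ∈ pfst Γ1) ∧ (∀ W, t = Sum.inr W → pr W ∈ psnd Γ1) ∧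
      (badS a b (pfst Γ1) \ badS a b (pfst Γ)).Countable ∧
      (badS a' b' (psnd Γ1) \ badS a' b' (psnd Γ)).Countable
  let stp : T → Subgroup (H ι × H ι') → Subgroup (H ι × H ι') := fun t Γ =>
    if h : ∃ Γ1, P t Γ Γ1 then h.choose else Γ
  have hwf : WellFounded r := hr.wf
  let chain : ∀ t : T, (∀ s, r s t → Subgroup (H ι × H ι')) → Set (Subgroup (H ι × H ι')) :=
    fun t f => insert Γ0 {Γ | ∃ s h, Γ = f s h}
  let F : T → Subgroup (H ι × H ι') := hwf.fix fun t f => stp t (sSup (chain t f))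
  let C : T → Set (Subgroup (H ι × H ι')) := fun t => insert Γ0 {Γ | ∃ s, r s t ∧ Γ = F s}
  have hF : ∀ t, F t = stp t (sSup (C t)) := by
    intro t
    have : F t = stp t (sSup (chain t fun s _ => F s)) := hwf.fix_eq _ t
    rw [this]; congr 2
    simp only [chain, C]; congr 1; ext; simp
  have p1 : pfst Γ0 = pureGp ι := by
    ext x; rw [mem_pfst]
    simp only [Γ0, Subgroup.mem_prod]
    exact ⟨fun ⟨_, h, _⟩ => h, fun h => ⟨1, h, one_mem _⟩⟩
  have p2 : psnd Γ0 = pureGp ι' := by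
    ext x; rw [mem_psnd]
    simp only [Γ0, Subgroup.mem_prod]
    exact ⟨fun ⟨_, _, h⟩ => h, fun h => ⟨1, one_mem _, h⟩⟩
  have hb1 : badS a b (pfst Γ0) = ∅ := by rw [p1, badS_pure hab]
  have hb2 : badS a' b' (psnd Γ0) = ∅ := by rw [p2, badS_pure hab']
  have main : ∀ t, P t (sSup (C t)) (F t) ∧
      badS a b (pfst (F t)) ⊆ (⋃ s ∈ {s | r s t ∨ s = t}, badS a b (pfst (F s)) \ badS a b (pfst (sSup (C s)))) ∧
      badS a' b' (psnd (F t)) ⊆ (⋃ s ∈ {s | r s t ∨ s = t}, badS a' b' (psnd (F s)) \ badS a' b' (psnd (sSup (C s)))) := by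
    intro t
    induction t using hwf.induction with
    | _ t ih =>
    have hne : (C t).Nonempty := ⟨Γ0, Or.inl rfl⟩
    have h0 : ∀ s, r s t → Γ0 ≤ F s := fun s hs =>
      le_trans (le_sSup (Or.inl rfl)) (ih s hs).1.1
    have hmono : ∀ s s', r s' t → r s s' → F s ≤ F s' := fun s s' h h' =>
      le_trans (le_sSup (Or.inr ⟨s, h', rfl⟩)) (ih s' h).1.1
    have hch : IsChain (· ≤ ·) (C t) := by
      rintro x hx y hy hxy
      rcases hx with rfl | ⟨s, hs, rfl⟩ <;> rcases hy with rfl | ⟨s', hs', rfl⟩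
      · exact absurd rfl hxy
      · exact Or.inl (h0 _ hs')
      · exact Or.inr (h0 _ hs)
      · rcases trichotomous_of r s s' with h | h | h
        · exact Or.inl (hmono _ _ hs' h)
        · subst h; exact absurd rfl hxy
        · exact Or.inr (hmono _ _ hs h)
    have hG : Good (sSup (C t)) := good_sSup hne hch (by
      rintro _ (rfl | ⟨s, hs, rfl⟩)
      · exact good_bot
      · exact (ih s hs).1.2.1)
    have hB1 : badS a b (pfst (sSup (C t))) ⊆ ⋃ s ∈ {s | r s t}, badS a b (pfst (F s)) \ badS a b (pfst (sSup (C s))) := by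
      intro x hx
      by_contra hc
      apply hx
      intro X hX
      obtain ⟨Γ', hΓ', hm⟩ := (mem_pfst_sSup hne hch _).1 hX.2
      rcases hΓ' with rfl | ⟨s, hs, rfl⟩
      · have : x ∉ badS a b (pfst Γ0) := by rw [hb1]; simp
        exact not_not.1 this X ⟨hX.1, hm⟩
      · have : x ∉ badS a b (pfst (F s)) := by
          intro h
          have h2 := (ih s hs).2.1 h
          apply hc
          simp only [mem_iUnion, mem_ofPred_eq] at h2 ⊢
          obtain ⟨s', h3, h4⟩ := h2
          exact ⟨s', h3.elim (fun h => trans_of r h hs) (fun h => h ▸ hs), h4⟩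
        exact not_not.1 this X ⟨hX.1, hm⟩
    have hB2 : badS a' b' (psnd (sSup (C t))) ⊆ ⋃ s ∈ {s | r s t}, badS a' b' (psnd (F s)) \ badS a' b' (psnd (sSup (C s))) := by
      intro x hx
      by_contra hc
      apply hx
      intro X hX
      obtain ⟨Γ', hΓ', hm⟩ := (mem_psnd_sSup hne hch _).1 hX.2
      rcases hΓ' with rfl | ⟨s, hs, rfl⟩
      · have : x ∉ badS a' b' (psnd Γ0) := by rw [hb2]; simp
        exact not_not.1 this X ⟨hX.1, hm⟩
      · have : x ∉ badS a' b' (psnd (F s)) := by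
          intro h
          have h2 := (ih s hs).2.2 h
          apply hc
          simp only [mem_iUnion, mem_ofPred_eq] at h2 ⊢
          obtain ⟨s', h3, h4⟩ := h2
          exact ⟨s', h3.elim (fun h => trans_of r h hs) (fun h => h ▸ hs), h4⟩
        exact not_not.1 this X ⟨hX.1, hm⟩
    have hinf : ∀ (B : Set Code) (K : T → Set Code), (∀ s, r s t → (K s).Countable) →
        B ⊆ (⋃ s ∈ {s | r s t}, K s) → Bᶜ.Infinite := by
      intro B K hK hBK hfin
      have hcard : Cardinal.mk B < Cardinal.continuum := by
        refine lt_of_le_of_lt (Cardinal.mk_le_mk_of_subset hBK) ?_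
        refine lt_of_le_of_lt (Cardinal.mk_biUnion_le _ _) (lt_of_le_of_lt (mul_le_mul_right (ciSup_le' (a := Cardinal.aleph0) ?_) _) ?_)
        · rintro ⟨s, hs⟩; exact Cardinal.le_aleph0_iff_set_countable.2 (hK s hs)
        · exact Cardinal.mul_lt_of_lt Cardinal.aleph0_le_continuum (hseg t) Cardinal.aleph0_lt_continuum
      have h1 : Cardinal.mk Code = Cardinal.continuum := card_Code
      have h2 := Cardinal.mk_sum_compl B
      have h3 := Cardinal.add_lt_of_lt Cardinal.aleph0_le_continuum hcard
        ((Cardinal.mk_lt_aleph0_iff.2 hfin.to_subtype).trans Cardinal.aleph0_lt_continuum)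
      rw [h2, h1] at h3
      exact lt_irrefl _ h3
    have hex : ∃ Γ1, P t (sSup (C t)) Γ1 := step2 hG t hab hab' yc hyc yc' hyc'
      (hinf _ _ (fun s hs => (ih s hs).1.2.2.2.2.1) hB1) (hinf _ _ (fun s hs => (ih s hs).1.2.2.2.2.2) hB2)
    have hP : P t (sSup (C t)) (F t) := by
      rw [hF t]; simp only [stp]; rw [dif_pos hex]; exact hex.choose_spec
    refine ⟨hP, ?_, ?_⟩
    · intro x hx
      simp only [mem_iUnion, mem_ofPred_eq]
      by_cases h : x ∈ badS a b (pfst (sSup (C t)))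
      · have := hB1 h
        simp only [mem_iUnion, mem_ofPred_eq] at this
        obtain ⟨s, h3, h4⟩ := this
        exact ⟨s, Or.inl h3, h4⟩
      · exact ⟨t, Or.inr rfl, hx, h⟩
    · intro x hx
      simp only [mem_iUnion, mem_ofPred_eq]
      by_cases h : x ∈ badS a' b' (psnd (sSup (C t)))
      · have := hB2 h
        simp only [mem_iUnion, mem_ofPred_eq] at this
        obtain ⟨s, h3, h4⟩ := this
        exact ⟨s, Or.inl h3, h4⟩
      · exact ⟨t, Or.inr rfl, hx, h⟩
  have hmono : ∀ s s', r s s' → F s ≤ F s' := fun s s' h =>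
      le_trans (le_sSup (Or.inr ⟨s, h, rfl⟩)) (main s').1.1
  have hch : IsChain (· ≤ ·) (range F) := by
    rintro _ ⟨s, rfl⟩ _ ⟨s', rfl⟩ hxy
    rcases trichotomous_of r s s' with h | h | h
    · exact Or.inl (hmono _ _ h)
    · subst h; exact absurd rfl hxy
    · exact Or.inr (hmono _ _ h)
  have hne : (range F).Nonempty := ⟨_, ⟨Sum.inl 1, rfl⟩⟩
  have hG : Good (sSup (range F)) := good_sSup hne hch (by rintro _ ⟨s, rfl⟩; exact (main s).1.2.1)
  refine final_iso hG ?_ ?_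
  · rw [Subgroup.eq_top_iff']
    intro g
    obtain ⟨W, rfl⟩ := pr_surj g
    exact pfst_mono (le_sSup (mem_range_self (Sum.inl W))) ((main (Sum.inl W)).1.2.2.1 W rfl)
  · rw [Subgroup.eq_top_iff']
    intro g
    obtain ⟨W, rfl⟩ := pr_surj g
    exact psnd_mono (le_sSup (mem_range_self (Sum.inr W))) ((main (Sum.inr W)).1.2.2.2.1 W rfl)

lemma card_Wd (h : Cardinal.mk ι ≤ Cardinal.continuum) : ∃ yc : Wd ι → Code, Function.Injective yc := by
  have h1 : Cardinal.mk Code = Cardinal.continuum := card_Code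
  have h2 : Cardinal.mk (Lt ι) ≤ Cardinal.continuum := by
    simp only [Lt, Cardinal.mk_prod, Cardinal.lift_id]
    refine Cardinal.mul_le_of_le Cardinal.aleph0_le_continuum (Cardinal.mul_le_of_le Cardinal.aleph0_le_continuum h ?_) ?_
    · simpa using Cardinal.aleph0_le_continuum
    · exact ((Cardinal.mk_lt_aleph0).trans Cardinal.aleph0_lt_continuum).le
  have h3 : Cardinal.mk (List (Lt ι)) ≤ Cardinal.continuum :=
    (Cardinal.mk_list_le_max _).trans (max_le Cardinal.aleph0_le_continuum h2)
  have h4 : Cardinal.mk (ℕ → List (Lt ι)) ≤ Cardinal.continuum := by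
    simp only [Cardinal.mk_pi, Cardinal.prod_const, Cardinal.lift_id, Cardinal.mk_nat]
    calc _ ≤ Cardinal.continuum ^ Cardinal.aleph0 := Cardinal.power_le_power_right h3
      _ = _ := Cardinal.continuum_power_aleph0
  have h5 : Cardinal.mk (Wd ι) ≤ Cardinal.mk (ℕ → List (Lt ι)) :=
    Cardinal.mk_le_of_injective (f := Wd.s) (fun x y h => by cases x; cases y; cases h; rfl)
  obtain ⟨f⟩ := (h5.trans (h4.trans h1.ge))
  exact ⟨f, f.injective⟩

theorem alg_iso (h2 : Nontrivial ι) (h2' : Nontrivial ι') (h : Cardinal.mk ι ≤ Cardinal.continuum)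
    (h' : Cardinal.mk ι' ≤ Cardinal.continuum) : Nonempty ((H ι ⧸ NN ι) ≃* (H ι' ⧸ NN ι')) := by
  obtain ⟨y, hy⟩ := card_Wd h
  obtain ⟨y', hy'⟩ := card_Wd h'
  exact main_iso h2 h2' y hy y' hy'

end GrifAux

namespace GrifAux
open unitInterval

section glue
variable {Z : Type} [TopologicalSpace Z]

def pj (x : ℝ) : I := projIcc 0 1 zero_le_one x
lemma pj_cont : Continuous pj := continuous_projIcc (h := zero_le_one)
lemma pj_coe (x : I) : pj x = x := projIcc_val _ x
lemma pj_of {x : ℝ} (h : x ∈ Icc (0:ℝ) 1) : pj x = ⟨x, h⟩ := projIcc_of_mem _ h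
lemma coe_pj {x : ℝ} (h : x ∈ Icc (0:ℝ) 1) : (pj x : ℝ) = x := by rw [pj_of h]

/-- the subpath of `p` from time `s` to time `t`, reparametrized linearly -/
def sub (p : C(I, Z)) (s t : ℝ) : C(I, Z) :=
  ⟨fun x => p (pj ((1 - x) * s + x * t)), p.continuous.comp (pj_cont.comp (by fun_prop))⟩

lemma sub_apply (p : C(I, Z)) (s t : ℝ) (x : I) : sub p s t x = p (pj ((1 - x) * s + x * t)) := rfl

lemma conv_mem {x s t : ℝ} (hx : x ∈ Icc (0:ℝ) 1) (h : s ≤ t) : (1 - x) * s + x * t ∈ Icc s t := by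
  obtain ⟨h0, h1⟩ := hx
  constructor <;> nlinarith

lemma conv_mem' {x s t : ℝ} (hx : x ∈ Icc (0:ℝ) 1) (hs : s ∈ Icc (0:ℝ) 1) (ht : t ∈ Icc (0:ℝ) 1) :
    (1 - x) * s + x * t ∈ Icc (0:ℝ) 1 := by
  obtain ⟨h0, h1⟩ := hx
  obtain ⟨h2, h3⟩ := hs
  obtain ⟨h4, h5⟩ := ht
  constructor <;> nlinarith

lemma sub_sub (p : C(I, Z)) (s t : ℝ) {a b : ℝ} (ha : a ∈ Icc (0:ℝ) 1) (hb : b ∈ Icc (0:ℝ) 1) :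
    sub (sub p s t) a b = sub p ((1-a)*s + a*t) ((1-b)*s+b*t) := by
  ext x
  simp only [sub_apply]
  rw [coe_pj (conv_mem' x.2 ha hb)]
  congr 2; ring

lemma sub_zero_one (p : C(I, Z)) : sub p 0 1 = p := by
  ext x; simp only [sub_apply]; rw [show (1 - (x:ℝ)) * 0 + x * 1 = x by ring, pj_coe]

def lh (p : C(I, Z)) : C(I, Z) := sub p 0 (1/2)
def rh (p : C(I, Z)) : C(I, Z) := sub p (1/2) 1

lemma lh_sub (p : C(I, Z)) (s t : ℝ) : lh (sub p s t) = sub p s ((s+t)/2) := by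
  rw [lh, sub_sub _ _ _ (by norm_num) (by norm_num)]; congr 1 <;> ring
lemma rh_sub (p : C(I, Z)) (s t : ℝ) : rh (sub p s t) = sub p ((s+t)/2) t := by
  rw [rh, sub_sub _ _ _ (by norm_num) (by norm_num)]; congr 1 <;> ring

lemma range_sub (p : C(I, Z)) (s t : ℝ) : range (sub p s t) ⊆ range p := by
  rintro _ ⟨x, rfl⟩; exact ⟨_, rfl⟩

lemma range_sub' (p : C(I, Z)) {s t : ℝ} (h : s ≤ t) : range (sub p s t) ⊆ (fun x => p (pj x)) '' Icc s t := by
  rintro _ ⟨x, rfl⟩; exact ⟨_, conv_mem x.2 h, rfl⟩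

lemma sub_zero (p : C(I, Z)) (s t : ℝ) : sub p s t 0 = p (pj s) := by simp [sub_apply]
lemma sub_one (p : C(I, Z)) (s t : ℝ) : sub p s t 1 = p (pj t) := by simp [sub_apply]

variable {κ : Type} {U : κ → Set Z}

lemma lebesgue (hU : ∀ i, IsOpen (U i)) (hc : ∀ z, ∃ i, z ∈ U i) (p : C(I, Z)) :
    ∃ δ > 0, ∀ s t : ℝ, 0 ≤ s → s ≤ t → t ≤ 1 → t - s < δ → ∃ i, range (sub p s t) ⊆ U i := by
  obtain ⟨δ, hδ, h⟩ := lebesgue_number_lemma_of_metric (s := (univ : Set I)) (c := fun i => p ⁻¹' U i)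
    isCompact_univ (fun i => (hU i).preimage p.continuous) (fun x _ => by
      obtain ⟨i, hi⟩ := hc (p x); exact mem_iUnion.2 ⟨i, hi⟩)
  refine ⟨δ, hδ, fun s t h0 hst h1 hd => ?_⟩
  obtain ⟨i, hi⟩ := h (pj s) trivial
  refine ⟨i, ?_⟩
  rintro _ ⟨x, rfl⟩
  apply hi
  have hm := conv_mem x.2 hst
  rw [Metric.mem_ball, Subtype.dist_eq, coe_pj ⟨h0.trans hm.1, hm.2.trans h1⟩, coe_pj ⟨h0, hst.trans h1⟩,
    Real.dist_eq, abs_of_nonneg (by linarith [hm.1])]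
  linarith [hm.2]

theorem dyad (hU : ∀ i, IsOpen (U i)) (hc : ∀ z, ∃ i, z ∈ U i) {Q : C(I, Z) → Prop}
    (hs : ∀ p : C(I, Z), (∃ i, range p ⊆ U i) → Q p) (hm : ∀ p, Q (lh p) → Q (rh p) → Q p) (p : C(I, Z)) : Q p := by
  obtain ⟨δ, hδ, h⟩ := lebesgue hU hc p
  have key : ∀ k : ℕ, ∀ s t : ℝ, 0 ≤ s → s ≤ t → t ≤ 1 → t - s < δ * 2 ^ k → Q (sub p s t) := by
    intro k
    induction k with
    | zero => intro s t h0 h1 h2 h3; exact hs _ (h s t h0 h1 h2 (by simpa using h3))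
    | succ k ih =>
      intro s t h0 h1 h2 h3
      rw [pow_succ] at h3
      apply hm
      · rw [lh_sub]; exact ih _ _ h0 (by linarith) (by linarith) (by linarith)
      · rw [rh_sub]; exact ih _ _ (by linarith) (by linarith) h2 (by linarith)
  obtain ⟨k, hk⟩ := pow_unbounded_of_one_lt (1/δ) (one_lt_two (α := ℝ))
  rw [← sub_zero_one p]
  refine key k 0 1 le_rfl zero_le_one le_rfl ?_
  rw [div_lt_iff₀ hδ] at hk; linarith

def sub2 (S : C(I × I, Z)) (a b c d : ℝ) : C(I × I, Z) :=
  ⟨fun x => S (pj ((1 - x.1) * a + x.1 * b), pj ((1 - x.2) * c + x.2 * d)),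
    S.continuous.comp ((pj_cont.comp (by fun_prop)).prodMk (pj_cont.comp (by fun_prop)))⟩

lemma sub2_apply (S : C(I × I, Z)) (a b c d : ℝ) (x : I × I) :
  sub2 S a b c d x = S (pj ((1 - x.1) * a + x.1 * b), pj ((1 - x.2) * c + x.2 * d)) := rfl

lemma sub2_sub2 (S : C(I × I, Z)) (a b c d : ℝ) {a' b' c' d' : ℝ} (ha : a' ∈ Icc (0:ℝ) 1) (hb : b' ∈ Icc (0:ℝ) 1)
    (hc : c' ∈ Icc (0:ℝ) 1) (hd : d' ∈ Icc (0:ℝ) 1) :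
    sub2 (sub2 S a b c d) a' b' c' d' = sub2 S ((1-a')*a+a'*b) ((1-b')*a+b'*b) ((1-c')*c+c'*d) ((1-d')*c+d'*d) := by
  ext x
  simp only [sub2_apply]
  rw [coe_pj (conv_mem' x.1.2 ha hb), coe_pj (conv_mem' x.2.2 hc hd)]
  congr 3 <;> ring

lemma sub2_id (S : C(I × I, Z)) : sub2 S 0 1 0 1 = S := by
  ext x; simp only [sub2_apply]
  rw [show (1 - (x.1:ℝ)) * 0 + x.1 * 1 = x.1 by ring, show (1 - (x.2:ℝ)) * 0 + x.2 * 1 = x.2 by ring, pj_coe, pj_coe]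

theorem dyad2 (hU : ∀ i, IsOpen (U i)) (hc : ∀ z, ∃ i, z ∈ U i) {Q : C(I × I, Z) → Prop}
    (hs : ∀ S : C(I × I, Z), (∃ i, range S ⊆ U i) → Q S)
    (h1 : ∀ S, Q (sub2 S 0 (1/2) 0 1) → Q (sub2 S (1/2) 1 0 1) → Q S)
    (h2 : ∀ S, Q (sub2 S 0 1 0 (1/2)) → Q (sub2 S 0 1 (1/2) 1) → Q S) (S : C(I × I, Z)) : Q S := by
  obtain ⟨δ, hδ, h⟩ := lebesgue_number_lemma_of_metric (s := (univ : Set (I × I))) (c := fun i => S ⁻¹' U i)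
    isCompact_univ (fun i => (hU i).preimage S.continuous) (fun x _ => by
      obtain ⟨i, hi⟩ := hc (S x); exact mem_iUnion.2 ⟨i, hi⟩)
  have key : ∀ k : ℕ, ∀ a b c d : ℝ, 0 ≤ a → a ≤ b → b ≤ 1 → b - a < δ * 2 ^ k → 0 ≤ c → c ≤ d → d ≤ 1 →
      d - c < δ * 2 ^ k → Q (sub2 S a b c d) := by
    intro k
    induction k with
    | zero =>
      intro a b c d ha hab hb hl hcc hcd hd hl'
      apply hs
      obtain ⟨i, hi⟩ := h (pj a, pj c) trivial
      refine ⟨i, ?_⟩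
      rintro _ ⟨x, rfl⟩
      apply hi
      have hm := conv_mem x.1.2 hab
      have hm' := conv_mem x.2.2 hcd
      rw [Metric.mem_ball, Prod.dist_eq, max_lt_iff, Subtype.dist_eq, Subtype.dist_eq]
      simp only
      rw [coe_pj ⟨ha.trans hm.1, hm.2.trans hb⟩, coe_pj ⟨ha, hab.trans hb⟩,
        coe_pj ⟨hcc.trans hm'.1, hm'.2.trans hd⟩, coe_pj ⟨hcc, hcd.trans hd⟩,
        Real.dist_eq, abs_of_nonneg (by linarith [hm.1]), Real.dist_eq, abs_of_nonneg (by linarith [hm'.1])]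
      constructor <;> linarith [hm.2, hm'.2]
    | succ k ih =>
      intro a b c d ha hab hb hl hcc hcd hd hl'
      rw [pow_succ] at hl hl'
      have half : ∀ c d, 0 ≤ c → c ≤ d → d ≤ 1 → d - c < δ * 2^k → Q (sub2 S a b c d) := by
        intro c d hcc hcd hd hl'
        apply h1
        · rw [sub2_sub2 _ _ _ _ _ (by norm_num) (by norm_num) (by norm_num) (by norm_num)]
          exact ih _ _ _ _ (by linarith) (by linarith) (by linarith) (by linarith) (by linarith) (by linarith)
            (by linarith) (by linarith)
        · rw [sub2_sub2 _ _ _ _ _ (by norm_num) (by norm_num) (by norm_num) (by norm_num)]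
          exact ih _ _ _ _ (by linarith) (by linarith) (by linarith) (by linarith) (by linarith) (by linarith)
            (by linarith) (by linarith)
      apply h2
      · rw [sub2_sub2 _ _ _ _ _ (by norm_num) (by norm_num) (by norm_num) (by norm_num)]
        convert half c ((c+d)/2) (by linarith) (by linarith) (by linarith) (by linarith) using 2 <;> ring
      · rw [sub2_sub2 _ _ _ _ _ (by norm_num) (by norm_num) (by norm_num) (by norm_num)]
        convert half ((c+d)/2) d (by linarith) (by linarith) (by linarith) (by linarith) using 2 <;> ring
  obtain ⟨k, hk⟩ := pow_unbounded_of_one_lt (1/δ) (one_lt_two (α := ℝ))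
  rw [div_lt_iff₀ hδ] at hk
  rw [← sub2_id S]
  exact key k 0 1 0 1 le_rfl zero_le_one le_rfl (by linarith) le_rfl zero_le_one le_rfl (by linarith)

def sbot (S : C(I × I, Z)) : C(I, Z) := ⟨fun x => S (x, 0), by fun_prop⟩
def stpp (S : C(I × I, Z)) : C(I, Z) := ⟨fun x => S (x, 1), by fun_prop⟩
def slft (S : C(I × I, Z)) : C(I, Z) := ⟨fun x => S (0, x), by fun_prop⟩
def srgt (S : C(I × I, Z)) : C(I, Z) := ⟨fun x => S (1, x), by fun_prop⟩

variable {K : Type} [Group K]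

/-- A local square-rule on small paths extends to all paths. -/
structure Loc (U : κ → Set Z) (v : C(I, Z) → K) : Prop where
  op : ∀ i, IsOpen (U i)
  cov : ∀ z, ∃ i, z ∈ U i
  const : ∀ z, v (ContinuousMap.const I z) = 1
  sq : ∀ S : C(I × I, Z), (∃ i, range S ⊆ U i) → v (sbot S) * v (srgt S) = v (slft S) * v (stpp S)

/-- square used for subdividing -/
def tsq (p : C(I, Z)) (s t r : ℝ) : C(I × I, Z) :=
  ⟨fun x => p (pj ((1 - x.1) * ((1-x.2)*s + x.2*r) + x.1 * ((1 - x.2)*t+x.2*r))),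
    p.continuous.comp (pj_cont.comp (by fun_prop))⟩

lemma tsq_range (p : C(I, Z)) (s t r : ℝ) : range (tsq p s t r) ⊆ range p := by
  rintro _ ⟨x, rfl⟩; exact ⟨_, rfl⟩

lemma tsq_bot (p : C(I, Z)) (s t r : ℝ) : sbot (tsq p s t r) = sub p s t := by
  ext x; simp [sbot, tsq, sub_apply]
lemma tsq_rgt (p : C(I, Z)) (s t r : ℝ) : srgt (tsq p s t r) = sub p t r := by
  ext x; simp [srgt, tsq, sub_apply]
lemma tsq_lft (p : C(I, Z)) (s t r : ℝ) : slft (tsq p s t r) = sub p s r := by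
  ext x; simp [slft, tsq, sub_apply]
lemma tsq_top (p : C(I, Z)) (s t r : ℝ) : stpp (tsq p s t r) = ContinuousMap.const I (p (pj r)) := by
  ext x; simp only [stpp, tsq, ContinuousMap.coe_mk, ContinuousMap.const_apply]
  congr 2; simp; ring

/-- full extension of a local rule -/
structure Full (U : κ → Set Z) (v V : C(I, Z) → K) : Prop where
  small : ∀ p : C(I, Z), (∃ i, range p ⊆ U i) → V p = v p
  half : ∀ p, V p = V (lh p) * V (rh p)
  sq : ∀ S : C(I × I, Z), V (sbot S) * V (srgt S) = V (slft S) * V (stpp S)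
  const : ∀ z, V (ContinuousMap.const I z) = 1

theorem Loc.full {v : C(I, Z) → K} (h : Loc U v) : ∃ V, Full U v V := by
  classical
  let A : ℕ → C(I, Z) → K := fun n => Nat.rec v (fun _ f p => f (lh p) * f (rh p)) n
  have A0 : ∀ p, A 0 p = v p := fun p => rfl
  have AS : ∀ n p, A (n+1) p = A n (lh p) * A n (rh p) := fun n p => rfl
  have hsm : ∀ p : C(I, Z), (∃ i, range p ⊆ U i) → v p = v (lh p) * v (rh p) := by
    rintro p ⟨i, hi⟩
    have := h.sq (tsq p 0 (1/2) 1) ⟨i, (tsq_range _ _ _ _).trans hi⟩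
    rw [tsq_bot, tsq_rgt, tsq_lft, tsq_top, h.const, mul_one, sub_zero_one] at this
    exact this.symm
  have hA : ∀ n, ∀ p : C(I, Z), (∃ i, range p ⊆ U i) → A n p = v p := by
    intro n
    induction n with
    | zero => intro p _; rfl
    | succ n ih =>
      rintro p ⟨i, hi⟩
      rw [AS, ih (lh p) ⟨i, (range_sub _ _ _).trans hi⟩, ih (rh p) ⟨i, (range_sub _ _ _).trans hi⟩, ← hsm p ⟨i, hi⟩]
  have hst : ∀ p, ∃ N, ∀ k ≥ N, A k p = A N p := by
    refine dyad (Q := fun p => ∃ N, ∀ k ≥ N, A k p = A N p) h.op h.cov ?_ ?_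
    · intro p hp; exact ⟨0, fun k _ => by rw [hA _ _ hp, hA _ _ hp]⟩
    · rintro p ⟨N, hN⟩ ⟨M, hM⟩
      refine ⟨max N M + 1, fun k hk => ?_⟩
      obtain ⟨k, rfl⟩ : ∃ j, k = j + 1 := ⟨k - 1, by omega⟩
      have hk' : max N M ≤ k := by omega
      rw [AS, AS, hN k (le_trans (le_max_left _ _) hk'), hM k (le_trans (le_max_right _ _) hk'),
        hN _ (le_max_left N M), hM _ (le_max_right N M)]
  choose N hN using hst
  have hhalf : ∀ p, A (N p) p = A (N (lh p)) (lh p) * A (N (rh p)) (rh p) := by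
    intro p
    let k := max (N p) (max (N (lh p)) (N (rh p)))
    rw [← hN p (k+1) (by omega), AS, hN (lh p) k (by omega), hN (rh p) k (by omega)]
  have hsmall : ∀ p : C(I, Z), (∃ i, range p ⊆ U i) → A (N p) p = v p := fun p hp => hA _ _ hp
  refine ⟨fun p => A (N p) p, hsmall, hhalf, ?_, ?_⟩
  · refine dyad2 (Q := fun S => A (N (sbot S)) (sbot S) * A (N (srgt S)) (srgt S) =
      A (N (slft S)) (slft S) * A (N (stpp S)) (stpp S)) h.op h.cov ?_ ?_ ?_
    · rintro S ⟨i, hi⟩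
      have sb : ∀ p : C(I, Z), range p ⊆ range S → ∃ i, range p ⊆ U i := fun p hp => ⟨i, hp.trans hi⟩
      rw [hsmall _ (sb _ ?_), hsmall _ (sb _ ?_), hsmall _ (sb _ ?_), hsmall _ (sb _ ?_)]
      · exact h.sq S ⟨i, hi⟩
      all_goals rintro _ ⟨x, rfl⟩; exact ⟨_, rfl⟩
    · intro S h1 h2
      have e1 : sbot (sub2 S 0 (1/2) 0 1) = lh (sbot S) := by
        ext x; simp [sbot, sub2_apply, lh, sub_apply, pj]
      have e2 : sbot (sub2 S (1/2) 1 0 1) = rh (sbot S) := by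
        ext x; simp [sbot, sub2_apply, rh, sub_apply, pj]
      have e3 : stpp (sub2 S 0 (1/2) 0 1) = lh (stpp S) := by
        ext x; simp [stpp, sub2_apply, lh, sub_apply, pj]
      have e4 : stpp (sub2 S (1/2) 1 0 1) = rh (stpp S) := by
        ext x; simp [stpp, sub2_apply, rh, sub_apply, pj]
      have e5 : slft (sub2 S 0 (1/2) 0 1) = slft S := by
        ext x; simp [slft, sub2_apply, pj]
      have e6 : srgt (sub2 S (1/2) 1 0 1) = srgt S := by
        ext x; simp [srgt, sub2_apply, pj]
      have e7 : srgt (sub2 S 0 (1/2) 0 1) = slft (sub2 S (1/2) 1 0 1) := by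
        ext x; simp [srgt, slft, sub2_apply]
      rw [e1, e7, e5, e3] at h1
      rw [e2, e6, e4] at h2
      rw [hhalf (sbot S), hhalf (stpp S), mul_assoc, h2, ← mul_assoc, h1, mul_assoc]
    · intro S h1 h2
      have e1 : slft (sub2 S 0 1 0 (1/2)) = lh (slft S) := by
        ext x; simp [slft, sub2_apply, lh, sub_apply, pj]
      have e2 : slft (sub2 S 0 1 (1/2) 1) = rh (slft S) := by
        ext x; simp [slft, sub2_apply, rh, sub_apply, pj]
      have e3 : srgt (sub2 S 0 1 0 (1/2)) = lh (srgt S) := by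
        ext x; simp [srgt, sub2_apply, lh, sub_apply, pj]
      have e4 : srgt (sub2 S 0 1 (1/2) 1) = rh (srgt S) := by
        ext x; simp [srgt, sub2_apply, rh, sub_apply, pj]
      have e5 : sbot (sub2 S 0 1 0 (1/2)) = sbot S := by
        ext x; simp [sbot, sub2_apply, pj]
      have e6 : stpp (sub2 S 0 1 (1/2) 1) = stpp S := by
        ext x; simp [stpp, sub2_apply, pj]
      have e7 : stpp (sub2 S 0 1 0 (1/2)) = sbot (sub2 S 0 1 (1/2) 1) := by
        ext x; simp [stpp, sbot, sub2_apply]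
      rw [e1, e5, e3, e7] at h1
      rw [e2, e4, e6] at h2
      rw [hhalf (slft S), hhalf (srgt S), ← mul_assoc, h1, mul_assoc, h2, mul_assoc]
  · intro z
    rw [hsmall _ (by obtain ⟨i, hi⟩ := h.cov z; exact ⟨i, by rintro _ ⟨x, rfl⟩; exact hi⟩), h.const]

lemma Full.split {v V : C(I, Z) → K} (h : Full U v V) (p : C(I, Z)) (s t r : ℝ) :
    V (sub p s r) = V (sub p s t) * V (sub p t r) := by
  have := h.sq (tsq p s t r)
  rwa [tsq_bot, tsq_rgt, tsq_lft, tsq_top, h.const, mul_one, eq_comm] at this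

lemma Full.homotopic {v V : C(I, Z) → K} (h : Full U v V) {x y : Z} {p q : Path x y} (hpq : p.Homotopic q) :
    V p.toContinuousMap = V q.toContinuousMap := by
  obtain ⟨F⟩ := hpq
  have := h.sq F.toContinuousMap
  have e1 : sbot F.toContinuousMap = ContinuousMap.const I x := by ext t; exact F.source t
  have e2 : stpp F.toContinuousMap = ContinuousMap.const I y := by ext t; exact F.target t
  have e3 : slft F.toContinuousMap = p.toContinuousMap := by ext t; exact F.apply_zero t
  have e4 : srgt F.toContinuousMap = q.toContinuousMap := by ext t; exact F.apply_one t
  rw [e1, e2, e3, e4, h.const, h.const, one_mul, mul_one] at this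
  exact this.symm

lemma lh_trans {x y z : Z} (p : Path x y) (q : Path y z) : lh (p.trans q).toContinuousMap = p.toContinuousMap := by
  ext t
  show (p.trans q) (pj ((1 - t) * 0 + t * (1/2))) = p t
  have h : (1 - (t:ℝ)) * 0 + t * (1/2) ∈ Icc (0:ℝ) 1 := conv_mem' t.2 (by norm_num) (by norm_num)
  rw [pj_of h, Path.trans_apply, dif_pos (by have := t.2.2; simp; linarith)]
  congr 1; ext; simp; ring

lemma rh_trans {x y z : Z} (p : Path x y) (q : Path y z) : rh (p.trans q).toContinuousMap = q.toContinuousMap := by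
  ext t
  show (p.trans q) (pj ((1 - t) * (1/2) + t * 1)) = q t
  have h : (1 - (t:ℝ)) * (1/2) + t * 1 ∈ Icc (0:ℝ) 1 := conv_mem' t.2 (by norm_num) (by norm_num)
  rw [pj_of h, Path.trans_apply]
  split_ifs with h2
  · have : t = 0 := by
      exact Subtype.ext (by have := t.2.1; norm_num at h2; show (t:ℝ) = 0; linarith)
    subst this; simp
  · congr 1; ext; simp; ring

lemma Full.trans {v V : C(I, Z) → K} (h : Full U v V) {x y z : Z} (p : Path x y) (q : Path y z) :
    V (p.trans q).toContinuousMap = V p.toContinuousMap * V q.toContinuousMap := by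
  rw [h.half, lh_trans, rh_trans]

/-- values on paths inside a set stay in a subgroup -/
lemma Full.mem {v V : C(I, Z) → K} (h : Full U v V) (hl : Loc U v) (B : Set Z) (L : Subgroup K)
    (hB : ∀ p : C(I, Z), (∃ i, range p ⊆ U i) → range p ⊆ B → v p ∈ L) (p : C(I, Z)) (hp : range p ⊆ B) : V p ∈ L := by
  revert hp
  apply dyad hl.op hl.cov (Q := fun p => range p ⊆ B → V p ∈ L)
  · intro p hp hp'; rw [h.small p hp]; exact hB p hp hp'
  · intro p h1 h2 hp
    rw [h.half]; exact L.mul_mem (h1 ((range_sub _ _ _).trans hp)) (h2 ((range_sub _ _ _).trans hp))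

end glue
end GrifAux

namespace GrifAux
open unitInterval

/-- Contour lemma: a loop that backtracks along a height function is null-homotopic. -/
theorem contour {Z : Type} [TopologicalSpace Z] {z : Z} (q : Path z z) (h : I → ℝ) (hc : Continuous h)
    (hn : ∀ t, 0 ≤ h t) (h0 : h 0 = 0) (h1 : h 1 = 0)
    (hq : ∀ s t, s ≤ t → h s = h t → (∀ r, s ≤ r → r ≤ t → h s ≤ h r) → q s = q t) :
    q.Homotopic (Path.refl z) := by
  obtain ⟨M, hM⟩ : ∃ M, ∀ t, h t ≤ M := by
    obtain ⟨x, -, hx⟩ := isCompact_univ.exists_isMaxOn (univ_nonempty (α := I)) hc.continuousOn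
    exact ⟨h x, fun t => hx (mem_univ t)⟩
  have hM0 : 0 ≤ M := (hn 0).trans (hM 0)
  let K : Set ((I × I) × I) := {x | x.2 ≤ x.1.2 ∧ h x.2 = min (x.1.1 * M) (h x.1.2) ∧
    ∀ r, h x.2 ≤ h (max x.2 (min x.1.2 r))}
  have hK : IsClosed K := by
    refine IsClosed.and (isClosed_le (by fun_prop) (by fun_prop)) (IsClosed.and
      (isClosed_eq (by fun_prop) (by fun_prop)) ?_)
    rw [show {x : (I × I) × I | ∀ r, h x.2 ≤ h (max x.2 (min x.1.2 r))} = ⋂ r, {x : (I × I) × I | h x.2 ≤ h (max x.2 (min x.1.2 r))} by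
      ext x; simp]
    exact isClosed_iInter fun r => isClosed_le (by fun_prop) (by fun_prop)
  have hKm : ∀ u t s, ((u, t), s) ∈ K ↔ s ≤ t ∧ h s = min (u * M) (h t) ∧ ∀ r, s ≤ r → r ≤ t → h s ≤ h r := by
    intro u t s
    constructor
    · rintro ⟨a, b, c⟩
      refine ⟨a, b, fun r hr hr' => ?_⟩
      have := c r
      simp only at this
      rwa [min_eq_right hr', max_eq_right hr] at this
    · rintro ⟨a, b, c⟩
      exact ⟨a, b, fun r => c _ (le_max_left _ _) (max_le a (min_le_left _ _))⟩
  have huniq : ∀ u t s s', ((u, t), s) ∈ K → ((u, t), s') ∈ K → q s = q s' := by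
    have : ∀ u t s s', s ≤ s' → ((u, t), s) ∈ K → ((u, t), s') ∈ K → q s = q s' := by
      intro u t s s' hs hk hk'
      rw [hKm] at hk hk'
      exact hq s s' hs (hk.2.1.trans hk'.2.1.symm) fun r hr hr' => hk.2.2 r hr (hr'.trans hk'.1)
    intro u t s s' hk hk'
    rcases le_total s s' with hs | hs
    · exact this _ _ _ _ hs hk hk'
    · exact (this _ _ _ _ hs hk' hk).symm
  have hex : ∀ x : I × I, ∃ s, (x, s) ∈ K := by
    rintro ⟨u, t⟩
    set c := min (u * M) (h t) with hcc
    have hc0 : 0 ≤ c := le_min (mul_nonneg u.2.1 hM0) (hn t)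
    have hcomp : IsCompact ({s : I | s ≤ t ∧ h s ≤ c}) :=
      (IsClosed.and (isClosed_le (by fun_prop) (by fun_prop)) (isClosed_le (by fun_prop) (by fun_prop))).isCompact
    obtain ⟨s, ⟨hs1, hs2⟩, hs3⟩ := hcomp.exists_isMaxOn ⟨0, by show (0:I) ≤ t ∧ h 0 ≤ c; exact ⟨t.2.1, h0 ▸ hc0⟩⟩ continuousOn_id
    have hs3 : ∀ r, r ≤ t → h r ≤ c → r ≤ s := fun r hr hr' => hs3 (show r ≤ t ∧ h r ≤ c from ⟨hr, hr'⟩)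
    have e : h s = c := by
      obtain ⟨r, hr, hr'⟩ := intermediate_value_Icc hs1 hc.continuousOn ⟨hs2, min_le_right _ _⟩
      have := hs3 r hr.2 hr'.le
      rw [le_antisymm hr.1 this, hr']
    refine ⟨s, (hKm _ _ _).2 ⟨hs1, e, fun r hr hr' => ?_⟩⟩
    by_contra hlt
    push Not at hlt
    have := hs3 r hr' (by linarith)
    rw [le_antisymm this hr] at hlt
    exact lt_irrefl _ hlt
  choose sg hsg using hex
  have hF : Continuous (fun x => q (sg x)) := by
    haveI : CompactSpace K := isCompact_iff_compactSpace.1 hK.isCompact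
    let f : K → I × I := fun x => x.1.1
    have hf : Topology.IsQuotientMap f := by
      apply Topology.IsQuotientMap.of_surjective_continuous
      · intro x; exact ⟨⟨(x, sg x), hsg x⟩, rfl⟩
      · fun_prop
    rw [hf.continuous_iff]
    have : (fun x => q (sg x)) ∘ f = fun x : K => q x.1.2 := by
      funext x
      exact huniq _ _ _ _ (hsg x.1.1) x.2
    rw [this]; fun_prop
  have hat : ∀ u t s, ((u,t),s) ∈ K → q (sg (u, t)) = q s := fun u t s hk => huniq _ _ _ _ (hsg (u,t)) hk
  refine (?_ : (Path.refl z).Homotopic q).symm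
  refine ⟨⟨⟨⟨fun x => q (sg x), hF⟩, fun t => ?_, fun t => ?_⟩, ?_⟩⟩
  · show q (sg (0, t)) = z
    rw [hat 0 t 0 ((hKm _ _ _).2 ⟨t.2.1, by simp [h0, hn], fun r _ _ => by rw [h0]; exact hn r⟩), q.source]
  · show q (sg (1, t)) = q t
    rw [hat 1 t t ((hKm _ _ _).2 ⟨le_rfl, by simp [hM], fun r h1 h2 => by rw [le_antisymm h1 h2]⟩)]
  · rintro u t (rfl | rfl)
    · show q (sg (u, 0)) = z
      rw [hat u 0 0 ((hKm _ _ _).2 ⟨le_rfl, by rw [h0, min_eq_right]; exact mul_nonneg u.2.1 hM0, fun r _ _ => by rw [h0]; exact hn r⟩), q.source]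
    · show q (sg (u, 1)) = (Path.refl z) 1
      rw [hat u 1 0 ((hKm _ _ _).2 ⟨zero_le_one, by rw [h0, h1, min_eq_right]; exact mul_nonneg u.2.1 hM0, fun r _ _ => by rw [h0]; exact hn r⟩), q.source]
      rfl

end GrifAux

namespace GrifAux
open unitInterval Griffiths

abbrev E3 := EuclideanSpace ℝ (Fin 3)

section geo
variable {ι : Type}

def mkp (α : ι) (P : GS1set) : GS ι := Quotient.mk (wedgeSetoid ι) ⟨α, P⟩

lemma mkp_surj (x : GS ι) : ∃ α P, x = mkp α P := by
  induction x using Quotient.inductionOn with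
  | h x => exact ⟨x.1, x.2, rfl⟩

lemma mkp_zero (α β : ι) (P Q : GS1set) (hP : P.1 = 0) (hQ : Q.1 = 0) : mkp α P = mkp β Q :=
  Quotient.sound (Or.inr ⟨hP, hQ⟩)

def co (x : GS ι) : E3 := Quotient.lift (fun y : Σ _ : ι, GS1set => y.2.val)
  (by rintro x y (rfl | ⟨h, h'⟩); exacts [rfl, h.trans h'.symm]) x

@[simp] lemma co_mkp (α : ι) (P : GS1set) : co (mkp α P) = P.1 := rfl

lemma dist_mkp (α : ι) (P Q : GS1set) : dist (mkp α P) (mkp α Q) = dist P.1 Q.1 := by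
  show preDist _ _ = _
  simp [preDist]

lemma dist_mkp_ne {α β : ι} (h : α ≠ β) (P Q : GS1set) :
    dist (mkp α P) (mkp β Q) = dist P.1 0 + dist 0 Q.1 := by
  show preDist _ _ = _
  simp [preDist, h]

lemma co_lip : LipschitzWith 1 (co : GS ι → E3) := by
  apply LipschitzWith.of_dist_le_mul
  intro x y
  obtain ⟨α, P, rfl⟩ := mkp_surj x
  obtain ⟨β, Q, rfl⟩ := mkp_surj y
  by_cases h : α = β
  · subst h; simp [dist_mkp]
  · rw [dist_mkp_ne h]; simpa using dist_triangle P.1 0 Q.1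

lemma co_cont : Continuous (co : GS ι → E3) := co_lip.continuous
@[fun_prop] lemma co_i_cont (i : Fin 3) : Continuous (fun x : GS ι => co x i) :=
  (EuclideanSpace.proj (𝕜 := ℝ) i).continuous.comp co_cont

lemma mkp_cont (α : ι) : Continuous (mkp α) :=
  (Isometry.of_dist_eq (fun P Q => by rw [dist_mkp]; rfl)).continuous

/-- the copy with index `α` -/
def XX (α : ι) : Set (GS ι) := range (mkp α)

lemma dist_XX {α : ι} {x y : GS ι} (hx : x ∈ XX α) (hy : y ∈ XX α) : dist x y = dist (co x) (co y) := by
  obtain ⟨P, rfl⟩ := hx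
  obtain ⟨Q, rfl⟩ := hy
  rw [dist_mkp]; rfl

lemma dist_zero {x y : GS ι} (hy : co y = 0) : dist x y = ‖co x‖ := by
  obtain ⟨α, P, rfl⟩ := mkp_surj x
  obtain ⟨β, Q, rfl⟩ := mkp_surj y
  rw [mkp_zero β α Q Q hy hy, dist_mkp, show Q.1 = 0 from hy]; simp

lemma eq_of_co_zero {x y : GS ι} (hx : co x = 0) (hy : co y = 0) : x = y := by
  rw [← dist_eq_zero, dist_zero hy, hx, norm_zero]

lemma mem_XX_of_zero {x : GS ι} (α : ι) (hx : co x = 0) : x ∈ XX α := by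
  obtain ⟨β, Q, rfl⟩ := mkp_surj x
  exact ⟨Q, mkp_zero _ _ _ _ hx hx⟩

lemma exists_XX (x : GS ι) : ∃ α, x ∈ XX α := by
  obtain ⟨α, P, rfl⟩ := mkp_surj x; exact ⟨α, P, rfl⟩

lemma XX_unique {α β : ι} {x : GS ι} (hx : co x ≠ 0) (h : x ∈ XX α) (h' : x ∈ XX β) : α = β := by
  by_contra hne
  obtain ⟨P, rfl⟩ := h
  obtain ⟨Q, hQ⟩ := h'
  have := dist_mkp_ne hne P Q
  rw [hQ, dist_self] at this
  have h1 : dist P.1 0 = 0 := by linarith [dist_nonneg (x := P.1) (y := (0:E3)), dist_nonneg (x := (0:E3)) (y := Q.1)]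
  exact hx (dist_eq_zero.1 h1)

lemma ext_XX {α : ι} {x y : GS ι} (hx : x ∈ XX α) (hy : y ∈ XX α) (h : co x = co y) : x = y := by
  rw [← dist_eq_zero, dist_XX hx hy, h, dist_self]

lemma XX_nhds {α : ι} {x : GS ι} (hx : co x ≠ 0) (h : x ∈ XX α) : ∀ᶠ y in nhds x, y ∈ XX α := by
  filter_upwards [Metric.ball_mem_nhds x (norm_pos_iff.2 hx)] with y hy
  by_contra hn
  obtain ⟨P, rfl⟩ := h
  obtain ⟨β, Q, rfl⟩ := mkp_surj y
  have hne : β ≠ α := by rintro rfl; exact hn ⟨Q, rfl⟩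
  rw [Metric.mem_ball, dist_mkp_ne hne, dist_zero_left, co_mkp] at hy
  linarith [dist_nonneg (x := Q.1) (y := (0:E3))]

lemma XX_isOpen (α : ι) : IsOpen {x : GS ι | x ∈ XX α ∧ co x ≠ 0} := by
  rw [isOpen_iff_mem_nhds]
  rintro x ⟨h, hx⟩
  filter_upwards [XX_nhds hx h, co_cont.continuousAt.eventually_ne hx] with y h1 h2 using ⟨h1, h2⟩

/-- continuity of a map with the same colours as a continuous one -/
lemma cont_of {T : Type*} [TopologicalSpace T] {f g : T → GS ι} (hf : Continuous fun t => co (f t)) (hg : Continuous g)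
    (h : ∀ t α, g t ∈ XX α → f t ∈ XX α) (h0 : ∀ t, co (g t) = 0 → co (f t) = 0) : Continuous f := by
  rw [continuous_iff_continuousAt]
  intro t
  rw [ContinuousAt, tendsto_iff_dist_tendsto_zero]
  by_cases hz : co (f t) = 0
  · simp only [dist_zero hz]
    have := (hf.tendsto t).norm
    rwa [hz, norm_zero] at this
  · have hz' : co (g t) ≠ 0 := fun e => hz (h0 t e)
    obtain ⟨α, hα⟩ := exists_XX (g t)
    have h1 := tendsto_iff_dist_tendsto_zero.1 (hf.tendsto t)
    refine h1.congr' ?_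
    filter_upwards [hg.continuousAt.eventually (XX_nhds hz' hα)] with s hs
    rw [dist_XX (h _ _ hs) (h _ _ hα)]

lemma mem_GS1set {P : E3} : P ∈ GS1set ↔ (0 ≤ P 2 ∧ P 2 ≤ 1) ∧ ∃ n : ℕ, ((n:ℝ)+3) * (P 0 ^ 2 + P 1 ^ 2) = 2 * (1 - P 2) * P 1 := by
  have key : ∀ (n : ℕ) (r a b : ℝ), a ^ 2 + (b - (1 - r) / (n + 3)) ^ 2 = ((1 - r) / (n + 3)) ^ 2 ↔
      ((n:ℝ)+3) * (a ^ 2 + b ^ 2) = 2 * (1 - r) * b := by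
    intro n r a b
    have : ((n:ℝ)+3) ≠ 0 := by positivity
    constructor
    · intro h; field_simp at h; nlinarith
    · intro h; field_simp; nlinarith
  simp only [GS1set, mem_iUnion, mem_ofPred_eq]
  constructor
  · rintro ⟨r, hr, n, h1, h2⟩
    subst h2
    exact ⟨hr, n, (key _ _ _ _).1 h1⟩
  · rintro ⟨h, n, hn⟩
    exact ⟨P 2, h, n, (key _ _ _ _).2 hn, rfl⟩

lemma co_mem (x : GS ι) : co x ∈ GS1set := by
  obtain ⟨α, P, rfl⟩ := mkp_surj x; exact P.2

lemma co2_nonneg (x : GS ι) : 0 ≤ co x 2 := (mem_GS1set.1 (co_mem x)).1.1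
lemma co2_le (x : GS ι) : co x 2 ≤ 1 := (mem_GS1set.1 (co_mem x)).1.2

lemma e3_ext {P Q : E3} (h0 : P 0 = Q 0) (h1 : P 1 = Q 1) (h2 : P 2 = Q 2) : P = Q := by
  ext i; fin_cases i <;> assumption

/-! ### the height zero part -/

abbrev HE (ι : Type) := {x : GS ι // co x 2 = 0}

def c0 (x : HE ι) : ℝ := co x.1 0
def c1 (x : HE ι) : ℝ := co x.1 1
@[fun_prop] lemma c0_cont : Continuous (c0 : HE ι → ℝ) := (co_i_cont 0).comp continuous_subtype_val
@[fun_prop] lemma c1_cont : Continuous (c1 : HE ι → ℝ) := (co_i_cont 1).comp continuous_subtype_val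

lemma he_eq (x : HE ι) : ∃ n : ℕ, ((n:ℝ)+3) * (c0 x ^ 2 + c1 x ^ 2) = 2 * c1 x := by
  obtain ⟨-, n, hn⟩ := mem_GS1set.1 (co_mem x.1)
  rw [x.2] at hn
  exact ⟨n, by rw [c0, c1, hn]; ring⟩

lemma c1_nonneg (x : HE ι) : 0 ≤ c1 x := by
  obtain ⟨n, hn⟩ := he_eq x
  have : 0 ≤ ((n:ℝ)+3) * (c0 x ^ 2 + c1 x ^ 2) := by positivity
  linarith

lemma co_zero_of_c1 {x : HE ι} (h : c1 x = 0) : co x.1 = 0 := by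
  obtain ⟨n, hn⟩ := he_eq x
  rw [h] at hn
  have h0 : c0 x = 0 := by
    have : ((n:ℝ)+3) ≠ 0 := by positivity
    simpa [this] using hn
  exact e3_ext h0 h x.2

/-- the base point -/
def bp (a : ι) : HE ι := ⟨basept a, rfl⟩
lemma co_bp (a : ι) : co (bp a).1 = 0 := rfl
lemma c1_bp (a : ι) : c1 (bp a) = 0 := rfl
lemma c0_bp (a : ι) : c0 (bp a) = 0 := rfl
lemma eq_bp {a : ι} {x : HE ι} (h : c1 x = 0) : x = bp a := Subtype.ext (eq_of_co_zero (co_zero_of_c1 h) rfl)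

/-- open edges -/
def OO (l : ι × ℕ) : Set (HE ι) := {x | x.1 ∈ XX l.1 ∧ 0 < c1 x ∧ ((l.2:ℝ)+3) * (c0 x ^ 2 + c1 x ^ 2) = 2 * c1 x}

lemma co_ne_of_c1 {x : HE ι} (h : 0 < c1 x) : co x.1 ≠ 0 := by
  intro h'; rw [c1, h'] at h; simp at h

lemma OO_iff (l : ι × ℕ) (x : HE ι) : x ∈ OO l ↔ (x.1 ∈ XX l.1 ∧ co x.1 ≠ 0) ∧ 0 < c1 x ∧
    2 * c1 x < ((l.2:ℝ)+4) * (c0 x ^ 2 + c1 x ^ 2) ∧ ((l.2:ℝ)+2) * (c0 x ^ 2 + c1 x ^ 2) < 2 * c1 x := by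
  constructor
  · rintro ⟨h1, h2, h3⟩
    have : 0 < c0 x ^ 2 + c1 x ^ 2 := by positivity
    exact ⟨⟨h1, co_ne_of_c1 h2⟩, h2, by linarith, by linarith⟩
  · rintro ⟨⟨h1, -⟩, h2, h3, h4⟩
    have hp : 0 < c0 x ^ 2 + c1 x ^ 2 := by positivity
    obtain ⟨n, hn⟩ := he_eq x
    rw [← hn] at h3 h4
    have h3 := lt_of_mul_lt_mul_right h3 hp.le
    have h4 := lt_of_mul_lt_mul_right h4 hp.le
    have h3' : n < l.2 + 1 := by exact_mod_cast (show (n:ℝ) < l.2 + 1 by linarith)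
    have h4' : l.2 < n + 1 := by exact_mod_cast (show (l.2:ℝ) < n + 1 by linarith)
    have : n = l.2 := by omega
    subst this
    exact ⟨h1, h2, hn⟩

lemma OO_isOpen (l : ι × ℕ) : IsOpen (OO l) := by
  have : OO l = {x : HE ι | (x.1 ∈ XX l.1 ∧ co x.1 ≠ 0) ∧ 0 < c1 x ∧
    2 * c1 x < ((l.2:ℝ)+4) * (c0 x ^ 2 + c1 x ^ 2) ∧ ((l.2:ℝ)+2) * (c0 x ^ 2 + c1 x ^ 2) < 2 * c1 x} := by
    ext x; exact OO_iff l x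
  rw [this]
  refine IsOpen.and ((XX_isOpen l.1).preimage continuous_subtype_val) (IsOpen.and ?_ (IsOpen.and ?_ ?_))
  all_goals exact isOpen_lt (by fun_prop) (by fun_prop)

lemma OO_unique {l l' : ι × ℕ} {x : HE ι} (h : x ∈ OO l) (h' : x ∈ OO l') : l = l' := by
  have hp : 0 < c0 x ^ 2 + c1 x ^ 2 := by have := h.2.1; positivity
  refine Prod.ext (XX_unique (co_ne_of_c1 h.2.1) h.1 h'.1) ?_
  have := mul_right_cancel₀ hp.ne' (h.2.2.trans h'.2.2.symm)
  exact_mod_cast (show (l.2:ℝ) = l'.2 by linarith)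

lemma exists_OO {x : HE ι} (h : c1 x ≠ 0) : ∃ l, x ∈ OO l := by
  obtain ⟨n, hn⟩ := he_eq x
  obtain ⟨α, hα⟩ := exists_XX x.1
  exact ⟨(α, n), hα, lt_of_le_of_ne (c1_nonneg x) h.symm, hn⟩

lemma OO_c1_le {l : ι × ℕ} {x : HE ι} (h : x ∈ OO l) : c1 x ≤ 2 / ((l.2:ℝ)+3) := by
  have h3 := h.2.2
  have h2 := h.2.1
  rw [le_div_iff₀ (by positivity)]
  have : ((l.2:ℝ)+3) * c1 x ^ 2 ≤ 2 * c1 x := by rw [← h3]; gcongr; nlinarith [sq_nonneg (c0 x)]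
  nlinarith

lemma OO_anti {l : ι × ℕ} {x : HE ι} (h : x ∈ OO l) (h0 : c0 x = 0) : c1 x = 2 / ((l.2:ℝ)+3) := by
  have h3 := h.2.2
  have h2 := h.2.1
  rw [h0] at h3
  rw [eq_div_iff (by positivity)]
  have : c1 x * (((l.2:ℝ)+3) * c1 x - 2) = 0 := by linarith
  rcases mul_eq_zero.1 this with h | h
  · exact absurd h h2.ne'
  · linarith

lemma OO_dist {l : ι × ℕ} {x : HE ι} (h : x ∈ OO l) (a : ι) : dist x (bp a) ≤ 2 / ((l.2:ℝ)+3) := by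
  rw [Subtype.dist_eq, dist_zero (co_bp a), EuclideanSpace.norm_eq, Fin.sum_univ_three]
  have h3 := h.2.2
  have hc := OO_c1_le h
  have h2 := h.2.1
  rw [show co x.1 0 = c0 x from rfl, show co x.1 1 = c1 x from rfl, x.2]
  apply Real.sqrt_le_iff.2
  refine ⟨by positivity, ?_⟩
  simp only [Real.norm_eq_abs, sq_abs]
  have e : c0 x ^ 2 + c1 x ^ 2 = 2 / ((l.2:ℝ)+3) * c1 x := by field_simp; linarith
  rw [e, sq, sq, mul_zero, add_zero]; gcongr

/-- parametrization of the edges -/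
def edP (n : ℕ) (θ : ℝ) : E3 := !₂[1/((n:ℝ)+3) * Real.sin (2 * Real.pi * θ), 1/((n:ℝ)+3) * (1 - Real.cos (2 * Real.pi * θ)), 0]

lemma edP_mem (n : ℕ) (θ : ℝ) : edP n θ ∈ GS1set := by
  rw [mem_GS1set]
  refine ⟨by simp [edP], n, ?_⟩
  simp only [edP, PiLp.toLp_apply, Matrix.cons_val_zero, Matrix.cons_val_one, Matrix.cons_val]
  have := Real.sin_sq_add_cos_sq (2 * Real.pi * θ)
  field_simp
  nlinarith

def ed (l : ι × ℕ) (θ : ℝ) : HE ι := ⟨mkp l.1 ⟨edP l.2 θ, edP_mem _ _⟩, by simp [edP]⟩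

lemma ed_cont (l : ι × ℕ) : Continuous (ed l) := by
  refine Continuous.subtype_mk ((mkp_cont l.1).comp (Continuous.subtype_mk ?_ _)) _
  refine (PiLp.continuous_toLp 2 _).comp (continuous_pi fun i => ?_)
  fin_cases i <;> simp <;> fun_prop

lemma c0_ed (l : ι × ℕ) (θ : ℝ) : c0 (ed l θ) = 1/((l.2:ℝ)+3) * Real.sin (2 * Real.pi * θ) := by
  simp [c0, ed, edP]
lemma c1_ed (l : ι × ℕ) (θ : ℝ) : c1 (ed l θ) = 1/((l.2:ℝ)+3) * (1 - Real.cos (2 * Real.pi * θ)) := by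
  simp [c1, ed, edP]
lemma ed_XX (l : ι × ℕ) (θ : ℝ) : (ed l θ).1 ∈ XX l.1 := ⟨_, rfl⟩
lemma ed_zero (l : ι × ℕ) (a : ι) : ed l 0 = bp a := eq_bp (by simp [c1_ed])
lemma ed_one (l : ι × ℕ) (a : ι) : ed l 1 = bp a := eq_bp (by simp [c1_ed])

lemma ed_OO {l : ι × ℕ} {θ : ℝ} (h : 0 < θ) (h' : θ < 1) : ed l θ ∈ OO l := by
  have hlt : Real.cos (2 * Real.pi * θ) < 1 := by
    refine lt_of_le_of_ne (Real.cos_le_one _) fun he => ?_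
    rw [Real.cos_eq_one_iff_of_lt_of_lt (by nlinarith [Real.pi_pos]) (by nlinarith [Real.pi_pos])] at he
    have := Real.pi_pos
    have : 2 * Real.pi * θ > 0 := by positivity
    linarith
  refine ⟨ed_XX _ _, ?_, ?_⟩
  · rw [c1_ed]; have : 0 < 1 - Real.cos (2 * Real.pi * θ) := by linarith
    positivity
  · rw [c0_ed, c1_ed]
    have := Real.sin_sq_add_cos_sq (2 * Real.pi * θ)
    field_simp
    nlinarith

end geo
end GrifAux

namespace GrifAux
open unitInterval Griffiths
section psi
open scoped Classical
variable {ι : Type}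

/-- complement of the antipodes of the circles of level `< m` -/
def V0 (ι : Type) (m : ℕ) : Set (HE ι) := {x | ¬ (c0 x = 0 ∧ 2 / ((m:ℝ)+2) ≤ c1 x)}

lemma V0_isOpen (m : ℕ) : IsOpen (V0 ι m) :=
  ((isClosed_eq c0_cont continuous_const).and (isClosed_le continuous_const c1_cont)).isOpen_compl

/-- the cover at stage `m` -/
def Um (m : ℕ) : Option (ι × ℕ) → Set (HE ι)
  | none => V0 ι m
  | some l => {x | l.2 < m ∧ x ∈ OO l}

lemma lev_lt {m n : ℕ} : 2 / ((m:ℝ)+2) ≤ 2 / ((n:ℝ)+3) ↔ n < m := by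
  rw [div_le_div_iff₀ (by positivity) (by positivity)]
  constructor
  · intro h; have : (n:ℝ) + 1 ≤ m := by linarith
    exact_mod_cast this
  · intro h; have : (n:ℝ) + 1 ≤ m := by exact_mod_cast h
    linarith

lemma OO_V0 {l : ι × ℕ} {m : ℕ} (h : m ≤ l.2) : OO l ⊆ V0 ι m := by
  rintro x hx ⟨-, h2⟩
  have := lev_lt.1 (h2.trans (OO_c1_le hx))
  omega

lemma OO_V0_c0 {l : ι × ℕ} {m : ℕ} {x : HE ι} (hx : x ∈ OO l) (h : l.2 < m) (hv : x ∈ V0 ι m) : c0 x ≠ 0 := by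
  intro h0
  exact hv ⟨h0, by rw [OO_anti hx h0]; exact lev_lt.2 h⟩

lemma Um_cov (m : ℕ) (z : HE ι) : ∃ i, z ∈ Um m i := by
  by_cases h : z ∈ V0 ι m
  · exact ⟨none, h⟩
  · have h' : c0 z = 0 ∧ 2 / ((m:ℝ)+2) ≤ c1 z := by simpa [V0] using h
    have : 0 < 2 / ((m:ℝ)+2) := by positivity
    obtain ⟨l, hl⟩ := exists_OO (x := z) (by linarith)
    exact ⟨some l, lev_lt.1 (h'.2.trans (OO_c1_le hl)), hl⟩

lemma Um_open (m : ℕ) (i : Option (ι × ℕ)) : IsOpen (Um m i) := by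
  cases i with
  | none => exact V0_isOpen m
  | some l => exact isOpen_const.and (OO_isOpen l)

/-- local potential at level `l` -/
def sg (l : ι × ℕ) (x : HE ι) : FG ι := if c0 x ≤ 0 then FreeGroup.of l else 1

def vv (m : ℕ) (p : C(I, HE ι)) : FG ι :=
  if h : ∃ l : ι × ℕ, l.2 < m ∧ range p ⊆ OO l then (sg h.choose (p 0))⁻¹ * sg h.choose (p 1) else 1

lemma vv_pos {m : ℕ} {p : C(I, HE ι)} {l : ι × ℕ} (h : l.2 < m) (hp : range p ⊆ OO l) :
    vv m p = (sg l (p 0))⁻¹ * sg l (p 1) := by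
  have hh : ∃ l : ι × ℕ, l.2 < m ∧ range p ⊆ OO l := ⟨l, h, hp⟩
  rw [vv, dif_pos hh, OO_unique (hh.choose_spec.2 ⟨0, rfl⟩) (hp ⟨0, rfl⟩)]

lemma sg_const {p : C(I, HE ι)} (h : ∀ t, c0 (p t) ≠ 0) (l : ι × ℕ) : sg l (p 0) = sg l (p 1) := by
  have hc : Continuous (fun t => c0 (p t)) := by fun_prop
  have key : ∀ t s, c0 (p t) ≤ 0 → ¬ c0 (p s) ≤ 0 → False := by
    intro t s ht hs
    push Not at hs
    obtain ⟨r, hr⟩ := mem_range_of_exists_le_of_exists_ge hc ⟨t, ht⟩ ⟨s, hs.le⟩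
    exact h r hr
  by_cases h0 : c0 (p 0) ≤ 0 <;> by_cases h1 : c0 (p 1) ≤ 0
  · simp [sg, h0, h1]
  · exact (key _ _ h0 h1).elim
  · exact (key _ _ h1 h0).elim
  · simp [sg, h0, h1]

lemma vv_V0 {m n : ℕ} {p : C(I, HE ι)} (hp : range p ⊆ V0 ι m) (hmn : ∀ l : ι × ℕ, range p ⊆ OO l → l.2 < n → l.2 < m) : vv n p = 1 := by
  by_cases h : ∃ l : ι × ℕ, l.2 < n ∧ range p ⊆ OO l
  · obtain ⟨l, h1, h2⟩ := h
    rw [vv_pos h1 h2, sg_const (fun t => OO_V0_c0 (h2 ⟨t, rfl⟩) (hmn l h2 h1) (hp ⟨t, rfl⟩)) l, inv_mul_cancel]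
  · rw [vv, dif_neg h]

lemma vv_V0' {m : ℕ} {p : C(I, HE ι)} (hp : range p ⊆ V0 ι m) : vv m p = 1 := vv_V0 hp fun _ _ h => h

lemma vv_loc (m : ℕ) : Loc (Um m) (vv m : C(I, HE ι) → FG ι) where
  op := Um_open m
  cov := Um_cov m
  const z := by
    by_cases h : ∃ l : ι × ℕ, l.2 < m ∧ range (ContinuousMap.const I z) ⊆ OO l
    · obtain ⟨l, h1, h2⟩ := h
      rw [vv_pos h1 h2]; simp
    · rw [vv, dif_neg h]
  sq := by
    rintro S ⟨i, hi⟩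
    have r1 : range (sbot S) ⊆ range S := by rintro _ ⟨x, rfl⟩; exact ⟨_, rfl⟩
    have r2 : range (srgt S) ⊆ range S := by rintro _ ⟨x, rfl⟩; exact ⟨_, rfl⟩
    have r3 : range (slft S) ⊆ range S := by rintro _ ⟨x, rfl⟩; exact ⟨_, rfl⟩
    have r4 : range (stpp S) ⊆ range S := by rintro _ ⟨x, rfl⟩; exact ⟨_, rfl⟩
    cases i with
    | none => rw [vv_V0' (r1.trans hi), vv_V0' (r2.trans hi), vv_V0' (r3.trans hi), vv_V0' (r4.trans hi)]
    | some l =>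
      have hl : l.2 < m := (hi ⟨(0,0), rfl⟩).1
      have hi : range S ⊆ OO l := fun x hx => (hi hx).2
      rw [vv_pos hl (r1.trans hi), vv_pos hl (r2.trans hi), vv_pos hl (r3.trans hi), vv_pos hl (r4.trans hi)]
      simp [sbot, srgt, slft, stpp, mul_assoc]

def VV (m : ℕ) : C(I, HE ι) → FG ι := (vv_loc m).full.choose
lemma VV_full (m : ℕ) : Full (Um m) (vv m : C(I, HE ι) → FG ι) (VV m) := (vv_loc m).full.choose_spec

lemma VV_V0 {m : ℕ} {p : C(I, HE ι)} (hp : range p ⊆ V0 ι m) : VV m p = 1 := by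
  rw [(VV_full m).small p ⟨none, hp⟩, vv_V0' hp]

lemma VV_OO {m : ℕ} {p : C(I, HE ι)} {l : ι × ℕ} (hp : range p ⊆ OO l) :
    VV m p = if l.2 < m then (sg l (p 0))⁻¹ * sg l (p 1) else 1 := by
  split_ifs with h
  · rw [(VV_full m).small p ⟨some l, fun x hx => ⟨h, hp hx⟩⟩, vv_pos h hp]
  · exact VV_V0 (hp.trans (OO_V0 (by omega)))

lemma rho_sg (m : ℕ) (l : ι × ℕ) (x : HE ι) : rho m (sg l x) = if l.2 < m then sg l x else 1 := by
  unfold sg; split_ifs <;> simp_all [rho]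

lemma V0_mono {m n : ℕ} (h : m ≤ n) : V0 ι n ⊆ V0 ι m := by
  rintro x hx ⟨h1, h2⟩
  refine hx ⟨h1, le_trans ?_ h2⟩
  gcongr

lemma VV_coh {m n : ℕ} (h : m ≤ n) (p : C(I, HE ι)) : rho m (VV n p) = VV m p := by
  refine dyad (Q := fun p => rho m (VV n p) = VV m p) (Um_open n) (Um_cov n) ?_ ?_ p
  · rintro p ⟨i, hi⟩
    cases i with
    | none => rw [VV_V0 hi, VV_V0 (hi.trans (V0_mono h)), map_one]
    | some l =>
      have hl : l.2 < n := (hi ⟨0, rfl⟩).1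
      have hi : range p ⊆ OO l := fun x hx => (hi hx).2
      rw [VV_OO hi, VV_OO hi, if_pos hl, map_mul, map_inv, rho_sg, rho_sg]
      split_ifs <;> simp
  · intro p h1 h2
    rw [(VV_full n).half, map_mul, h1, h2, ← (VV_full m).half]

/-- few low-level letters -/
def Cnt (m c : ℕ) (p : C(I, HE ι)) : Prop := ∀ n, (cut m (VV n p).toWord).length ≤ c

/-- elements without low letters -/
def Hi (m : ℕ) : Subgroup (FG ι) where
  carrier := {g | cut m g.toWord = []}
  one_mem' := by simp
  inv_mem' := by
    intro g hg
    simp only [mem_ofPred_eq, FreeGroup.toWord_inv, cut_invRev] at *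
    rw [hg]; rfl
  mul_mem' := by
    intro a b ha hb
    have := cut_sublist (FreeGroup.toWord_mul_sublist a b) m
    simp only [mem_ofPred_eq] at *
    rw [cut_append, ha, hb] at this
    simpa using this

lemma sg_Hi {m : ℕ} {l : ι × ℕ} (h : m ≤ l.2) (x : HE ι) : sg l x ∈ Hi m := by
  unfold sg; split_ifs
  · show cut m (FreeGroup.of l).toWord = []
    rw [FreeGroup.toWord_of, cut_cons_neg (by simpa using h)]; rfl
  · exact Subgroup.one_mem _

lemma sg_len (l : ι × ℕ) (x : HE ι) : (sg l x).toWord.length ≤ 1 := by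
  unfold sg; split_ifs <;> simp

lemma VV_Hi {m : ℕ} {p : C(I, HE ι)} (hp : range p ⊆ V0 ι m) (n : ℕ) : VV n p ∈ Hi (ι := ι) m := by
  refine (VV_full n).mem (vv_loc n) (V0 ι m) (Hi m) ?_ p hp
  rintro p ⟨i, hi⟩ hp
  by_cases h : ∃ l : ι × ℕ, l.2 < n ∧ range p ⊆ OO l
  · obtain ⟨l, h1, h2⟩ := h
    by_cases h3 : l.2 < m
    · rw [vv_V0 hp fun l' h' _ => by rwa [← OO_unique (h2 ⟨0, rfl⟩) (h' ⟨0, rfl⟩)]]; exact Subgroup.one_mem _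
    · rw [vv_pos h1 h2]
      exact Subgroup.mul_mem _ (Subgroup.inv_mem _ (sg_Hi (by omega) _)) (sg_Hi (by omega) _)
  · rw [vv, dif_neg h]; exact Subgroup.one_mem _

lemma cut_len (m : ℕ) (l : List (Lt ι)) : (cut m l).length ≤ l.length := List.length_filter_le _ _

lemma Cnt_small {m : ℕ} {p : C(I, HE ι)} (hp : ∃ i, range p ⊆ Um m i) : Cnt m 2 p := by
  obtain ⟨i, hi⟩ := hp
  intro n
  cases i with
  | none =>
    have : cut m (VV n p).toWord = [] := VV_Hi hi n
    simp [this]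
  | some l =>
    have hi : range p ⊆ OO l := fun x hx => (hi hx).2
    refine (cut_len _ _).trans ?_
    rw [VV_OO hi]
    split_ifs
    · refine (FreeGroup.toWord_mul_sublist _ _).length_le.trans ?_
      rw [List.length_append, FreeGroup.toWord_inv, FreeGroup.invRev_length]
      have := sg_len l (p 0)
      have := sg_len l (p 1)
      omega
    · simp

lemma Cnt_half {m c d : ℕ} {p : C(I, HE ι)} (h1 : Cnt m c (lh p)) (h2 : Cnt m d (rh p)) : Cnt m (c + d) p := by
  intro n
  rw [(VV_full n).half]
  refine (cut_sublist (FreeGroup.toWord_mul_sublist _ _) m).length_le.trans ?_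
  rw [cut_append, List.length_append]
  exact add_le_add (h1 n) (h2 n)

/-- uniform bounds for all subpaths -/
lemma Cnt_bound (p : C(I, HE ι)) (m : ℕ) : ∃ C, ∀ s t : ℝ, 0 ≤ s → s ≤ t → t ≤ 1 → Cnt m C (sub p s t) := by
  obtain ⟨δ, hδ, h⟩ := lebesgue (Um_open m) (Um_cov m) p
  have key : ∀ k : ℕ, ∀ s t : ℝ, 0 ≤ s → s ≤ t → t ≤ 1 → t - s < δ * 2 ^ k → Cnt m (2 * 2 ^ k) (sub p s t) := by
    intro k
    induction k with
    | zero => intro s t h0 h1 h2 h3; exact Cnt_small (h s t h0 h1 h2 (by simpa using h3))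
    | succ k ih =>
      intro s t h0 h1 h2 h3
      rw [pow_succ] at h3
      rw [show 2 * 2 ^ (k+1) = 2 * 2 ^ k + 2 * 2 ^ k by ring]
      apply Cnt_half
      · rw [lh_sub]; exact ih _ _ h0 (by linarith) (by linarith) (by linarith)
      · rw [rh_sub]; exact ih _ _ (by linarith) (by linarith) h2 (by linarith)
  obtain ⟨k, hk⟩ := pow_unbounded_of_one_lt (1/δ) (one_lt_two (α := ℝ))
  rw [div_lt_iff₀ hδ] at hk
  exact ⟨_, fun s t h0 h1 h2 => key k s t h0 h1 h2 (by linarith)⟩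

lemma VV_red (p : C(I, HE ι)) : ∃ V : Wd ι, ppi V = (fun n => VV n p) ∧ Red V ∧
    ∀ m, ∃ N, ∀ n, N ≤ n → cut m (VV n p).toWord = V.s m := by
  apply exists_reduced
  · intro m n h; exact VV_coh h p
  · intro m
    obtain ⟨C, hC⟩ := Cnt_bound p m
    refine ⟨C, fun n => ?_⟩
    have := hC 0 1 le_rfl zero_le_one le_rfl
    rw [sub_zero_one] at this
    exact this n

/-- the invariant of a path -/
def ps (p : C(I, HE ι)) : H ι := ⟨fun n => VV n p, by
  obtain ⟨V, h, -⟩ := VV_red p; exact ⟨V, h⟩⟩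

lemma ps_nf_cnt {m c : ℕ} {p : C(I, HE ι)} (h : Cnt m c p) : ((nf (ps p)).s m).length ≤ c := by
  obtain ⟨V, h1, h2, h3⟩ := VV_red p
  have : pr V = ps p := Subtype.ext h1
  rw [← this, nf_pr h2]
  obtain ⟨N, hN⟩ := h3 m
  rw [← hN N le_rfl]; exact h N

lemma ps_bound (p : C(I, HE ι)) (m : ℕ) : ∃ C, ∀ s t : ℝ, 0 ≤ s → s ≤ t → t ≤ 1 → ((nf (ps (sub p s t))).s m).length ≤ C := by
  obtain ⟨C, hC⟩ := Cnt_bound p m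
  exact ⟨C, fun s t h0 h1 h2 => ps_nf_cnt (hC s t h0 h1 h2)⟩

lemma ps_ext {p : C(I, HE ι)} {g : H ι} (h : ∀ n, VV n p = g.1 n) : ps p = g := Subtype.ext (funext h)

lemma ps_split (p : C(I, HE ι)) (s t r : ℝ) : ps (sub p s r) = ps (sub p s t) * ps (sub p t r) :=
  ps_ext fun n => (VV_full n).split p s t r

lemma ps_const (z : HE ι) : ps (ContinuousMap.const I z) = 1 := ps_ext fun n => (VV_full n).const z

lemma ps_sq (S : C(I × I, HE ι)) : ps (sbot S) * ps (srgt S) = ps (slft S) * ps (stpp S) :=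
  Subtype.ext (funext fun n => (VV_full n).sq S)

lemma ps_homotopic {x y : HE ι} {p q : Path x y} (h : p.Homotopic q) : ps p.toContinuousMap = ps q.toContinuousMap :=
  Subtype.ext (funext fun n => (VV_full n).homotopic h)

lemma ps_trans {x y z : HE ι} (p : Path x y) (q : Path y z) :
    ps (p.trans q).toContinuousMap = ps p.toContinuousMap * ps q.toContinuousMap :=
  Subtype.ext (funext fun n => (VV_full n).trans p q)

/-- path inside one copy has pure invariant -/
lemma ps_pure {α : ι} {p : C(I, HE ι)} (hp : ∀ t, (p t).1 ∈ XX α) : PureH (ps p) := by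
  obtain ⟨V, h1, h2, h3⟩ := VV_red p
  refine ⟨V, ⟨α, fun n x hx => ?_⟩, Subtype.ext h1⟩
  obtain ⟨N, hN⟩ := h3 n
  rw [← hN N le_rfl, mem_cut] at hx
  let L : Subgroup (FG ι) :=
  { carrier := {g | ∀ x ∈ g.toWord, x.1.1 = α}
    one_mem' := by simp
    inv_mem' := by
      intro g hg x hx
      rw [FreeGroup.toWord_inv, FreeGroup.invRev, List.mem_reverse, List.mem_map] at hx
      obtain ⟨y, hy, rfl⟩ := hx
      exact hg y hy
    mul_mem' := by
      intro a b ha hb x hx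
      rcases List.mem_append.1 ((FreeGroup.toWord_mul_sublist a b).subset hx) with h | h
      exacts [ha x h, hb x h] }
  have key : VV N p ∈ L := by
    refine (VV_full N).mem (vv_loc N) {x | x.1 ∈ XX α} L ?_ p (by rintro _ ⟨t, rfl⟩; exact hp t)
    rintro p - hp
    by_cases h : ∃ l : ι × ℕ, l.2 < N ∧ range p ⊆ OO l
    · obtain ⟨l, h1, h2⟩ := h
      have hla : l.1 = α := XX_unique (co_ne_of_c1 (h2 ⟨0, rfl⟩).2.1) (h2 ⟨0, rfl⟩).1 (hp ⟨0, rfl⟩)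
      have hs : ∀ x, sg l x ∈ L := by
        intro x; unfold sg; split_ifs
        · intro y hy; rw [FreeGroup.toWord_of, List.mem_singleton] at hy; subst hy; exact hla
        · exact L.one_mem
      rw [vv_pos h1 h2]
      exact L.mul_mem (L.inv_mem (hs _)) (hs _)
    · rw [vv, dif_neg h]; exact L.one_mem
  exact key x hx.1

end psi
end GrifAux

namespace GrifAux
open unitInterval Griffiths
variable {ι : Type}

/-! ## Weights -/

/-- bounded letter counts -/
def OK (C : ℕ → ℕ) (W : Wd ι) : Prop := ∀ n, (W.s n).length ≤ C n

def wtt (C : ℕ → ℕ) (W : Wd ι) (n : ℕ) : ℝ := (1/2)^(n+1) * ((W.s n).length / ((C n : ℝ) + 1))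

/-- total weight of a word -/
def wt (C : ℕ → ℕ) (W : Wd ι) : ℝ := ∑' n, wtt C W n

variable {C : ℕ → ℕ}

lemma OK.left {X Y : Wd ι} (h : OK C (X * Y)) : OK C X := fun n => by
  have := h n; rw [Wd.s_mul, List.length_append] at this; omega
lemma OK.right {X Y : Wd ι} (h : OK C (X * Y)) : OK C Y := fun n => by
  have := h n; rw [Wd.s_mul, List.length_append] at this; omega
lemma OK.dvd {X Y : Wd ι} (h : OK C Y) (hd : X ∣ Y) : OK C X := by
  obtain ⟨e, rfl⟩ := hd; exact h.left

lemma wtt_nonneg (W : Wd ι) (n : ℕ) : 0 ≤ wtt C W n := by unfold wtt; positivity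
lemma OK.wtt_le {W : Wd ι} (h : OK C W) (n : ℕ) : wtt C W n ≤ (1/2)^(n+1) := by
  have : ((W.s n).length : ℝ) ≤ C n := by exact_mod_cast h n
  unfold wtt
  refine mul_le_of_le_one_right (by positivity) ?_
  rw [div_le_one (by positivity)]; linarith
lemma geo_sum : Summable (fun n : ℕ => ((1:ℝ)/2)^(n+1)) := by
  simpa only [pow_succ] using (summable_geometric_two).mul_right (1/2)
lemma OK.summ {W : Wd ι} (h : OK C W) : Summable (wtt C W) :=
  Summable.of_nonneg_of_le (wtt_nonneg W) h.wtt_le geo_sum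

lemma wt_nonneg (W : Wd ι) : 0 ≤ wt C W := tsum_nonneg (wtt_nonneg W)

lemma OK.wt_mul {X Y : Wd ι} (h : OK C (X * Y)) : wt C (X * Y) = wt C X + wt C Y := by
  unfold wt
  rw [← h.left.summ.tsum_add h.right.summ]
  congr 1; funext n
  simp only [wtt, Wd.s_mul, List.length_append]; push_cast; ring

lemma wt_one : wt C (1 : Wd ι) = 0 := by simp [wt, wtt]

lemma OK.wt_pos {W : Wd ι} (h : OK C W) (h1 : W ≠ 1) : 0 < wt C W := by
  obtain ⟨n, hn⟩ := Wd.exists_s_ne h1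
  refine h.summ.tsum_pos (wtt_nonneg W) n ?_
  have : 0 < (W.s n).length := List.length_pos_iff.2 hn
  unfold wtt; positivity

lemma OK.wt_tail {W : Wd ι} (h : OK C W) {m : ℕ} (hm : W.s m = []) : wt C W ≤ (1/2)^m := by
  have h0 : ∀ n ∈ Finset.range m, wtt C W n = 0 := by
    intro n hn
    have : W.s n = [] := by rw [← W.coh n m (Finset.mem_range.1 hn).le, hm]; rfl
    simp [wtt, this]
  rw [wt, ← h.summ.sum_add_tsum_nat_add m, Finset.sum_eq_zero h0, zero_add]
  refine (((summable_nat_add_iff m).2 h.summ).tsum_le_tsum (fun n => h.wtt_le (n + m))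
    ((summable_nat_add_iff m).2 geo_sum)).trans (le_of_eq ?_)
  have : ∀ n : ℕ, ((1:ℝ)/2)^(n+m+1) = (1/2)^n * ((1/2)^m * (1/2)) := fun n => by ring
  simp_rw [this]
  rw [tsum_mul_right, tsum_geometric_two]; ring

lemma OK.wt_le_one {W : Wd ι} (h : OK C W) : wt C W ≤ 1 := by
  have h0 : W.s 0 = [] := by
    rw [← W.cut_self 0, List.eq_nil_iff_forall_not_mem]; intro x hx; simp [mem_cut] at hx
  simpa using h.wt_tail h0

lemma OK.wt_mono {X Y : Wd ι} (h : OK C Y) (hd : X ∣ Y) : wt C X ≤ wt C Y := by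
  obtain ⟨e, rfl⟩ := hd; rw [h.wt_mul]; linarith [wt_nonneg (C := C) e]

/-- an occurrence of a letter versus a prefix -/
lemma Wd.occ_pre {X R A B : Wd ι} {z : Lt ι} (h : X * Wd.of z * R = A * B) : A ∣ X ∨ X * Wd.of z ∣ A := by
  rw [mul_assoc] at h
  rcases Wd.levi h with ⟨e, h1, h2⟩ | ⟨e, h1, h2⟩
  · rcases Wd.levi h2 with ⟨f, h3, h4⟩ | ⟨f, h3, h4⟩
    · right; exact ⟨f, by rw [h1, h3, mul_assoc]⟩
    · rcases Wd.of_eq_mul h3 with h5 | h5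
      · left; rw [h1, h5, mul_one]
      · right; rw [h1, h3, h5, mul_one]
  · left; exact ⟨e, h1⟩

/-! ## Glueing arcs -/

lemma glue {Z J : Type} [MetricSpace Z] (b : Z) (f : J → ℝ → Z) (lo hi : J → ℝ)
    (hf : ∀ i, Continuous (f i)) (hd : ∀ i j t, t ∈ Ioo (lo i) (hi i) → t ∈ Ioo (lo j) (hi j) → i = j)
    (hb : ∀ i t, t ∉ Ioo (lo i) (hi i) → f i t = b)
    (hfin : ∀ ε > 0, {i | ∃ t, ε ≤ dist (f i t) b}.Finite) :
    ∃ g : ℝ → Z, Continuous g ∧ (∀ i t, t ∈ Ioo (lo i) (hi i) → g t = f i t) ∧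
      ∀ t, (∀ i, t ∉ Ioo (lo i) (hi i)) → g t = b := by
  classical
  let g : ℝ → Z := fun t => if h : ∃ i, t ∈ Ioo (lo i) (hi i) then f h.choose t else b
  have hg1 : ∀ i t, t ∈ Ioo (lo i) (hi i) → g t = f i t := by
    intro i t ht
    have h : ∃ i, t ∈ Ioo (lo i) (hi i) := ⟨i, ht⟩
    simp only [g, dif_pos h]
    rw [hd _ _ t h.choose_spec ht]
  have hg2 : ∀ t, (∀ i, t ∉ Ioo (lo i) (hi i)) → g t = b := by
    intro t ht
    simp only [g]; rw [dif_neg (by push Not; exact ht)]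
  refine ⟨g, ?_, hg1, hg2⟩
  rw [continuous_iff_continuousAt]
  intro t
  by_cases h : ∃ i, t ∈ Ioo (lo i) (hi i)
  · obtain ⟨i, hi'⟩ := h
    refine ((hf i).continuousAt).congr ?_
    filter_upwards [isOpen_Ioo.mem_nhds hi'] with s hs using (hg1 i s hs).symm
  · push Not at h
    rw [Metric.continuousAt_iff', hg2 t h]
    intro ε hε
    have : ∀ᶠ s in nhds t, ∀ i ∈ {i | ∃ t, ε ≤ dist (f i t) b}, dist (f i s) b < ε := by
      rw [Filter.eventually_all_finite (hfin ε hε)]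
      intro i _
      have := Metric.continuousAt_iff'.1 ((hf i).continuousAt (x := t)) ε hε
      rwa [hb i t (h i)] at this
    filter_upwards [this] with s hs
    by_cases h' : ∃ i, s ∈ Ioo (lo i) (hi i)
    · obtain ⟨i, hi'⟩ := h'
      rw [hg1 i s hi']
      by_contra hc
      exact hc (hs i ⟨s, not_lt.1 hc⟩)
    · push Not at h'
      rw [hg2 s h', dist_self]; exact hε

/-! ## Letter paths -/

def lp (z : Lt ι) : C(I, HE ι) :=
  ⟨fun t => ed z.1 (if z.2 then (t:ℝ) else 1 - t), (ed_cont z.1).comp (by split_ifs <;> fun_prop)⟩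

lemma V0_of_c0 {m : ℕ} {x : HE ι} (h : c0 x ≠ 0) : x ∈ V0 ι m := fun h' => h h'.1
lemma V0_of_c1 {m : ℕ} {x : HE ι} (h : c1 x = 0) : x ∈ V0 ι m := fun h' => by
  have := h'.2; rw [h] at this
  have h2 : 0 < 2 / ((m:ℝ)+2) := by positivity
  linarith

lemma VV_cc (m : ℕ) (p : C(I, HE ι)) (s : ℝ) : VV m (sub p s s) = 1 := by
  have : sub p s s = ContinuousMap.const I (p (pj s)) := by
    refine ContinuousMap.ext fun x => ?_
    rw [sub_apply, show (1 - (x:ℝ)) * s + x * s = s by ring]; rfl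
  rw [this, (VV_full m).const]

lemma VV_lp_true (m : ℕ) (l : ι × ℕ) : VV m (lp (l, true)) = if l.2 < m then FreeGroup.of l else 1 := by
  have e1 : VV m (sub (lp (l, true)) 0 (1/4)) = 1 := by
    refine VV_V0 fun x hx => ?_
    obtain ⟨t, ⟨h0, h1⟩, rfl⟩ := range_sub' _ (by norm_num) hx
    show ed l (pj t : ℝ) ∈ _
    rw [coe_pj ⟨h0, by linarith⟩]
    rcases h0.eq_or_lt with rfl | h0
    · exact V0_of_c1 (by rw [c1_ed]; simp)
    · refine V0_of_c0 (ne_of_gt ?_)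
      rw [c0_ed]
      have := Real.sin_pos_of_pos_of_lt_pi (x := 2 * Real.pi * t) (by positivity) (by nlinarith [Real.pi_pos])
      positivity
  have e3 : VV m (sub (lp (l, true)) (3/4) 1) = 1 := by
    refine VV_V0 fun x hx => ?_
    obtain ⟨t, ⟨h0, h1⟩, rfl⟩ := range_sub' _ (by norm_num) hx
    show ed l (pj t : ℝ) ∈ _
    rw [coe_pj ⟨by linarith, h1⟩]
    rcases h1.eq_or_lt with rfl | h1
    · exact V0_of_c1 (by rw [c1_ed]; simp)
    · refine V0_of_c0 (ne_of_lt ?_)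
      rw [c0_ed]
      have := Real.sin_pos_of_pos_of_lt_pi (x := 2 * Real.pi * t - Real.pi) (by nlinarith [Real.pi_pos]) (by nlinarith [Real.pi_pos])
      rw [Real.sin_sub_pi] at this
      have h3 : (0:ℝ) < 1 / (l.2 + 3) := by positivity
      nlinarith
  have hr : range (sub (lp (l, true)) (1/4) (3/4)) ⊆ OO l := by
    intro x hx
    obtain ⟨t, ⟨h0, h1⟩, rfl⟩ := range_sub' _ (by norm_num) hx
    show ed l (pj t : ℝ) ∈ _
    rw [coe_pj ⟨by linarith, by linarith⟩]
    exact ed_OO (by linarith) (by linarith)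
  have s0 : sg l (sub (lp (l, true)) (1/4) (3/4) 0) = 1 := by
    rw [sub_zero]
    show sg l (ed l (pj (1/4) : ℝ)) = 1
    rw [coe_pj (by norm_num), sg, if_neg]
    rw [c0_ed, show 2 * Real.pi * (1/4) = Real.pi / 2 by ring, Real.sin_pi_div_two]
    push Not; positivity
  have s1 : sg l (sub (lp (l, true)) (1/4) (3/4) 1) = FreeGroup.of l := by
    rw [sub_one]
    show sg l (ed l (pj (3/4) : ℝ)) = _
    rw [coe_pj (by norm_num), sg, if_pos]
    rw [c0_ed, show 2 * Real.pi * (3/4) = Real.pi / 2 + Real.pi by ring, Real.sin_add_pi, Real.sin_pi_div_two]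
    have h3 : (0:ℝ) < 1 / (l.2 + 3) := by positivity
    linarith
  rw [← sub_zero_one (lp (l, true)), (VV_full m).split _ 0 (1/4) 1, (VV_full m).split _ (1/4) (3/4) 1, e1, e3,
    VV_OO hr, s0, s1]
  simp

lemma VV_lp (m : ℕ) (z : Lt ι) : VV m (lp z) = FreeGroup.mk ((Wd.of z).s m) := by
  obtain ⟨l, b⟩ := z
  have key : VV m (lp (l, true)) = FreeGroup.mk ((Wd.of (l, true)).s m) := by
    rw [VV_lp_true, Wd.of]; simp only; split_ifs <;> rfl
  cases b with
  | true => exact key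
  | false =>
    have h : lp (l, false) = sub (lp (l, true)) 1 0 := by
      refine ContinuousMap.ext fun t => ?_
      show ed l (1 - (t:ℝ)) = ed l (pj ((1 - t) * 1 + t * 0) : ℝ)
      rw [coe_pj (conv_mem' t.2 (by norm_num) (by norm_num))]; ring_nf
    have h2 := (VV_full m).split (lp (l, true)) 0 1 0
    rw [VV_cc, sub_zero_one, ← h] at h2
    rw [eq_inv_of_mul_eq_one_right h2.symm, key, FreeGroup.inv_mk, ← Wd.s_inv, Wd.of_inv]
    rfl

/-- letter occurrences -/
def Ocr (W : Wd ι) := {x : Wd ι × Lt ι × Wd ι // W = x.1 * Wd.of x.2.1 * x.2.2}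

lemma Ocr.eq {W : Wd ι} {i j : Ocr W} (h : j.1.1 = i.1.1) : i = j := by
  obtain ⟨⟨X, z, R⟩, hi⟩ := i
  obtain ⟨⟨X', z', R'⟩, hj⟩ := j
  simp only at h hi hj
  subst h
  have e : Wd.of z' * R' = Wd.of z * R := by
    apply mul_left_cancel (a := X'); rw [← mul_assoc, ← mul_assoc, ← hi, ← hj]
  have e2 := congrArg (fun w => Wd.s w (z.1.2 + z'.1.2 + 1)) e
  simp only [Wd.s_mul] at e2
  rw [Wd.of_s_pos (by omega), Wd.of_s_pos (by omega)] at e2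
  obtain rfl : z' = z := by simpa using congrArg List.head? e2
  obtain rfl := mul_left_cancel e
  rfl

def clp (x : ℝ) : ℝ := max 0 (min 1 x)

def arc (C : ℕ → ℕ) (X : Wd ι) (z : Lt ι) (t : ℝ) : HE ι :=
  ed z.1 (if z.2 then clp ((t - wt C X) / wt C (Wd.of z)) else 1 - clp ((t - wt C X) / wt C (Wd.of z)))

lemma arc_cont (X : Wd ι) (z : Lt ι) : Continuous (arc C X z) := by
  unfold arc clp
  refine (ed_cont z.1).comp ?_
  split_ifs <;> fun_prop

lemma clp_lo {x : ℝ} (h : x ≤ 0) : clp x = 0 := max_eq_left ((min_le_right _ _).trans h)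
lemma clp_hi {x : ℝ} (h : 1 ≤ x) : clp x = 1 := by simp [clp, min_eq_left h]
lemma clp_mid {x : ℝ} (h : 0 ≤ x) (h1 : x ≤ 1) : clp x = x := by
  rw [clp, min_eq_right h1, max_eq_right h]

lemma ed_zero' (l : ι × ℕ) (a : ι) : ed l 0 = bp a := by apply eq_bp; rw [c1_ed]; simp
lemma ed_one' (l : ι × ℕ) (a : ι) : ed l 1 = bp a := by apply eq_bp; rw [c1_ed]; simp

theorem word_path (a : ι) (W : Wd ι) (hW : OK C W) : ∃ g : C(I, HE ι), g 0 = bp a ∧ g (pj (wt C W)) = bp a ∧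
    (∀ X Y R, W = X * Y * R → ∀ m, VV m (sub g (wt C X) (wt C (X * Y))) = FreeGroup.mk (Y.s m)) ∧
    ∀ t, g t = bp a ∨ ∃ X z R, W = X * Wd.of z * R ∧ g t ∈ OO z.1 := by
  have hwz : ∀ i : Ocr W, 0 < wt C (Wd.of i.1.2.1) := fun i => by
    have : OK C (i.1.1 * Wd.of i.1.2.1 * i.1.2.2) := i.2 ▸ hW
    exact this.left.right.wt_pos (Wd.of_ne_one _)
  have hwx : ∀ i : Ocr W, wt C (i.1.1 * Wd.of i.1.2.1) = wt C i.1.1 + wt C (Wd.of i.1.2.1) := fun i => by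
    have : OK C (i.1.1 * Wd.of i.1.2.1 * i.1.2.2) := i.2 ▸ hW
    exact this.left.wt_mul
  have hOO : ∀ (i : Ocr W) t, t ∈ Ioo (wt C i.1.1) (wt C (i.1.1 * Wd.of i.1.2.1)) → arc C i.1.1 i.1.2.1 t ∈ OO i.1.2.1.1 := by
    intro i t ht
    rw [hwx, mem_Ioo] at ht
    have h1 : 0 < (t - wt C i.1.1) / wt C (Wd.of i.1.2.1) := div_pos (by linarith) (hwz i)
    have h2 : (t - wt C i.1.1) / wt C (Wd.of i.1.2.1) < 1 := by rw [div_lt_one (hwz i)]; linarith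
    unfold arc
    rw [clp_mid h1.le h2.le]
    split_ifs
    · exact ed_OO h1 h2
    · exact ed_OO (by linarith) (by linarith)
  have hoff : ∀ (i : Ocr W) t, t ∉ Ioo (wt C i.1.1) (wt C (i.1.1 * Wd.of i.1.2.1)) → arc C i.1.1 i.1.2.1 t = bp a := by
    intro i t ht
    rw [hwx, mem_Ioo, not_and_or, not_lt, not_lt] at ht
    unfold arc
    rcases ht with ht | ht
    · rw [clp_lo (div_nonpos_of_nonpos_of_nonneg (by linarith) (hwz i).le)]
      split_ifs
      · exact ed_zero' _ _
      · rw [_root_.sub_zero]; exact ed_one' _ _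
    · rw [clp_hi ((one_le_div (hwz i)).2 (by linarith))]
      split_ifs
      · exact ed_one' _ _
      · rw [sub_self]; exact ed_zero' _ _
  obtain ⟨g, hg, hg1, hg2⟩ := glue (J := Ocr W) (bp a) (fun i => arc C i.1.1 i.1.2.1) (fun i => wt C i.1.1)
    (fun i => wt C (i.1.1 * Wd.of i.1.2.1)) (fun i => arc_cont _ _) (by
      rintro ⟨⟨X, z, R⟩, hi⟩ ⟨⟨X', z', R'⟩, hj⟩ t ht ht'
      simp only at hi hj ht ht'
      have hd : X' ∣ X := by
        rcases Wd.occ_pre (hi.symm.trans (hj.trans (mul_assoc _ _ _))) with h | h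
        · exact h
        · have := (hW.dvd ⟨_, hj.trans (mul_assoc _ _ _)⟩).wt_mono h; linarith [ht.2, ht'.1]
      have hd' : X ∣ X' := by
        rcases Wd.occ_pre (hj.symm.trans (hi.trans (mul_assoc _ _ _))) with h | h
        · exact h
        · have := (hW.dvd ⟨_, hi.trans (mul_assoc _ _ _)⟩).wt_mono h; linarith [ht'.2, ht.1]
      exact Ocr.eq (Wd.dvd_antisymm' hd hd'))
    hoff (by
      intro ε hε
      obtain ⟨m, hm⟩ := exists_nat_gt (2 / ε)
      have hl : ∀ i : Ocr W, (∃ t, ε ≤ dist (arc C i.1.1 i.1.2.1 t) (bp a)) → i.1.2.1.1.2 < m := by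
        rintro i ⟨t, ht⟩
        by_contra hc
        push Not at hc
        by_cases h : t ∈ Ioo (wt C i.1.1) (wt C (i.1.1 * Wd.of i.1.2.1))
        · have h1 := OO_dist (a := a) (hOO i t h)
          have hc' : (m:ℝ) ≤ i.1.2.1.1.2 := by exact_mod_cast hc
          have h2 : 2 / ((i.1.2.1.1.2:ℝ) + 3) < ε := by
            rw [div_lt_comm₀ (by positivity) hε]; linarith
          linarith
        · rw [hoff i t h, dist_self] at ht; linarith
      have hlen : ∀ i : Ocr W, i.1.2.1.1.2 < m → ((i.1.1 * Wd.of i.1.2.1).s m).length = (i.1.1.s m).length + 1 := by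
        intro i hi; rw [Wd.s_mul, Wd.of_s_pos hi]; simp
      have hdl : ∀ {A B : Wd ι}, A ∣ B → (A.s m).length ≤ (B.s m).length := by
        rintro A _ ⟨e, rfl⟩; simp
      refine Finite.of_finite_image (f := fun i : Ocr W => (i.1.1.s m).length) ((finite_Iio (W.s m).length).subset ?_) ?_
      · rintro _ ⟨i, hi, rfl⟩
        have := hdl (Dvd.intro _ i.2.symm)
        rw [hlen i (hl i hi)] at this
        show (i.1.1.s m).length < _
        omega
      · intro i hi j hj hij
        simp only at hij
        have hd : j.1.1 ∣ i.1.1 := by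
          rcases Wd.occ_pre (i.2.symm.trans (j.2.trans (mul_assoc _ _ _))) with h | h
          · exact h
          · have := hdl h; rw [hlen i (hl i hi)] at this; omega
        have hd' : i.1.1 ∣ j.1.1 := by
          rcases Wd.occ_pre (j.2.symm.trans (i.2.trans (mul_assoc _ _ _))) with h | h
          · exact h
          · have := hdl h; rw [hlen j (hl j hj)] at this; omega
        exact Ocr.eq (Wd.dvd_antisymm' hd hd'))
  have hwI : ∀ {X : Wd ι}, OK C X → wt C X ∈ Icc (0:ℝ) 1 := fun h => ⟨wt_nonneg _, h.wt_le_one⟩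
  let G : C(I, HE ι) := ⟨fun t => g t, by fun_prop⟩
  have hG : ∀ {t : ℝ}, t ∈ Icc (0:ℝ) 1 → G (pj t) = g t := fun ht => by
    show g (pj _ : ℝ) = _; rw [coe_pj ht]
  have hcase : ∀ t, g t = bp a ∨ ∃ i : Ocr W, t ∈ Ioo (wt C i.1.1) (wt C (i.1.1 * Wd.of i.1.2.1)) := by
    intro t
    by_cases h : ∃ i : Ocr W, t ∈ Ioo (wt C i.1.1) (wt C (i.1.1 * Wd.of i.1.2.1))
    · exact Or.inr h
    · push Not at h; exact Or.inl (hg2 t h)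
  have hocrOK : ∀ i : Ocr W, OK C (i.1.1 * Wd.of i.1.2.1) := fun i => hW.dvd ⟨_, i.2⟩
  have hend : ∀ {A : Wd ι}, A ∣ W → g (wt C A) = bp a := by
    rintro A ⟨e, he⟩
    refine hg2 _ fun i hi => ?_
    rcases Wd.occ_pre (i.2.symm.trans he) with h | h
    · have := (hocrOK i).left.wt_mono h; linarith [hi.1]
    · have := (hW.dvd ⟨e, he⟩).wt_mono h; linarith [hi.2]
  refine ⟨G, ?_, ?_, ?_, ?_⟩
  · refine hg2 _ fun i hi => ?_
    have := wt_nonneg (C := C) i.1.1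
    have h2 := hi.1
    simp at h2; linarith
  · rw [hG (hwI hW)]; exact hend dvd_rfl
  · -- values
    intro X Y R hXYR m
    have base : ∀ X Y R : Wd ι, W = X * Y * R → Y.s m = [] → VV m (sub G (wt C X) (wt C (X * Y))) = 1 := by
      intro X Y R hXYR hY
      have hOK : OK C (X * Y) := hW.dvd ⟨_, hXYR⟩
      refine VV_V0 fun x hx => ?_
      obtain ⟨t, ht, rfl⟩ := range_sub' _ (hOK.wt_mono ⟨_, rfl⟩) hx
      have htI : t ∈ Icc (0:ℝ) 1 := ⟨(wt_nonneg _).trans ht.1, ht.2.trans hOK.wt_le_one⟩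
      show G (pj t) ∈ _
      rw [hG htI]
      rcases hcase t with h | ⟨i, hi⟩
      · rw [h]; exact V0_of_c1 (c1_bp _)
      · rw [hg1 i t hi]
        refine OO_V0 ?_ (hOO i t hi)
        by_contra hc
        push Not at hc
        rcases Wd.occ_pre (i.2.symm.trans (hXYR.trans (mul_assoc _ _ _))) with ⟨e, he⟩ | h
        · rcases Wd.occ_pre (i.2.symm.trans hXYR) with h | h
          · have := hocrOK i |>.left.wt_mono h; linarith [hi.1, ht.2]
          · rw [he, mul_assoc] at h
            obtain ⟨f, hf⟩ := h
            rw [mul_assoc] at hf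
            have := mul_left_cancel hf
            rw [this] at hY
            simp [Wd.of_s_pos hc] at hY
        · have := hOK.left.wt_mono h; linarith [hi.2, ht.1]
    generalize hk : (Y.s m).length = k
    induction k generalizing X Y with
    | zero =>
      have hY : Y.s m = [] := List.length_eq_zero_iff.1 hk
      rw [hY]; exact base X Y R hXYR hY
    | succ k ih =>
      cases hY : Y.s m with
      | nil => rw [hY] at hk; simp at hk
      | cons z L =>
        obtain ⟨X1, R1, e1, e2, e3⟩ := Wd.letter_split (L1 := []) hY
        have hz : z.1.2 < m := by
          have : z ∈ cut m (Y.s m) := by rw [Y.cut_self, hY]; simp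
          exact (mem_cut.1 this).2
        have hL : L.length = k := by rw [hY] at hk; simpa using hk
        let i : Ocr W := ⟨(X * X1, z, R1 * R), by rw [hXYR, e1]; simp only [mul_assoc]⟩
        have k1 : VV m (sub G (wt C X) (wt C (X * X1))) = 1 :=
          base X X1 (Wd.of z * (R1 * R)) (by rw [hXYR, e1]; simp only [mul_assoc]) e2
        have k2 : VV m (sub G (wt C (X * X1)) (wt C (X * X1 * Wd.of z))) = FreeGroup.mk ((Wd.of z).s m) := by
          rw [← VV_lp]
          congr 1
          refine ContinuousMap.ext fun t => ?_
          have hm := conv_mem t.2 ((hocrOK i).wt_mono ⟨_, rfl⟩ : wt C (X * X1) ≤ wt C (X * X1 * Wd.of z))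
          have hI := conv_mem' t.2 (hwI (hocrOK i).left) (hwI (hocrOK i))
          rw [sub_apply, hG hI]
          have : g ((1 - ↑t) * wt C (X * X1) + ↑t * wt C (X * X1 * Wd.of z)) =
              arc C (X * X1) z ((1 - ↑t) * wt C (X * X1) + ↑t * wt C (X * X1 * Wd.of z)) := by
            generalize ht : (1 - (t:ℝ)) * wt C (X * X1) + ↑t * wt C (X * X1 * Wd.of z) = u at hm
            by_cases h : u ∈ Ioo (wt C (X * X1)) (wt C (X * X1 * Wd.of z))
            · exact hg1 i u h
            · rw [hoff i u h]
              rw [mem_Ioo, not_and_or, not_lt, not_lt] at h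
              rcases h with h | h
              · rw [le_antisymm h hm.1]; exact hend ((Dvd.intro _ rfl : X * X1 ∣ X * X1 * Wd.of z).trans ⟨_, i.2⟩)
              · rw [le_antisymm hm.2 h]; exact hend ⟨_, i.2⟩
          have hw : wt C (X * X1 * Wd.of z) = wt C (X * X1) + wt C (Wd.of z) := hwx i
          have hw0 : wt C (Wd.of z) ≠ 0 := (hwz i).ne'
          rw [this, arc, hw, show ((1 - (t:ℝ)) * wt C (X * X1) + ↑t * (wt C (X * X1) + wt C (Wd.of z)) - wt C (X * X1)) / wt C (Wd.of z) = t by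
            field_simp; ring, clp_mid t.2.1 t.2.2]
          rfl
        have k3 := ih (X * X1 * Wd.of z) R1 (by rw [hXYR, e1]; simp only [mul_assoc]) (by rw [e3, hL])
        rw [(VV_full m).split _ _ (wt C (X * X1)) _, (VV_full m).split _ (wt C (X * X1)) (wt C (X * X1 * Wd.of z)) _, k1, k2, e1]
        rw [show X * (X1 * Wd.of z * R1) = X * X1 * Wd.of z * R1 by simp only [mul_assoc], k3, e3, Wd.of_s_pos hz, one_mul]
        rfl
  · intro t
    rcases hcase t with h | ⟨i, hi⟩
    · exact Or.inl h
    · right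
      refine ⟨_, _, _, i.2, ?_⟩
      show g t ∈ _
      rw [hg1 i t hi]; exact hOO i t hi

/-- every word is realized by a loop in the earring -/
theorem word_loop (a : ι) (W : Wd ι) : ∃ q : Path (bp a) (bp a), ps q.toContinuousMap = pr W ∧
    ∀ α, (∀ n, ∀ x ∈ W.s n, x.1.1 = α) → ∀ t, (q t).1 ∈ XX α := by
  obtain ⟨g, h0, h1, h2, h3⟩ := word_path (C := fun n => (W.s n).length) a W fun n => le_rfl
  let C : ℕ → ℕ := fun n => (W.s n).length
  refine ⟨⟨sub g 0 (wt C W), ?_, ?_⟩, ps_ext fun n => ?_, fun α hα t => ?_⟩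
  · show sub g 0 (wt C W) 0 = _
    rw [sub_zero, ← h0]; congr 1; exact pj_coe 0
  · show sub g 0 (wt C W) 1 = _
    rw [sub_one]; exact h1
  · have := h2 1 W 1 (by simp) n
    rw [wt_one, one_mul] at this
    exact this
  · show (sub g 0 (wt C W) t).1 ∈ _
    rw [sub_apply]
    rcases h3 (pj ((1 - ↑t) * 0 + ↑t * wt C W)) with h | ⟨X, z, R, e, h⟩
    · rw [h]; exact mem_XX_of_zero α (co_bp a)
    · have hz : z.1.1 = α := hα (z.1.2 + 1) z (by rw [e]; simp [Wd.of_self_mem])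
      rw [← hz]; exact h.1
end GrifAux

namespace GrifAux
open unitInterval Griffiths
variable {ι : Type}

lemma seg_ev {Z : Type} [TopologicalSpace Z] (q : C(I, Z)) {U : Set Z} (hU : IsOpen U) {t₀ : I} (h : q t₀ ∈ U) :
    ∀ᶠ t : I in nhds t₀, range (sub q t₀ t) ⊆ U := by
  obtain ⟨δ, hδ, hb⟩ := Metric.mem_nhds_iff.1 ((hU.preimage q.continuous).mem_nhds h)
  filter_upwards [Metric.ball_mem_nhds t₀ hδ] with t ht
  rintro _ ⟨x, rfl⟩
  rw [sub_apply]
  apply hb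
  have hm := conv_mem' x.2 t₀.2 t.2
  rw [Metric.mem_ball, Subtype.dist_eq, Real.dist_eq] at ht ⊢
  rw [coe_pj hm, show (1 - (x:ℝ)) * t₀ + x * t - t₀ = x * (t - t₀) by ring, abs_mul, abs_of_nonneg x.2.1]
  have := x.2.2
  nlinarith [abs_nonneg ((t:ℝ) - t₀)]

/-- potential in `H` -/
def sgH (l : ι × ℕ) (x : HE ι) : H ι := if c0 x ≤ 0 then pr (Wd.of (l, true)) else 1

lemma ps_OO {p : C(I, HE ι)} {l : ι × ℕ} (hp : range p ⊆ OO l) : ps p = (sgH l (p 0))⁻¹ * sgH l (p 1) := by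
  have key : ∀ (x : HE ι) n, (sgH l x).1 n = if l.2 < n then sg l x else 1 := by
    intro x n
    unfold sgH sg
    by_cases h1 : c0 x ≤ 0 <;> by_cases h2 : l.2 < n <;> simp only [h1, h2, if_true, if_false]
    · show FreeGroup.mk ((Wd.of (l, true)).s n) = _
      rw [Wd.of_s_pos h2]; rfl
    · show FreeGroup.mk ((Wd.of (l, true)).s n) = _
      rw [Wd.of_s_neg h2]; rfl
    · rfl
    · rfl
  refine ps_ext fun n => ?_
  show _ = ((sgH l (p 0)).1 n)⁻¹ * (sgH l (p 1)).1 n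
  rw [VV_OO hp, key, key]
  split_ifs <;> simp

lemma edge_ex (g : H ι) (l : ι × ℕ) : ∃ x : Wd ι × Bool, Red (x.1 * Wd.of (l, x.2)) ∧
    (x.2 = true → nf g = x.1 ∧ nf (g * pr (Wd.of (l, true))) = x.1 * Wd.of (l, x.2)) ∧
    (x.2 = false → nf g = x.1 * Wd.of (l, x.2) ∧ nf (g * pr (Wd.of (l, true))) = x.1) := by
  have hr : Red (Wd.of (l, true)) := by
    intro a b c h hb
    by_contra hb1
    rcases Wd.of_eq_mul h with h1 | h1
    · exact hb1 (Wd.mul_eq_one h1).2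
    · rw [h1, mul_one] at h
      rcases Wd.of_eq_mul h with h2 | h2
      · rw [h2, one_mul] at h
        rw [← h, pr_eq_one] at hb
        have := hb (l.2 + 1)
        rw [Wd.of_s_pos (by simp)] at this
        exact FreeGroup.of_ne_one l this
      · exact hb1 h2
  obtain ⟨A, B, D, h1, h2, h3⟩ := red_mul (red_nf g) hr
  rcases Wd.of_eq_mul h2 with h4 | h4
  · rw [h4, one_mul] at h2
    rw [inv_eq_one.1 h4, mul_one] at h1
    subst h2
    refine ⟨(A, true), h3, fun _ => ⟨h1, ?_⟩, by simp⟩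
    rw [← nf_pr h3, map_mul, ← h1, pr_nf]
  · rw [h4, mul_one] at h2
    have h5 : D = Wd.of (l, false) := by rw [← inv_inv D, ← h2, Wd.of_inv]; rfl
    rw [h4, mul_one] at h3
    subst h5
    refine ⟨(A, false), by rw [← h1]; exact red_nf g, by simp, fun _ => ⟨h1, ?_⟩⟩
    rw [← nf_pr h3]; congr 1
    rw [← pr_nf g, h1, map_mul, mul_assoc, ← map_mul, h2, map_mul, pr_inv, mul_inv_cancel, mul_one]

def eB (g : H ι) (l : ι × ℕ) : Wd ι := (edge_ex g l).choose.1
def eS (g : H ι) (l : ι × ℕ) : Bool := (edge_ex g l).choose.2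
def eZ (g : H ι) (l : ι × ℕ) : Lt ι := (l, eS g l)

/-- position on an edge -/
def vt (x : HE ι) : ℝ := 1/2 - c0 x * |c0 x| / (2 * (c0 x ^ 2 + c1 x ^ 2))
def th (b : Bool) (x : HE ι) : ℝ := if b then vt x else 1 - vt x

lemma th_cont {b : Bool} {x : HE ι} (h : 0 < c1 x) : ContinuousAt (th b) x := by
  have : ContinuousAt (vt (ι := ι)) x := by
    unfold vt
    refine continuousAt_const.sub (ContinuousAt.div (by fun_prop) (by fun_prop) (by positivity))
  unfold th; split_ifs
  · exact this
  · exact continuousAt_const.sub this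

lemma OO_D {l : ι × ℕ} {x : HE ι} (h : x ∈ OO l) : c0 x ^ 2 + c1 x ^ 2 = 2 * c1 x / ((l.2:ℝ) + 3) := by
  rw [← h.2.2]; field_simp

/-- distance to the near end -/
lemma vt_lo {l : ι × ℕ} {x : HE ι} (h : x ∈ OO l) (h0 : 0 < c0 x) : vt x = c1 x * (l.2 + 3) / 4 := by
  have h1 := h.2.1
  have e : c0 x * |c0 x| = 2 * c1 x / ((l.2:ℝ) + 3) - c1 x ^ 2 := by rw [abs_of_pos h0, ← OO_D h]; ring
  rw [vt, e, OO_D h]; field_simp; ring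
lemma vt_hi {l : ι × ℕ} {x : HE ι} (h : x ∈ OO l) (h0 : c0 x ≤ 0) : vt x = 1 - c1 x * (l.2 + 3) / 4 := by
  have h1 := h.2.1
  have e : c0 x * |c0 x| = -(2 * c1 x / ((l.2:ℝ) + 3) - c1 x ^ 2) := by rw [abs_of_nonpos h0, ← OO_D h]; ring
  rw [vt, e, OO_D h]; field_simp; ring

lemma vt_mem {l : ι × ℕ} {x : HE ι} (h : x ∈ OO l) : vt x ∈ Ioo (0:ℝ) 1 := by
  have h1 := h.2.1
  have h2 : c1 x * (l.2 + 3) ≤ 2 := by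
    have := OO_c1_le h; rwa [le_div_iff₀ (by positivity)] at this
  have h3 : 0 < c1 x * ((l.2:ℝ) + 3) := by positivity
  rcases le_or_gt (c0 x) 0 with h0 | h0
  · rw [vt_hi h h0]; constructor <;> linarith
  · rw [vt_lo h h0]; constructor <;> linarith

lemma th_mem (b : Bool) {l : ι × ℕ} {x : HE ι} (h : x ∈ OO l) : th b x ∈ Ioo (0:ℝ) 1 := by
  have := vt_mem h
  unfold th; split_ifs
  · exact this
  · exact ⟨by linarith [this.2], by linarith [this.1]⟩

lemma vt_inj {l : ι × ℕ} {x y : HE ι} (hx : x ∈ OO l) (hy : y ∈ OO l) (h : vt x = vt y) : x = y := by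
  have hl : (0:ℝ) < (l.2:ℝ) + 3 := by positivity
  have bx : c1 x * (l.2 + 3) ≤ 2 := by
    have := OO_c1_le hx; rwa [le_div_iff₀ (by positivity)] at this
  have b_y : c1 y * (l.2 + 3) ≤ 2 := by
    have := OO_c1_le hy; rwa [le_div_iff₀ (by positivity)] at this
  have anti : ∀ {z : HE ι}, z ∈ OO l → 0 < c0 z → c1 z * (l.2 + 3) < 2 := by
    intro z hz h0
    have h3 := hz.2.2
    have h4 := hz.2.1
    by_contra hc
    push Not at hc
    nlinarith [mul_pos hl (pow_pos h0 2)]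
  have hc1 : c1 x = c1 y ∧ (c0 x ≤ 0 ↔ c0 y ≤ 0) := by
    rcases le_or_gt (c0 x) 0 with h0 | h0 <;> rcases le_or_gt (c0 y) 0 with h0' | h0'
    · rw [vt_hi hx h0, vt_hi hy h0'] at h
      exact ⟨mul_right_cancel₀ hl.ne' (by linarith), by simp [h0, h0']⟩
    · rw [vt_hi hx h0, vt_lo hy h0'] at h; linarith [anti hy h0']
    · rw [vt_lo hx h0, vt_hi hy h0'] at h; linarith [anti hx h0]
    · rw [vt_lo hx h0, vt_lo hy h0'] at h
      exact ⟨mul_right_cancel₀ hl.ne' (by linarith), by simp [not_le.2 h0, not_le.2 h0']⟩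
  have hc0 : c0 x = c0 y := by
    have e : c0 x ^ 2 = c0 y ^ 2 := by
      have e1 := OO_D hx; have e2 := OO_D hy; rw [hc1.1] at e1; linarith
    rcases le_or_gt (c0 x) 0 with h0 | h0
    · have := hc1.2.1 h0
      have e' : (-c0 x) ^ 2 = (-c0 y) ^ 2 := by linarith
      have := (pow_left_inj₀ (by linarith) (by linarith) two_ne_zero).1 e'
      linarith
    · have h1 : 0 < c0 y := by
        by_contra hc; exact absurd (hc1.2.2 (not_lt.1 hc)) (not_le.2 h0)
      exact (pow_left_inj₀ h0.le h1.le two_ne_zero).1 e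
  refine Subtype.ext (ext_XX hx.1 hy.1 (e3_ext hc0 hc1.1 ?_))
  rw [x.2, y.2]

open scoped Classical in
/-- the lift of `q` to the tree: branch word and height -/
def gm (q : C(I, HE ι)) (t : I) (l : ι × ℕ) : H ι := ps (sub q 0 t) * (sgH l (q t))⁻¹
open scoped Classical in
def TT (q : C(I, HE ι)) (t : I) : Wd ι :=
  if h : ∃ l, q t ∈ OO l then eB (gm q t h.choose) h.choose * Wd.of (eZ (gm q t h.choose) h.choose) else nf (ps (sub q 0 t))
open scoped Classical in
def hgt (C : ℕ → ℕ) (q : C(I, HE ι)) (t : I) : ℝ :=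
  if h : ∃ l, q t ∈ OO l then wt C (eB (gm q t h.choose) h.choose) + th (eS (gm q t h.choose) h.choose) (q t) *
    wt C (Wd.of (eZ (gm q t h.choose) h.choose)) else wt C (nf (ps (sub q 0 t)))

variable {C : ℕ → ℕ} {q : C(I, HE ι)}

lemma TT_edge {t : I} {l : ι × ℕ} (h : q t ∈ OO l) : TT q t = eB (gm q t l) l * Wd.of (eZ (gm q t l) l) := by
  have hgt' : ∃ l, q t ∈ OO l := ⟨l, h⟩
  rw [TT, dif_pos hgt', OO_unique hgt'.choose_spec h]
lemma hgt_edge {t : I} {l : ι × ℕ} (h : q t ∈ OO l) : hgt C q t = wt C (eB (gm q t l) l) + th (eS (gm q t l) l) (q t) *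
    wt C (Wd.of (eZ (gm q t l) l)) := by
  have hgt' : ∃ l, q t ∈ OO l := ⟨l, h⟩
  rw [hgt, dif_pos hgt', OO_unique hgt'.choose_spec h]
lemma no_OO {x : HE ι} (h : c1 x = 0) : ¬ ∃ l, x ∈ OO l := by
  rintro ⟨l, hl⟩; exact hl.2.1.ne' h
lemma TT_base {t : I} (h : c1 (q t) = 0) : TT q t = nf (ps (sub q 0 t)) := by rw [TT, dif_neg (no_OO h)]
lemma hgt_base {t : I} (h : c1 (q t) = 0) : hgt C q t = wt C (nf (ps (sub q 0 t))) := by rw [hgt, dif_neg (no_OO h)]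

/-- comparison of the lift with the group element -/
lemma edge_nf {t : I} {l : ι × ℕ} (h : q t ∈ OO l) :
    (nf (ps (sub q 0 t)) = eB (gm q t l) l ∧ th (eS (gm q t l) l) (q t) = c1 (q t) * (l.2 + 3) / 4) ∨
    (nf (ps (sub q 0 t)) = TT q t ∧ th (eS (gm q t l) l) (q t) = 1 - c1 (q t) * (l.2 + 3) / 4) := by
  obtain ⟨-, h2, h3⟩ := (edge_ex (gm q t l) l).choose_spec
  rw [TT_edge h]
  have hg : ps (sub q 0 t) = gm q t l * sgH l (q t) := by rw [gm, inv_mul_cancel_right]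
  rw [hg]
  change eS (gm q t l) l = true → nf (gm q t l) = eB (gm q t l) l ∧ _ = eB (gm q t l) l * Wd.of (eZ (gm q t l) l) at h2
  change eS (gm q t l) l = false → nf (gm q t l) = eB (gm q t l) l * Wd.of (eZ (gm q t l) l) ∧ _ = eB (gm q t l) l at h3
  cases hb : eS (gm q t l) l with
  | true =>
    obtain ⟨e1, e2⟩ := h2 hb
    rcases le_or_gt (c0 (q t)) 0 with h0 | h0
    · right; rw [sgH, if_pos h0]; exact ⟨e2, by rw [th, if_pos rfl, vt_hi h h0]⟩
    · left; rw [sgH, if_neg (not_le.2 h0), mul_one]; exact ⟨e1, by rw [th, if_pos rfl, vt_lo h h0]⟩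
  | false =>
    obtain ⟨e1, e2⟩ := h3 hb
    rcases le_or_gt (c0 (q t)) 0 with h0 | h0
    · left; rw [sgH, if_pos h0]; exact ⟨e2, by rw [th, if_neg (by simp), vt_hi h h0]; ring⟩
    · right; rw [sgH, if_neg (not_le.2 h0), mul_one]; exact ⟨e1, by rw [th, if_neg (by simp), vt_lo h h0]⟩

lemma gm_const {t₀ t : I} {l : ι × ℕ} (h : range (sub q t₀ t) ⊆ OO l) : gm q t l = gm q t₀ l := by
  have := ps_OO h
  rw [sub_zero, sub_one, pj_coe, pj_coe] at this
  rw [gm, gm, ps_split q 0 t₀ t, this]; group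

open scoped Classical in
lemma near {t₀ : I} (h : c1 (q t₀) = 0) (m : ℕ) : ∀ᶠ t : I in nhds t₀, ∃ A B D : Wd ι,
    nf (ps (sub q 0 t₀)) = A * D ∧ nf (ps (sub q 0 t)) = A * B ∧ D.s m = [] ∧ B.s m = [] := by
  filter_upwards [seg_ev q (V0_isOpen m) (V0_of_c1 (m := m) h)] with t ht
  have h0 : (nf (ps (sub q t₀ t))).s m = [] := by
    have hc : Cnt m 0 (sub q t₀ t) := fun n => by
      have : cut m (VV n (sub q t₀ t)).toWord = [] := VV_Hi ht n
      rw [this]; rfl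
    exact List.length_eq_zero_iff.1 (Nat.le_zero.1 (ps_nf_cnt hc))
  obtain ⟨A, B, D, h1, h2, h3⟩ := red_mul (red_nf (ps (sub q 0 t₀))) (red_nf (ps (sub q t₀ t)))
  refine ⟨A, B, D, h1, ?_, ?_, ?_⟩
  · rw [← nf_pr h3, ps_split q 0 t₀ t, ← pr_nf (ps (sub q 0 t₀)), ← pr_nf (ps (sub q t₀ t)), h1, h2, ← map_mul]
    congr 1
    simp only [map_mul, pr_inv]; group
  · rw [h2, Wd.s_mul, List.append_eq_nil_iff, Wd.s_inv] at h0
    rw [← FreeGroup.invRev_invRev (L₁ := D.s m), h0.1]; rfl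
  · rw [h2, Wd.s_mul, List.append_eq_nil_iff] at h0; exact h0.2

/-- finite counting bound along the lift -/
def OKq (C : ℕ → ℕ) (q : C(I, HE ι)) : Prop := ∀ t, OK C (TT q t) ∧ OK C (nf (ps (sub q 0 t)))

lemma exists_OKq (q : C(I, HE ι)) : ∃ C, OKq C q := by
  choose C hC using ps_bound q
  refine ⟨fun n => C n + 1, fun t => ?_⟩
  have h1 : ∀ n, ((nf (ps (sub q 0 t))).s n).length ≤ C n := fun n => hC n 0 t le_rfl t.2.1 t.2.2
  refine ⟨fun n => ?_, fun n => (h1 n).trans (Nat.le_succ _)⟩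
  by_cases h : c1 (q t) = 0
  · rw [TT_base h]; exact (h1 n).trans (Nat.le_succ _)
  · obtain ⟨l, hl⟩ := exists_OO h
    rcases edge_nf hl with ⟨e, -⟩ | ⟨e, -⟩
    · rw [TT_edge hl, ← e, Wd.s_mul, List.length_append]
      have h2 : ∀ z : Lt ι, ((Wd.of z).s n).length ≤ 1 := by
        intro z; simp only [Wd.of]; split_ifs <;> simp
      have := h1 n
      have := h2 (eZ (gm q t l) l)
      show _ ≤ C n + 1
      omega
    · rw [← e]; exact (h1 n).trans (Nat.le_succ _)

lemma edge_wt (hC : OKq C q) {t : I} {l : ι × ℕ} (hl : q t ∈ OO l) :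
    0 < wt C (Wd.of (eZ (gm q t l) l)) ∧ wt C (TT q t) = wt C (eB (gm q t l) l) + wt C (Wd.of (eZ (gm q t l) l)) ∧
    wt C (eB (gm q t l) l) < hgt C q t ∧ hgt C q t < wt C (TT q t) := by
  have h := (hC t).1
  rw [TT_edge hl] at h ⊢
  have h1 := h.right.wt_pos (Wd.of_ne_one _)
  obtain ⟨h2, h3⟩ := th_mem (eS (gm q t l) l) hl
  rw [hgt_edge hl, h.wt_mul]
  exact ⟨h1, rfl, by nlinarith, by nlinarith⟩

lemma hgt_nonneg (hC : OKq C q) (t : I) : 0 ≤ hgt C q t := by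
  by_cases h : c1 (q t) = 0
  · rw [hgt_base h]; exact wt_nonneg _
  · obtain ⟨l, hl⟩ := exists_OO h
    exact (wt_nonneg _).trans (edge_wt hC hl).2.2.1.le

/-- height versus weight of the group element -/
lemma hgt_close (hC : OKq C q) {t : I} {l : ι × ℕ} (hl : q t ∈ OO l) :
    |hgt C q t - wt C (nf (ps (sub q 0 t)))| ≤ c1 (q t) * (l.2 + 3) / 4 * wt C (Wd.of (eZ (gm q t l) l)) := by
  obtain ⟨h1, h2, -, -⟩ := edge_wt hC hl
  have h3 := hl.2.1
  have h4 : 0 ≤ c1 (q t) * (l.2 + 3) / 4 * wt C (Wd.of (eZ (gm q t l) l)) := by positivity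
  rcases edge_nf hl with ⟨e, e'⟩ | ⟨e, e'⟩
  · rw [e, hgt_edge hl, e', abs_le]; constructor <;> linarith
  · rw [e, hgt_edge hl, e', h2, abs_le]; constructor <;> linarith

lemma hgt_cont (hC : OKq C q) : Continuous (hgt C q) := by
  rw [continuous_iff_continuousAt]
  intro t₀
  by_cases h : c1 (q t₀) = 0
  · rw [Metric.continuousAt_iff']
    intro ε hε
    obtain ⟨m, hm⟩ := exists_pow_lt_of_lt_one (show 0 < ε / 4 by positivity) (show (1/2:ℝ) < 1 by norm_num)
    have hc : ∀ᶠ t in nhds t₀, c1 (q t) * (m + 3) / 4 < ε / 4 := by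
      have : ContinuousAt (fun t => c1 (q t) * (m + 3) / 4) t₀ := by fun_prop
      refine this.eventually_lt_const ?_
      simp only [h]; linarith
    filter_upwards [near h m, hc] with t ⟨A, B, D, e1, e2, e3, e4⟩ hct
    have hO0 := (hC t₀).2
    have hO := (hC t).2
    rw [Real.dist_eq, hgt_base h]
    have k1 : |wt C (nf (ps (sub q 0 t))) - wt C (nf (ps (sub q 0 t₀)))| ≤ (1/2)^m := by
      rw [e1] at hO0 ⊢
      rw [e2] at hO ⊢
      rw [hO0.wt_mul, hO.wt_mul, abs_le]
      have := hO0.right.wt_tail e3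
      have := hO.right.wt_tail e4
      have := wt_nonneg (C := C) D
      have := wt_nonneg (C := C) B
      constructor <;> linarith
    have k2 : |hgt C q t - wt C (nf (ps (sub q 0 t)))| ≤ ε / 4 := by
      by_cases h' : c1 (q t) = 0
      · rw [hgt_base h', sub_self, abs_zero]; positivity
      · obtain ⟨l, hl⟩ := exists_OO h'
        refine (hgt_close hC hl).trans ?_
        have hOz : OK C (Wd.of (eZ (gm q t l) l)) := by
          have := (hC t).1; rw [TT_edge hl] at this; exact this.right
        have p1 := hl.2.1
        have p2 := wt_nonneg (C := C) (Wd.of (eZ (gm q t l) l))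
        have p3 : c1 (q t) * (l.2 + 3) ≤ 2 := by
          have := OO_c1_le hl; rwa [le_div_iff₀ (by positivity)] at this
        have p4 : 0 ≤ c1 (q t) * ((l.2:ℝ) + 3) := by positivity
        by_cases hlm : l.2 < m
        · have q1 := hOz.wt_le_one
          have q2 : (l.2:ℝ) ≤ m := by exact_mod_cast hlm.le
          have : c1 (q t) * (l.2 + 3) ≤ c1 (q t) * (m + 3) := by gcongr
          nlinarith
        · have q1 := hOz.wt_tail (m := m) (Wd.of_s_neg (by simpa [eZ] using hlm))
          nlinarith
    rw [abs_le] at k1 k2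
    rw [abs_lt]; constructor <;> linarith [k1.1, k1.2, k2.1, k2.2]
  · obtain ⟨l, hl⟩ := exists_OO h
    have : ContinuousAt (fun t => wt C (eB (gm q t₀ l) l) + th (eS (gm q t₀ l) l) (q t) *
        wt C (Wd.of (eZ (gm q t₀ l) l))) t₀ :=
      continuousAt_const.add (((th_cont hl.2.1).comp q.continuous.continuousAt).mul continuousAt_const)
    refine this.congr ?_
    filter_upwards [seg_ev q (OO_isOpen l) hl] with t ht
    have h2 : q t ∈ OO l := ht ⟨1, by rw [sub_one, pj_coe]⟩
    rw [hgt_edge h2, gm_const ht]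

lemma nf_dvd_TT (t : I) : TT q t = nf (ps (sub q 0 t)) ∨ ∃ z, TT q t = nf (ps (sub q 0 t)) * Wd.of z := by
  by_cases h : c1 (q t) = 0
  · exact Or.inl (TT_base h)
  · obtain ⟨l, hl⟩ := exists_OO h
    rcases edge_nf hl with ⟨e, -⟩ | ⟨e, -⟩
    · right; exact ⟨_, by rw [TT_edge hl, e]⟩
    · exact Or.inl e.symm

lemma pre_dvd {A D X : Wd ι} {z : Lt ι} {m : ℕ} (hz : z.1.2 < m) (hD : D.s m = []) (h : X * Wd.of z ∣ A * D) :
    X * Wd.of z ∣ A := by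
  obtain ⟨R, hR⟩ := h
  rcases Wd.occ_pre hR.symm with ⟨e, he⟩ | h
  · rw [he, mul_assoc, mul_assoc] at hR
    have := mul_left_cancel hR
    rw [this] at hD
    simp [Wd.of_s_pos hz] at hD
  · exact h

/-- letter prefixes persist while the height stays above -/
lemma loc_pre (hC : OKq C q) (X : Wd ι) (z : Lt ι) (t₀ : I) (h0 : wt C X < hgt C q t₀) :
    ∀ᶠ t in nhds t₀, (X * Wd.of z ∣ TT q t ↔ X * Wd.of z ∣ TT q t₀) := by
  by_cases h : c1 (q t₀) = 0
  · obtain ⟨k, hk⟩ := exists_pow_lt_of_lt_one (show 0 < hgt C q t₀ - wt C X by linarith) (show (1/2:ℝ) < 1 by norm_num)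
    have hkm : ((1:ℝ)/2)^(k + (z.1.2 + 1)) ≤ (1/2)^k := pow_le_pow_of_le_one (by norm_num) (by norm_num) (by omega)
    filter_upwards [near h (k + (z.1.2 + 1))] with t ⟨A, B, D, e1, e2, e3, e4⟩
    have hz : z.1.2 < k + (z.1.2 + 1) := by omega
    rw [TT_base h]
    constructor
    · intro hd
      have key : X * Wd.of z ∣ nf (ps (sub q 0 t)) := by
        rcases nf_dvd_TT (q := q) t with h1 | ⟨z', h1⟩
        · rwa [h1] at hd
        · rw [h1] at hd
          obtain ⟨R, hR⟩ := hd
          rcases Wd.occ_pre hR.symm with ⟨e, he⟩ | h2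
          · exfalso
            rw [he, mul_assoc, mul_assoc] at hR
            have h3 := mul_left_cancel hR
            rcases Wd.of_eq_mul h3 with h4 | h4
            · rw [h4, mul_one] at he
              have hO0 := (hC t₀).2
              have hO := (hC t).2
              rw [hgt_base h] at hk
              rw [e1] at hk hO0
              rw [he, e2] at hk
              rw [e2] at hO
              rw [hO0.wt_mul, hO.wt_mul] at hk
              linarith [hO0.right.wt_tail e3, wt_nonneg (C := C) B]
            · exact Wd.of_ne_one z (Wd.mul_eq_one h4).1
          · exact h2
      rw [e2] at key
      rw [e1]; exact (pre_dvd hz e4 key).trans ⟨_, rfl⟩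
    · intro hd
      rw [e1] at hd
      have h1 : X * Wd.of z ∣ nf (ps (sub q 0 t)) := by rw [e2]; exact (pre_dvd hz e3 hd).trans ⟨_, rfl⟩
      rcases nf_dvd_TT (q := q) t with h2 | ⟨z', h2⟩
      · rwa [h2]
      · rw [h2]; exact h1.trans ⟨_, rfl⟩
  · obtain ⟨l, hl⟩ := exists_OO h
    filter_upwards [seg_ev q (OO_isOpen l) hl] with t ht
    have h2 : q t ∈ OO l := ht ⟨1, by rw [sub_one, pj_coe]⟩
    rw [TT_edge h2, gm_const ht, TT_edge hl]

lemma TT_dvd (hC : OKq C q) {s t : I} (hst : s ≤ t) (hm : ∀ r, s ≤ r → r ≤ t → hgt C q s ≤ hgt C q r) :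
    TT q s ∣ TT q t := by
  classical
  have key : ∀ X z, X * Wd.of z ∣ TT q s → X * Wd.of z ∣ TT q t := by
    intro X z hd
    have hlt : wt C X < hgt C q s := by
      by_cases h : c1 (q s) = 0
      · have h1 := (hC s).1
        rw [hgt_base h, ← TT_base h]
        refine lt_of_lt_of_le ?_ (h1.wt_mono hd)
        rw [(h1.dvd hd).wt_mul]
        linarith [(h1.dvd hd).right.wt_pos (Wd.of_ne_one z)]
      · obtain ⟨l, hl⟩ := exists_OO h
        refine lt_of_le_of_lt ?_ (edge_wt hC hl).2.2.1
        have h1 := (hC s).1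
        rw [TT_edge hl] at h1 hd
        obtain ⟨R, hR⟩ := hd
        rcases Wd.occ_pre (R := 1) ((mul_one _).trans (hR.trans (mul_assoc _ _ _))) with h2 | h2
        · exact h1.left.wt_mono h2
        · exfalso
          obtain ⟨f, rfl⟩ := h2
          rw [mul_assoc, mul_assoc, mul_assoc] at hR
          have h3 := mul_left_cancel hR
          have h4 : (1 : Wd ι) = f * (Wd.of z * R) := mul_left_cancel (a := Wd.of (eZ (gm q s l) l)) (by rw [mul_one]; exact h3)
          exact Wd.of_ne_one z (Wd.mul_eq_one (Wd.mul_eq_one h4.symm).2).1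
    have hc : ContinuousOn (fun r => decide (X * Wd.of z ∣ TT q r)) (Icc s t) := by
      intro r hr
      refine ContinuousAt.continuousWithinAt ?_
      refine (continuousAt_const (y := decide (X * Wd.of z ∣ TT q r))).congr ?_
      filter_upwards [loc_pre hC X z r (hlt.trans_le (hm r hr.1 hr.2))] with r' hr'
      simp [hr']
    have := isPreconnected_Icc.constant hc (left_mem_Icc.2 hst) (right_mem_Icc.2 hst)
    simpa [hd] using this
  rw [Wd.dvd_iff]
  intro n
  rcases List.eq_nil_or_concat ((TT q s).s n) with h | ⟨L, x, h⟩
  · rw [h]; exact List.nil_prefix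
  · rw [List.concat_eq_append] at h
    obtain ⟨X, R, e1, e2, e3⟩ := Wd.letter_split (L2 := []) h
    have := Wd.dvd_iff.1 (key X x ⟨R, e1⟩) n
    have h2 : (TT q s).s n = (X * Wd.of x).s n := by rw [e1, Wd.s_mul, e3, List.append_nil]
    rwa [h2]

lemma eq_of_wt {X Y : Wd ι} (h : OK C Y) (hd : X ∣ Y) (hw : wt C Y ≤ wt C X) : X = Y := by
  obtain ⟨e, rfl⟩ := hd
  by_contra hc
  have : e ≠ 1 := fun h' => hc (by rw [h', mul_one])
  rw [h.wt_mul] at hw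
  linarith [h.right.wt_pos this]

lemma Wd.mul_of_inj {X X' : Wd ι} {z z' : Lt ι} (h : X * Wd.of z = X' * Wd.of z') : X = X' ∧ z = z' := by
  have key : ∀ {X X' : Wd ι} {z z' : Lt ι}, X * Wd.of z = X' * Wd.of z' → X' ∣ X := by
    intro X X' z z' h
    rcases Wd.occ_pre (R := 1) ((mul_one _).trans h) with h2 | ⟨f, rfl⟩
    · exact h2
    · exfalso
      rw [mul_assoc] at h
      have := mul_left_cancel ((mul_one _).trans h)
      exact Wd.of_ne_one z' (Wd.mul_eq_one this.symm).2
  have e : X' = X := Wd.dvd_antisymm' (key h) (key h.symm)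
  have := Ocr.eq (W := X * Wd.of z) (i := ⟨(X, z, 1), by simp⟩) (j := ⟨(X', z', 1), by simp [h]⟩) e
  have := congrArg (fun i => i.1.2.1) this
  exact ⟨e.symm, this⟩

/-- loops with trivial invariant are null-homotopic in the earring -/
theorem null_of_ps {a : ι} (q : Path (bp a) (bp a)) (h1 : ps q.toContinuousMap = 1) :
    q.Homotopic (Path.refl (bp a)) := by
  obtain ⟨C, hC⟩ := exists_OKq q.toContinuousMap
  have e0 : ps (sub q.toContinuousMap 0 0) = 1 := ps_ext fun n => VV_cc n _ 0
  refine contour q (hgt C q.toContinuousMap) (hgt_cont hC) (hgt_nonneg hC) ?_ ?_ ?_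
  · rw [hgt_base (by show c1 (q 0) = 0; rw [q.source]; rfl)]
    show wt C (nf (ps (sub _ 0 0))) = 0
    rw [e0, nf_one, wt_one]
  · rw [hgt_base (by show c1 (q 1) = 0; rw [q.target]; rfl)]
    show wt C (nf (ps (sub _ 0 1))) = 0
    rw [sub_zero_one, h1, nf_one, wt_one]
  · intro s t hst he hm
    have hd := TT_dvd hC hst hm
    have hOt := (hC t).1
    by_cases ht : c1 (q t) = 0
    · by_cases hs : c1 (q s) = 0
      · rw [eq_bp (a := a) hs, eq_bp (a := a) ht]
      · exfalso
        obtain ⟨l, hl⟩ := exists_OO hs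
        have k1 := (edge_wt hC (t := s) hl).2.2.2
        have k2 := hgt_base (C := C) (q := q.toContinuousMap) (t := t) ht
        rw [← TT_base (q := q.toContinuousMap) (t := t) ht] at k2
        linarith [hOt.wt_mono hd]
    · obtain ⟨l, hl⟩ := exists_OO ht
      obtain ⟨-, -, k1, k2⟩ := edge_wt hC (t := t) hl
      have hd' := hd
      rw [TT_edge (q := q.toContinuousMap) (t := t) hl] at hd' hOt
      obtain ⟨R, hR⟩ := hd'
      rcases Wd.occ_pre (R := 1) ((mul_one _).trans hR) with h2 | h2
      · exfalso
        have k3 := hOt.left.wt_mono h2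
        by_cases hs : c1 (q s) = 0
        · have k4 := hgt_base (C := C) (q := q.toContinuousMap) (t := s) hs
          rw [← TT_base (q := q.toContinuousMap) (t := s) hs] at k4
          linarith
        · obtain ⟨l', hl'⟩ := exists_OO hs
          linarith [(edge_wt hC (t := s) hl').2.2.2]
      · rw [← TT_edge (q := q.toContinuousMap) (t := t) hl] at h2
        have hT := Wd.dvd_antisymm' hd h2
        by_cases hs : c1 (q s) = 0
        · exfalso
          have k4 := hgt_base (C := C) (q := q.toContinuousMap) (t := s) hs
          rw [← TT_base (q := q.toContinuousMap) (t := s) hs, hT] at k4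
          linarith
        · obtain ⟨l', hl'⟩ := exists_OO hs
          obtain ⟨j1, j2, -, -⟩ := edge_wt hC (t := s) hl'
          rw [hgt_edge (q := q.toContinuousMap) (t := t) hl, hgt_edge (q := q.toContinuousMap) (t := s) hl'] at he
          rw [TT_edge (q := q.toContinuousMap) (t := t) hl, TT_edge (q := q.toContinuousMap) (t := s) hl'] at hT
          obtain ⟨i1, i2⟩ := Wd.mul_of_inj hT
          rw [← i1, ← i2] at he
          have i3 : l' = l := congrArg Prod.fst i2
          have i4 := congrArg Prod.snd i2
          simp only [eZ] at i4
          rw [← i4] at he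
          have i5 := mul_right_cancel₀ j1.ne' (add_left_cancel he)
          subst i3
          refine vt_inj hl' hl ?_
          unfold th at i5
          split_ifs at i5
          · exact i5
          · exact sub_right_injective i5
end GrifAux

namespace GrifAux
open unitInterval Griffiths
variable {ι : Type}

/-! ### pushing down to height zero -/

/-- the push-down map in coordinates -/
def rP (P : E3) (u : ℝ) : E3 :=
  !₂[(1 - (1 - u) * P 2) / (1 - P 2) * P 0, (1 - (1 - u) * P 2) / (1 - P 2) * P 1, (1 - u) * P 2]

lemma rP_mem {P : E3} (h : P ∈ GS1set) (u : I) : rP P u ∈ GS1set := by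
  rw [mem_GS1set] at h ⊢
  obtain ⟨⟨h0, h1⟩, n, hn⟩ := h
  have hu0 := u.2.1
  have hu1 := u.2.2
  simp only [rP, PiLp.toLp_apply, Matrix.cons_val_zero, Matrix.cons_val_one, Matrix.cons_val]
  refine ⟨⟨mul_nonneg (by linarith) h0, by nlinarith⟩, n, ?_⟩
  by_cases h2 : 1 - P 2 = 0
  · simp [h2]
  · have e : (1 - (1 - (u:ℝ)) * P 2) = (1 - (1 - u) * P 2) / (1 - P 2) * (1 - P 2) := by field_simp
    generalize (1 - (1 - (u:ℝ)) * P 2) / (1 - P 2) = k at e ⊢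
    rw [e]; linear_combination k ^ 2 * hn

/-- the push-down homotopy -/
def rt (x : GS ι) (u : I) : GS ι := mkp (exists_XX x).choose ⟨rP (co x) u, rP_mem (co_mem x) u⟩

lemma co_rt (x : GS ι) (u : I) : co (rt x u) = rP (co x) u := rfl

lemma rt_zero {x : GS ι} (u : I) (h : co x = 0) : co (rt x u) = 0 := by
  rw [co_rt, h]; apply e3_ext <;> simp [rP]

lemma rt_XX {x : GS ι} (u : I) (α : ι) (h : x ∈ XX α) : rt x u ∈ XX α := by
  by_cases h0 : co x = 0
  · exact mem_XX_of_zero α (rt_zero u h0)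
  · rw [XX_unique h0 h (exists_XX x).choose_spec]; exact ⟨_, rfl⟩

lemma rt_cont {T : Type} [TopologicalSpace T] {f : T → GS ι} (hf : Continuous f) (h : ∀ t, co (f t) 2 < 1) {u : T → I}
    (hu : Continuous u) : Continuous fun t => rt (f t) (u t) := by
  refine cont_of (g := f) ?_ hf (fun t α => rt_XX _ α) (fun t => rt_zero _)
  have h0 : ∀ i, Continuous fun t => co (f t) i := fun i => (co_i_cont i).comp hf
  have h1 := h0 0
  have h2 := h0 1
  have h3 := h0 2
  have h4 : ∀ t, 1 - co (f t) 2 ≠ 0 := fun t => by linarith [h t]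
  have hk : Continuous fun t => (1 - (1 - (u t : ℝ)) * co (f t) 2) / (1 - co (f t) 2) :=
    (continuous_const.sub ((continuous_const.sub (continuous_subtype_val.comp hu)).mul h3)).div (continuous_const.sub h3) h4
  refine (PiLp.continuous_toLp 2 _).comp (continuous_pi fun i => ?_)
  fin_cases i
  · exact hk.mul h1
  · exact hk.mul h2
  · exact (continuous_const.sub (continuous_subtype_val.comp hu)).mul h3

lemma rt_u0 {x : GS ι} (h : co x 2 < 1) : rt x 0 = x := by
  obtain ⟨α, hα⟩ := exists_XX x
  refine ext_XX (rt_XX _ _ hα) hα ?_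
  have h4 : 1 - co x 2 ≠ 0 := by linarith
  rw [co_rt]; apply e3_ext <;> simp [rP, h4]

lemma rt_u1 (x : GS ι) : co (rt x 1) 2 = 0 := by simp [co_rt, rP]

lemma rt_he {x : GS ι} (h : co x 2 = 0) (u : I) : rt x u = x := by
  obtain ⟨α, hα⟩ := exists_XX x
  refine ext_XX (rt_XX _ _ hα) hα ?_
  rw [co_rt]; apply e3_ext <;> simp [rP, h]

/-- pushing a map down -/
def rC {T : Type} [TopologicalSpace T] (f : C(T, GS ι)) (h : ∀ t, co (f t) 2 < 1) : C(T, HE ι) :=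
  ⟨fun t => ⟨rt (f t) 1, rt_u1 _⟩, (rt_cont f.continuous h continuous_const).subtype_mk _⟩

/-! ### the cover and the invariant -/

def UU : Option ι → Set (GS ι)
  | none => {x | co x 2 < 1}
  | some α => {x | x ∈ XX α ∧ 0 < co x 2}

lemma UU_open (i : Option ι) : IsOpen (UU i) := by
  cases i with
  | none => exact isOpen_lt (by fun_prop) (by fun_prop)
  | some α =>
    have : UU (some α) = {x : GS ι | x ∈ XX α ∧ co x ≠ 0} ∩ {x | 0 < co x 2} := by
      ext x
      constructor
      · rintro ⟨h1, h2⟩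
        exact ⟨⟨h1, fun h => by rw [h] at h2; simp at h2⟩, h2⟩
      · rintro ⟨⟨h1, -⟩, h2⟩; exact ⟨h1, h2⟩
    rw [this]
    exact (XX_isOpen α).inter (isOpen_lt (by fun_prop) (by fun_prop))

lemma UU_cov (x : GS ι) : ∃ i, x ∈ UU i := by
  by_cases h : co x 2 < 1
  · exact ⟨none, h⟩
  · obtain ⟨α, hα⟩ := exists_XX x
    exact ⟨some α, hα, by linarith⟩

open scoped Classical in
def vG (p : C(I, GS ι)) : H ι ⧸ NN ι :=
  if h : ∀ t, co (p t) 2 < 1 then QuotientGroup.mk (ps (rC p h)) else 1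

lemma vG_low {p : C(I, GS ι)} (h : ∀ t, co (p t) 2 < 1) : vG p = QuotientGroup.mk (ps (rC p h)) := dif_pos h

lemma vG_pure {p : C(I, GS ι)} {α : ι} (hp : ∀ t, p t ∈ XX α) : vG p = 1 := by
  by_cases h : ∀ t, co (p t) 2 < 1
  · rw [vG_low h, QuotientGroup.eq_one_iff]
    exact pure_mem_NC _ (ps_pure (α := α) fun t => rt_XX _ _ (hp t))
  · exact dif_neg h

lemma vG_loc : Loc (UU : Option ι → Set (GS ι)) vG where
  op := UU_open
  cov := UU_cov
  const z := by
    obtain ⟨α, hα⟩ := exists_XX z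
    exact vG_pure (α := α) fun _ => hα
  sq S hS := by
    obtain ⟨i, hi⟩ := hS
    have hi : ∀ x, S x ∈ UU i := fun x => hi ⟨x, rfl⟩
    cases i with
    | none =>
      have hi : ∀ x, co (S x) 2 < 1 := hi
      rw [vG_low (p := sbot S) fun t => hi _, vG_low (p := srgt S) fun t => hi _, vG_low (p := slft S) fun t => hi _,
        vG_low (p := stpp S) fun t => hi _, ← QuotientGroup.mk_mul, ← QuotientGroup.mk_mul]
      exact congrArg _ (ps_sq (rC S hi))
    | some α =>
      rw [vG_pure (p := sbot S) fun t => (hi _).1, vG_pure (p := srgt S) fun t => (hi _).1,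
        vG_pure (p := slft S) fun t => (hi _).1, vG_pure (p := stpp S) fun t => (hi _).1]

/-- the inclusion of the height zero part -/
def inc : C(HE ι, GS ι) := ⟨Subtype.val, continuous_subtype_val⟩

lemma null_mem {a : ι} (q : Path (bp a) (bp a)) (h : (q.map inc.continuous).Homotopic (Path.refl _)) :
    ps q.toContinuousMap ∈ NN ι := by
  obtain ⟨V, hV⟩ := (vG_loc (ι := ι)).full
  have h1 := hV.homotopic h
  have hl : ∀ t, co ((q.map inc.continuous).toContinuousMap t) 2 < 1 := fun t => by
    rw [show co ((q.map inc.continuous).toContinuousMap t) 2 = 0 from (q t).2]; norm_num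
  rw [hV.small _ ⟨none, by rintro _ ⟨t, rfl⟩; exact hl t⟩, vG_low hl] at h1
  have h2 : V (Path.refl (inc (bp a))).toContinuousMap = 1 := hV.const _
  rw [h2, QuotientGroup.eq_one_iff] at h1
  convert h1 using 2
  exact ContinuousMap.ext fun t => Subtype.ext (rt_he (q t).2 1).symm

/-! ### single cones are simply connected -/

lemma tip_mem : (!₂[0, 0, 1] : E3) ∈ GS1set := by
  rw [mem_GS1set]; exact ⟨by simp, 0, by simp⟩

lemma GS1_star : StarConvex ℝ (!₂[0, 0, 1] : E3) GS1set := by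
  intro P hP a b ha hb hab
  rw [mem_GS1set] at hP ⊢
  obtain ⟨⟨h0, h1⟩, n, hn⟩ := hP
  obtain rfl : a = 1 - b := by linarith
  simp only [PiLp.add_apply, PiLp.smul_apply, Matrix.cons_val_zero, Matrix.cons_val_one, Matrix.cons_val,
    smul_eq_mul]
  refine ⟨⟨by nlinarith, by nlinarith⟩, n, ?_⟩
  linear_combination b ^ 2 * hn

lemma XX_homotopic {x y : GS ι} {α : ι} (p q : Path x y) (hp : ∀ t, p t ∈ XX α) (hq : ∀ t, q t ∈ XX α) : p.Homotopic q := by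
  have : ContractibleSpace GS1set := GS1_star.contractibleSpace ⟨_, tip_mem⟩
  have hx : x ∈ XX α := by simpa using hp 0
  have hy : y ∈ XX α := by simpa using hp 1
  obtain ⟨P, rfl⟩ := hx
  obtain ⟨Q, rfl⟩ := hy
  have lift : ∀ r : Path (mkp α P) (mkp α Q), (∀ t, r t ∈ XX α) → ∃ r' : Path P Q, r = r'.map (mkp_cont α) := by
    intro r hr
    refine ⟨⟨⟨fun t => ⟨co (r t), co_mem _⟩, (co_cont.comp r.continuous).subtype_mk _⟩, ?_, ?_⟩, ?_⟩
    · exact Subtype.ext (by simp)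
    · exact Subtype.ext (by simp)
    · ext t; exact ext_XX (hr t) ⟨_, rfl⟩ rfl
  obtain ⟨p', rfl⟩ := lift p hp
  obtain ⟨q', rfl⟩ := lift q hq
  obtain ⟨F⟩ := SimplyConnectedSpace.paths_homotopic p' q'
  exact ⟨F.map ⟨_, mkp_cont α⟩⟩

/-- connecting a point of height zero to the base point -/
lemma conn (a : ι) {α : ι} (y : HE ι) (hy : y.1 ∈ XX α) : ∃ c : Path (bp a) y, ∀ t, (c t).1 ∈ XX α := by
  obtain ⟨n, hn⟩ := he_eq y
  have hN : ((n:ℝ)+3) ≠ 0 := by positivity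
  have hs : (1 - ((n:ℝ)+3) * c1 y) ^ 2 + (((n:ℝ)+3) * c0 y) ^ 2 = 1 := by linear_combination ((n:ℝ)+3) * hn
  obtain ⟨φ, h1, h2⟩ : ∃ φ, Real.cos φ = 1 - ((n:ℝ)+3) * c1 y ∧ Real.sin φ = ((n:ℝ)+3) * c0 y := by
    set z : ℂ := ⟨1 - ((n:ℝ)+3) * c1 y, ((n:ℝ)+3) * c0 y⟩ with hz
    have hz1 : ‖z‖ = 1 := by
      rw [Complex.norm_def, Complex.normSq_apply, Real.sqrt_eq_one]; simp only [hz]; linarith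
    refine ⟨z.arg, ?_, ?_⟩
    · rw [Complex.cos_arg (by rw [← norm_ne_zero_iff, hz1]; norm_num), hz1, div_one]
    · rw [Complex.sin_arg, hz1, div_one]
  have hpi := Real.pi_pos
  have hφ : 2 * Real.pi * (φ / (2 * Real.pi)) = φ := by field_simp
  refine ⟨⟨⟨fun t => ed (α, n) (t * (φ / (2 * Real.pi))), (ed_cont _).comp (by fun_prop)⟩, ?_, ?_⟩, fun t => ed_XX (α, n) _⟩
  · simp [ed_zero (α, n) a]
  · refine Subtype.ext (ext_XX (ed_XX _ _) hy (e3_ext ?_ ?_ ((ed (α, n) _).2.trans y.2.symm)))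
    · show c0 (ed (α, n) _) = c0 y
      rw [c0_ed]; simp [hφ, h2]; field_simp
    · show c1 (ed (α, n) _) = c1 y
      rw [c1_ed]; simp [hφ, h1]; field_simp

end GrifAux

namespace GrifAux
open unitInterval Griffiths
variable {ι : Type}

/-! ### every loop can be pushed to height zero -/

lemma sq_homotopic {Z : Type} [TopologicalSpace Z] (S : C(I × I, Z)) {x y x' y' : Z} (p : Path x y) (r : Path y y')
    (l : Path x x') (q : Path x' y') (hp : ∀ t, p t = S (t, 0)) (hr : ∀ t, r t = S (1, t)) (hl : ∀ t, l t = S (0, t))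
    (hq : ∀ t, q t = S (t, 1)) : (p.trans r).Homotopic (l.trans q) := by
  obtain rfl : S (0, 0) = x := by rw [← hp 0]; simp
  obtain rfl : S (1, 0) = y := by rw [← hp 1]; simp
  obtain rfl : S (0, 1) = x' := by rw [← hl 1]; simp
  obtain rfl : S (1, 1) = y' := by rw [← hr 1]; simp
  let e : Path (0 : I) 1 := ⟨⟨id, continuous_id⟩, rfl, rfl⟩
  let p' : Path ((0, 0) : I × I) (1, 0) := e.prod (Path.refl 0)
  let r' : Path ((1, 0) : I × I) (1, 1) := (Path.refl 1).prod e
  let l' : Path ((0, 0) : I × I) (0, 1) := (Path.refl 0).prod e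
  let q' : Path ((0, 1) : I × I) (1, 1) := e.prod (Path.refl 1)
  obtain rfl : p'.map S.continuous = p := by ext t; rw [hp]; rfl
  obtain rfl : r'.map S.continuous = r := by ext t; rw [hr]; rfl
  obtain rfl : l'.map S.continuous = l := by ext t; rw [hl]; rfl
  obtain rfl : q'.map S.continuous = q := by ext t; rw [hq]; rfl
  rw [← Path.map_trans, ← Path.map_trans]
  have : ContractibleSpace I := (convex_Icc (0:ℝ) 1).contractibleSpace ⟨0, by simp⟩
  obtain ⟨F⟩ := SimplyConnectedSpace.paths_homotopic (p'.trans r') (l'.trans q')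
  exact ⟨F.map S⟩

lemma trans_XX {x y z : GS ι} {α : ι} {p : Path x y} {q : Path y z} (hp : ∀ t, p t ∈ XX α) (hq : ∀ t, q t ∈ XX α) (t : I) :
    (p.trans q) t ∈ XX α := by
  have h : (p.trans q) t ∈ range (p.trans q) := ⟨t, rfl⟩
  rw [Path.trans_range] at h
  rcases h with ⟨s, hs⟩ | ⟨s, hs⟩ <;> rw [← hs]
  exacts [hp s, hq s]

lemma symm_XX {x y : GS ι} {α : ι} {p : Path x y} (hp : ∀ t, p t ∈ XX α) (t : I) : p.symm t ∈ XX α := hp _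

open Path.Homotopic (Quotient)
open Path.Homotopic.Quotient (mk)

/-- good classes of paths from the base point -/
def Gd (a : ι) (x : GS ι) : Set (Quotient (inc (bp a)) x) :=
  {γ | ∃ (q : Path (bp a) (bp a)) (α : ι) (r : Path (inc (bp a)) x), (∀ t, r t ∈ XX α) ∧
    γ = (mk (q.map inc.continuous)).trans (mk r)}

lemma Gd_cone {a : ι} {x y : GS ι} {γ} (h : γ ∈ Gd a x) (p : Path x y) {α : ι} (hp : ∀ t, p t ∈ UU (some α)) :
    γ.trans (mk p) ∈ Gd a y := by
  obtain ⟨q, β, r, hr, rfl⟩ := h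
  have h0 : x ∈ XX β := by simpa using hr 1
  obtain ⟨h1, h2⟩ : x ∈ UU (some α) := by simpa using hp 0
  obtain rfl := XX_unique (fun h => by rw [h] at h2; simp at h2) h0 h1
  refine ⟨q, β, r.trans p, trans_XX hr fun t => (hp t).1, ?_⟩
  rw [Path.Homotopic.Quotient.trans_assoc, ← Path.Homotopic.Quotient.mk_trans]

lemma Gd_low {a : ι} {x y : GS ι} {γ} (h : γ ∈ Gd a x) (p : Path x y) (hp : ∀ t, p t ∈ UU none) :
    γ.trans (mk p) ∈ Gd a y := by
  have hp : ∀ t, co (p t) 2 < 1 := hp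
  obtain ⟨q, α, r, hr, rfl⟩ := h
  have hx1 : co x 2 < 1 := by simpa using hp 0
  have hy1 : co y 2 < 1 := by simpa using hp 1
  have hx : x ∈ XX α := by simpa using hr 1
  obtain ⟨β, hy⟩ := exists_XX y
  let x' : HE ι := ⟨rt x 1, rt_u1 x⟩
  let y' : HE ι := ⟨rt y 1, rt_u1 y⟩
  let vx : Path x (inc x') := ⟨⟨fun u => rt x u, rt_cont continuous_const (fun _ => hx1) continuous_id⟩, rt_u0 hx1, rfl⟩
  let vy : Path y (inc y') := ⟨⟨fun u => rt y u, rt_cont continuous_const (fun _ => hy1) continuous_id⟩, rt_u0 hy1, rfl⟩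
  let rp : Path x' y' := ⟨rC p.toContinuousMap hp, Subtype.ext (by simp [rC, x']), Subtype.ext (by simp [rC, y'])⟩
  obtain ⟨c, hc⟩ := conn a x' (rt_XX 1 α hx)
  obtain ⟨d, hd⟩ := conn a y' (rt_XX 1 β hy)
  have hsq : (p.trans vy).Homotopic (vx.trans (rp.map inc.continuous)) := by
    refine sq_homotopic ⟨fun z : I × I => rt (p z.1) z.2, rt_cont (p.continuous.comp continuous_fst) (fun _ => hp _)
      continuous_snd⟩ _ _ _ _ (fun t => (rt_u0 (hp t)).symm) (fun t => ?_) (fun t => ?_) (fun t => rfl)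
    · show rt y t = rt (p 1) t; simp
    · show rt x t = rt (p 0) t; simp
  have hcc : (r.trans vx).Homotopic (c.map inc.continuous) :=
    XX_homotopic (α := α) _ _ (trans_XX hr fun t => rt_XX _ _ hx) hc
  rw [← Path.Homotopic.Quotient.eq, Path.Homotopic.Quotient.mk_trans, Path.Homotopic.Quotient.mk_trans] at hsq
  rw [← Path.Homotopic.Quotient.eq, Path.Homotopic.Quotient.mk_trans] at hcc
  refine ⟨q.trans (c.trans (rp.trans d.symm)), β, (d.map inc.continuous).trans vy.symm,
    trans_XX hd (symm_XX (p := vy) fun t => rt_XX _ _ hy), ?_⟩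
  have e : mk p = (mk vx).trans ((mk (rp.map inc.continuous)).trans (mk vy).symm) := by
    rw [← Path.Homotopic.Quotient.trans_assoc, ← hsq, Path.Homotopic.Quotient.trans_assoc,
      Path.Homotopic.Quotient.trans_symm, Path.Homotopic.Quotient.trans_refl]
  have e2 : (mk (d.map inc.continuous)).symm.trans ((mk (d.map inc.continuous)).trans (mk vy).symm) = (mk vy).symm := by
    rw [← Path.Homotopic.Quotient.trans_assoc, Path.Homotopic.Quotient.symm_trans, Path.Homotopic.Quotient.refl_trans]
  rw [Path.map_trans, Path.map_trans, Path.map_trans, ← Path.map_symm]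
  simp only [Path.Homotopic.Quotient.mk_trans, Path.Homotopic.Quotient.mk_symm, Path.Homotopic.Quotient.trans_assoc, e2]
  rw [e, ← hcc]
  simp only [Path.Homotopic.Quotient.trans_assoc]

lemma Gd_all (a : ι) (p : C(I, GS ι)) : ∀ (x y : GS ι) (hx : p 0 = x) (hy : p 1 = y), ∀ γ ∈ Gd a x,
    γ.trans (mk ⟨p, hx, hy⟩) ∈ Gd a y := by
  refine dyad (Q := fun p => ∀ (x y : GS ι) (hx : p 0 = x) (hy : p 1 = y), ∀ γ ∈ Gd a x,
    γ.trans (mk ⟨p, hx, hy⟩) ∈ Gd a y) UU_open UU_cov ?_ ?_ p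
  · rintro p ⟨i, hi⟩ x y hx hy γ hγ
    cases i with
    | none => exact Gd_low hγ _ fun t => hi ⟨t, rfl⟩
    | some α => exact Gd_cone hγ _ fun t => hi ⟨t, rfl⟩
  · intro p h1 h2 x y hx hy γ hγ
    have a0 : lh p 0 = x := by rw [lh, sub_zero, ← hx]; congr 1; exact pj_coe 0
    have a1 : lh p 1 = p (pj (1/2)) := by rw [lh, sub_one]
    have b0 : rh p 0 = p (pj (1/2)) := by rw [rh, sub_zero]
    have b1 : rh p 1 = y := by rw [rh, sub_one, ← hy]; congr 1; exact pj_coe 1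
    have := h2 _ _ b0 b1 _ (h1 _ _ a0 a1 _ hγ)
    rw [Path.Homotopic.Quotient.trans_assoc, ← Path.Homotopic.Quotient.mk_trans] at this
    convert this using 3
    ext t
    rw [Path.trans_apply]
    split_ifs with ht
    · show p t = p _
      congr 1
      have : ((1 - (2 * (t:ℝ))) * 0 + (2 * (t:ℝ)) * (1/2)) = t := by ring
      show t = pj ((1 - (2 * (t:ℝ))) * 0 + (2 * (t:ℝ)) * (1/2))
      rw [this, pj_coe]
    · show p t = p _
      congr 1
      have : ((1 - (2 * (t:ℝ) - 1)) * (1/2) + (2 * (t:ℝ) - 1) * 1) = t := by ring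
      show t = pj ((1 - (2 * (t:ℝ) - 1)) * (1/2) + (2 * (t:ℝ) - 1) * 1)
      rw [this, pj_coe]

lemma inc_surj (a : ι) (p : Path (inc (bp a)) (inc (bp a))) : ∃ q : Path (bp a) (bp a), p.Homotopic (q.map inc.continuous) := by
  have h0 : Path.Homotopic.Quotient.refl _ ∈ Gd a (inc (bp a)) := by
    refine ⟨Path.refl _, a, Path.refl _, fun t => mem_XX_of_zero a (co_bp a), ?_⟩
    rw [Path.Homotopic.Quotient.mk_refl, Path.Homotopic.Quotient.trans_refl]; rfl
  obtain ⟨q, α, r, hr, h⟩ := Gd_all a p.toContinuousMap _ _ p.source p.target _ h0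
  have hr' : r.Homotopic (Path.refl _) := XX_homotopic (α := α) _ _ hr fun t => mem_XX_of_zero α (co_bp a)
  rw [Path.Homotopic.Quotient.eq.2 hr', Path.Homotopic.Quotient.mk_refl, Path.Homotopic.Quotient.trans_refl,
    Path.Homotopic.Quotient.refl_trans] at h
  exact ⟨q, Path.Homotopic.Quotient.eq.1 h⟩

/-! ### the isomorphism -/

/-- the invariant on the fundamental group of the height zero part -/
def psh (a : ι) : FundamentalGroup (HE ι) (bp a) →* H ι := MonoidHom.mk'
  (fun x => (_root_.Quotient.lift (fun q : Path (bp a) (bp a) => ps q.toContinuousMap) (fun _ _ h => ps_homotopic h) x)⁻¹) (by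
    intro x y
    induction x using _root_.Quotient.inductionOn with | _ p
    induction y using _root_.Quotient.inductionOn with | _ q
    rw [← mul_inv_rev]
    exact congrArg _ (ps_trans q p))

lemma psh_mk (a : ι) (q : Path (bp a) (bp a)) : psh a (FundamentalGroup.fromPath (mk q)) = (ps q.toContinuousMap)⁻¹ := rfl

lemma psh_bij (a : ι) : Function.Bijective (psh a) := by
  constructor
  · rw [injective_iff_map_eq_one]
    intro x
    induction x using _root_.Quotient.inductionOn with | _ q
    intro h
    exact Path.Homotopic.Quotient.eq.2 (null_of_ps q (inv_eq_one.1 h))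
  · intro g
    obtain ⟨W, hW⟩ := pr_surj g⁻¹
    obtain ⟨q, hq, -⟩ := word_loop a W
    exact ⟨FundamentalGroup.fromPath (mk q), by rw [psh_mk, hq, hW, inv_inv]⟩

theorem pi_iso (a : ι) : Nonempty ((H ι ⧸ NN ι) ≃* FundamentalGroup (GS ι) (basept a)) := by
  let Ps : FundamentalGroup (HE ι) (bp a) ≃* H ι := MulEquiv.ofBijective (psh a) (psh_bij a)
  let J : FundamentalGroup (HE ι) (bp a) →* FundamentalGroup (GS ι) (basept a) := FundamentalGroup.map inc (bp a)
  let θ : H ι →* FundamentalGroup (GS ι) (basept a) := J.comp Ps.symm.toMonoidHom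
  have hθ : ∀ x, θ (psh a x) = J x := fun x => congrArg J (Ps.symm_apply_apply x)
  have hs : Function.Surjective θ := by
    intro y
    induction y using _root_.Quotient.inductionOn with | _ p
    obtain ⟨q, hq⟩ := inc_surj a p
    exact ⟨psh a (FundamentalGroup.fromPath (mk q)), (hθ _).trans (Path.Homotopic.Quotient.eq.2 hq.symm)⟩
  have hk : NN ι = θ.ker := by
    apply le_antisymm
    · rw [NN, NC, Subgroup.closure_le]
      rintro _ ⟨d, -, p, ⟨W, ⟨α, hα⟩, rfl⟩, rfl⟩
      obtain ⟨q, hq, hX⟩ := word_loop a W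
      have h1 : θ (pr W)⁻¹ = 1 := by
        rw [← hq, ← psh_mk, hθ]
        exact Path.Homotopic.Quotient.eq.2 (XX_homotopic (α := α) (q.map inc.continuous) (Path.refl _) (hX α hα)
          fun t => mem_XX_of_zero α (co_bp a))
      have h2 : θ (pr W) = 1 := by rw [← inv_eq_one, ← map_inv, h1]
      show θ _ = 1
      rw [map_mul, map_mul, h2, mul_one, ← map_mul, mul_inv_cancel, map_one]
    · intro g hg
      obtain ⟨x, rfl⟩ := (psh_bij a).2 g
      rw [MonoidHom.mem_ker, hθ] at hg
      revert hg
      induction x using _root_.Quotient.inductionOn with | _ q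
      intro hg
      exact inv_mem (null_mem q (Path.Homotopic.Quotient.eq.1 hg))
  exact ⟨(QuotientGroup.quotientMulEquivOfEq hk).trans (QuotientGroup.quotientKerEquivOfSurjective θ hs)⟩

theorem final (ι : Type) (a : ι) (h2 : 2 ≤ Cardinal.mk ι) (hcont : Cardinal.mk ι ≤ 2 ^ Cardinal.aleph0) :
    Nonempty (FundamentalGroup (GS (Fin 2)) (basept (0 : Fin 2)) ≃* FundamentalGroup (GS ι) (basept a)) := by
  have hn : Nontrivial ι := by
    rw [← Cardinal.one_lt_iff_nontrivial]
    exact lt_of_lt_of_le (by norm_num) h2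
  obtain ⟨e1⟩ := pi_iso (0 : Fin 2)
  obtain ⟨e2⟩ := pi_iso a
  obtain ⟨e⟩ := alg_iso (ι := Fin 2) (ι' := ι) inferInstance hn
    ((Cardinal.lt_aleph0_of_finite _).le.trans Cardinal.aleph0_le_continuum)
    (by rwa [Cardinal.two_power_aleph0] at hcont)
  exact ⟨(e1.symm.trans e).trans e2⟩

end GrifAux

open Griffiths in
/-- **Theorem A.** If `κ` is a cardinal with `2 ≤ κ ≤ 2^ℵ₀` then the fundamental group of the
Griffiths double cone `𝔾𝕊₂` is isomorphic to the fundamental group of the `κ`-fold Griffiths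
space `𝔾𝕊_κ` (here the `κ`-fold space is realized as `GS ι` for a type `ι` of cardinality
`κ`, with wedge base point `∘`). -/
theorem fundamentalGroup_GS_two_iso_of_le_continuum
    (ι : Type) (a : ι) (h2 : 2 ≤ Cardinal.mk ι)
    (hcont : Cardinal.mk ι ≤ 2 ^ Cardinal.aleph0) :
    Nonempty (FundamentalGroup (GS (Fin 2)) (basept (0 : Fin 2)) ≃*
      FundamentalGroup (GS ι) (basept a)) := by
  exact GrifAux.final ι a h2 hcont
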